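/- Let x > 0 and assume that for every M ≥ 1 a normalized ground-state vector ψ_M of H_M(x) exists. Let r ∈ (0,2), D and E be defined from x as in the context. Then for every δ ∈ (0,1/2) and every ε > 0 there exists N₀ such that for all even integers N1, N2 ≥ 2 with N = N1 + N2 ≥ N₀ and δ ≤ ξ ≤ 1 − δ, where ξ = N1/N, the logarithmic bipartite fidelity satisfies | F_{N1,N2} − [ (1/6)·ln N + (1/6)·ln(ξ(1−ξ)) − ln D + (E/72)·(1/ξ + 1/(1−ξ) − 1)·N^{−1} ] | ≤ ε·N^{−1}. -/

import Mathlib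

open scoped Classical

noncomputable section

/-- Spin configurations of an `N`-site chain: `0` encodes `↑`, `1` encodes `↓`. -/
abbrev Conf (N : ℕ) := Fin N → Fin 2

def pauliX : Matrix (Fin 2) (Fin 2) ℂ := !![0, 1; 1, 0]
def pauliY : Matrix (Fin 2) (Fin 2) ℂ := !![0, -Complex.I; Complex.I, 0]
def pauliZ : Matrix (Fin 2) (Fin 2) ℂ := !![1, 0; 0, -1]

/-- The operator acting as `A` on site `i` and as the identity elsewhere. -/
def siteOp (N : ℕ) (i : Fin N) (A : Matrix (Fin 2) (Fin 2) ℂ) :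
    Matrix (Conf N) (Conf N) ℂ :=
  Matrix.of fun α β =>
    A (α i) (β i) * ∏ j ∈ Finset.univ.erase i, (if α j = β j then (1 : ℂ) else 0)

/-- Left boundary field `p = (1/2)(1/2 − x)`. -/
def pL (x : ℝ) : ℝ := (1/2) * (1/2 - x)

/-- Right boundary field `p̄ = (1/2)(1/2 − 1/x)`. -/
def pR (x : ℝ) : ℝ := (1/2) * (1/2 - 1/x)

/-- The open XXZ Hamiltonian at `Δ = −1/2` with diagonal boundary fields. -/
def XXZ (N : ℕ) (hN : 0 < N) (x : ℝ) : Matrix (Conf N) (Conf N) ℂ :=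
  (-(1/2) : ℂ) • (∑ i : Fin (N-1),
      (siteOp N ⟨i.1, by have := i.2; omega⟩ pauliX *
          siteOp N ⟨i.1+1, by have := i.2; omega⟩ pauliX
        + siteOp N ⟨i.1, by have := i.2; omega⟩ pauliY *
          siteOp N ⟨i.1+1, by have := i.2; omega⟩ pauliY
        - (1/2 : ℂ) • (siteOp N ⟨i.1, by have := i.2; omega⟩ pauliZ *
          siteOp N ⟨i.1+1, by have := i.2; omega⟩ pauliZ)))
  + ((pL x : ℝ) : ℂ) • siteOp N ⟨0, hN⟩ pauliZ
  + ((pR x : ℝ) : ℂ) • siteOp N ⟨N-1, by omega⟩ pauliZ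

/-- The special eigenvalue `E₀`. -/
def E0 (N : ℕ) (x : ℝ) : ℝ := -(3*(N:ℝ) - 1)/4 - (1-x)^2/(2*x)

/-- The basis state with `⌊N/2⌋` down spins followed by `⌈N/2⌉` up spins. -/
def baseState (N : ℕ) : Conf N := fun i => if i.1 < N/2 then 1 else 0

/-- `ψ` is a normalized ground-state vector of `H_N(x)`; for `N = 0` it is the
scalar `1` by convention. -/
def IsGroundState (N : ℕ) (x : ℝ) (ψ : Conf N → ℂ) : Prop :=
  if h : 0 < N then
    (XXZ N h x).mulVec ψ = ((E0 N x : ℝ) : ℂ) • ψ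
    ∧ (∀ φ : Conf N → ℂ, (XXZ N h x).mulVec φ = ((E0 N x : ℝ) : ℂ) • φ → ∃ c : ℂ, φ = c • ψ)
    ∧ ψ (baseState N) = 1
  else ∀ α, ψ α = 1

/-- The overlap `O_{N1,N2} = ⟨ψ, ψ1 ⊗ ψ2⟩` (bilinear, unconjugated pairing). -/
def overlap (N1 N2 : ℕ) (ψ : Conf (N1+N2) → ℂ) (ψ1 : Conf N1 → ℂ) (ψ2 : Conf N2 → ℂ) : ℂ :=
  ∑ α : Conf N1, ∑ β : Conf N2, ψ (Fin.append α β) * ψ1 α * ψ2 β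

/-- The square norm `O_{M,0} = ⟨ψ, ψ⟩` (bilinear pairing). -/
def selfOverlap (M : ℕ) (ψ : Conf M → ℂ) : ℂ := ∑ α : Conf M, ψ α * ψ α

/-- `γ_N`: `A_V(N+1)` for `N` even, `N_8(N+1)` for `N` odd. -/
def gammaN (N : ℕ) : ℝ :=
  if N % 2 = 0 then
    ((2:ℝ)⁻¹) ^ (N/2) * ∏ i ∈ Finset.Icc 1 (N/2),
      ((Nat.factorial (6*i-2) : ℝ) * (Nat.factorial (2*i-1) : ℝ)) /
        ((Nat.factorial (4*i-2) : ℝ) * (Nat.factorial (4*i-1) : ℝ))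
  else
    ∏ i ∈ Finset.range ((N+1)/2),
      (((3*i+1 : ℕ) : ℝ) * (Nat.factorial (6*i) : ℝ) * (Nat.factorial (2*i) : ℝ)) /
        ((Nat.factorial (4*i) : ℝ) * (Nat.factorial (4*i+1) : ℝ))

/-- Binomial coefficient `C(a,b)` for integers, vanishing unless `0 ≤ b ≤ a`. -/
def zchoose (a b : ℤ) : ℤ := if 0 ≤ b ∧ b ≤ a then (a.toNat).choose b.toNat else 0

/-- The logarithmic bipartite fidelity. -/
def LBF (N1 N2 : ℕ) (ψ : Conf (N1+N2) → ℂ) (ψ1 : Conf N1 → ℂ) (ψ2 : Conf N2 → ℂ) : ℂ :=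
  -Complex.log ((overlap N1 N2 ψ ψ1 ψ2)^2 /
    (selfOverlap N1 ψ1 * selfOverlap N2 ψ2 * selfOverlap (N1+N2) ψ))

namespace OpenXXZ

open MvPolynomial

/-- The primitive cube root of unity `exp (2πi/3)`. -/
def q : ℂ := Complex.exp (2 * Real.pi / 3 * Complex.I)

lemma q_pow_three : q ^ 3 = 1 := by
  rw [q, ← Complex.exp_nat_mul]
  convert Complex.exp_two_pi_mul_I using 2
  push_cast; ring

lemma q_eq : q = -1 / 2 + Real.sqrt 3 / 2 * Complex.I := by
  have h : (2 * Real.pi / 3 : ℂ) = ((Real.pi - Real.pi / 3 : ℝ) : ℂ) := by push_cast; ring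
  rw [q, h, Complex.exp_mul_I, ← Complex.ofReal_cos, ← Complex.ofReal_sin, Real.cos_pi_sub,
    Real.sin_pi_sub, Real.cos_pi_div_three, Real.sin_pi_div_three]
  push_cast; ring

lemma q_ne_one : q ≠ 1 := by
  rw [q_eq]
  intro h
  have := congrArg Complex.re h
  norm_num at this

lemma q_sq : q ^ 2 + q + 1 = 0 := by
  have h : (q - 1) * (q ^ 2 + q + 1) = 0 := by linear_combination q_pow_three
  exact (mul_eq_zero.1 h).resolve_left (sub_ne_zero.2 q_ne_one)

lemma q_ne_zero : q ≠ 0 := fun h => by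
  have := q_pow_three
  rw [h] at this; norm_num at this

/-- The anisotropy constant `q - q⁻¹`. -/
def kap : ℂ := q - q ^ 2

lemma kap_sq : kap ^ 2 = -3 := by
  have := q_sq
  unfold kap; grind

lemma kap_ne_zero : kap ≠ 0 := fun h => by
  have := kap_sq
  rw [h] at this; norm_num at this

/-- The weight `q z - q⁻¹ w`. -/
def wa (z w : ℂ) : ℂ := q * z - q ^ 2 * w

/-- The adjacent transposition of the sites `i` and `i + 1`. -/
abbrev sw (i : ℕ) : Equiv.Perm ℕ := Equiv.swap i (i + 1)

lemma sub_rename_swap_dvd (i : ℕ) (p : MvPolynomial ℕ ℂ) :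
    (X (i + 1) - X i : MvPolynomial ℕ ℂ) ∣ rename (sw i) p - p := by
  induction p using MvPolynomial.induction_on with
  | C a => simp
  | add p p' hp hp' =>
    have : rename (sw i) (p + p') - (p + p') =
      (rename (sw i) p - p) + (rename (sw i) p' - p') := by rw [map_add]; ring
    rw [this]; exact dvd_add hp hp'
  | mul_X p j hp =>
    have : rename (sw i) (p * X j) - p * X j =
      (rename (sw i) p - p) * X (sw i j) + p * (X (sw i j) - X j) := by
      rw [map_mul, rename_X]; ring
    rw [this]
    refine dvd_add (hp.mul_right _) (Dvd.dvd.mul_left ?_ _)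
    rcases eq_or_ne j i with rfl | h
    · simp
    rcases eq_or_ne j (i + 1) with rfl | h'
    · rw [Equiv.swap_apply_right]
      exact ⟨-1, by ring⟩
    · rw [Equiv.swap_apply_of_ne_of_ne h h']; simp

lemma exists_hecke (i : ℕ) (p : MvPolynomial ℕ ℂ) : ∃ p' : MvPolynomial ℕ ℂ,
    (X (i + 1) - X i) * p' =
      (C q * X i - C (q ^ 2) * X (i + 1)) * rename (sw i) p - C kap * X (i + 1) * p := by
  obtain ⟨d, hd⟩ := sub_rename_swap_dvd i p
  refine ⟨(C q * X i - C (q ^ 2) * X (i + 1)) * d - C q * p, ?_⟩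
  simp only [kap, C_sub]
  linear_combination (-(C q * X i - C (q ^ 2) * X (i + 1))) * hd

/-- The Demazure–Lusztig operator implementing the exchange of sites `i` and `i + 1`. -/
def hecke (i : ℕ) (p : MvPolynomial ℕ ℂ) : MvPolynomial ℕ ℂ := (exists_hecke i p).choose

lemma hecke_spec (i : ℕ) (p : MvPolynomial ℕ ℂ) : (X (i + 1) - X i) * hecke i p =
      (C q * X i - C (q ^ 2) * X (i + 1)) * rename (sw i) p - C kap * X (i + 1) * p :=
  (exists_hecke i p).choose_spec

lemma eval_hecke (i : ℕ) (p : MvPolynomial ℕ ℂ) (z : ℕ → ℂ) :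
    (z (i + 1) - z i) * eval z (hecke i p) =
      wa (z i) (z (i + 1)) * eval (z ∘ sw i) p - kap * z (i + 1) * eval z p := by
  have := congrArg (eval z) (hecke_spec i p)
  simpa [eval_rename, wa] using this

lemma eval_hecke' (i : ℕ) (p : MvPolynomial ℕ ℂ) (z : ℕ → ℂ) (h : z i ≠ z (i + 1)) :
    eval z (hecke i p) =
      (wa (z i) (z (i + 1)) * eval (z ∘ sw i) p - kap * z (i + 1) * eval z p) /
        (z (i + 1) - z i) := by
  rw [eq_div_iff (sub_ne_zero.2 h.symm), ← eval_hecke]; ring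

lemma eq_of_generic_eval (D p p' : MvPolynomial ℕ ℂ) (hD : D ≠ 0)
    (h : ∀ z, eval z D ≠ 0 → eval z p = eval z p') : p = p' := by
  have : D * (p - p') = 0 := by
    apply MvPolynomial.funext
    intro z
    by_cases hz : eval z D = 0
    · simp [hz]
    · simp [h z hz]
  exact sub_eq_zero.1 ((mul_eq_zero.1 this).resolve_left hD)

lemma X_sub_X_ne_zero {i j : ℕ} (h : i ≠ j) : (X i - X j : MvPolynomial ℕ ℂ) ≠ 0 :=
  sub_ne_zero.2 fun e => h (X_injective e)

lemma hecke_comm (i j : ℕ) (hij : i + 1 < j) (p : MvPolynomial ℕ ℂ) :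
    hecke i (hecke j p) = hecke j (hecke i p) := by
  refine eq_of_generic_eval ((X i - X (i + 1)) * (X j - X (j + 1))) _ _
    (mul_ne_zero (X_sub_X_ne_zero (by omega)) (X_sub_X_ne_zero (by omega))) fun z hz => ?_
  have h1 : z i ≠ z (i + 1) := fun h => hz (by simp [h])
  have h2 : z j ≠ z (j + 1) := fun h => hz (by simp [h])
  have e1 : (sw i) j = j := Equiv.swap_apply_of_ne_of_ne (by omega) (by omega)
  have e2 : (sw i) (j + 1) = j + 1 := Equiv.swap_apply_of_ne_of_ne (by omega) (by omega)
  have e3 : (sw j) i = i := Equiv.swap_apply_of_ne_of_ne (by omega) (by omega)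
  have e4 : (sw j) (i + 1) = i + 1 := Equiv.swap_apply_of_ne_of_ne (by omega) (by omega)
  have e : (z ∘ sw i) ∘ sw j = (z ∘ sw j) ∘ sw i := by
    funext m
    simp only [Function.comp]
    congr 1
    simp only [Equiv.swap_apply_def]
    split_ifs <;> omega
  rw [eval_hecke' i _ z h1, eval_hecke' j _ z h2, eval_hecke' j _ (z ∘ sw i) (by simpa [e1, e2]),
    eval_hecke' j _ z h2, eval_hecke' i _ z h1, eval_hecke' i _ (z ∘ sw j) (by simpa [e3, e4])]
  simp only [Function.comp_apply, e1, e2, e3, e4, e]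
  have n1 := sub_ne_zero.2 h1.symm
  have n2 := sub_ne_zero.2 h2.symm
  field_simp
  ring

lemma hecke_braid (i : ℕ) (p : MvPolynomial ℕ ℂ) :
    hecke i (hecke (i + 1) (hecke i p)) = hecke (i + 1) (hecke i (hecke (i + 1) p)) := by
  refine eq_of_generic_eval ((X i - X (i + 1)) * (X (i + 1) - X (i + 2)) * (X i - X (i + 2))) _ _
    (mul_ne_zero (mul_ne_zero (X_sub_X_ne_zero (by omega)) (X_sub_X_ne_zero (by omega)))
      (X_sub_X_ne_zero (by omega))) fun z hz => ?_
  have h1 : z i ≠ z (i + 1) := fun h => hz (by simp [h])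
  have h2 : z (i + 1) ≠ z (i + 2) := fun h => hz (by simp [h])
  have h3 : z i ≠ z (i + 2) := fun h => hz (by simp [h])
  have e1 : (sw i) (i + 2) = i + 2 := Equiv.swap_apply_of_ne_of_ne (by omega) (by omega)
  have e2 : (sw (i + 1)) i = i := Equiv.swap_apply_of_ne_of_ne (by omega) (by omega)
  have e3 : (sw i) i = i + 1 := Equiv.swap_apply_left _ _
  have e4 : (sw i) (i + 1) = i := Equiv.swap_apply_right _ _
  have e5 : (sw (i + 1)) (i + 1) = i + 2 := Equiv.swap_apply_left _ _
  have e6 : (sw (i + 1)) (i + 2) = i + 1 := Equiv.swap_apply_right _ _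
  have i1 : ∀ y : ℕ → ℂ, (y ∘ sw i) ∘ sw i = y := fun y => by
    funext m; simp [Function.comp]
  have i2 : ∀ y : ℕ → ℂ, (y ∘ sw (i + 1)) ∘ sw (i + 1) = y := fun y => by
    funext m; simp [Function.comp]
  have e : ((z ∘ sw i) ∘ sw (i + 1)) ∘ sw i = ((z ∘ sw (i + 1)) ∘ sw i) ∘ sw (i + 1) := by
    funext m
    simp only [Function.comp]
    congr 1
    by_cases m1 : m = i
    · subst m1; rw [e3, e5, e1, e2, e3, e5]
    by_cases m2 : m = i + 1
    · subst m2; rw [e4, e2, e3, e5, e1, e6]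
    by_cases m3 : m = i + 2
    · subst m3; rw [e1, e6, e4, e2]
    have u1 : (sw i) m = m := Equiv.swap_apply_of_ne_of_ne m1 m2
    have u2 : (sw (i + 1)) m = m := Equiv.swap_apply_of_ne_of_ne m2 m3
    rw [u1, u2, u1, u2]
  have g : ∀ (y : ℕ → ℂ) (p : MvPolynomial ℕ ℂ), y i ≠ y (i + 1) →
    eval y (hecke i p) =
      (wa (y i) (y (i + 1)) * eval (y ∘ sw i) p - kap * y (i + 1) * eval y p) /
        (y (i + 1) - y i) := fun y p h => eval_hecke' i p y h
  have g' : ∀ (y : ℕ → ℂ) (p : MvPolynomial ℕ ℂ), y (i + 1) ≠ y (i + 2) →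
    eval y (hecke (i + 1) p) =
      (wa (y (i + 1)) (y (i + 2)) * eval (y ∘ sw (i + 1)) p - kap * y (i + 2) * eval y p) /
        (y (i + 2) - y (i + 1)) := fun y p h => eval_hecke' (i + 1) p y h
  have n1 := sub_ne_zero.2 h1.symm
  have n2 := sub_ne_zero.2 h2.symm
  have n3 := sub_ne_zero.2 h3.symm
  have n1' := sub_ne_zero.2 h1
  have n2' := sub_ne_zero.2 h2
  simp only [g z _ h1, g' z _ h2, g (z ∘ sw i) _ (by simpa [e3, e4] using h1.symm),
    g' (z ∘ sw (i + 1)) _ (by simpa [e5, e6] using h2.symm),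
    g' (z ∘ sw i) _ (by simpa [e4, e1] using h3), g (z ∘ sw (i + 1)) _ (by simpa [e2, e5] using h3),
    g ((z ∘ sw i) ∘ sw (i + 1)) _ (by simpa [e2, e3, e5, e1] using h2),
    g' ((z ∘ sw (i + 1)) ∘ sw i) _ (by simpa [e1, e4, e6, e2] using h1), i1, i2, e,
    Function.comp_apply, e1, e2, e3, e4, e5, e6]
  rw [div_eq_div_iff (by assumption) (by assumption)]
  unfold wa kap
  generalize eval (((z ∘ sw (i + 1)) ∘ sw i) ∘ sw (i + 1)) p = p6
  generalize eval ((z ∘ sw (i + 1)) ∘ sw i) p = p5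
  generalize eval ((z ∘ sw i) ∘ sw (i + 1)) p = p4
  generalize eval (z ∘ sw i) p = p3
  generalize eval (z ∘ sw (i + 1)) p = p2
  generalize eval z p = p1
  generalize z i = x at *
  generalize z (i + 1) = y at *
  generalize z (i + 2) = w at *
  rw [show x - y = -(y - x) by ring, show y - w = -(w - y) by ring]
  field_simp
  ring

end OpenXXZ

namespace OpenXXZ

open MvPolynomial

/-- Spin configurations on the half-infinite chain (`1` encodes `↓`). -/
abbrev Cfg := ℕ → Fin 2

lemma sw_left (i : ℕ) : sw i i = i + 1 := Equiv.swap_apply_left _ _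

lemma sw_right (i : ℕ) : sw i (i + 1) = i := Equiv.swap_apply_right _ _

lemma sw_of_ne {i j : ℕ} (h : j ≠ i) (h' : j ≠ i + 1) : sw i j = j :=
  Equiv.swap_apply_of_ne_of_ne h h'

lemma sw_lt {i N j : ℕ} (h : i + 1 < N) : sw i j < N ↔ j < N := by
  by_cases h1 : j = i
  · subst h1; rw [sw_left]; omega
  by_cases h2 : j = i + 1
  · subst h2; rw [sw_right]; omega
  rw [sw_of_ne h1 h2]

lemma comp_sw_sw {β : Type*} (y : ℕ → β) (i : ℕ) : (y ∘ sw i) ∘ sw i = y := by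
  funext m; simp [Function.comp]

lemma comp_sw_comm {β : Type*} (y : ℕ → β) {i j : ℕ} (hij : i + 1 < j) :
    (y ∘ sw i) ∘ sw j = (y ∘ sw j) ∘ sw i := by
  funext m
  simp only [Function.comp]
  congr 1
  simp only [Equiv.swap_apply_def]
  split_ifs <;> omega

lemma comp_sw_of_eq {β : Type*} (y : ℕ → β) {i : ℕ} (h : y i = y (i + 1)) : y ∘ sw i = y := by
  funext m
  simp only [Function.comp]
  by_cases h1 : m = i
  · subst h1; rw [sw_left, h]
  by_cases h2 : m = i + 1
  · subst h2; rw [sw_right, h]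
  rw [sw_of_ne h1 h2]

/-- Up followed by down at the sites `i`, `i + 1` of a chain of length `N`. -/
def Desc (N : ℕ) (α : Cfg) (i : ℕ) : Prop := i + 1 < N ∧ α i = 0 ∧ α (i + 1) = 1

/-- The sum of the positions of the down spins. -/
def wt (N : ℕ) (α : Cfg) : ℕ := ∑ j ∈ Finset.range N, j * (α j).val

lemma wt_lt {N : ℕ} {α : Cfg} {i : ℕ} (h : Desc N α i) : wt N (α ∘ sw i) < wt N α := by
  obtain ⟨hi, h0, h1⟩ := h
  unfold wt
  have m1 : i ∈ Finset.range N := by simp; omega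
  have m2 : i + 1 ∈ (Finset.range N).erase i := by simp; omega
  rw [← Finset.add_sum_erase _ _ m1, ← Finset.add_sum_erase _ _ m2,
    ← Finset.add_sum_erase (Finset.range N) (fun j => j * (α j).val) m1,
    ← Finset.add_sum_erase _ (fun j => j * (α j).val) m2]
  have : ∑ x ∈ ((Finset.range N).erase i).erase (i + 1), x * ((α ∘ sw i) x).val =
      ∑ x ∈ ((Finset.range N).erase i).erase (i + 1), x * (α x).val := by
    refine Finset.sum_congr rfl fun x hx => ?_
    simp only [Finset.mem_erase] at hx
    simp only [Function.comp]
    rw [sw_of_ne hx.2.1 hx.1]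
  rw [this]
  simp [Function.comp, h0, h1]

/-- The configuration with `n` down spins followed by `n` up spins. -/
def Base (n : ℕ) (α : Cfg) : Prop := (∀ i < n, α i = 1) ∧ ∀ i, n ≤ i → i < 2 * n → α i = 0

/-- The polynomial solution of the exchange relations with base component `f`. -/
def psi (n : ℕ) (f : MvPolynomial ℕ ℂ) (α : Cfg) : MvPolynomial ℕ ℂ :=
  if h : ∃ i, Desc (2 * n) α i then hecke h.choose (psi n f (α ∘ sw h.choose))
  else if Base n α then f else 0
termination_by wt (2 * n) α
decreasing_by exact wt_lt h.choose_spec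

lemma psi_of_not_desc {n : ℕ} {f : MvPolynomial ℕ ℂ} {α : Cfg} (h : ¬ ∃ i, Desc (2 * n) α i) :
    psi n f α = if Base n α then f else 0 := by
  rw [psi, dif_neg h]

lemma desc_comp_sw_iff {N : ℕ} {α : Cfg} {i j : ℕ} (h : i + 1 < j ∨ j + 1 < i) :
    Desc N (α ∘ sw j) i ↔ Desc N α i := by
  unfold Desc
  simp only [Function.comp]
  rw [sw_of_ne (by omega) (by omega), sw_of_ne (by omega) (by omega)]

lemma psi_desc (n : ℕ) (f : MvPolynomial ℕ ℂ) (α : Cfg) (j : ℕ) (hj : Desc (2 * n) α j) :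
    psi n f α = hecke j (psi n f (α ∘ sw j)) := by
  induction h : wt (2 * n) α using Nat.strong_induction_on generalizing α j with
  | _ w ih =>
    have hex : ∃ i, Desc (2 * n) α i := ⟨j, hj⟩
    have key := hex.choose_spec
    rw [psi, dif_pos hex]
    generalize hex.choose = i at key
    rcases eq_or_ne i j with rfl | hne
    · rfl
    have far : i + 1 < j ∨ j + 1 < i := by
      obtain ⟨-, a, b⟩ := hj
      obtain ⟨-, c, d⟩ := key
      rcases lt_or_gt_of_ne hne with hlt | hlt
      · left
        rcases Nat.lt_or_ge (i + 1) j with h' | h'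
        · exact h'
        · have : j = i + 1 := by omega
          subst this; simp [a] at d
      · right
        rcases Nat.lt_or_ge (j + 1) i with h' | h'
        · exact h'
        · have : i = j + 1 := by omega
          subst this; simp [b] at c
    rw [ih _ (h ▸ wt_lt key) (α ∘ sw i) j ((desc_comp_sw_iff (by omega)).2 hj) rfl,
      ih _ (h ▸ wt_lt hj) (α ∘ sw j) i ((desc_comp_sw_iff (by omega)).2 key) rfl]
    rcases far with h' | h'
    · rw [hecke_comm i j h', comp_sw_comm α h']
    · rw [hecke_comm j i h', comp_sw_comm α h']

lemma hecke_smul (i : ℕ) (c : ℂ) (p : MvPolynomial ℕ ℂ) : hecke i (C c * p) = C c * hecke i p := by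
  refine eq_of_generic_eval (X (i + 1) - X i) _ _ (X_sub_X_ne_zero (by omega)) fun z hz => ?_
  have h : z i ≠ z (i + 1) := fun h => hz (by simp [h])
  rw [eval_mul, eval_hecke' _ _ _ h, eval_hecke' _ _ _ h, eval_mul, eval_mul, eval_C, eval_C]
  ring

lemma hecke_zero (i : ℕ) : hecke i 0 = 0 := by simpa using hecke_smul i 0 0

lemma psi_aligned (n : ℕ) (f : MvPolynomial ℕ ℂ)
    (hf : ∀ i, i + 1 < 2 * n → i + 1 ≠ n → hecke i f = C (q ^ 2) * f)
    (α : Cfg) (i : ℕ) (hi : i + 1 < 2 * n) (hα : α i = α (i + 1)) :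
    hecke i (psi n f α) = C (q ^ 2) * psi n f α := by
  induction h : wt (2 * n) α using Nat.strong_induction_on generalizing α i with
  | _ w ih =>
    by_cases hex : ∃ j, Desc (2 * n) α j
    · obtain ⟨j, hj⟩ := hex
      by_cases far : i + 1 < j ∨ j + 1 < i
      · have e := ih _ (h ▸ wt_lt hj) (α ∘ sw j) i hi (by
          simp only [Function.comp]
          rw [sw_of_ne (by omega) (by omega), sw_of_ne (by omega) (by omega), hα]) rfl
        rw [psi_desc n f α j hj]
        rcases far with h' | h'
        · rw [hecke_comm i j h', e, hecke_smul]
        · rw [← hecke_comm j i h', e, hecke_smul]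
      · obtain ⟨hj1, hj2, hj3⟩ := id hj
        have hne : i ≠ j := by rintro rfl; rw [hα, hj3] at hj2; simp at hj2
        rcases lt_or_gt_of_ne hne with hlt | hlt
        · obtain rfl : j = i + 1 := by omega
          have d2 : Desc (2 * n) (α ∘ sw (i + 1)) i := by
            refine ⟨hi, ?_, ?_⟩
            · simp only [Function.comp]; rw [sw_of_ne (by omega) (by omega), hα, hj2]
            · simp only [Function.comp]; rw [sw_left, hj3]
          have w1 := wt_lt hj
          have w2 := wt_lt d2
          have e := ih _ (by omega) ((α ∘ sw (i + 1)) ∘ sw i) (i + 1) hj1 (by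
            simp only [Function.comp]
            rw [sw_right, sw_of_ne (by omega) (by omega),
              sw_of_ne (i := i) (by omega) (by omega), sw_right, hα]) rfl
          rw [psi_desc n f α _ hj, psi_desc n f _ _ d2, hecke_braid, e, hecke_smul, hecke_smul]
        · obtain rfl : i = j + 1 := by omega
          have d2 : Desc (2 * n) (α ∘ sw j) (j + 1) := by
            refine ⟨hi, ?_, ?_⟩
            · simp only [Function.comp]; rw [sw_right, hj2]
            · simp only [Function.comp]; rw [sw_of_ne (by omega) (by omega), ← hα, hj3]
          have w1 := wt_lt hj
          have w2 := wt_lt d2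
          have e := ih _ (by omega) ((α ∘ sw j) ∘ sw (j + 1)) j hj1 (by
            simp only [Function.comp]
            rw [sw_left, sw_of_ne (i := j + 1) (by omega) (by omega), sw_left,
              sw_of_ne (by omega) (by omega), hα]) rfl
          rw [psi_desc n f α _ hj, psi_desc n f _ _ d2, ← hecke_braid, e, hecke_smul, hecke_smul]
    · rw [psi_of_not_desc hex]
      split_ifs with hb
      · refine hf i hi fun hin => ?_
        have a1 := hb.1 i (by omega)
        have a2 := hb.2 (i + 1) (by omega) (by omega)
        rw [← hα, a1] at a2
        simp at a2
      · simp [hecke_zero]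

/-- Configurations without descents generate everything under the exchange moves. -/
lemma block_induction {l r : ℕ} {Pr : Cfg → Prop}
    (h0 : ∀ α, (¬ ∃ i, l ≤ i ∧ Desc r α i) → Pr α)
    (h1 : ∀ α i, l ≤ i → Desc r α i → Pr (α ∘ sw i) → Pr α) (α : Cfg) : Pr α := by
  induction h : wt r α using Nat.strong_induction_on generalizing α with
  | _ w ih =>
    by_cases hex : ∃ i, l ≤ i ∧ Desc r α i
    · obtain ⟨i, hi, hd⟩ := hex
      exact h1 α i hi hd (ih _ (h ▸ wt_lt hd) _ rfl)
    · exact h0 α hex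

end OpenXXZ

namespace OpenXXZ

open MvPolynomial

/-- The reflected weight for a pair of down spins. -/
def wb (z w : ℂ) : ℂ := q - q ^ 2 * (z * w)

/-- The reflected weight for a pair of up spins. -/
def wc (z w : ℂ) : ℂ := q * (z * w) - q ^ 2

lemma wb_comm (z w : ℂ) : wb z w = wb w z := by unfold wb; ring

lemma wc_comm (z w : ℂ) : wc z w = wc w z := by unfold wc; ring

/-- The contribution of the ordered pair of sites `(i, l)`. -/
def pf (h : ℂ → ℂ → ℂ) (z : ℕ → ℂ) (i l : ℕ) : ℂ :=
  if i < l then wa (z i) (z l) * h (z i) (z l) else 1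

/-- The contribution of a set `s` of aligned spins with boundary weight `κ`. -/
def blk (κ : ℂ → ℂ) (h : ℂ → ℂ → ℂ) (s : Finset ℕ) (z : ℕ → ℂ) : ℂ :=
  (∏ i ∈ s, κ (z i)) * ∏ i ∈ s, ∏ l ∈ s, pf h z i l

lemma pf_self (h : ℂ → ℂ → ℂ) (z : ℕ → ℂ) (i : ℕ) : pf h z i i = 1 := by simp [pf]

lemma blk_insert (κ : ℂ → ℂ) (h : ℂ → ℂ → ℂ) {s : Finset ℕ} {j : ℕ} (hj : j ∉ s) (z : ℕ → ℂ) :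
    blk κ h (insert j s) z = κ (z j) * (∏ l ∈ s, (pf h z j l * pf h z l j)) * blk κ h s z := by
  unfold blk
  have : ∀ i ∈ s, ∏ l ∈ insert j s, pf h z i l = pf h z i j * ∏ l ∈ s, pf h z i l := fun i _ =>
    Finset.prod_insert hj
  rw [Finset.prod_insert hj, Finset.prod_insert hj, Finset.prod_insert hj, pf_self,
    Finset.prod_congr rfl this, Finset.prod_mul_distrib, Finset.prod_mul_distrib]
  ring

lemma sw_lt_sw {k i l : ℕ} (h : ¬ ((i = k ∨ i = k + 1) ∧ (l = k ∨ l = k + 1))) :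
    sw k i < sw k l ↔ i < l := by
  simp only [Equiv.swap_apply_def]
  split_ifs <;> omega

lemma blk_sw_of_not (κ : ℂ → ℂ) (h : ℂ → ℂ → ℂ) {s : Finset ℕ} {k : ℕ}
    (hk : ¬ (k ∈ s ∧ k + 1 ∈ s)) (z : ℕ → ℂ) :
    blk κ h s (z ∘ sw k) = blk κ h (s.map (sw k).toEmbedding) z := by
  unfold blk
  simp only [Finset.prod_map, Equiv.coe_toEmbedding, Function.comp_apply]
  congr 1
  refine Finset.prod_congr rfl fun i hi => Finset.prod_congr rfl fun l hl => ?_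
  unfold pf
  simp only [Function.comp_apply]
  by_cases e : i = l
  · subst e; simp
  have hh : ¬ ((i = k ∨ i = k + 1) ∧ (l = k ∨ l = k + 1)) := by
    rintro ⟨rfl | rfl, rfl | rfl⟩
    · exact e rfl
    · exact hk ⟨hi, hl⟩
    · exact hk ⟨hl, hi⟩
    · exact e rfl
  simp only [sw_lt_sw hh]

lemma blk_sw_of_mem (κ : ℂ → ℂ) (h : ℂ → ℂ → ℂ) (hs : ∀ z w, h z w = h w z) {s : Finset ℕ} {k : ℕ}
    (hk : k ∈ s) (hk' : k + 1 ∈ s) (z : ℕ → ℂ) :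
    wa (z k) (z (k + 1)) * blk κ h s (z ∘ sw k) = wa (z (k + 1)) (z k) * blk κ h s z := by
  obtain ⟨s', h1, rfl⟩ : ∃ s', k + 1 ∉ s' ∧ s = insert (k + 1) s' :=
    ⟨s.erase (k + 1), by simp, (Finset.insert_erase hk').symm⟩
  have hk2 : k ∈ s' := by simpa using hk
  obtain ⟨t, h2, rfl⟩ : ∃ t, k ∉ t ∧ s' = insert k t :=
    ⟨s'.erase k, by simp, (Finset.insert_erase hk2).symm⟩
  have h3 : k + 1 ∉ t := fun h => h1 (by simp [h])
  rw [blk_insert _ _ h1, blk_insert _ _ h1, blk_insert _ _ h2, blk_insert _ _ h2,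
    Finset.prod_insert h2, Finset.prod_insert h2]
  have ht : ∀ l ∈ t, sw k l = l := fun l hl => sw_of_ne
    (by rintro rfl; exact h2 hl) (by rintro rfl; exact h3 hl)
  have e0 : blk κ h t (z ∘ sw k) = blk κ h t z := by
    unfold blk pf
    simp only [Function.comp_apply]
    refine congrArg₂ _ (Finset.prod_congr rfl fun l hl => by rw [ht l hl])
      (Finset.prod_congr rfl fun l hl => Finset.prod_congr rfl fun m hm => by rw [ht l hl, ht m hm])
  have e1 : ∏ l ∈ t, (pf h (z ∘ sw k) k l * pf h (z ∘ sw k) l k) =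
      ∏ l ∈ t, (pf h z (k + 1) l * pf h z l (k + 1)) := by
    refine Finset.prod_congr rfl fun l hl => ?_
    have n1 : l ≠ k := by rintro rfl; exact h2 hl
    have n2 : l ≠ k + 1 := by rintro rfl; exact h3 hl
    unfold pf
    simp only [Function.comp_apply, ht l hl, sw_left,
      show (k + 1 < l ↔ k < l) by omega, show (l < k + 1 ↔ l < k) by omega]
  have e2 : ∏ l ∈ t, (pf h (z ∘ sw k) (k + 1) l * pf h (z ∘ sw k) l (k + 1)) =
      ∏ l ∈ t, (pf h z k l * pf h z l k) := by
    refine Finset.prod_congr rfl fun l hl => ?_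
    have n1 : l ≠ k := by rintro rfl; exact h2 hl
    have n2 : l ≠ k + 1 := by rintro rfl; exact h3 hl
    unfold pf
    simp only [Function.comp_apply, ht l hl, sw_right,
      show (k + 1 < l ↔ k < l) by omega, show (l < k + 1 ↔ l < k) by omega]
  rw [e0, e1, e2]
  simp only [pf, Function.comp_apply, sw_left, sw_right]
  simp only [show ¬ (k + 1 < k) by omega, show k < k + 1 by omega, if_true, if_false]
  rw [hs (z (k + 1)) (z k)]
  ring

/-- Boundary weights: `kd`, `ku` enter the base component, `mu`, `nu` are the resulting weights
of an up spin at the left end and a down spin at the right end. -/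
structure Wts where
  kd : ℂ → ℂ
  ku : ℂ → ℂ
  mu : ℂ → ℂ
  nu : ℂ → ℂ

/-- The base component. -/
def Wts.f (W : Wts) (n : ℕ) (z : ℕ → ℂ) : ℂ :=
  blk W.kd wb (Finset.range n) z * blk W.ku wc (Finset.Ico n (2 * n)) z

/-- Families of solutions of the exchange relations with the prescribed base components. -/
structure Sol (W : Wts) (Φ : ℕ → Cfg → (ℕ → ℂ) → ℂ) : Prop where
  aligned : ∀ n α z i, (∀ j, z j ≠ 0) → i + 1 < 2 * n → α i = α (i + 1) →
    wa (z i) (z (i + 1)) * Φ n α (z ∘ sw i) = wa (z (i + 1)) (z i) * Φ n α z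
  exch : ∀ n α z i, (∀ j, z j ≠ 0) → i + 1 < 2 * n → α i = 1 → α (i + 1) = 0 →
    (z (i + 1) - z i) * Φ n (α ∘ sw i) z =
      wa (z i) (z (i + 1)) * Φ n α (z ∘ sw i) - kap * z (i + 1) * Φ n α z
  base : ∀ n α z, (∀ j, z j ≠ 0) → (¬ ∃ i, Desc (2 * n) α i) →
    Φ n α z = if Base n α then W.f n z else 0

/-- The weights of the inhomogeneous ground state. -/
def W1 (B : ℂ) : Wts where
  kd z := B * z - 1
  ku _ := 1
  mu _ := 1
  nu z := q - q ^ 2 * B * z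

/-- The weights of the mirror image of the inhomogeneous ground state. -/
def W2 (B : ℂ) : Wts where
  kd _ := 1
  ku z := B * z⁻¹ - 1
  mu z := q - q ^ 2 * B * z⁻¹
  nu _ := 1

/-- The compatibility condition between the boundary weights. -/
def Wts.Good (W : Wts) : Prop := ∀ z w : ℂ, z ≠ 0 → w ≠ 0 →
  wa z w * W.kd w * W.ku z - kap * w * W.kd z * W.ku w = (w - z) * W.mu z * W.nu w

lemma W1_good (B : ℂ) : (W1 B).Good := fun z w _ _ => by
  have := q_sq
  simp only [W1, wa, kap]
  ring

lemma W2_good (B : ℂ) : (W2 B).Good := fun z w hz hw => by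
  have := q_sq
  simp only [W2, wa, kap]
  field_simp
  ring

lemma wf_aligned (W : Wts) (n i : ℕ) (hi : i + 1 < 2 * n) (hn : i + 1 ≠ n) (z : ℕ → ℂ) :
    wa (z i) (z (i + 1)) * W.f n (z ∘ sw i) = wa (z (i + 1)) (z i) * W.f n z := by
  have hm : ∀ s : Finset ℕ, (∀ j, sw i j ∈ s ↔ j ∈ s) → s.map (sw i).toEmbedding = s := by
    intro s hs
    ext j
    simp only [Finset.mem_map_equiv]
    rw [← hs, Equiv.symm_swap]; simp
  unfold Wts.f
  by_cases h : i + 1 < n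
  · have e1 := blk_sw_of_mem W.kd wb wb_comm (s := Finset.range n) (k := i) (by simp; omega)
      (by simp; omega) z
    have e2 := blk_sw_of_not W.ku wc (s := Finset.Ico n (2 * n)) (k := i) (by simp; omega) z
    rw [hm] at e2
    · rw [e2]; linear_combination blk W.ku wc (Finset.Ico n (2 * n)) z * e1
    · intro j
      by_cases h1 : j = i
      · subst h1; rw [sw_left]; simp; omega
      by_cases h2 : j = i + 1
      · subst h2; rw [sw_right]; simp; omega
      rw [sw_of_ne h1 h2]
  · have e1 := blk_sw_of_mem W.ku wc wc_comm (s := Finset.Ico n (2 * n)) (k := i) (by simp; omega)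
      (by simp; omega) z
    have e2 := blk_sw_of_not W.kd wb (s := Finset.range n) (k := i) (by simp; omega) z
    rw [hm] at e2
    · rw [e2]; linear_combination blk W.kd wb (Finset.range n) z * e1
    · intro j
      by_cases h1 : j = i
      · subst h1; rw [sw_left]; simp; omega
      by_cases h2 : j = i + 1
      · subst h2; rw [sw_right]; simp; omega
      rw [sw_of_ne h1 h2]

/-- The base component as a polynomial. -/
def fpoly (B : ℂ) (n : ℕ) : MvPolynomial ℕ ℂ :=
  ((∏ i ∈ Finset.range n, (C B * X i - 1)) *
    ∏ i ∈ Finset.range n, ∏ l ∈ Finset.range n, (if i < l then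
      (C q * X i - C (q ^ 2) * X l) * (C q - C (q ^ 2) * (X i * X l)) else 1)) *
  ∏ i ∈ Finset.Ico n (2 * n), ∏ l ∈ Finset.Ico n (2 * n), (if i < l then
      (C q * X i - C (q ^ 2) * X l) * (C q * (X i * X l) - C (q ^ 2)) else 1)

lemma eval_fpoly (B : ℂ) (n : ℕ) (z : ℕ → ℂ) : eval z (fpoly B n) = (W1 B).f n z := by
  have h : ∀ (p : Prop) [Decidable p] (a : MvPolynomial ℕ ℂ),
      eval z (if p then a else 1) = if p then eval z a else 1 := by
    intro p _ a; split_ifs <;> simp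
  simp [fpoly, Wts.f, blk, pf, W1, wa, wb, wc, h]

/-- The polynomial solution for the weights `W1`. -/
def phi (B : ℂ) (n : ℕ) (α : Cfg) (z : ℕ → ℂ) : ℂ := eval z (psi n (fpoly B n) α)

lemma eval_hecke_of_aligned {p : MvPolynomial ℕ ℂ} {i : ℕ} (hp : hecke i p = C (q ^ 2) * p)
    (z : ℕ → ℂ) : wa (z i) (z (i + 1)) * eval (z ∘ sw i) p = wa (z (i + 1)) (z i) * eval z p := by
  have := eval_hecke i p z
  rw [hp, eval_mul, eval_C] at this
  unfold kap at this
  unfold wa at *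
  linear_combination -this

lemma hecke_of_aligned {p : MvPolynomial ℕ ℂ} {i : ℕ}
    (hp : ∀ z, wa (z i) (z (i + 1)) * eval (z ∘ sw i) p = wa (z (i + 1)) (z i) * eval z p) :
    hecke i p = C (q ^ 2) * p := by
  refine eq_of_generic_eval (X (i + 1) - X i) _ _ (X_sub_X_ne_zero (by omega)) fun z hz => ?_
  have h : z i ≠ z (i + 1) := fun h => hz (by simp [h])
  rw [eval_hecke' _ _ _ h, eval_mul, eval_C, hp, div_eq_iff (sub_ne_zero.2 h.symm)]
  unfold wa kap
  ring

lemma sol_phi (B : ℂ) : Sol (W1 B) (phi B) where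
  aligned n α z i _ hi hα := by
    refine eval_hecke_of_aligned (psi_aligned n _ (fun j hj hjn => ?_) α i hi hα) z
    refine hecke_of_aligned fun z => ?_
    rw [eval_fpoly, eval_fpoly]
    exact wf_aligned _ n j hj hjn z
  exch n α z i _ hi h1 h0 := by
    have : Desc (2 * n) (α ∘ sw i) i := ⟨hi, by simp [Function.comp, h0],
      by simp only [Function.comp, sw_right, h1]⟩
    unfold phi
    rw [psi_desc n _ _ _ this, comp_sw_sw, eval_hecke]
  base n α z _ h := by
    unfold phi
    rw [psi_of_not_desc h]
    split_ifs
    · exact eval_fpoly B n z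
    · simp

end OpenXXZ

namespace OpenXXZ

open Finset

lemma blk_congr (κ : ℂ → ℂ) (h : ℂ → ℂ → ℂ) {s : Finset ℕ} {y z : ℕ → ℂ} (e : ∀ i ∈ s, y i = z i) :
    blk κ h s y = blk κ h s z := by
  unfold blk pf
  exact congrArg₂ _ (prod_congr rfl fun l hl => by rw [e l hl])
    (prod_congr rfl fun l hl => prod_congr rfl fun m hm => by rw [e l hl, e m hm])

/-- Generic inhomogeneity parameters. -/
structure Gen (z : ℕ → ℂ) : Prop where
  ne_zero : ∀ _i, z _i ≠ 0
  inj : Function.Injective z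
  wb_ne : ∀ _i _j, _i ≠ _j → wb (z _i) (z _j) ≠ 0

lemma Gen.comp {z : ℕ → ℂ} (hz : Gen z) (σ : Equiv.Perm ℕ) : Gen (z ∘ σ) where
  ne_zero i := hz.ne_zero _
  inj := hz.inj.comp σ.injective
  wb_ne i j hij := hz.wb_ne _ _ (σ.injective.ne hij)

lemma Gen.ne {z : ℕ → ℂ} (hz : Gen z) {i j : ℕ} (h : i ≠ j) : z i ≠ z j := hz.inj.ne h

/-- The base component with the up spin `j` moved in front of the other up spins. -/
def gg (W : Wts) (n j : ℕ) (z : ℕ → ℂ) : ℂ :=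
  blk W.kd wb ((range (n + 1)).erase j) z * blk W.ku wc (insert j (Ico (n + 1) (2 * n))) z

/-- The weight of the ordered pair formed by `i` and `j`. -/
def wo (z : ℕ → ℂ) (j i : ℕ) : ℂ := if j < i then wa (z j) (z i) else wa (z i) (z j)

/-- The coefficients of the single-up-spin components. -/
def cc (n k j : ℕ) (z : ℕ → ℂ) : ℂ :=
  if j = k then ∏ i ∈ Ioc k n, (wa (z k) (z i) / (z i - z k))
  else -kap * z j / (z j - z k) * ∏ i ∈ (Ioc k n).erase j, (wo z j i / (z i - z j))

lemma gg_sw_eq (W : Wts) {n k : ℕ} (hk : k + 1 ≤ n) (z : ℕ → ℂ) :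
    gg W n (k + 1) (z ∘ sw k) = gg W n k z := by
  unfold gg
  rw [blk_sw_of_not _ _ (by simp), blk_sw_of_not _ _ (by simp; omega)]
  congr 2
  · ext i
    rw [mem_map_equiv, Equiv.symm_swap]
    simp only [mem_erase, mem_range, Equiv.swap_apply_def]
    split_ifs <;> omega
  · ext i
    rw [mem_map_equiv, Equiv.symm_swap]
    simp only [mem_insert, mem_Ico, Equiv.swap_apply_def]
    split_ifs <;> omega

lemma gg_sw_lt (W : Wts) {n k j : ℕ} (hj : k + 1 < j) (hjn : j ≤ n) (z : ℕ → ℂ) :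
    wa (z k) (z (k + 1)) * gg W n j (z ∘ sw k) = wa (z (k + 1)) (z k) * gg W n j z := by
  unfold gg
  have e1 := blk_sw_of_mem W.kd wb wb_comm (s := (range (n + 1)).erase j) (k := k)
    (by simp; omega) (by simp; omega) z
  have e2 := blk_sw_of_not W.ku wc (s := insert j (Ico (n + 1) (2 * n))) (k := k)
    (by simp; omega) z
  have e3 : (insert j (Ico (n + 1) (2 * n))).map (sw k).toEmbedding =
      insert j (Ico (n + 1) (2 * n)) := by
    ext i
    rw [mem_map_equiv, Equiv.symm_swap]
    simp only [mem_insert, mem_Ico, Equiv.swap_apply_def]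
    split_ifs <;> omega
  rw [e3] at e2
  rw [e2]
  linear_combination blk W.ku wc (insert j (Ico (n + 1) (2 * n))) z * e1

lemma cc_step {n k j : ℕ} (hj : k + 1 < j) (hjn : j ≤ n) {z : ℕ → ℂ} (hz : Function.Injective z) :
    (z (k + 1) - z k) * cc n k j z =
      wa (z (k + 1)) (z k) * cc n (k + 1) j (z ∘ sw k) - kap * z (k + 1) * cc n (k + 1) j z := by
  have e1 : (Ioc k n).erase j = insert (k + 1) ((Ioc (k + 1) n).erase j) := by
    ext i; simp only [mem_insert, mem_erase, mem_Ioc]; omega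
  have e2 : sw k j = j := sw_of_ne (by omega) (by omega)
  unfold cc
  rw [if_neg (by omega), if_neg (by omega), if_neg (by omega), e1, prod_insert (by simp)]
  have e3 : ∏ i ∈ (Ioc (k + 1) n).erase j, (wo (z ∘ sw k) j i / ((z ∘ sw k) i - (z ∘ sw k) j)) =
      ∏ i ∈ (Ioc (k + 1) n).erase j, (wo z j i / (z i - z j)) := by
    refine prod_congr rfl fun i hi => ?_
    simp only [mem_erase, mem_Ioc] at hi
    simp only [wo, Function.comp_apply, e2, sw_of_ne (i := k) (j := i) (by omega) (by omega)]
  rw [e3]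
  simp only [Function.comp_apply, e2, sw_right]
  generalize ∏ i ∈ (Ioc (k + 1) n).erase j, (wo z j i / (z i - z j)) = R
  have h1 := sub_ne_zero.2 (hz.ne (show j ≠ k by omega))
  have h2 := sub_ne_zero.2 (hz.ne (show j ≠ k + 1 by omega))
  have h3 := sub_ne_zero.2 (hz.ne (show k + 1 ≠ j by omega))
  unfold wo
  rw [if_neg (by omega)]
  unfold wa kap
  rw [show z (k + 1) - z j = -(z j - z (k + 1)) by ring]
  field_simp
  ring

lemma cc_diag {n k : ℕ} (hk : k + 1 ≤ n) {z : ℕ → ℂ} (hz : Function.Injective z) :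
    (z (k + 1) - z k) * cc n k k z =
      wa (z k) (z (k + 1)) * cc n (k + 1) (k + 1) (z ∘ sw k) := by
  have e1 : Ioc k n = insert (k + 1) (Ioc (k + 1) n) := by
    ext i; simp only [mem_insert, mem_Ioc]; omega
  unfold cc
  rw [if_pos rfl, if_pos rfl, e1, prod_insert (by simp)]
  have e3 : ∏ i ∈ Ioc (k + 1) n, (wa ((z ∘ sw k) (k + 1)) ((z ∘ sw k) i) /
      ((z ∘ sw k) i - (z ∘ sw k) (k + 1))) = ∏ i ∈ Ioc (k + 1) n, (wa (z k) (z i) / (z i - z k)) := by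
    refine prod_congr rfl fun i hi => ?_
    simp only [mem_Ioc] at hi
    simp only [Function.comp_apply, sw_right, sw_of_ne (i := k) (j := i) (by omega) (by omega)]
  rw [e3]
  have h1 := sub_ne_zero.2 (hz.ne (show k + 1 ≠ k by omega))
  field_simp

lemma cc_succ {n k : ℕ} (hk : k + 1 ≤ n) {z : ℕ → ℂ} (hz : Function.Injective z) :
    (z (k + 1) - z k) * cc n k (k + 1) z = -(kap * z (k + 1)) * cc n (k + 1) (k + 1) z := by
  have e1 : (Ioc k n).erase (k + 1) = Ioc (k + 1) n := by
    ext i; simp only [mem_erase, mem_Ioc]; omega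
  unfold cc
  rw [if_neg (by omega), if_pos rfl, e1]
  have e3 : ∏ i ∈ Ioc (k + 1) n, (wo z (k + 1) i / (z i - z (k + 1))) =
      ∏ i ∈ Ioc (k + 1) n, (wa (z (k + 1)) (z i) / (z i - z (k + 1))) := by
    refine prod_congr rfl fun i hi => ?_
    simp only [mem_Ioc] at hi
    unfold wo
    rw [if_pos (by omega)]
  rw [e3]
  have h1 := sub_ne_zero.2 (hz.ne (show k + 1 ≠ k by omega))
  field_simp

/-- Spin configurations with a single up spin at `k` among the first `n + 1` sites. -/
def UpAt (n k : ℕ) (α : Cfg) : Prop := ∀ j < 2 * n, α j = if j ≤ n ∧ j ≠ k then 1 else 0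

lemma single_up {W : Wts} {Φ : ℕ → Cfg → (ℕ → ℂ) → ℂ} (hΦ : Sol W Φ) {n : ℕ} (hn : 1 ≤ n) (d : ℕ) :
    ∀ k, k + d = n → ∀ z, Gen z → ∀ α, UpAt n k α →
      Φ n α z = ∑ j ∈ Icc k n, cc n k j z * gg W n j z := by
  induction d with
  | zero =>
    rintro k hk z hz α hα
    obtain rfl : k = n := by omega
    rw [hΦ.base k α z hz.ne_zero, if_pos]
    · have e1 : (range (k + 1)).erase k = range k := by ext i; simp; omega
      have e2 : insert k (Ico (k + 1) (2 * k)) = Ico k (2 * k) := by ext i; simp; omega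
      simp [cc, gg, e1, e2, Wts.f]
    · refine ⟨fun i hi => ?_, fun i hi hi' => ?_⟩
      · rw [hα i (by omega), if_pos (by omega)]
      · rw [hα i (by omega), if_neg (by omega)]
    · rintro ⟨i, hi, h0, h1⟩
      rw [hα i (by omega)] at h0
      rw [hα _ hi] at h1
      split_ifs at h0 h1
      all_goals simp_all
      omega
  | succ d ih =>
    rintro k hk z hz α hα
    have hkn : k + 1 ≤ n := by omega
    have hα' : UpAt n (k + 1) (α ∘ sw k) := by
      intro j hj
      simp only [Function.comp_apply]
      rw [hα _ ((sw_lt (by omega)).2 hj)]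
      simp only [Equiv.swap_apply_def]
      split_ifs <;> first | rfl | (exfalso; omega)
    have hex := hΦ.exch n (α ∘ sw k) z k hz.ne_zero (by omega)
      (by rw [hα' k (by omega), if_pos (by omega)]) (by rw [hα' _ (by omega), if_neg (by omega)])
    rw [comp_sw_sw, ih (k + 1) (by omega) z hz _ hα',
      ih (k + 1) (by omega) (z ∘ sw k) (hz.comp _) _ hα'] at hex
    have e1 : Icc (k + 1) n = insert (k + 1) (Ioc (k + 1) n) := by
      ext i; simp only [mem_insert, mem_Ioc, mem_Icc]; omega
    have e2 : Icc k n = insert k (Icc (k + 1) n) := by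
      ext i; simp only [mem_insert, mem_Icc]; omega
    rw [e2, sum_insert (by simp)]
    rw [e1, sum_insert (by simp)] at hex ⊢
    rw [sum_insert (by simp), gg_sw_eq W hkn] at hex
    have h1 := sub_ne_zero.2 (hz.ne (show k + 1 ≠ k by omega))
    refine mul_left_cancel₀ h1 (hex.trans ?_)
    have key : (z (k + 1) - z k) * ∑ x ∈ Ioc (k + 1) n, cc n k x z * gg W n x z =
        wa (z k) (z (k + 1)) * ∑ x ∈ Ioc (k + 1) n, cc n (k + 1) x (z ∘ sw k) * gg W n x (z ∘ sw k)
        - kap * z (k + 1) * ∑ x ∈ Ioc (k + 1) n, cc n (k + 1) x z * gg W n x z := by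
      rw [mul_sum, mul_sum, mul_sum, ← sum_sub_distrib]
      refine sum_congr rfl fun j hj => ?_
      rw [mem_Ioc] at hj
      linear_combination gg W n j z * cc_step hj.1 hj.2 hz.inj -
        cc n (k + 1) j (z ∘ sw k) * gg_sw_lt W hj.1 hj.2 z
    linear_combination -key - gg W n k z * cc_diag hkn hz.inj
      - gg W n (k + 1) z * cc_succ hkn hz.inj

end OpenXXZ

namespace OpenXXZ

open Finset

/-- The combined weight of an up spin with parameter `v` and the up spins in `T`. -/
def hh (T : Finset ℕ) (v : ℂ) (z : ℕ → ℂ) : ℂ := ∏ w ∈ T, (wa v (z w) * wc v (z w))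

/-- The interpolation variable. -/
def xx (u : ℂ) : ℂ := q ^ 2 * u + q / u

lemma xx_sub {u v : ℂ} (hu : u ≠ 0) (hv : v ≠ 0) :
    xx u - xx v = -((u - v) * wb u v) / (u * v) := by
  unfold xx wb
  field_simp
  ring

lemma wa_mul_wc {u w : ℂ} (hu : u ≠ 0) (hw : w ≠ 0) :
    wa u w * wc u w = u * (w * (xx u - (w + w⁻¹))) := by
  have := q_pow_three
  unfold xx wa wc
  field_simp
  linear_combination (-u - u * w ^ 2 + q * w) * this

lemma wa_mul_wb {u w : ℂ} (hu : u ≠ 0) :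
    wa u w * wb u w = u * (q ^ 2 + q * w ^ 2 - w * (u + u⁻¹)) := by
  have := q_pow_three
  unfold wa wb
  field_simp
  linear_combination (-u ^ 2 * w - w + q * u * w ^ 2) * this

lemma hh_lagrange {s T : Finset ℕ} (hsT : T.card + 1 = s.card) {z : ℕ → ℂ} (hz : Gen z) {u : ℂ}
    (hu : u ≠ 0) :
    hh T u z = ∑ j ∈ s, hh T (z j) z *
      ∏ i ∈ s.erase j, ((u - z i) * wb u (z i) / ((z j - z i) * wb (z j) (z i))) := by
  set Q : Polynomial ℂ := ∏ w ∈ T,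
    (Polynomial.C (z w) * (Polynomial.X - Polynomial.C (z w + (z w)⁻¹))) with hQ
  have hev : ∀ v, v ≠ 0 → hh T v z = v ^ T.card * Q.eval (xx v) := by
    intro v hv
    rw [hQ, Polynomial.eval_prod, ← prod_const, ← prod_mul_distrib]
    refine prod_congr rfl fun w _ => ?_
    rw [wa_mul_wc hv (hz.ne_zero w)]
    simp
  have hinj : Set.InjOn (fun i => xx (z i)) s := by
    intro i _ j _ hij
    by_contra hne
    have h := sub_eq_zero.2 hij
    simp only at h
    rw [xx_sub (hz.ne_zero i) (hz.ne_zero j)] at h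
    have h1 := hz.wb_ne i j hne
    have h2 := sub_ne_zero.2 (hz.ne hne)
    have h3 := hz.ne_zero i
    have h4 := hz.ne_zero j
    simp_all
  have hdeg : Q.degree < s.card := by
    rw [hQ, Polynomial.degree_prod]
    have : ∀ w ∈ T, (Polynomial.C (z w) * (Polynomial.X - Polynomial.C (z w + (z w)⁻¹))).degree
        = 1 := fun w _ => by
      rw [Polynomial.degree_mul, Polynomial.degree_C (hz.ne_zero w), Polynomial.degree_X_sub_C]
      rfl
    rw [sum_congr rfl this, ← hsT]
    simp only [sum_const, nsmul_eq_mul, mul_one]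
    exact_mod_cast Nat.lt_succ_self _
  clear_value Q
  have hLag := Lagrange.eq_interpolate hinj hdeg
  have h2 := congrArg (Polynomial.eval (xx u)) hLag
  rw [Lagrange.interpolate_apply, Polynomial.eval_finsetSum] at h2
  rw [hev u hu, h2, mul_sum]
  refine sum_congr rfl fun j hj => ?_
  rw [hev _ (hz.ne_zero j), Polynomial.eval_mul, Polynomial.eval_C, Lagrange.basis,
    Polynomial.eval_prod]
  have hc : (s.erase j).card = T.card := by rw [card_erase_of_mem hj]; omega
  have e : (∏ i ∈ s.erase j, ((u - z i) * wb u (z i) / ((z j - z i) * wb (z j) (z i)))) *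
      (z j) ^ T.card = u ^ T.card * ∏ i ∈ s.erase j,
        Polynomial.eval (xx u) (Lagrange.basisDivisor (xx (z j)) (xx (z i))) := by
    rw [← hc, ← prod_const, ← prod_const, ← prod_mul_distrib, ← prod_mul_distrib]
    refine prod_congr rfl fun i hi => ?_
    have hne : j ≠ i := (ne_of_mem_erase hi).symm
    have h1 := hz.wb_ne j i hne
    have h2 := sub_ne_zero.2 (hz.ne hne)
    have h3 := hz.ne_zero i
    have h4 := hz.ne_zero j
    simp only [Lagrange.basisDivisor, Polynomial.eval_mul, Polynomial.eval_C, Polynomial.eval_sub,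
      Polynomial.eval_X]
    rw [xx_sub hu h3, xx_sub h4 h3]
    field_simp
  linear_combination -Polynomial.eval (xx (z j)) Q * e

/-- The coefficients in the left boundary expansion of the component `↑↓⋯↓↑⋯↑`. -/
def KK (W : Wts) (n j : ℕ) (z : ℕ → ℂ) : ℂ :=
  W.nu (z j) * hh (Ico (n + 1) (2 * n)) (z j) z * blk W.kd wb ((Ioc 0 n).erase j) z *
    (∏ i ∈ (Ioc 0 n).erase j, (wo z j i / (z i - z j))) * blk W.ku wc (Ico (n + 1) (2 * n)) z

lemma prod_pf_up {T : Finset ℕ} {j : ℕ} (hj : ∀ w ∈ T, j < w) (z : ℕ → ℂ) :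
    ∏ l ∈ T, (pf wc z j l * pf wc z l j) = hh T (z j) z := by
  refine prod_congr rfl fun w hw => ?_
  have := hj w hw
  simp [pf, this, this.le]

lemma prod_pf_down {T : Finset ℕ} {j : ℕ} (hj : j ∉ T) (z : ℕ → ℂ) :
    ∏ l ∈ T, (pf wb z j l * pf wb z l j) = ∏ l ∈ T, (wo z j l * wb (z j) (z l)) := by
  refine prod_congr rfl fun w hw => ?_
  have hne : j ≠ w := by rintro rfl; exact hj hw
  unfold pf wo
  rcases lt_or_gt_of_ne hne with h | h
  · simp [h, h.le]
  · rw [if_neg (by omega), if_pos h, if_neg (by omega), wb_comm, one_mul]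

lemma up_first {W : Wts} {Φ : ℕ → Cfg → (ℕ → ℂ) → ℂ} (hΦ : Sol W Φ) (hW : W.Good) {n : ℕ}
    (hn : 1 ≤ n) {z : ℕ → ℂ} (hz : Gen z) {α : Cfg} (hα : UpAt n 0 α) :
    Φ n α z = W.mu (z 0) * ∑ j ∈ Ioc 0 n, KK W n j z *
      ∏ i ∈ (Ioc 0 n).erase j, (wa (z 0) (z i) * wb (z 0) (z i)) := by
  have e0 : Icc 0 n = insert 0 (Ioc 0 n) := by
    ext i; simp only [mem_insert, mem_Ioc, mem_Icc]; omega
  rw [single_up hΦ hn n 0 (by omega) z hz α hα, e0, sum_insert (by simp)]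
  have e1 : (range (n + 1)).erase 0 = Ioc 0 n := by
    ext i; simp only [mem_erase, mem_range, mem_Ioc]; omega
  have hg0 : gg W n 0 z = blk W.kd wb (Ioc 0 n) z * (W.ku (z 0) * hh (Ico (n + 1) (2 * n)) (z 0) z *
      blk W.ku wc (Ico (n + 1) (2 * n)) z) := by
    unfold gg
    rw [e1, blk_insert _ _ (by simp), prod_pf_up]
    intro w hw; rw [mem_Ico] at hw; omega
  rw [hg0, hh_lagrange (s := Ioc 0 n) (T := Ico (n + 1) (2 * n)) (by simp; omega) hz (hz.ne_zero 0)]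
  rw [mul_sum, sum_mul, mul_sum, mul_sum, mul_sum, ← sum_add_distrib]
  refine sum_congr rfl fun j hj => ?_
  have hj' := mem_Ioc.1 hj
  have e2 : (range (n + 1)).erase j = insert 0 ((Ioc 0 n).erase j) := by
    ext i; simp only [mem_erase, mem_range, mem_Ioc, mem_insert]; omega
  have hg : gg W n j z = W.kd (z 0) * (∏ i ∈ (Ioc 0 n).erase j, (wa (z 0) (z i) * wb (z 0) (z i))) *
      blk W.kd wb ((Ioc 0 n).erase j) z * (W.ku (z j) * hh (Ico (n + 1) (2 * n)) (z j) z *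
      blk W.ku wc (Ico (n + 1) (2 * n)) z) := by
    unfold gg
    rw [e2, blk_insert _ _ (by simp), blk_insert _ _ (by simp; omega), prod_pf_up]
    · congr 3
      refine prod_congr rfl fun i hi => ?_
      simp only [mem_erase, mem_Ioc] at hi
      simp [pf, hi.2.1]
    · intro w hw; rw [mem_Ico] at hw; omega
  have hd : blk W.kd wb (Ioc 0 n) z = W.kd (z j) *
      (∏ l ∈ (Ioc 0 n).erase j, (wo z j l * wb (z j) (z l))) *
        blk W.kd wb ((Ioc 0 n).erase j) z := by
    conv_lhs => rw [← insert_erase hj]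
    rw [blk_insert _ _ (notMem_erase _ _), prod_pf_down (notMem_erase _ _)]
  have hc0 : cc n 0 0 z = wa (z 0) (z j) / (z j - z 0) *
      ∏ i ∈ (Ioc 0 n).erase j, (wa (z 0) (z i) / (z i - z 0)) := by
    unfold cc
    rw [if_pos rfl, ← mul_prod_erase _ _ hj]
  have hcj : cc n 0 j z = -kap * z j / (z j - z 0) *
      ∏ i ∈ (Ioc 0 n).erase j, (wo z j i / (z i - z j)) := by
    unfold cc
    rw [if_neg (by omega)]
  have hp : (∏ i ∈ (Ioc 0 n).erase j, (wa (z 0) (z i) / (z i - z 0))) *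
      (∏ l ∈ (Ioc 0 n).erase j, (wo z j l * wb (z j) (z l))) *
      (∏ i ∈ (Ioc 0 n).erase j, ((z 0 - z i) * wb (z 0) (z i) / ((z j - z i) * wb (z j) (z i)))) =
      (∏ i ∈ (Ioc 0 n).erase j, (wa (z 0) (z i) * wb (z 0) (z i))) *
      ∏ i ∈ (Ioc 0 n).erase j, (wo z j i / (z i - z j)) := by
    rw [← prod_mul_distrib, ← prod_mul_distrib, ← prod_mul_distrib]
    refine prod_congr rfl fun i hi => ?_
    simp only [mem_erase, mem_Ioc] at hi
    have h1 := hz.wb_ne j i (by omega)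
    have h2 := sub_ne_zero.2 (hz.ne (show i ≠ 0 by omega))
    have h3 := sub_ne_zero.2 (hz.ne (show i ≠ j by omega))
    rw [show z 0 - z i = -(z i - z 0) by ring, show z j - z i = -(z i - z j) by ring]
    field_simp
  have hgood := hW (z 0) (z j) (hz.ne_zero 0) (hz.ne_zero j)
  have hne := sub_ne_zero.2 (hz.ne (show j ≠ 0 by omega))
  rw [hg, hd, hc0, hcj]
  unfold KK
  generalize (∏ i ∈ (Ioc 0 n).erase j, (wa (z 0) (z i) / (z i - z 0))) = p1 at *
  generalize (∏ l ∈ (Ioc 0 n).erase j, (wo z j l * wb (z j) (z l))) = p2 at *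
  generalize (∏ i ∈ (Ioc 0 n).erase j,
    ((z 0 - z i) * wb (z 0) (z i) / ((z j - z i) * wb (z j) (z i)))) = p3 at *
  generalize (∏ i ∈ (Ioc 0 n).erase j, (wa (z 0) (z i) * wb (z 0) (z i))) = p4 at *
  generalize ∏ i ∈ (Ioc 0 n).erase j, (wo z j i / (z i - z j)) = p5 at *
  generalize hh (Ico (n + 1) (2 * n)) (z j) z = H
  generalize blk W.kd wb ((Ioc 0 n).erase j) z = Dj
  generalize blk W.ku wc (Ico (n + 1) (2 * n)) z = U
  have hgood' : wa (z 0) (z j) / (z j - z 0) * W.kd (z j) * W.ku (z 0) +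
      -kap * z j / (z j - z 0) * W.kd (z 0) * W.ku (z j) = W.mu (z 0) * W.nu (z j) := by
    field_simp
    linear_combination hgood
  linear_combination wa (z 0) (z j) / (z j - z 0) * W.kd (z j) * W.ku (z 0) * Dj * H * U * hp +
    p4 * p5 * Dj * H * U * hgood'

end OpenXXZ

namespace OpenXXZ

open Finset

lemma exists_threshold {l r : ℕ} (hlr : l ≤ r) {α : Cfg} (h : ¬ ∃ i, l ≤ i ∧ Desc r α i) :
    ∃ m, l ≤ m ∧ m ≤ r ∧ ∀ j, l ≤ j → j < r → α j = if j < m then 1 else 0 := by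
  induction r, hlr using Nat.le_induction with
  | base => exact ⟨l, le_rfl, le_rfl, fun j h1 h2 => by omega⟩
  | succ r hr ih =>
    obtain ⟨m, hm1, hm2, hm⟩ := ih fun ⟨i, hi, hd⟩ => h ⟨i, hi, by have := hd.1; omega, hd.2⟩
    by_cases h1 : α r = 1
    · refine ⟨r + 1, by omega, le_rfl, fun j hj1 hj2 => ?_⟩
      rw [if_pos hj2]
      rcases Nat.lt_or_ge j r with hj | hj
      · by_cases hmr : m = r
        · rw [hm j hj1 hj, if_pos (by omega)]
        · exfalso
          refine h ⟨r - 1, by omega, by omega, ?_, ?_⟩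
          · rw [hm _ (by omega) (by omega), if_neg (by omega)]
          · rw [show r - 1 + 1 = r by omega, h1]
      · rw [show j = r by omega, h1]
    · refine ⟨m, hm1, by omega, fun j hj1 hj2 => ?_⟩
      rcases Nat.lt_or_ge j r with hj | hj
      · exact hm j hj1 hj
      · rw [if_neg (by omega), show j = r by omega]
        omega

/-- The number of down spins among the first `N` sites. -/
def cnt (N : ℕ) (α : Cfg) : ℕ := ∑ j ∈ range N, (α j).val

lemma cnt_sw {N i : ℕ} (hi : i + 1 < N) (α : Cfg) : cnt N (α ∘ sw i) = cnt N α := by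
  unfold cnt
  refine sum_nbij' (sw i) (sw i) ?_ ?_ ?_ ?_ ?_
  · intro j hj; simp only [mem_range] at *; exact (sw_lt hi).2 hj
  · intro j hj; simp only [mem_range] at *; exact (sw_lt hi).2 hj
  · intro j _; simp
  · intro j _; simp
  · intro j _; simp

lemma sum_threshold {l r m : ℕ} (hl : l ≤ m) (hm : m ≤ r) {α : Cfg}
    (h : ∀ j, l ≤ j → j < r → α j = if j < m then 1 else 0) :
    ∑ j ∈ Ico l r, (α j).val = m - l := by
  rw [← sum_Ico_consecutive _ hl hm]
  have e1 : ∀ j ∈ Ico l m, (α j).val = 1 := fun j hj => by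
    rw [mem_Ico] at hj; rw [h j hj.1 (by omega), if_pos hj.2]; rfl
  have e2 : ∀ j ∈ Ico m r, (α j).val = 0 := fun j hj => by
    rw [mem_Ico] at hj; rw [h j (by omega) hj.2, if_neg (by omega)]; rfl
  rw [sum_congr rfl e1, sum_congr rfl e2]
  simp

lemma exch_desc {W : Wts} {Φ : ℕ → Cfg → (ℕ → ℂ) → ℂ} (hΦ : Sol W Φ) {n i : ℕ} {α : Cfg}
    (h : Desc (2 * n) α i) {z : ℕ → ℂ} (hz : Gen z) :
    Φ n α z = (wa (z i) (z (i + 1)) * Φ n (α ∘ sw i) (z ∘ sw i) -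
      kap * z (i + 1) * Φ n (α ∘ sw i) z) / (z (i + 1) - z i) := by
  have := hΦ.exch n (α ∘ sw i) z i hz.ne_zero h.1
    (by simp only [Function.comp, sw_left]; exact h.2.2)
    (by simp only [Function.comp, sw_right]; exact h.2.1)
  rw [comp_sw_sw] at this
  rw [← this, mul_div_cancel_left₀ _ (sub_ne_zero.2 (hz.ne (by omega)))]

lemma zero_of_cnt {W : Wts} {Φ : ℕ → Cfg → (ℕ → ℂ) → ℂ} (hΦ : Sol W Φ) (n : ℕ) (α : Cfg) :
    cnt (2 * n) α ≠ n → ∀ z, Gen z → Φ n α z = 0 := by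
  refine block_induction (l := 0) (r := 2 * n)
    (Pr := fun α => cnt (2 * n) α ≠ n → ∀ z, Gen z → Φ n α z = 0) ?_ ?_ α
  · intro α h hc z hz
    rw [hΦ.base n α z hz.ne_zero (fun ⟨i, hi⟩ => h ⟨i, Nat.zero_le _, hi⟩), if_neg]
    rintro ⟨h1, h2⟩
    refine hc ?_
    have := sum_threshold (l := 0) (r := 2 * n) (m := n) (by omega) (by omega) (α := α)
      (fun j _ hj => by
        split_ifs with hjn
        · exact h1 j hjn
        · exact h2 j (by omega) hj)
    simpa [cnt] using this
  · intro α i _ hd ih hc z hz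
    have hc' : cnt (2 * n) (α ∘ sw i) ≠ n := by rwa [cnt_sw hd.1]
    rw [exch_desc hΦ hd hz, ih hc' z hz, ih hc' _ (hz.comp _)]
    simp

lemma update_comp_sw {z : ℕ → ℂ} {u : ℂ} {i : ℕ} (hi : 1 ≤ i) :
    Function.update z 0 u ∘ sw i = Function.update (z ∘ sw i) 0 u := by
  funext j
  by_cases h0 : j = 0
  · subst h0
    simp only [Function.comp]
    rw [sw_of_ne (by omega) (by omega)]; simp
  · simp only [Function.comp]
    rw [Function.update_of_ne h0, Function.update_of_ne]
    · rfl
    · simp only [Equiv.swap_apply_def]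
      split_ifs <;> omega

open Polynomial in
/-- The dependence of the components on the first inhomogeneity parameter. -/
lemma left_structure {W : Wts} {Φ : ℕ → Cfg → (ℕ → ℂ) → ℂ} (hΦ : Sol W Φ) (hW : W.Good) {n : ℕ}
    (hn : 1 ≤ n) (α : Cfg) : ∀ z : ℕ → ℂ, ∃ P : ℂ[X], P.natDegree ≤ n - 1 ∧
      ∀ u, Gen (Function.update z 0 u) → Φ n α (Function.update z 0 u) =
        (if α 0 = 1 then W.kd u else W.mu u) * u ^ (n - 1) * P.eval (u + u⁻¹) := by
  have hlin : ∀ (s : Finset ℕ) (z : ℕ → ℂ), ∃ P : ℂ[X], P.natDegree ≤ s.card ∧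
      ∀ u, u ≠ 0 → ∏ i ∈ s, (wa u (z i) * wb u (z i)) = u ^ s.card * P.eval (u + u⁻¹) := by
    intro s z
    refine ⟨∏ i ∈ s, (C (q ^ 2 + q * z i ^ 2) - C (z i) * X), ?_, ?_⟩
    · refine (natDegree_prod_le _ _).trans ?_
      refine (sum_le_card_nsmul _ _ 1 fun i _ => ?_).trans (by simp)
      compute_degree
    · intro u hu
      rw [eval_prod, ← prod_const, ← prod_mul_distrib]
      refine prod_congr rfl fun i _ => ?_
      rw [wa_mul_wb hu]
      simp
  refine block_induction (l := 1) (r := 2 * n) (Pr := fun α => ∀ z : ℕ → ℂ, ∃ P : ℂ[X],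
    P.natDegree ≤ n - 1 ∧ ∀ u, Gen (Function.update z 0 u) → Φ n α (Function.update z 0 u) =
        (if α 0 = 1 then W.kd u else W.mu u) * u ^ (n - 1) * P.eval (u + u⁻¹)) ?_ ?_ α
  · intro α h z
    by_cases hc : cnt (2 * n) α = n
    swap
    · exact ⟨0, by simp, fun u hu => by rw [zero_of_cnt hΦ n α hc _ hu]; simp⟩
    obtain ⟨m, hm1, hm2, hm⟩ := exists_threshold (by omega) h
    have hsum := sum_threshold hm1 hm2 hm
    have hc' : (α 0).val + (m - 1) = n := by
      have h2 := hc
      rw [cnt, range_eq_Ico, ← sum_Ico_consecutive _ (Nat.zero_le 1) (by omega), hsum] at h2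
      simpa using h2
    by_cases h0 : α 0 = 1
    · have hmn : m = n := by simp [h0] at hc'; omega
      have hnd : ¬ ∃ i, Desc (2 * n) α i := by
        rintro ⟨i, hi⟩
        rcases Nat.eq_zero_or_pos i with rfl | hi0
        · have := hi.2.1; rw [h0] at this; simp at this
        · exact h ⟨i, hi0, hi⟩
      have hb : Base n α := by
        subst hmn
        refine ⟨fun i hi => ?_, fun i hi1 hi2 => ?_⟩
        · rcases Nat.eq_zero_or_pos i with rfl | hi0
          · exact h0
          · rw [hm i hi0 (by omega), if_pos hi]
        · rw [hm i (by omega) hi2, if_neg (by omega)]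
      obtain ⟨P, hP1, hP2⟩ := hlin (Ico 1 n) z
      refine ⟨P * C (blk W.kd wb (Ico 1 n) z * blk W.ku wc (Ico n (2 * n)) z), ?_, ?_⟩
      · refine (natDegree_mul_C_le _ _).trans (hP1.trans (by simp))
      · intro u hu
        have hu0 : u ≠ 0 := by simpa using hu.ne_zero 0
        have e : ∀ i ∈ Ico 1 (2 * n), Function.update z 0 u i = z i := fun i hi => by
          rw [mem_Ico] at hi
          rw [Function.update_of_ne (by omega)]
        rw [hΦ.base n α _ hu.ne_zero hnd, if_pos hb, if_pos h0, Wts.f,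
          show range n = insert 0 (Ico 1 n) by ext i; simp; omega, blk_insert _ _ (by simp),
          blk_congr _ _ (fun i hi => e i (Ico_subset_Ico le_rfl (by omega) hi)),
          blk_congr (s := Ico n (2 * n)) _ _ (fun i hi => e i (Ico_subset_Ico hn le_rfl hi)),
          Function.update_self]
        have e2 : ∏ l ∈ Ico 1 n, (pf wb (Function.update z 0 u) 0 l *
            pf wb (Function.update z 0 u) l 0) = ∏ i ∈ Ico 1 n, (wa u (z i) * wb u (z i)) := by
          refine prod_congr rfl fun i hi => ?_
          have hi' := mem_Ico.1 hi
          simp [pf, show 0 < i by omega, show i ≠ 0 by omega]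
        rw [e2, hP2 u hu0]
        simp only [Nat.card_Ico, eval_mul, eval_C]
        ring
    · have h0' : α 0 = 0 := by omega
      have hup : UpAt n 0 α := by
        intro j hj
        rcases Nat.eq_zero_or_pos j with rfl | hj0
        · simp [h0']
        · simp [h0'] at hc'
          rw [hm j hj0 hj]
          refine if_congr ?_ rfl rfl
          omega
      choose! P hP1 hP2 using fun s : Finset ℕ => hlin s z
      refine ⟨∑ j ∈ Ioc 0 n, C (KK W n j z) * P ((Ioc 0 n).erase j), ?_, ?_⟩
      · refine natDegree_sum_le_of_forall_le _ _ fun j hj => ?_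
        refine (natDegree_C_mul_le _ _).trans ((hP1 _).trans ?_)
        rw [card_erase_of_mem hj]; simp
      · intro u hu
        have hu0 : u ≠ 0 := by simpa using hu.ne_zero 0
        rw [up_first hΦ hW hn hu hup, if_neg h0, Function.update_self, mul_assoc, eval_finsetSum,
          mul_sum _ _ (u ^ _)]
        congr 1
        refine sum_congr rfl fun j hj => ?_
        have hj' := mem_Ioc.1 hj
        have e : ∀ i, 1 ≤ i → Function.update z 0 u i = z i := fun i hi => by
          rw [Function.update_of_ne (by omega)]
        have e1 : KK W n j (Function.update z 0 u) = KK W n j z := by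
          unfold KK hh wo
          rw [e j hj'.1, blk_congr _ _ (fun i hi => e i (by simp at hi; omega)),
            blk_congr (s := Ico (n + 1) (2 * n)) _ _ (fun i hi => e i (by simp at hi; omega))]
          congr 2
          · congr 2
            refine prod_congr rfl fun i hi => ?_
            rw [e i (by simp at hi; omega)]
          · refine prod_congr rfl fun i hi => ?_
            rw [e i (by simp at hi; omega)]
        have e2 : ∏ i ∈ (Ioc 0 n).erase j, (wa u (Function.update z 0 u i) *
            wb u (Function.update z 0 u i)) =
            ∏ i ∈ (Ioc 0 n).erase j, (wa u (z i) * wb u (z i)) := by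
          refine prod_congr rfl fun i hi => ?_
          rw [e i (by simp at hi; omega)]
        rw [e1, e2, hP2 _ u hu0, card_erase_of_mem hj]
        simp only [Nat.card_Ioc, eval_mul, eval_C, Nat.sub_zero]
        ring
  · intro α i hi hd ih z
    by_cases hne : z i = z (i + 1)
    · refine ⟨0, by simp, fun u hu => absurd ?_ (hu.ne (show i ≠ i + 1 by omega))⟩
      rw [Function.update_of_ne (by omega), Function.update_of_ne (by omega), hne]
    · obtain ⟨P1, h1, h1'⟩ := ih (z ∘ sw i)
      obtain ⟨P2, h2, h2'⟩ := ih z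
      refine ⟨C (wa (z i) (z (i + 1)) / (z (i + 1) - z i)) * P1 -
        C (kap * z (i + 1) / (z (i + 1) - z i)) * P2, ?_, ?_⟩
      · refine (natDegree_sub_le_of_le (m := n - 1) (n := n - 1) ?_ ?_).trans (max_self _).le
        · exact (natDegree_C_mul_le _ _).trans h1
        · exact (natDegree_C_mul_le _ _).trans h2
      · intro u hu
        have hs : (α ∘ sw i) 0 = α 0 := by
          simp only [Function.comp]; rw [sw_of_ne (by omega) (by omega)]
        have hu' := hu.comp (sw i)
        rw [update_comp_sw hi] at hu'
        rw [exch_desc hΦ hd hu, update_comp_sw hi, h1' u hu', h2' u hu, hs,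
          Function.update_of_ne (by omega), Function.update_of_ne (by omega)]
        simp only [eval_sub, eval_mul, eval_C]
        have := sub_ne_zero.2 (Ne.symm hne)
        field_simp

end OpenXXZ

namespace OpenXXZ

open Finset

/-- Dropping the first `k` entries. -/
def sh {β : Type*} (k : ℕ) (y : ℕ → β) : ℕ → β := fun j => y (j + k)

lemma sh_comp_sw {β : Type*} {k i : ℕ} (hi : k ≤ i) (y : ℕ → β) :
    sh k (y ∘ sw i) = sh k y ∘ sw (i - k) := by
  funext j
  simp only [sh, Function.comp]
  congr 1
  simp only [Equiv.swap_apply_def]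
  split_ifs <;> omega

lemma Gen.sh {z : ℕ → ℂ} (hz : Gen z) (k : ℕ) : Gen (sh k z) where
  ne_zero i := hz.ne_zero _
  inj i j h := by have := hz.inj h; omega
  wb_ne i j hij := hz.wb_ne _ _ (by omega)

lemma q_sq_ne_one : q ^ 2 ≠ 1 := fun h => q_ne_one (by
  have := q_pow_three
  calc q = q * q ^ 2 := by rw [h, mul_one]
    _ = 1 := by rw [← this]; ring)

variable {W : Wts} {Φ : ℕ → Cfg → (ℕ → ℂ) → ℂ}

lemma singlet_aligned (hΦ : Sol W Φ) {n i : ℕ} (hi : i + 1 < 2 * n) {z : ℕ → ℂ}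
    (h0 : ∀ j, z j ≠ 0) (hn : z (i + 1) = q ^ 2 * z i) {α : Cfg} (hα : α i = α (i + 1)) :
    Φ n α z = 0 := by
  have := hΦ.aligned n α z i h0 hi hα
  have e1 : wa (z i) (z (i + 1)) = 0 := by
    rw [hn]; unfold wa; linear_combination -q * z i * q_pow_three
  have e2 : wa (z (i + 1)) (z i) = (1 - q ^ 2) * z i := by
    rw [hn]; unfold wa; linear_combination z i * q_pow_three
  rw [e1, e2, zero_mul] at this
  rcases mul_eq_zero.1 this.symm with h | h
  · rcases mul_eq_zero.1 h with h | h
    · exact absurd (sub_eq_zero.1 h).symm q_sq_ne_one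
    · exact absurd h (h0 i)
  · exact h

lemma singlet_flip (hΦ : Sol W Φ) {n i : ℕ} (hi : i + 1 < 2 * n) {z : ℕ → ℂ}
    (h0 : ∀ j, z j ≠ 0) (hn : z (i + 1) = q ^ 2 * z i) {α : Cfg} (h1 : α i = 1)
    (h2 : α (i + 1) = 0) : Φ n (α ∘ sw i) z = -q * Φ n α z := by
  have := hΦ.exch n α z i h0 hi h1 h2
  have e1 : wa (z i) (z (i + 1)) = 0 := by
    rw [hn]; unfold wa; linear_combination -q * z i * q_pow_three
  rw [e1, hn] at this
  have h3 : (q ^ 2 - 1) * z i ≠ 0 := mul_ne_zero (sub_ne_zero.2 q_sq_ne_one) (h0 i)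
  apply mul_left_cancel₀ h3
  unfold kap at this
  have h4 := q_sq
  linear_combination this + z i * Φ n α z * q * (q - 1) * h4

/-- Contraction of the first two sites with the dual singlet. -/
lemma contraction (hΦ : Sol W Φ) {n : ℕ} (hi : 0 + 1 < 2 * n) {y : ℕ → ℂ}
    (h0 : ∀ j, y j ≠ 0) (hn : y 0 = q ^ 2 * y 1) {α : Cfg} (h1 : α 0 = 1) (h2 : α 1 = 0) :
    Φ n α y - q * Φ n (α ∘ sw 0) y = wa (y 0) (y 1) / (kap * y 1) * Φ n α (y ∘ sw 0) := by
  have := hΦ.exch n α y 0 h0 hi h1 h2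
  rw [div_mul_eq_mul_div, eq_div_iff (mul_ne_zero kap_ne_zero (h0 1))]
  simp only [zero_add, hn] at this ⊢
  unfold kap at *
  linear_combination this + y 1 * Φ n (α ∘ sw 0) y * q_pow_three

/-- The factor produced by the reduction of the chain. -/
def redFac (W : Wts) (n : ℕ) (z : ℕ → ℂ) : ℂ :=
  q ^ (n - 1) * W.kd (z 0) * W.ku (z 1) * ∏ i ∈ Ico 2 (2 * n), (wa (z 1) (z i) * wc (z 1) (z i))

lemma blk_sh (κ : ℂ → ℂ) (h : ℂ → ℂ → ℂ) (k : ℕ) (s : Finset ℕ) (z : ℕ → ℂ) :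
    blk κ h s (sh k z) = blk κ h (s.map (addRightEmbedding k)) z := by
  unfold blk
  simp only [prod_map, addRightEmbedding_apply]
  congr 1
  refine prod_congr rfl fun i _ => prod_congr rfl fun l _ => ?_
  simp [pf, sh]

lemma blk_zero (κ : ℂ → ℂ) (h : ℂ → ℂ → ℂ) {s : Finset ℕ} {i l : ℕ} (hi : i ∈ s) (hl : l ∈ s)
    (hil : i < l) {z : ℕ → ℂ} (h0 : wa (z i) (z l) = 0) : blk κ h s z = 0 := by
  have hp : pf h z i l = 0 := by simp [pf, hil, h0]
  have h2 : ∏ i ∈ s, ∏ l ∈ s, pf h z i l = 0 := prod_eq_zero hi (prod_eq_zero hl hp)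
  rw [blk, h2, mul_zero]

lemma cnt_two {N : ℕ} (α : Cfg) : cnt (N + 2) α = (α 0).val + (α 1).val + cnt N (sh 2 α) := by
  unfold cnt
  rw [sum_range_succ', sum_range_succ']
  simp only [sh, zero_add]
  ring_nf

lemma reduction (hΦ : Sol W Φ) {n : ℕ} (hn : 1 ≤ n) (α : Cfg) : α 0 = 1 → α 1 = 0 →
    ∀ z, Gen z → z 1 = q ^ 2 * z 0 → Φ n α z = redFac W n z * Φ (n - 1) (sh 2 α) (sh 2 z) := by
  refine block_induction (l := 2) (r := 2 * n) (Pr := fun α => α 0 = 1 → α 1 = 0 →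
    ∀ z, Gen z → z 1 = q ^ 2 * z 0 → Φ n α z = redFac W n z * Φ (n - 1) (sh 2 α) (sh 2 z)) ?_ ?_ α
  · intro α h a0 a1 z hz hz1
    have hcnt := cnt_two (N := 2 * n - 2) α
    rw [show 2 * n - 2 + 2 = 2 * n by omega, a0, a1] at hcnt
    simp only [Fin.val_one, Fin.val_zero, add_zero] at hcnt
    by_cases hc : cnt (2 * n) α = n
    swap
    · rw [zero_of_cnt hΦ n α hc z hz, zero_of_cnt hΦ (n - 1) _ _ _ (hz.sh 2), mul_zero]
      rw [show 2 * (n - 1) = 2 * n - 2 by omega]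
      omega
    obtain ⟨m, hm1, hm2, hm⟩ := exists_threshold (by omega) h
    have hsum := sum_threshold hm1 hm2 hm
    have hmn : m = n + 1 := by
      have h2 := hc
      rw [cnt, range_eq_Ico, ← sum_Ico_consecutive _ (Nat.zero_le 2) (by omega), hsum] at h2
      simp [sum_range_succ, a0, a1] at h2
      omega
    subst hmn
    have hup : UpAt n 1 α := by
      intro j hj
      rcases Nat.lt_or_ge j 2 with hj2 | hj2
      · interval_cases j
        · simp [a0]
        · simp [a1]
      · rw [hm j hj2 hj]
        refine if_congr ?_ rfl rfl
        omega
    have hnd : ¬ ∃ i, Desc (2 * (n - 1)) (sh 2 α) i := fun ⟨i, hi1, hi2, hi3⟩ =>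
      h ⟨i + 2, by omega, by omega, hi2, by rw [show i + 2 + 1 = i + 1 + 2 by ring]; exact hi3⟩
    have hb : Base (n - 1) (sh 2 α) := by
      refine ⟨fun i hi => ?_, fun i hi1 hi2 => ?_⟩
      · rw [sh, hm _ (by omega) (by omega), if_pos (by omega)]
      · rw [sh, hm _ (by omega) (by omega), if_neg (by omega)]
    have hwa : wa (z 0) (z 1) = 0 := by
      rw [hz1]; unfold wa; linear_combination -q * z 0 * q_pow_three
    rw [hΦ.base _ _ _ (hz.sh 2).ne_zero hnd, if_pos hb,
      single_up hΦ hn (n - 1) 1 (by omega) z hz α hup, sum_eq_single_of_mem 1 (by simp; omega)]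
    swap
    · intro j hj hj1
      rw [mem_Icc] at hj
      unfold gg
      rw [blk_zero (i := 0) (l := 1) _ _ (by simp; omega) (by simp; omega) (by omega) hwa]
      simp
    rw [Wts.f, blk_sh, blk_sh]
    have s1 : (range (n - 1)).map (addRightEmbedding 2) = Ioc 1 n := by
      ext j; simp only [mem_map, mem_range, addRightEmbedding_apply, mem_Ioc]
      exact ⟨fun ⟨i, hi, h⟩ => by omega, fun h => ⟨j - 2, by omega, by omega⟩⟩
    have s2 : (Ico (n - 1) (2 * (n - 1))).map (addRightEmbedding 2) = Ico (n + 1) (2 * n) := by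
      ext j; simp only [mem_map, mem_Ico, addRightEmbedding_apply]
      exact ⟨fun ⟨i, hi, h⟩ => by omega, fun h => ⟨j - 2, by omega, by omega⟩⟩
    have s3 : (range (n + 1)).erase 1 = insert 0 (Ioc 1 n) := by
      ext j; simp only [mem_erase, mem_range, mem_insert, mem_Ioc]; omega
    have s4 : Ico 2 (2 * n) = Ioc 1 n ∪ Ico (n + 1) (2 * n) := by
      ext j; simp only [mem_union, mem_Ico, mem_Ioc]; omega
    rw [s1, s2, gg, s3, blk_insert _ _ (by simp), blk_insert _ _ (by simp; omega), redFac, s4,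
      prod_union (by rw [disjoint_left]; intro j; simp only [mem_Ico, mem_Ioc]; omega), cc,
      if_pos rfl]
    have p1 : ∏ l ∈ Ico (n + 1) (2 * n), (pf wc z 1 l * pf wc z l 1) =
        ∏ l ∈ Ico (n + 1) (2 * n), (wa (z 1) (z l) * wc (z 1) (z l)) := by
      refine prod_congr rfl fun i hi => ?_
      rw [mem_Ico] at hi
      simp [pf, show 1 < i by omega, show ¬ i < 1 by omega]
    have p2 : (∏ i ∈ Ioc 1 n, (wa (z 1) (z i) / (z i - z 1))) *
        ∏ l ∈ Ioc 1 n, (pf wb z 0 l * pf wb z l 0) =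
        q ^ (n - 1) * ∏ i ∈ Ioc 1 n, (wa (z 1) (z i) * wc (z 1) (z i)) := by
      rw [show n - 1 = (Ioc 1 n).card by simp, ← prod_const, ← prod_mul_distrib,
        ← prod_mul_distrib]
      refine prod_congr rfl fun i hi => ?_
      rw [mem_Ioc] at hi
      have hne := sub_ne_zero.2 (hz.ne (show i ≠ 1 by omega))
      have e : wa (z 0) (z i) * wb (z 0) (z i) = q * wc (z 1) (z i) * (z i - z 1) := by
        have := q_pow_three
        rw [hz1]
        unfold wa wb wc
        linear_combination (-q ^ 2 * z 0 + q ^ 3 * z 0 ^ 2 * z i) * this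
      simp only [pf, show 0 < i by omega, if_true, show ¬ i < 0 by omega, if_false, mul_one, e]
      field_simp
    rw [p1]
    linear_combination W.kd (z 0) * blk W.kd wb (Ioc 1 n) z * (W.ku (z 1) *
      (∏ l ∈ Ico (n + 1) (2 * n), (wa (z 1) (z l) * wc (z 1) (z l))) *
      blk W.ku wc (Ico (n + 1) (2 * n)) z) * p2
  · intro α i hi hd ih a0 a1 z hz hz1
    have hfac : redFac W n (z ∘ sw i) = redFac W n z := by
      unfold redFac
      simp only [Function.comp]
      rw [sw_of_ne (j := 0) (by omega) (by omega), sw_of_ne (j := 1) (by omega) (by omega)]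
      congr 1
      refine prod_nbij' (sw i) (sw i) ?_ ?_ ?_ ?_ ?_
      · intro j hj; simp only [mem_Ico, Equiv.swap_apply_def] at *
        have := hd.1
        split_ifs <;> omega
      · intro j hj; simp only [mem_Ico, Equiv.swap_apply_def] at *
        have := hd.1
        split_ifs <;> omega
      · intro j _; simp
      · intro j _; simp
      · intro j _; rfl
    have h0 : (α ∘ sw i) 0 = 1 := by
      simp only [Function.comp]; rw [sw_of_ne (by omega) (by omega), a0]
    have h1 : (α ∘ sw i) 1 = 0 := by
      simp only [Function.comp]; rw [sw_of_ne (by omega) (by omega), a1]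
    have hd' : Desc (2 * (n - 1)) (sh 2 α) (i - 2) := by
      have := hd.1
      refine ⟨by omega, ?_, ?_⟩
      · rw [sh, show i - 2 + 2 = i by omega]; exact hd.2.1
      · rw [sh, show i - 2 + 1 + 2 = i + 1 by omega]; exact hd.2.2
    rw [exch_desc hΦ hd hz, ih h0 h1 z hz hz1, ih h0 h1 _ (hz.comp _), hfac,
      exch_desc hΦ hd' (hz.sh 2), sh_comp_sw hi, sh_comp_sw hi]
    · simp only [sh]
      rw [show i - 2 + 2 = i by omega, show i - 2 + 1 + 2 = i + 1 by omega]
      ring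
    · simp only [Function.comp]
      rw [sw_of_ne (by omega) (by omega), sw_of_ne (by omega) (by omega), hz1]

lemma wa_mul_wc_singlet {u v w : ℂ} (hu : u ≠ 0) (hw : w ≠ 0) (hv : v = q ^ 2 * u) :
    wa v w * wc v w = -(v * w) * (w + w⁻¹ + (u + u⁻¹ + (v + v⁻¹))) := by
  have h1 := q_pow_three
  have h2 := q_sq
  have hq := q_ne_zero
  subst hv
  have e : (q ^ 2 * u)⁻¹ = q * u⁻¹ := by
    field_simp
    linear_combination -h1
  rw [e]
  unfold wa wc
  linear_combination (q ^ 3 * u ^ 2 * w - q ^ 2 * u - q ^ 2 * u * w ^ 2) * h1 +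
    (q ^ 2 * u ^ 2 * w + q ^ 2 * w) * h2 + q ^ 2 * u * mul_inv_cancel₀ hw +
    q ^ 2 * w * (1 + q) * mul_inv_cancel₀ hu

end OpenXXZ

namespace OpenXXZ

open Finset

/-- Inhomogeneity parameters that are generic together with their inverses. -/
structure Gen2 (z : ℕ → ℂ) : Prop where
  ne_zero : ∀ _i, z _i ≠ 0
  inj : Function.Injective z
  mul_ne : ∀ _i _j, _i ≠ _j → (z _i * z _j) ^ 3 ≠ 1

lemma Gen2.gen {z : ℕ → ℂ} (hz : Gen2 z) : Gen z where
  ne_zero := hz.ne_zero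
  inj := hz.inj
  wb_ne i j hij h := by
    refine hz.mul_ne i j hij ?_
    have e : z i * z j = q ^ 2 := by
      unfold wb at h
      linear_combination -q * h - z i * z j * q_pow_three
    rw [e]
    linear_combination (q ^ 3 + 1) * q_pow_three

/-- The inverse parameters. -/
def iv (z : ℕ → ℂ) : ℕ → ℂ := fun j => (z j)⁻¹

lemma Gen2.iv {z : ℕ → ℂ} (hz : Gen2 z) : Gen2 (iv z) where
  ne_zero i := inv_ne_zero (hz.ne_zero i)
  inj i j h := hz.inj (inv_injective h)
  mul_ne i j hij h := by
    refine hz.mul_ne i j hij ?_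
    rw [OpenXXZ.iv, OpenXXZ.iv, ← mul_inv, inv_pow] at h
    exact inv_eq_one.1 h

lemma Gen2.comp {z : ℕ → ℂ} (hz : Gen2 z) (σ : Equiv.Perm ℕ) : Gen2 (z ∘ σ) where
  ne_zero i := hz.ne_zero _
  inj := hz.inj.comp σ.injective
  mul_ne i j hij := hz.mul_ne _ _ (σ.injective.ne hij)

lemma Gen2.sh {z : ℕ → ℂ} (hz : Gen2 z) (k : ℕ) : Gen2 (sh k z) where
  ne_zero i := hz.ne_zero _
  inj i j h := by have := hz.inj h; omega
  mul_ne i j hij := hz.mul_ne _ _ (by omega)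

variable {W : Wts} {Φ : ℕ → Cfg → (ℕ → ℂ) → ℂ}

lemma sol_congr (hΦ : Sol W Φ) {n : ℕ} (α : Cfg) : ∀ β : Cfg, (∀ j < 2 * n, α j = β j) →
    ∀ y z, Gen y → Gen z → (∀ j < 2 * n, y j = z j) → Φ n α y = Φ n β z := by
  have hD : ∀ {α β : Cfg}, (∀ j < 2 * n, α j = β j) → ∀ {i}, Desc (2 * n) α i →
      Desc (2 * n) β i := by
    rintro α β h i ⟨h1, h2, h3⟩
    exact ⟨h1, by rw [← h i (by omega), h2], by rw [← h (i + 1) h1, h3]⟩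
  refine block_induction (l := 0) (r := 2 * n) (Pr := fun α => ∀ β : Cfg,
    (∀ j < 2 * n, α j = β j) → ∀ y z, Gen y → Gen z → (∀ j < 2 * n, y j = z j) →
      Φ n α y = Φ n β z) ?_ ?_ α
  · intro α h β hab y z hy hz hyz
    have hb : Base n α ↔ Base n β := by
      refine and_congr (forall_congr' fun i => ?_) (forall_congr' fun i => ?_)
      · refine forall_congr' fun hi => ?_
        rw [hab i (by omega)]
      · refine forall_congr' fun _ => forall_congr' fun hi => ?_
        rw [hab i (by omega)]
    rw [hΦ.base n α y hy.ne_zero (fun ⟨i, hi⟩ => h ⟨i, Nat.zero_le _, hi⟩),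
      hΦ.base n β z hz.ne_zero (fun ⟨i, hi⟩ =>
        h ⟨i, Nat.zero_le _, hD (fun j hj => (hab j hj).symm) hi⟩)]
    refine if_congr hb ?_ rfl
    rw [Wts.f, Wts.f, blk_congr _ _ (fun i hi => hyz i (by simp at hi; omega)),
      blk_congr (s := Ico n (2 * n)) _ _ (fun i hi => hyz i (by simp at hi; omega))]
  · intro α i _ hd ih β hab y z hy hz hyz
    have h1 : ∀ j < 2 * n, (α ∘ sw i) j = (β ∘ sw i) j := fun j hj =>
      hab _ ((sw_lt hd.1).2 hj)
    have h2 : ∀ j < 2 * n, (y ∘ sw i) j = (z ∘ sw i) j := fun j hj =>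
      hyz _ ((sw_lt hd.1).2 hj)
    rw [exch_desc hΦ hd hy, exch_desc hΦ (hD hab hd) hz, ih _ h1 _ _ hy hz hyz,
      ih _ h1 _ _ (hy.comp _) (hz.comp _) h2, hyz _ hd.1, hyz i (by have := hd.1; omega)]

/-- Reversal of the first `N` sites. -/
def rv (N j : ℕ) : ℕ := if j < N then N - 1 - j else j

lemma rv_rv (N j : ℕ) : rv N (rv N j) = j := by
  unfold rv
  split_ifs <;> omega

/-- Reversal as a permutation. -/
def rvE (N : ℕ) : Equiv.Perm ℕ := ⟨rv N, rv N, rv_rv N, rv_rv N⟩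

/-- Reversal and spin flip of the first `N` sites. -/
def fl (N : ℕ) (α : Cfg) : Cfg := fun j => if j < N then 1 - α (rv N j) else α j

lemma rv_sw {N i : ℕ} (hi : i + 1 < N) (j : ℕ) : sw i (rv N j) = rv N (sw (N - 2 - i) j) := by
  simp only [rv, Equiv.swap_apply_def]
  split_ifs <;> omega

lemma fl_sw {N i : ℕ} (hi : i + 1 < N) (α : Cfg) :
    fl N (α ∘ sw i) = fl N α ∘ sw (N - 2 - i) := by
  funext j
  have h : sw (N - 2 - i) j < N ↔ j < N := sw_lt (by omega)
  unfold fl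
  simp only [Function.comp]
  by_cases hj : j < N
  · rw [if_pos hj, if_pos (h.2 hj), rv_sw hi]
  · rw [if_neg hj, if_neg (fun hh => hj (h.1 hh)), sw_of_ne (by omega) (by omega),
      sw_of_ne (by omega) (by omega)]

lemma fl_apply {N j : ℕ} (hj : j < N) (α : Cfg) : fl N α j = 1 - α (N - 1 - j) := by
  rw [fl, if_pos hj, rv, if_pos hj]

/-- The mirror image of a family of solutions. -/
def mir (Φ : ℕ → Cfg → (ℕ → ℂ) → ℂ) (n : ℕ) (α : Cfg) (z : ℕ → ℂ) : ℂ :=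
  (∏ i ∈ range (2 * n), z i ^ (2 * n - 2)) * Φ n (fl (2 * n) α) (iv z ∘ rv (2 * n))

lemma prod_pairs (s : Finset ℕ) (c : ℕ → ℂ) :
    ∏ i ∈ s, ∏ l ∈ s, (if i < l then c i * c l else 1) = ∏ i ∈ s, c i ^ (s.card - 1) := by
  have h1 : ∀ i ∈ s, ∀ l ∈ s, (if i < l then c i * c l else 1) =
      (if i < l then c i else 1) * (if i < l then c l else 1) := fun i _ l _ => by
    split_ifs <;> simp
  rw [prod_congr rfl fun i hi => (prod_congr rfl (h1 i hi)).trans prod_mul_distrib,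
    prod_mul_distrib, prod_comm (f := fun i l => if i < l then c l else 1), ← prod_mul_distrib]
  refine prod_congr rfl fun i hi => ?_
  rw [← prod_mul_distrib, ← mul_prod_erase _ _ hi]
  simp only [lt_irrefl, if_false, one_mul]
  rw [← card_erase_of_mem hi, ← prod_const]
  refine prod_congr rfl fun l hl => ?_
  have := ne_of_mem_erase hl
  rcases lt_or_gt_of_ne this with h | h
  · simp [h, h.le, not_lt.2 h.le]
  · simp [h, h.le, not_lt.2 h.le]

lemma blk_mir {κ κ' : ℂ → ℂ} {h h' : ℂ → ℂ → ℂ} {z : ℕ → ℂ} (h0 : ∀ j, z j ≠ 0)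
    (hκ : ∀ i, κ (z i)⁻¹ = κ' (z i))
    (hh : ∀ i j, h (z i)⁻¹ (z j)⁻¹ = h' (z j) (z i) * ((z i) * (z j))⁻¹) (N : ℕ) (s : Finset ℕ)
    (hs : ∀ j ∈ s, j < N) (M : ℕ) (hM : M = 2 * (s.card - 1)) :
    (∏ i ∈ s.map (rvE N).toEmbedding, z i ^ M) * blk κ h s (iv z ∘ rv N) =
      blk κ' h' (s.map (rvE N).toEmbedding) z := by
  unfold blk
  simp only [prod_map, Equiv.coe_toEmbedding]
  have e1 : ∀ i, (iv z ∘ rv N) i = (z (rvE N i))⁻¹ := fun i => rfl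
  have e2 : ∀ i ∈ s, ∀ l ∈ s, pf h (iv z ∘ rv N) i l = pf h' z (rvE N l) (rvE N i) *
      (if i < l then ((z (rvE N i)) ^ 2)⁻¹ * ((z (rvE N l)) ^ 2)⁻¹ else 1) := by
    intro i hi l hl
    have a1 := hs i hi
    have a2 := hs l hl
    have e : rvE N l < rvE N i ↔ i < l := by
      change rv N l < rv N i ↔ _
      unfold rv
      rw [if_pos a1, if_pos a2]
      omega
    unfold pf
    rw [e1, e1, hh]
    by_cases hil : i < l
    · rw [if_pos hil, if_pos (e.2 hil), if_pos hil]
      have b1 := h0 (rvE N i)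
      have b2 := h0 (rvE N l)
      unfold wa
      field_simp
    · rw [if_neg hil, if_neg (fun hc => hil (e.1 hc)), if_neg hil, mul_one]
  rw [prod_congr rfl fun i hi => (prod_congr rfl (e2 i hi)).trans prod_mul_distrib,
    prod_mul_distrib (s := s), prod_pairs s (fun i => ((z (rvE N i)) ^ 2)⁻¹),
    prod_comm (f := fun i l => pf h' z (rvE N l) (rvE N i))]
  have e3 : ∏ i ∈ s, κ ((iv z ∘ rv N) i) = ∏ i ∈ s, κ' (z (rvE N i)) :=
    prod_congr rfl fun i _ => by rw [e1, hκ]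
  have e4 : (∏ i ∈ s, z (rvE N i) ^ M) * ∏ i ∈ s, ((z (rvE N i)) ^ 2)⁻¹ ^ (s.card - 1) = 1 := by
    rw [← prod_mul_distrib]
    refine prod_eq_one fun i _ => ?_
    rw [hM, inv_pow, ← pow_mul, mul_inv_cancel₀ (pow_ne_zero _ (h0 _))]
  rw [e3]
  linear_combination (∏ i ∈ s, κ' (z (rvE N i))) *
    (∏ y ∈ s, ∏ x ∈ s, pf h' z (rvE N y) (rvE N x)) * e4

lemma iv_sw (z : ℕ → ℂ) {N i : ℕ} (hi : i + 1 < N) :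
    iv (z ∘ sw i) ∘ rv N = (iv z ∘ rv N) ∘ sw (N - 2 - i) := by
  funext j
  simp only [iv, Function.comp]
  rw [rv_sw hi]

lemma prod_pow_sw (z : ℕ → ℂ) {N i : ℕ} (hi : i + 1 < N) (M : ℕ) :
    ∏ j ∈ range N, (z ∘ sw i) j ^ M = ∏ j ∈ range N, z j ^ M := by
  refine prod_nbij' (sw i) (sw i) ?_ ?_ ?_ ?_ ?_
  · intro j hj; simp only [mem_range] at *; exact (sw_lt hi).2 hj
  · intro j hj; simp only [mem_range] at *; exact (sw_lt hi).2 hj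
  · intro j _; simp
  · intro j _; simp
  · intro j _; simp

lemma sol_mir {B : ℂ} (hΦ : Sol (W1 B) Φ) : Sol (W2 B) (mir Φ) where
  aligned n α z i h0 hi hα := by
    have h0' : ∀ j, (iv z ∘ rv (2 * n)) j ≠ 0 := fun j => inv_ne_zero (h0 _)
    have := hΦ.aligned n (fl (2 * n) α) (iv z ∘ rv (2 * n)) (2 * n - 2 - i) h0' (by omega) (by
      rw [fl_apply (by omega), fl_apply (by omega), show 2 * n - 1 - (2 * n - 2 - i) = i + 1 by omega,
        show 2 * n - 1 - (2 * n - 2 - i + 1) = i by omega, hα])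
    have e1 : (iv z ∘ rv (2 * n)) (2 * n - 2 - i) = (z (i + 1))⁻¹ := by
      simp only [iv, rv, Function.comp]
      rw [if_pos (by omega), show 2 * n - 1 - (2 * n - 2 - i) = i + 1 by omega]
    have e2 : (iv z ∘ rv (2 * n)) (2 * n - 2 - i + 1) = (z i)⁻¹ := by
      simp only [iv, rv, Function.comp]
      rw [if_pos (by omega), show 2 * n - 1 - (2 * n - 2 - i + 1) = i by omega]
    rw [e1, e2] at this
    unfold mir
    rw [iv_sw z hi, prod_pow_sw z hi]
    have a1 := h0 i
    have a2 := h0 (i + 1)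
    have b1 : wa (z (i + 1))⁻¹ (z i)⁻¹ = wa (z i) (z (i + 1)) * (z i * z (i + 1))⁻¹ := by
      unfold wa; field_simp
    have b2 : wa (z i)⁻¹ (z (i + 1))⁻¹ = wa (z (i + 1)) (z i) * (z i * z (i + 1))⁻¹ := by
      unfold wa; field_simp
    rw [b1, b2] at this
    field_simp at this
    linear_combination (∏ j ∈ range (2 * n), z j ^ (2 * n - 2)) * this
  exch n α z i h0 hi h1 h2 := by
    have h0' : ∀ j, (iv z ∘ rv (2 * n)) j ≠ 0 := fun j => inv_ne_zero (h0 _)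
    have := hΦ.exch n (fl (2 * n) α) (iv z ∘ rv (2 * n)) (2 * n - 2 - i) h0' (by omega)
      (by rw [fl_apply (by omega), show 2 * n - 1 - (2 * n - 2 - i) = i + 1 by omega, h2]; rfl)
      (by rw [fl_apply (by omega), show 2 * n - 1 - (2 * n - 2 - i + 1) = i by omega, h1]; rfl)
    have e1 : (iv z ∘ rv (2 * n)) (2 * n - 2 - i) = (z (i + 1))⁻¹ := by
      simp only [iv, rv, Function.comp]
      rw [if_pos (by omega), show 2 * n - 1 - (2 * n - 2 - i) = i + 1 by omega]
    have e2 : (iv z ∘ rv (2 * n)) (2 * n - 2 - i + 1) = (z i)⁻¹ := by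
      simp only [iv, rv, Function.comp]
      rw [if_pos (by omega), show 2 * n - 1 - (2 * n - 2 - i + 1) = i by omega]
    rw [e1, e2] at this
    unfold mir
    rw [iv_sw z hi, prod_pow_sw z hi, fl_sw hi]
    have a1 := h0 i
    have a2 := h0 (i + 1)
    have b1 : wa (z (i + 1))⁻¹ (z i)⁻¹ = wa (z i) (z (i + 1)) * (z i * z (i + 1))⁻¹ := by
      unfold wa; field_simp
    rw [b1] at this
    field_simp at this
    linear_combination (∏ j ∈ range (2 * n), z j ^ (2 * n - 2)) * this
  base n α z h0 hα := by
    have h0' : ∀ j, (iv z ∘ rv (2 * n)) j ≠ 0 := fun j => inv_ne_zero (h0 _)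
    have hf : ∀ {a : Fin 2}, 1 - a = 0 ↔ a = 1 := by decide
    have hf' : ∀ {a : Fin 2}, 1 - a = 1 ↔ a = 0 := by decide
    have hnd : ¬ ∃ i, Desc (2 * n) (fl (2 * n) α) i := by
      rintro ⟨i, hi1, hi2, hi3⟩
      rw [fl_apply (by omega)] at hi2 hi3
      refine hα ⟨2 * n - 2 - i, by omega, ?_, ?_⟩
      · rw [← hf', ← hi3]; congr 2; omega
      · rw [← hf, ← hi2]; congr 2; omega
    unfold mir
    rw [hΦ.base _ _ _ h0' hnd]
    have hb : Base n (fl (2 * n) α) ↔ Base n α := by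
      constructor
      · rintro ⟨b1, b2⟩
        refine ⟨fun i hi => ?_, fun i hi1 hi2 => ?_⟩
        · have := b2 (2 * n - 1 - i) (by omega) (by omega)
          rw [fl_apply (by omega), hf] at this
          rwa [show 2 * n - 1 - (2 * n - 1 - i) = i by omega] at this
        · have := b1 (2 * n - 1 - i) (by omega)
          rw [fl_apply (by omega), hf'] at this
          rwa [show 2 * n - 1 - (2 * n - 1 - i) = i by omega] at this
      · rintro ⟨b1, b2⟩
        refine ⟨fun i hi => ?_, fun i hi1 hi2 => ?_⟩
        · rw [fl_apply (by omega), hf', b2 _ (by omega) (by omega)]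
        · rw [fl_apply (by omega), hf, b1 _ (by omega)]
    rw [if_congr hb rfl rfl]
    split_ifs with hbn
    swap
    · simp
    have s1 : (range n).map (rvE (2 * n)).toEmbedding = Ico n (2 * n) := by
      ext j
      rw [mem_map_equiv, mem_range, mem_Ico]
      change rv (2 * n) j < n ↔ _
      unfold rv; split_ifs <;> omega
    have s2 : (Ico n (2 * n)).map (rvE (2 * n)).toEmbedding = range n := by
      ext j
      rw [mem_map_equiv, mem_range, mem_Ico]
      change n ≤ rv (2 * n) j ∧ rv (2 * n) j < 2 * n ↔ _
      unfold rv; split_ifs <;> omega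
    have r1 := blk_mir (κ := (W1 B).kd) (κ' := (W2 B).ku) (h := wb) (h' := wc) h0 (fun i => rfl)
      (fun i j => by
        have a1 := h0 i
        have a2 := h0 j
        unfold wb wc; field_simp) (2 * n) (range n) (fun j hj => by simp at hj; omega)
        (2 * n - 2) (by simp; omega)
    have r2 := blk_mir (κ := (W1 B).ku) (κ' := (W2 B).kd) (h := wc) (h' := wb) h0 (fun i => rfl)
      (fun i j => by
        have a1 := h0 i
        have a2 := h0 j
        unfold wb wc; field_simp) (2 * n) (Ico n (2 * n)) (fun j hj => by simp at hj; omega)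
        (2 * n - 2) (by simp; omega)
    rw [s1] at r1
    rw [s2] at r2
    rw [Wts.f, Wts.f, ← r1, ← r2, ← prod_range_mul_prod_Ico _ (show n ≤ 2 * n by omega)]
    ring

end OpenXXZ

namespace OpenXXZ

open Finset

/-- The cubic `c³ - 3 * c`, i.e. `z³ + z⁻³` for `c = z + z⁻¹`. -/
def cY (c : ℂ) : ℂ := c ^ 3 - 3 * c

/-- The basis functions of the determinants. -/
def ww (k : ℕ) (c : ℂ) : ℂ := cY c ^ (k / 2) * c ^ (k % 2)

lemma ww_add_two (k : ℕ) (c : ℂ) : ww (k + 2) c = cY c * ww k c := by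
  unfold ww
  rw [show (k + 2) / 2 = k / 2 + 1 by omega, show (k + 2) % 2 = k % 2 by omega]
  ring

/-- The matrix with entries `w_k(c_i)`. -/
def wM (m : ℕ) (c : ℕ → ℂ) : Matrix (Fin m) (Fin m) ℂ := Matrix.of fun i k => ww k (c i)

/-- The Vandermonde determinant of the first `m` entries of `c`. -/
def vdm (m : ℕ) (c : ℕ → ℂ) : ℂ := (Matrix.vandermonde fun i : Fin m => c i).det

/-- The ratio of determinants, a symmetric polynomial in the first `m` entries of `c`. -/
def EE (m : ℕ) (c : ℕ → ℂ) : ℂ := (wM m c).det / vdm m c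

lemma EE_congr {m : ℕ} {c d : ℕ → ℂ} (h : ∀ j < m, c j = d j) : EE m c = EE m d := by
  have e1 : wM m c = wM m d := by
    ext i k
    simp only [wM, Matrix.of_apply, h i i.2]
  have e2 : vdm m c = vdm m d := by
    unfold vdm
    congr 2
    funext i
    exact h i i.2
  rw [EE, EE, e1, e2]

lemma EE_perm {m : ℕ} (σ : Equiv.Perm ℕ) (hσ : ∀ j, σ j < m ↔ j < m) (c : ℕ → ℂ) :
    EE m (c ∘ σ) = EE m c := by
  let τ : Equiv.Perm (Fin m) := Equiv.ofBijective (fun j => ⟨σ j, (hσ j).2 j.2⟩)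
    ((Finite.injective_iff_bijective).1 fun i j h => Fin.ext (σ.injective (Fin.mk.inj_iff.1 h)))
  have hτ : ∀ j : Fin m, ((τ j : Fin m) : ℕ) = σ j := fun j => rfl
  have e1 : wM m (c ∘ σ) = (wM m c).submatrix τ id := by
    ext j k
    simp only [wM, Matrix.of_apply, Matrix.submatrix_apply, Function.comp, hτ, id]
  have e2 : (Matrix.vandermonde fun j : Fin m => (c ∘ σ) j) =
      (Matrix.vandermonde fun j : Fin m => c j).submatrix τ id := by
    ext j k
    simp only [Matrix.vandermonde_apply, Matrix.submatrix_apply, Function.comp, hτ, id]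
  have hs : (((Equiv.Perm.sign τ : ℤˣ) : ℤ) : ℂ) ≠ 0 := by simp
  rw [EE, EE, vdm, vdm, e1, e2, Matrix.det_permute, Matrix.det_permute, mul_div_mul_left _ _ hs]

lemma EE_sw {m i : ℕ} (hi : i + 1 < m) (c : ℕ → ℂ) : EE m (c ∘ sw i) = EE m c :=
  EE_perm (sw i) (fun _ => sw_lt hi) c

lemma vdm_succ (m : ℕ) (c : ℕ → ℂ) :
    vdm (m + 1) c = (∏ j ∈ range m, (c (j + 1) - c 0)) * vdm m (sh 1 c) := by
  unfold vdm
  rw [Matrix.det_vandermonde, Matrix.det_vandermonde, Fin.prod_univ_succ]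
  congr 1
  · rw [Fin.prod_Ioi_zero, prod_range]
    rfl
  · refine prod_congr rfl fun i _ => ?_
    rw [Fin.prod_Ioi_succ]
    rfl

lemma vdm_ne_zero {m : ℕ} {c : ℕ → ℂ} (h : Set.InjOn c (Set.Iio m)) : vdm m c ≠ 0 := by
  unfold vdm
  rw [Ne, Matrix.det_vandermonde_eq_zero_iff]
  rintro ⟨i, j, hij, hne⟩
  exact hne (Fin.ext (h i.2 j.2 hij))

lemma vdm_last (m : ℕ) : ∀ c : ℕ → ℂ,
    vdm (m + 1) c = vdm m c * ∏ j ∈ range m, (c m - c j) := by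
  induction m with
  | zero => intro c; rw [vdm_succ]; simp [vdm]
  | succ m ih =>
    intro c
    rw [vdm_succ, ih, vdm_succ m c, prod_range_succ (fun j => c (j + 1) - c 0), prod_range_succ']
    simp only [sh]
    ring

/-- Block structure of the first two rows and columns. -/
lemma det_two_block {m : ℕ} (M : Matrix (Fin (m + 2)) (Fin (m + 2)) ℂ) (M' : Matrix (Fin m) (Fin m) ℂ)
    (h0 : ∀ k : Fin m, M 0 k.succ.succ = 0) (h1 : ∀ k : Fin m, M 1 k.succ.succ = 0)
    (h2 : ∀ i k : Fin m, M i.succ.succ k.succ.succ = M' i k) :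
    M.det = (M 0 0 * M 1 1 - M 0 1 * M 1 0) * M'.det := by
  have e : M'.det = (M.submatrix (fun i : Fin m => i.succ.succ) fun i : Fin m => i.succ.succ).det := by
    congr 1
    ext i k
    exact (h2 i k).symm
  rw [Matrix.det_succ_row_zero, Fin.sum_univ_succ, Fin.sum_univ_succ]
  simp only [h0, mul_zero, zero_mul, sum_const_zero, add_zero]
  rw [Matrix.det_succ_row_zero, Fin.sum_univ_succ, Matrix.det_succ_row_zero, Fin.sum_univ_succ]
  have s1 : ∀ k : Fin m, (M.submatrix Fin.succ (Fin.succAbove 0)) 0 k.succ = 0 := fun k => h1 k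
  have s2 : ∀ k : Fin m, (M.submatrix Fin.succ (Fin.succAbove (Fin.succ 0))) 0 k.succ = 0 :=
    fun k => h1 k
  simp only [s1, s2, mul_zero, zero_mul, sum_const_zero, add_zero]
  have t1 : ((M.submatrix Fin.succ (Fin.succAbove 0)).submatrix Fin.succ (Fin.succAbove 0)).det
      = M'.det := e.symm
  have t2 : ((M.submatrix Fin.succ (Fin.succAbove (Fin.succ 0))).submatrix Fin.succ
      (Fin.succAbove 0)).det = M'.det := e.symm
  rw [t1, t2]
  have u1 : (M.submatrix Fin.succ (Fin.succAbove 0)) 0 0 = M 1 1 := rfl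
  have u2 : (M.submatrix Fin.succ (Fin.succAbove (Fin.succ 0))) 0 0 = M 1 0 := rfl
  rw [u1, u2]
  simp
  ring

lemma cY_sub (a b c : ℂ) (h : cY a = cY b) (hab : a ≠ b) :
    cY c - cY a = (c - a) * (c - b) * (c + a + b) := by
  have : a ^ 2 + a * b + b ^ 2 = 3 := by
    have := sub_ne_zero.2 hab
    refine mul_left_cancel₀ this ?_
    unfold cY at h
    linear_combination h
  unfold cY
  linear_combination (c - a) * this

/-- Recursion for the ratio of determinants. -/
lemma EE_rec (m : ℕ) {c : ℕ → ℂ} (h : Set.InjOn c (Set.Iio (m + 2))) (hY : cY (c 0) = cY (c 1)) :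
    EE (m + 2) c = (∏ i ∈ range m, (c (i + 2) + c 0 + c 1)) * EE m (sh 2 c) := by
  have h01 : c 0 ≠ c 1 := fun e => by
    have := h (show (0 : ℕ) ∈ Set.Iio (m + 2) by simp) (show (1 : ℕ) ∈ Set.Iio (m + 2) by simp) e
    omega
  let U : Matrix (Fin (m + 2)) (Fin (m + 2)) ℂ := Matrix.of fun j k =>
    if j = k then 1 else if (j : ℕ) + 2 = k then -cY (c 0) else 0
  have hU : U.det = 1 := by
    rw [Matrix.det_of_isUpperTriangular]
    · simp [U]
    · intro i j hij
      have hij' : (j : ℕ) < i := hij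
      simp only [U, Matrix.of_apply]
      rw [if_neg (by rintro rfl; omega), if_neg (by omega)]
  have hcol : ∀ i (k : Fin m), (wM (m + 2) c * U) i k.succ.succ = (cY (c i) - cY (c 0)) * ww k (c i) := by
    intro i k
    have e : ∀ j, wM (m + 2) c i j * U j k.succ.succ =
        (if j = k.succ.succ then ww j (c i) else 0) +
          (if j = k.castSucc.castSucc then -cY (c 0) * ww j (c i) else 0) := by
      intro j
      simp only [wM, U, Matrix.of_apply]
      by_cases h1 : j = k.succ.succ
      · rw [if_pos h1, if_pos h1, if_neg (by
          rw [h1]; intro hh; simp [Fin.ext_iff] at hh; omega)]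
        ring
      · rw [if_neg h1, if_neg h1]
        by_cases h2 : j = k.castSucc.castSucc
        · rw [if_pos h2, if_pos (by rw [h2]; simp)]
          ring
        · rw [if_neg h2, if_neg (fun hh => h2 (Fin.ext (by simp at hh ⊢; omega)))]
          ring
    rw [Matrix.mul_apply, sum_congr rfl fun j _ => e j, sum_add_distrib, sum_ite_eq', sum_ite_eq',
      if_pos (mem_univ _), if_pos (mem_univ _)]
    simp only [Fin.val_succ, Fin.val_castSucc, ww_add_two]
    ring
  have hc0 : ∀ i, (wM (m + 2) c * U) i 0 = 1 := by
    intro i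
    have e : ∀ j, wM (m + 2) c i j * U j 0 = if j = 0 then ww j (c i) else 0 := by
      intro j
      simp only [wM, U, Matrix.of_apply]
      split_ifs with h1 h2
      · ring
      · simp at h2
      · ring
    rw [Matrix.mul_apply, sum_congr rfl fun j _ => e j, sum_ite_eq', if_pos (mem_univ _)]
    simp [ww]
  have hc1 : ∀ i, (wM (m + 2) c * U) i 1 = c i := by
    intro i
    have e : ∀ j, wM (m + 2) c i j * U j 1 = if j = 1 then ww j (c i) else 0 := by
      intro j
      simp only [wM, U, Matrix.of_apply]
      split_ifs with h1 h2
      · ring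
      · simp at h2
      · ring
    rw [Matrix.mul_apply, sum_congr rfl fun j _ => e j, sum_ite_eq', if_pos (mem_univ _)]
    simp [ww]
  have hdet : (wM (m + 2) c).det = (c 1 - c 0) *
      ((∏ i ∈ range m, (cY (c (i + 2)) - cY (c 0))) * (wM m (sh 2 c)).det) := by
    rw [← mul_one (wM (m + 2) c).det, ← hU, ← Matrix.det_mul, det_two_block _
      (Matrix.of fun i k => (cY (c (i + 2)) - cY (c 0)) * wM m (sh 2 c) i k)]
    · rw [Matrix.det_mul_column (fun i : Fin m => cY (c (i + 2)) - cY (c 0)) (wM m (sh 2 c)),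
        hc0, hc0, hc1, hc1, prod_range]
      simp
    · intro k
      rw [hcol]
      simp
    · intro k
      rw [hcol]
      simp [← hY]
    · intro i k
      rw [hcol]
      rfl
  have hv : vdm (m + 2) c = (c 1 - c 0) * (∏ j ∈ range m, (c (j + 2) - c 0)) *
      (∏ j ∈ range m, (c (j + 2) - c 1)) * vdm m (sh 2 c) := by
    rw [vdm_succ, vdm_succ, prod_range_succ']
    have : sh 1 (sh 1 c) = sh 2 c := by funext j; rfl
    rw [this]
    simp only [sh, show ∀ j, j + 1 + 1 = j + 2 from fun _ => rfl, zero_add]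
    ring
  have hv0 : vdm (m + 2) c ≠ 0 := vdm_ne_zero h
  rw [EE, EE, hdet]
  rw [hv] at hv0 ⊢
  have a1 := right_ne_zero_of_mul hv0
  have a2 := left_ne_zero_of_mul hv0
  have hp : ∏ i ∈ range m, (cY (c (i + 2)) - cY (c 0)) = (∏ j ∈ range m, (c (j + 2) - c 0)) *
      (∏ j ∈ range m, (c (j + 2) - c 1)) * ∏ i ∈ range m, (c (i + 2) + c 0 + c 1) := by
    rw [← prod_mul_distrib, ← prod_mul_distrib]
    exact prod_congr rfl fun i _ => cY_sub _ _ _ hY h01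
  rw [hp, div_eq_iff (mul_ne_zero a2 a1), ← mul_div_assoc, div_mul_eq_mul_div, eq_div_iff a1]
  ring

/-- Polynomial version of `ww`. -/
def wwP (k : ℕ) : Polynomial ℂ :=
  (Polynomial.X ^ 3 - Polynomial.C 3 * Polynomial.X) ^ (k / 2) * Polynomial.X ^ (k % 2)

lemma eval_wwP (k : ℕ) (x : ℂ) : (wwP k).eval x = ww k x := by
  simp [wwP, ww, cY]

lemma natDegree_wwP_le (k : ℕ) : (wwP k).natDegree ≤ 3 * (k / 2) + k % 2 := by
  unfold wwP
  compute_degree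
  omega

/-- As a function of its first argument the ratio is a polynomial. -/
lemma EE_poly (M : ℕ) {c : ℕ → ℂ} (h : Set.InjOn (sh 1 c) (Set.Iio M)) :
    ∃ P : Polynomial ℂ, P.natDegree ≤ M / 2 ∧
      ∀ x, (∀ j < M, x ≠ c (j + 1)) → EE (M + 1) (Function.update c 0 x) = P.eval x := by
  let PD : Polynomial ℂ := ∑ k : Fin (M + 1), Polynomial.C ((-1) ^ (k : ℕ) *
    ((wM (M + 1) c).submatrix Fin.succ k.succAbove).det) * wwP k
  have hPD : ∀ x, PD.eval x = (wM (M + 1) (Function.update c 0 x)).det := by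
    intro x
    rw [Matrix.det_succ_row_zero, Polynomial.eval_finsetSum]
    refine sum_congr rfl fun k _ => ?_
    have : (wM (M + 1) (Function.update c 0 x)).submatrix Fin.succ k.succAbove =
        (wM (M + 1) c).submatrix Fin.succ k.succAbove := by
      ext i j
      simp [wM]
    rw [this, Polynomial.eval_mul, Polynomial.eval_C, eval_wwP]
    simp only [wM, Matrix.of_apply, Fin.val_zero, Function.update_self]
    ring
  have hdeg : PD.natDegree ≤ M + M / 2 := by
    refine Polynomial.natDegree_sum_le_of_forall_le _ _ fun k _ => ?_
    refine (Polynomial.natDegree_C_mul_le _ _).trans ((natDegree_wwP_le _).trans ?_)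
    have := k.2
    omega
  have hdvd : (∏ j ∈ range M, (Polynomial.X - Polynomial.C (c (j + 1)))) ∣ PD := by
    refine prod_dvd_of_coprime ?_ ?_
    · intro i hi j hj hij
      refine Polynomial.pairwise_coprime_X_sub_C (s := fun i : range M => c (i + 1)) ?_
        (i := ⟨i, hi⟩) (j := ⟨j, hj⟩) (by simpa using hij)
      rintro ⟨a, ha⟩ ⟨b, hb⟩ hab
      simp only [mem_range] at ha hb
      exact Subtype.ext (h ha hb hab)
    · intro j hj
      rw [Polynomial.dvd_iff_isRoot, Polynomial.IsRoot, hPD]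
      simp only [mem_range] at hj
      refine Matrix.det_zero_of_row_eq (i := 0) (j := ⟨j + 1, by omega⟩) (by simp [Fin.ext_iff]) ?_
      ext k
      simp [wM]
  obtain ⟨P, hP⟩ := hdvd
  have hmon : (∏ j ∈ range M, (Polynomial.X - Polynomial.C (c (j + 1)))).Monic :=
    Polynomial.monic_prod_of_monic _ _ fun i _ => Polynomial.monic_X_sub_C _
  have hnd : (∏ j ∈ range M, (Polynomial.X - Polynomial.C (c (j + 1)))).natDegree = M := by
    rw [Polynomial.natDegree_prod_of_monic _ _ fun i _ => Polynomial.monic_X_sub_C _]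
    simp
  refine ⟨Polynomial.C ((-1) ^ M * (vdm M (sh 1 c))⁻¹) * P, ?_, ?_⟩
  · refine (Polynomial.natDegree_C_mul_le _ _).trans ?_
    by_cases h0 : P = 0
    · simp [h0]
    rw [hP, hmon.natDegree_mul' h0, hnd] at hdeg
    omega
  · intro x hx
    have hs : sh 1 (Function.update c 0 x) = sh 1 c := by
      funext j
      simp [sh]
    have h1 : ∏ j ∈ range M, (x - c (j + 1)) ≠ 0 :=
      prod_ne_zero_iff.2 fun j hj => sub_ne_zero.2 (hx j (by simpa using hj))
    have h2 : ∏ j ∈ range M, (c (j + 1) - x) = (-1) ^ M * ∏ j ∈ range M, (x - c (j + 1)) := by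
      rw [← card_range M, ← prod_const, card_range, ← prod_mul_distrib]
      exact prod_congr rfl fun j _ => by ring
    have h3 := vdm_ne_zero h
    have h4 : ((-1 : ℂ) ^ M) * (-1) ^ M = 1 := by rw [← mul_pow]; simp
    rw [EE, ← hPD, hP, vdm_succ, hs]
    simp only [Function.update_self, ne_eq, Nat.add_eq_zero_iff, one_ne_zero, and_false,
      not_false_eq_true, Function.update_of_ne, Polynomial.eval_mul, Polynomial.eval_prod,
      Polynomial.eval_sub, Polynomial.eval_X, Polynomial.eval_C]
    have h5 : ((-1 : ℂ) ^ M) ≠ 0 := pow_ne_zero _ (by simp)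
    rw [h2]
    field_simp
    rw [← pow_mul, mul_comm M 2, pow_mul]
    simp

/-- A relation among the basis functions evaluates the ratio of determinants. -/
lemma EE_last (m : ℕ) {c : ℕ → ℂ} (h : Set.InjOn c (Set.Iio (m + 1))) (a : ℕ → ℂ) (P : ℂ → ℂ)
    (hP : ∀ x, (∏ j ∈ range m, (x - c j)) * P x = ww m x + ∑ k ∈ range m, a k * ww k x) :
    EE (m + 1) c = P (c m) * EE m c := by
  have hdet : (wM (m + 1) c).det = (∏ j ∈ range m, (c m - c j)) * P (c m) * (wM m c).det := by
    let b : Fin (m + 1) → ℂ := fun k => if (k : ℕ) < m then a k else 1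
    have hb : ∀ i : Fin (m + 1), ∑ k, b k • wM (m + 1) c i k =
        (∏ j ∈ range m, (c i - c j)) * P (c i) := by
      intro i
      rw [hP, Fin.sum_univ_castSucc, sum_range]
      simp [b, wM, add_comm]
    have h1 := Matrix.det_updateCol_sum (wM (m + 1) c) (Fin.last m) b
    have h2 : b (Fin.last m) = 1 := by simp [b]
    rw [h2, one_smul] at h1
    rw [← h1, Matrix.det_succ_column _ (Fin.last m), Fin.sum_univ_castSucc, sum_eq_zero]
    · have : ((-1 : ℂ) ^ (m + m)) = 1 := by rw [← two_mul, pow_mul]; simp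
      simp only [Matrix.updateCol_self, hb, Fin.val_last, zero_add, this, one_mul]
      congr 2
      ext i j
      simp [wM]
    · intro i _
      have : ∏ j ∈ range m, (c (i.castSucc : Fin (m + 1)) - c j) = 0 :=
        prod_eq_zero (mem_range.2 i.2) (by simp)
      simp only [Matrix.updateCol_self, hb, this]
      ring
  have hv := vdm_ne_zero h
  rw [EE, EE, hdet]
  rw [vdm_last] at hv ⊢
  have := left_ne_zero_of_mul hv
  have := right_ne_zero_of_mul hv
  field_simp

end OpenXXZ

namespace OpenXXZ

open Finset

/-- Extension of a finite configuration by zero. -/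
def ext (N : ℕ) (γ : Fin N → Fin 2) : Cfg := fun j => if h : j < N then γ ⟨j, h⟩ else 0

/-- Sum over the configurations of the first `N` sites. -/
def csum (N : ℕ) (F : Cfg → ℂ) : ℂ := ∑ γ : Fin N → Fin 2, F (ext N γ)

lemma csum_congr {N : ℕ} {F G : Cfg → ℂ} (h : ∀ α, F α = G α) : csum N F = csum N G :=
  sum_congr rfl fun _ _ => h _

lemma csum_mul_left {N : ℕ} (a : ℂ) (F : Cfg → ℂ) : csum N (fun α => a * F α) = a * csum N F :=
  (mul_sum _ _ _).symm

lemma csum_add {N : ℕ} (F G : Cfg → ℂ) : csum N (fun α => F α + G α) = csum N F + csum N G :=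
  sum_add_distrib

lemma csum_invol {N : ℕ} (e : Cfg → Cfg) (he : ∀ γ : Fin N → Fin 2, e (e (ext N γ)) = ext N γ)
    (h0 : ∀ γ : Fin N → Fin 2, ∀ j, N ≤ j → e (ext N γ) j = 0) (F : Cfg → ℂ) :
    csum N (fun α => F (e α)) = csum N F := by
  have hext : ∀ γ : Fin N → Fin 2, ext N (fun j => e (ext N γ) j) = e (ext N γ) := by
    intro γ
    funext j
    unfold ext
    split_ifs with h
    · rfl
    · exact (h0 γ j (by omega)).symm
  have hinv : Function.Involutive fun (γ : Fin N → Fin 2) (j : Fin N) => e (ext N γ) j := by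
    intro γ
    funext j
    simp only
    rw [hext, he]
    simp [ext]
  refine Fintype.sum_equiv hinv.toPerm _ _ fun γ => ?_
  change F _ = F (ext N fun j => e (ext N γ) j)
  rw [hext]

lemma csum_sw {N i : ℕ} (hi : i + 1 < N) (F : Cfg → ℂ) :
    csum N (fun α => F (α ∘ sw i)) = csum N F := by
  refine csum_invol (fun α => α ∘ sw i) (fun γ => comp_sw_sw _ _) (fun γ j hj => ?_) F
  have : ¬ sw i j < N := fun h => by have := (sw_lt hi).1 h; omega
  simp only [Function.comp, ext]
  rw [dif_neg this]

lemma fl_fl (N : ℕ) (α : Cfg) : fl N (fl N α) = α := by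
  funext j
  unfold fl
  have h : j < N → rv N j < N := fun h => by unfold rv; split_ifs; omega
  by_cases hj : j < N
  · rw [if_pos hj, if_pos (h hj), rv_rv]
    exact sub_sub_cancel _ _
  · rw [if_neg hj, if_neg hj]

lemma csum_fl {N : ℕ} (F : Cfg → ℂ) : csum N (fun α => F (fl N α)) = csum N F :=
  csum_invol (fl N) (fun γ => fl_fl _ _) (fun γ j hj => by
    simp only [fl, ext]
    rw [if_neg (by omega), dif_neg (by omega)]) F

/-- Prepend a spin. -/
def pre (a : Fin 2) (α : Cfg) : Cfg := fun j => if j = 0 then a else α (j - 1)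

lemma csum_succ (N : ℕ) (F : Cfg → ℂ) :
    csum (N + 1) F = csum N (fun α => F (pre 0 α)) + csum N (fun α => F (pre 1 α)) := by
  unfold csum
  rw [← (Fin.consEquiv fun _ => Fin 2).sum_comp, Fintype.sum_prod_type, Fin.sum_univ_two]
  have : ∀ (a : Fin 2) (γ : Fin N → Fin 2),
      ext (N + 1) (Fin.consEquiv (fun _ => Fin 2) (a, γ)) = pre a (ext N γ) := by
    intro a γ
    funext j
    unfold ext pre
    rcases j with _ | j
    · simp [Fin.consEquiv]
    · simp only [Nat.add_eq_zero_iff, one_ne_zero, and_false, if_false, Nat.add_sub_cancel]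
      by_cases h : j < N
      · rw [dif_pos (by omega), dif_pos h]
        rfl
      · rw [dif_neg (by omega), dif_neg h]
  simp only [this]

variable {W : Wts} {Φ : ℕ → Cfg → (ℕ → ℂ) → ℂ}

/-- The overlap of the inhomogeneous vectors. -/
def SS (n1 n2 : ℕ) (Φ : ℕ → Cfg → (ℕ → ℂ) → ℂ) (z : ℕ → ℂ) : ℂ :=
  csum (2 * (n1 + n2)) fun γ => Φ (n1 + n2) γ z * Φ n1 γ (iv z) *
    Φ n2 (sh (2 * n1) γ) (sh (2 * n1) (iv z))

lemma pair_sw (hΦ : Sol W Φ) {n m i : ℕ} (hn : i + 1 < 2 * n) (hm : i + 1 < 2 * m) {z : ℕ → ℂ}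
    (h0 : ∀ j, z j ≠ 0) (hz : z i ≠ z (i + 1)) (α : Cfg)
    (h1 : α i = 1) (h2 : α (i + 1) = 0) :
    Φ n α (z ∘ sw i) * Φ m α (iv (z ∘ sw i)) +
      Φ n (α ∘ sw i) (z ∘ sw i) * Φ m (α ∘ sw i) (iv (z ∘ sw i)) =
    Φ n α z * Φ m α (iv z) + Φ n (α ∘ sw i) z * Φ m (α ∘ sw i) (iv z) := by
  have h0' : ∀ j, iv z j ≠ 0 := fun j => inv_ne_zero (h0 j)
  have e1 := hΦ.exch n α z i h0 hn h1 h2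
  have e2 := hΦ.exch n α (z ∘ sw i) i (fun j => h0 _) hn h1 h2
  have e3 := hΦ.exch m α (iv z) i h0' hm h1 h2
  have e4 := hΦ.exch m α (iv z ∘ sw i) i (fun j => h0' _) hm h1 h2
  rw [comp_sw_sw] at e2 e4
  have es : iv (z ∘ sw i) = iv z ∘ sw i := rfl
  rw [es]
  simp only [Function.comp_apply, sw_left, sw_right, iv] at e2 e3 e4
  have hi := h0 i
  have hi1 := h0 (i + 1)
  have hd := sub_ne_zero.2 hz
  have hd' := sub_ne_zero.2 hz.symm
  change _ * Φ m (α ∘ sw i) (iv z) = _ * Φ m α (iv z ∘ sw i) - _ * Φ m α (iv z) at e3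
  change _ * Φ m (α ∘ sw i) (iv z ∘ sw i) = _ * Φ m α (iv z) - _ * Φ m α (iv z ∘ sw i) at e4
  generalize Φ n α z = a at *
  generalize Φ n α (z ∘ sw i) = a' at *
  generalize Φ n (α ∘ sw i) z = c at *
  generalize Φ n (α ∘ sw i) (z ∘ sw i) = c' at *
  generalize Φ m α (iv z) = b at *
  generalize Φ m α (iv z ∘ sw i) = b' at *
  generalize Φ m (α ∘ sw i) (iv z) = d at *
  generalize Φ m (α ∘ sw i) (iv z ∘ sw i) = d' at *
  generalize z i = u at *
  generalize z (i + 1) = v at *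
  have f3 : (u - v) * d = wa v u * b' - kap * u * b := by
    unfold wa at e3 ⊢
    field_simp at e3
    linear_combination e3
  have f4 : (v - u) * d' = wa u v * b - kap * v * b' := by
    unfold wa at e4 ⊢
    field_simp at e4
    linear_combination e4
  have hk : (u - v) ^ 2 = kap ^ 2 * (u * v) - wa u v * wa v u := by
    have := q_sq
    rw [kap_sq]
    unfold wa
    linear_combination ((q ^ 2 - q) * u * v + u * v) * this - (u ^ 2 + v ^ 2) * q_pow_three
  refine mul_left_cancel₀ (mul_ne_zero hd hd) ?_
  have g1 : (u - v) * (u - v) * (c' * d') =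
      -((wa v u * a - kap * u * a') * (wa u v * b - kap * v * b')) := by
    rw [← e2, ← f4]; ring
  have g2 : (u - v) * (u - v) * (c * d) =
      -((wa u v * a' - kap * v * a) * (wa v u * b' - kap * u * b)) := by
    rw [← e1, ← f3]; ring
  linear_combination g1 - g2 + (a' * b' - a * b) * hk

lemma wa_inv {u v : ℂ} (hu : u ≠ 0) (hv : v ≠ 0) : wa u⁻¹ v⁻¹ = wa v u * (u * v)⁻¹ := by
  unfold wa; field_simp

lemma wa_ne_zero {u v : ℂ} (h : u ^ 3 ≠ v ^ 3) : wa u v ≠ 0 := by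
  intro e
  refine h ?_
  unfold wa at e
  have : u = q * v := by linear_combination q ^ 2 * e - (u - q * v) * q_pow_three
  rw [this]
  linear_combination v ^ 3 * q_pow_three

lemma singlet_or {u v : ℂ} (h : u ^ 3 = v ^ 3) : u = v ∨ v = q ^ 2 * u ∨ u = q ^ 2 * v := by
  have h2 := q_sq
  have h3 := q_pow_three
  have : (u - v) * ((v - q ^ 2 * u) * (u - q ^ 2 * v)) = 0 := by
    linear_combination -q ^ 2 * h + u * v * (u - v) * q * h3 + u * v * (u - v) * h2
  rcases mul_eq_zero.1 this with h | h
  · exact .inl (sub_eq_zero.1 h)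
  · rcases mul_eq_zero.1 h with h | h
    · exact .inr (.inl (sub_eq_zero.1 h))
    · exact .inr (.inr (sub_eq_zero.1 h))

lemma pair_sw_aligned (hΦ : Sol W Φ) {n m i : ℕ} (hn : i + 1 < 2 * n) (hm : i + 1 < 2 * m)
    {z : ℕ → ℂ} (h0 : ∀ j, z j ≠ 0) (ha : wa (z i) (z (i + 1)) ≠ 0)
    (hb : wa (z (i + 1)) (z i) ≠ 0) (α : Cfg) (h : α i = α (i + 1)) :
    Φ n α (z ∘ sw i) * Φ m α (iv (z ∘ sw i)) = Φ n α z * Φ m α (iv z) := by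
  have h0' : ∀ j, iv z j ≠ 0 := fun j => inv_ne_zero (h0 j)
  have e1 := hΦ.aligned n α z i h0 hn h
  have e2 := hΦ.aligned m α (iv z) i h0' hm h
  have es : iv (z ∘ sw i) = iv z ∘ sw i := rfl
  rw [es]
  have hc := mul_ne_zero (h0 i) (h0 (i + 1))
  rw [show iv z i = (z i)⁻¹ from rfl, show iv z (i + 1) = (z (i + 1))⁻¹ from rfl,
    wa_inv (h0 _) (h0 _), wa_inv (h0 _) (h0 _)] at e2
  have e3 : wa (z (i + 1)) (z i) * Φ m α (iv z ∘ sw i) = wa (z i) (z (i + 1)) * Φ m α (iv z) := by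
    have := h0 i
    have := h0 (i + 1)
    field_simp at e2
    linear_combination e2
  refine mul_left_cancel₀ (mul_ne_zero ha hb) ?_
  linear_combination wa (z (i + 1)) (z i) * Φ m α (iv z ∘ sw i) * e1 +
    wa (z (i + 1)) (z i) * Φ n α z * e3

lemma pair_sw_singlet (hΦ : Sol W Φ) {n m i : ℕ} (hn : i + 1 < 2 * n) (hm : i + 1 < 2 * m)
    {z : ℕ → ℂ} (h0 : ∀ j, z j ≠ 0) (hs : z (i + 1) = q ^ 2 * z i ∨ z i = q ^ 2 * z (i + 1))
    (α : Cfg) (h : α i = α (i + 1)) :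
    Φ n α (z ∘ sw i) * Φ m α (iv (z ∘ sw i)) = Φ n α z * Φ m α (iv z) := by
  have hqi : ∀ {u v : ℂ}, v = q ^ 2 * u → u⁻¹ = q ^ 2 * v⁻¹ := by
    rintro u v rfl
    by_cases hu : u = 0
    · simp [hu]
    have := q_ne_zero
    field_simp
  have h0' : ∀ j, iv z j ≠ 0 := fun j => inv_ne_zero (h0 j)
  rcases hs with hs | hs
  · have a1 : Φ n α z = 0 := singlet_aligned hΦ hn h0 hs h
    have a2 : Φ m α (iv (z ∘ sw i)) = 0 := singlet_aligned hΦ hm (fun j => h0' _) (by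
      simp only [iv, Function.comp, sw_left, sw_right]; exact hqi hs) h
    rw [a1, a2, zero_mul, mul_zero]
  · have a1 : Φ n α (z ∘ sw i) = 0 := singlet_aligned hΦ hn (fun j => h0 _) (by
      simp only [Function.comp, sw_left, sw_right]; exact hs) h
    have a2 : Φ m α (iv z) = 0 := singlet_aligned hΦ hm h0' (hqi hs) h
    rw [a1, a2, zero_mul, mul_zero]

/-- The overlap is symmetric in the inhomogeneity parameters of the left block. -/
lemma SS_sw (hΦ : Sol W Φ) {n1 n2 i : ℕ} (hi : i + 1 < 2 * n1) {z : ℕ → ℂ}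
    (h0 : ∀ j, z j ≠ 0) (hz : z i ≠ z (i + 1)) : SS n1 n2 Φ (z ∘ sw i) = SS n1 n2 Φ z := by
  have hn : i + 1 < 2 * (n1 + n2) := by omega
  have hal : ∀ α : Cfg, α i = α (i + 1) → Φ (n1 + n2) α (z ∘ sw i) * Φ n1 α (iv (z ∘ sw i)) =
      Φ (n1 + n2) α z * Φ n1 α (iv z) := by
    intro α h
    by_cases h3 : z i ^ 3 = z (i + 1) ^ 3
    · rcases singlet_or h3 with e | e | e
      · exact absurd e hz
      · exact pair_sw_singlet hΦ hn hi h0 (.inl e) α h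
      · exact pair_sw_singlet hΦ hn hi h0 (.inr e) α h
    · exact pair_sw_aligned hΦ hn hi h0 (wa_ne_zero h3) (wa_ne_zero (Ne.symm h3)) α h
  have key : ∀ α : Cfg, Φ (n1 + n2) α (z ∘ sw i) * Φ n1 α (iv (z ∘ sw i)) +
      Φ (n1 + n2) (α ∘ sw i) (z ∘ sw i) * Φ n1 (α ∘ sw i) (iv (z ∘ sw i)) =
      Φ (n1 + n2) α z * Φ n1 α (iv z) + Φ (n1 + n2) (α ∘ sw i) z * Φ n1 (α ∘ sw i) (iv z) := by
    intro α
    by_cases h : α i = α (i + 1)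
    · rw [comp_sw_of_eq α h, hal α h]
    · have hcases : (α i = 1 ∧ α (i + 1) = 0) ∨ (α i = 0 ∧ α (i + 1) = 1) := by
        generalize α i = a at *
        generalize α (i + 1) = b at *
        revert a b; decide
      rcases hcases with ⟨h1, h2⟩ | ⟨h1, h2⟩
      · exact pair_sw hΦ hn hi h0 hz α h1 h2
      · have := pair_sw hΦ hn hi h0 hz (α ∘ sw i) (by simp [h2]) (by simp [h1])
        rw [comp_sw_sw] at this
        linear_combination this
  have hR : ∀ α : Cfg, sh (2 * n1) (α ∘ sw i) = sh (2 * n1) α := by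
    intro α
    funext j
    simp only [sh, Function.comp]
    rw [sw_of_ne (by omega) (by omega)]
  have hR' : sh (2 * n1) (iv (z ∘ sw i)) = sh (2 * n1) (iv z) := by
    funext j
    simp only [sh, Function.comp, iv]
    rw [sw_of_ne (by omega) (by omega)]
  have dbl : ∀ F : Cfg → ℂ, csum (2 * (n1 + n2)) F + csum (2 * (n1 + n2)) F =
      csum (2 * (n1 + n2)) (fun α => F α + F (α ∘ sw i)) := by
    intro F
    rw [csum_add, csum_sw hn]
  have h2 : SS n1 n2 Φ (z ∘ sw i) + SS n1 n2 Φ (z ∘ sw i) = SS n1 n2 Φ z + SS n1 n2 Φ z := by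
    unfold SS
    rw [dbl, dbl]
    refine csum_congr fun α => ?_
    rw [hR, hR']
    linear_combination Φ n2 (sh (2 * n1) α) (sh (2 * n1) (iv z)) * key α
  linear_combination h2 / 2

/-- Reduction of the overlap when the first two sites form a singlet. -/
lemma SS_rec (hΦ : Sol W Φ) (m n2 : ℕ) {z : ℕ → ℂ} (hz : Gen2 z) (h1 : z 1 = q ^ 2 * z 0) :
    SS (m + 1) n2 Φ z = -q * redFac W (m + 1 + n2) z * redFac W (m + 1) (iv z ∘ sw 0) *
      SS m n2 Φ (sh 2 z) := by
  have h0 := hz.ne_zero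
  have hq := q_ne_zero
  have h0' : ∀ j, iv z j ≠ 0 := fun j => inv_ne_zero (h0 j)
  have hy : iv z 0 = q ^ 2 * iv z 1 := by
    simp only [iv, h1]
    have := h0 0
    field_simp
  have hco : wa (iv z 0) (iv z 1) / (kap * iv z 1) = -q := by
    rw [div_eq_iff (mul_ne_zero kap_ne_zero (h0' 1)), hy]
    unfold wa kap
    ring
  set N := 2 * (m + n2) with hN
  have hN2 : 2 * (m + 1 + n2) = N + 1 + 1 := by omega
  unfold SS
  rw [hN2, csum_succ, csum_succ, csum_succ]
  have hs : ∀ a b α, sh 2 (pre a (pre b α)) = α := fun a b α => by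
    funext j; simp [sh, pre]
  have hs' : ∀ a b α, sh (2 * (m + 1)) (pre a (pre b α)) = sh (2 * m) α := fun a b α => by
    rw [← hs a b α]
    funext j
    simp only [sh]
    rw [hs]
    congr 1
  have hz' : sh (2 * (m + 1)) (iv z) = sh (2 * m) (iv (sh 2 z)) := by
    funext j
    simp only [sh, iv]
    congr 2
  have hswap : ∀ α, pre 0 (pre 1 α) = pre 1 (pre 0 α) ∘ sw 0 := by
    intro α
    funext j
    simp only [Function.comp, pre, Equiv.swap_apply_def]
    rcases j with _ | _ | j <;> simp
  have al0 : ∀ a α, Φ (m + 1 + n2) (pre a (pre a α)) z = 0 := fun a α =>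
    singlet_aligned hΦ (i := 0) (by omega) h0 h1 (by simp [pre])
  have fl0 : ∀ α, Φ (m + 1 + n2) (pre 0 (pre 1 α)) z = -q * Φ (m + 1 + n2) (pre 1 (pre 0 α)) z := by
    intro α
    rw [hswap]
    exact singlet_flip hΦ (i := 0) (by omega) h0 h1 (by simp [pre]) (by simp [pre])
  have ctr : ∀ α, Φ (m + 1) (pre 1 (pre 0 α)) (iv z) - q * Φ (m + 1) (pre 0 (pre 1 α)) (iv z) =
      -q * Φ (m + 1) (pre 1 (pre 0 α)) (iv z ∘ sw 0) := by
    intro α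
    rw [hswap, contraction hΦ (by omega) h0' hy (by simp [pre]) (by simp [pre]), hco]
  have rd1 : ∀ α, Φ (m + 1 + n2) (pre 1 (pre 0 α)) z =
      redFac W (m + 1 + n2) z * Φ (m + n2) α (sh 2 z) := by
    intro α
    rw [reduction hΦ (by omega) _ (by simp [pre]) (by simp [pre]) z hz.gen h1, hs]
    congr 2
    omega
  have rd2 : ∀ α, Φ (m + 1) (pre 1 (pre 0 α)) (iv z ∘ sw 0) =
      redFac W (m + 1) (iv z ∘ sw 0) * Φ m α (iv (sh 2 z)) := by
    intro α
    rw [reduction hΦ (by omega) _ (by simp [pre]) (by simp [pre]) _ (hz.iv.comp _).gen (by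
      simpa using hy), hs]
    congr 2
  simp only [al0, zero_mul, csum_congr (N := N) (F := fun _ => (0 : ℂ)) (G := fun _ => 0)
    fun _ => rfl, hs', hz', fl0, rd1]
  rw [← csum_mul_left]
  have z0 : csum N (fun _ => 0) = 0 := by simp [csum]
  rw [z0, zero_add, add_zero, ← csum_add]
  refine csum_congr fun α => ?_
  have c1 := ctr α
  rw [rd2] at c1
  linear_combination redFac W (m + 1 + n2) z * Φ (m + n2) α (sh 2 z) *
    Φ n2 (sh (2 * m) α) (sh (2 * m) (iv (sh 2 z))) * c1

end OpenXXZ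

namespace OpenXXZ
open Finset Polynomial

/-- The symmetric variable of a rapidity. -/
def cf (z : ℂ) : ℂ := z + z⁻¹

lemma cf_inv (z : ℂ) : cf z⁻¹ = cf z := by unfold cf; rw [inv_inv, add_comm]

lemma cf_inj {a b : ℂ} (ha : a ≠ 0) (hb : b ≠ 0) (h : cf a = cf b) : a = b ∨ a * b = 1 := by
  unfold cf at h
  field_simp at h
  have : (a - b) * (a * b - 1) = 0 := by linear_combination h
  rcases mul_eq_zero.1 this with h | h
  · exact .inl (sub_eq_zero.1 h)
  · exact .inr (sub_eq_zero.1 h)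

lemma cf_pow_three {a : ℂ} (ha : a ≠ 0) : cY (cf a) = a ^ 3 + (a ^ 3)⁻¹ := by
  unfold cY cf
  field_simp
  ring

/-- The closed form of the overlap. -/
def ZZ (B : ℂ) (n1 n2 : ℕ) (z : ℕ → ℂ) : ℂ :=
  (-B) ^ (n1 + n2) * (∏ j ∈ range (2 * n1), z j ^ n2) * (∏ j ∈ range (2 * n2), z (j + 2 * n1) ^ n1) *
    EE (2 * n1) (cf ∘ z) * EE (2 * n2) (sh (2 * n1) (cf ∘ z)) *
    EE (2 * (n1 + n2) + 1) (Function.update (cf ∘ z) (2 * (n1 + n2)) (cf (B * q ^ 2)))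

/-- The boundary rapidity is generic with respect to the inhomogeneities. -/
structure GN (ζ : ℂ) (z : ℕ → ℂ) : Prop where
  g : Gen2 z
  ne : ∀ _i, z _i ≠ ζ
  mul_ne : ∀ _i, z _i * ζ ≠ 1

lemma GN.comp {ζ : ℂ} {z : ℕ → ℂ} (hz : GN ζ z) (σ : Equiv.Perm ℕ) : GN ζ (z ∘ σ) :=
  ⟨hz.g.comp σ, fun _ => hz.ne _, fun _ => hz.mul_ne _⟩

lemma Gen2.cf_inj {z : ℕ → ℂ} (hz : Gen2 z) : Function.Injective (cf ∘ z) := by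
  intro i j h
  rcases OpenXXZ.cf_inj (hz.ne_zero i) (hz.ne_zero j) h with h | h
  · exact hz.inj h
  · by_contra hij
    exact hz.mul_ne i j hij (by rw [h, one_pow])

lemma GN.cf_ne {ζ : ℂ} (hζ : ζ ≠ 0) {z : ℕ → ℂ} (hz : GN ζ z) (i : ℕ) : cf (z i) ≠ cf ζ := by
  intro h
  rcases OpenXXZ.cf_inj (hz.g.ne_zero i) hζ h with h | h
  · exact hz.ne i h
  · exact hz.mul_ne i h

lemma GN.injOn {ζ : ℂ} (hζ : ζ ≠ 0) {z : ℕ → ℂ} (hz : GN ζ z) (m : ℕ) :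
    Set.InjOn (Function.update (cf ∘ z) m (cf ζ)) (Set.Iio (m + 1)) := by
  intro i hi j hj h
  rcases eq_or_ne i m with rfl | hi'
  · rcases eq_or_ne j i with rfl | hj'
    · rfl
    · rw [Function.update_self, Function.update_of_ne hj'] at h
      exact absurd h.symm (hz.cf_ne hζ j)
  · rcases eq_or_ne j m with rfl | hj'
    · rw [Function.update_self, Function.update_of_ne hi'] at h
      exact absurd h (hz.cf_ne hζ i)
    · rw [Function.update_of_ne hi', Function.update_of_ne hj'] at h
      exact hz.g.cf_inj h

lemma ZZ_sw (B : ℂ) {n1 n2 i : ℕ} (hi : i + 1 < 2 * n1) (z : ℕ → ℂ) :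
    ZZ B n1 n2 (z ∘ sw i) = ZZ B n1 n2 z := by
  unfold ZZ
  have e1 : ∏ j ∈ range (2 * n1), (z ∘ sw i) j ^ n2 = ∏ j ∈ range (2 * n1), z j ^ n2 :=
    prod_pow_sw z hi n2
  have e2 : ∀ j, (z ∘ sw i) (j + 2 * n1) = z (j + 2 * n1) := fun j => by
    simp only [Function.comp]
    rw [sw_of_ne (by omega) (by omega)]
  have e3 : sh (2 * n1) (cf ∘ z ∘ sw i) = sh (2 * n1) (cf ∘ z) := by
    funext j
    simp only [sh, Function.comp] at e2 ⊢
    rw [e2]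
  have e4 : Function.update (cf ∘ z ∘ sw i) (2 * (n1 + n2)) (cf (B * q ^ 2)) =
      Function.update (cf ∘ z) (2 * (n1 + n2)) (cf (B * q ^ 2)) ∘ sw i := by
    funext j
    simp only [Function.comp]
    rcases eq_or_ne j (2 * (n1 + n2)) with rfl | hj
    · rw [Function.update_self, sw_of_ne (by omega) (by omega), Function.update_self]
    · rw [Function.update_of_ne hj, Function.update_of_ne]
      · rfl
      intro h
      apply hj
      have := congrArg (sw i) h
      rw [Equiv.swap_apply_self] at this
      rw [this, sw_of_ne (by omega) (by omega)]
  rw [e1, e3, e4, EE_sw (by omega), ← Function.comp_assoc, EE_sw hi]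
  simp only [e2]

lemma cY_singlet {z : ℕ → ℂ} (h0 : z 0 ≠ 0) (h1 : z 1 = q ^ 2 * z 0) :
    cY (cf (z 0)) = cY (cf (z 1)) := by
  have : (z 1) ^ 3 = z 0 ^ 3 := by
    rw [h1, mul_pow, ← pow_mul, mul_comm 2 3, pow_mul, q_pow_three, one_pow, one_mul]
  have h0' : z 1 ≠ 0 := by rw [h1]; exact mul_ne_zero (pow_ne_zero _ q_ne_zero) h0
  rw [cf_pow_three h0, cf_pow_three h0', this]

lemma ZZ_rec {B : ℂ} (hB : B ≠ 0) (m n2 : ℕ) {z : ℕ → ℂ} (hz : GN (B * q ^ 2) z)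
    (h1 : z 1 = q ^ 2 * z 0) :
    ZZ B (m + 1) n2 z = -B * (z 0 * z 1) ^ n2 * (∏ j ∈ range (2 * n2), z (j + 2 * m + 2)) *
      (∏ i ∈ range (2 * m), (cf (z (i + 2)) + cf (z 0) + cf (z 1))) *
      ((∏ i ∈ range (2 * (m + n2)), (cf (z (i + 2)) + cf (z 0) + cf (z 1))) *
        (cf (B * q ^ 2) + cf (z 0) + cf (z 1))) * ZZ B m n2 (sh 2 z) := by
  have hζ : B * q ^ 2 ≠ 0 := mul_ne_zero hB (pow_ne_zero _ q_ne_zero)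
  have hY := cY_singlet (hz.g.ne_zero 0) h1
  have e1 : EE (2 * (m + 1)) (cf ∘ z) =
      (∏ i ∈ range (2 * m), (cf (z (i + 2)) + cf (z 0) + cf (z 1))) * EE (2 * m) (cf ∘ sh 2 z) :=
    EE_rec (2 * m) (fun i _ j _ h => hz.g.cf_inj h) hY
  have e2 : EE (2 * (m + 1 + n2) + 1) (Function.update (cf ∘ z) (2 * (m + 1 + n2)) (cf (B * q ^ 2))) =
      ((∏ i ∈ range (2 * (m + n2)), (cf (z (i + 2)) + cf (z 0) + cf (z 1))) *
        (cf (B * q ^ 2) + cf (z 0) + cf (z 1))) *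
      EE (2 * (m + n2) + 1) (Function.update (cf ∘ sh 2 z) (2 * (m + n2)) (cf (B * q ^ 2))) := by
    have hin := hz.injOn hζ (2 * (m + 1 + n2))
    have hN : 2 * (m + 1 + n2) + 1 = 2 * (m + n2) + 1 + 2 := by omega
    rw [hN] at hin ⊢
    rw [EE_rec _ hin]
    · rw [Function.update_of_ne (by omega), Function.update_of_ne (by omega), prod_range_succ,
        show 2 * (m + n2) + 2 = 2 * (m + 1 + n2) by omega, Function.update_self]
      congr 1
      · congr 1
        refine prod_congr rfl fun i hi => ?_
        rw [mem_range] at hi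
        rw [Function.update_of_ne (by omega)]
        rfl
      · congr 1
        funext j
        simp only [sh, Function.update_apply, Function.comp]
        by_cases h : j = 2 * (m + n2)
        · rw [if_pos (by omega), if_pos h]
        · rw [if_neg (by omega), if_neg h]
    · rw [Function.update_of_ne (by omega), Function.update_of_ne (by omega)]
      exact hY
  have e3 : sh (2 * (m + 1)) (cf ∘ z) = sh (2 * m) (cf ∘ sh 2 z) := by
    funext j
    simp only [sh, Function.comp]
    congr 2
  unfold ZZ
  rw [e1, e2, e3, show 2 * (m + 1) = 2 * m + 1 + 1 by omega, prod_range_succ', prod_range_succ']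
  have e4 : ∏ j ∈ range (2 * n2), z (j + (2 * m + 1 + 1)) ^ (m + 1) =
      (∏ j ∈ range (2 * n2), z (j + 2 * m + 2)) * ∏ j ∈ range (2 * n2), sh 2 z (j + 2 * m) ^ m := by
    rw [← prod_mul_distrib]
    refine prod_congr rfl fun j _ => ?_
    simp only [sh]
    rw [show j + (2 * m + 1 + 1) = j + 2 * m + 2 by omega]
    ring
  have e5 : ∏ k ∈ range (2 * m), z (k + 1 + 1) ^ n2 = ∏ j ∈ range (2 * m), sh 2 z j ^ n2 := rfl
  rw [e4, e5]
  ring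

/-- The properties of the boundary weights used in the evaluation of the overlap. -/
structure Wts.Nice (B : ℂ) (W : Wts) : Prop where
  good : W.Good
  quad : ∀ u, u ≠ 0 → W.kd u * W.ku (q ^ 2 * u) * W.kd (q ^ 2 * u)⁻¹ * W.ku u⁻¹ =
    B * q ^ 2 * (cf (B * q ^ 2) + cf u + cf (q ^ 2 * u))
  lin : ∃ a b : ℂ, ∀ u, u ≠ 0 → W.kd u * W.kd u⁻¹ = a + b * cf u
  lin' : ∃ a b : ℂ, ∀ u, u ≠ 0 → W.mu u * W.mu u⁻¹ = a + b * cf u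

lemma q_sq_mul_inv (u : ℂ) : (q ^ 2 * u)⁻¹ = q * u⁻¹ := by
  rw [mul_inv]
  congr 1
  exact inv_eq_of_mul_eq_one_right (by rw [← pow_succ, q_pow_three])

lemma quad_aux {B u : ℂ} (hB : B ≠ 0) (hu : u ≠ 0) : (B * u - 1) * (B * (q * u⁻¹) - 1) =
    B * q ^ 2 * (cf (B * q ^ 2) + cf u + cf (q ^ 2 * u)) := by
  unfold cf
  rw [mul_comm B (q ^ 2), q_sq_mul_inv, q_sq_mul_inv]
  linear_combination B ^ 2 * q * mul_inv_cancel₀ hu -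
    (B ^ 2 * q + B * B⁻¹ + B * q * u + B * u⁻¹) * q_pow_three - mul_inv_cancel₀ hB -
    (B * u + B * u⁻¹) * q_sq

lemma W1_nice {B : ℂ} (hB : B ≠ 0) : (W1 B).Nice B where
  good := W1_good B
  quad u hu := by
    rw [← quad_aux hB hu, q_sq_mul_inv]
    simp only [W1, mul_one]
  lin := ⟨B ^ 2 + 1, -B, fun u hu => by simp only [W1, cf]; field_simp; ring⟩
  lin' := ⟨1, 0, fun u hu => by simp [W1]⟩

lemma W2_nice {B : ℂ} (hB : B ≠ 0) : (W2 B).Nice B where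
  good := W2_good B
  quad u hu := by
    rw [← quad_aux hB hu]
    simp only [W2, one_mul, mul_one, q_sq_mul_inv, inv_inv]
    ring
  lin := ⟨1, 0, fun u hu => by simp [W2]⟩
  lin' := ⟨q ^ 2 + q * B ^ 2, -B, fun u hu => by
    simp only [W2, cf, inv_inv]
    linear_combination (-B * (u + u⁻¹) + q * B ^ 2 * (u * u⁻¹)) * q_pow_three +
      q * B ^ 2 * mul_inv_cancel₀ hu⟩

lemma SS_of_singlet {B : ℂ} (hB : B ≠ 0) {W : Wts} (hW : W.Nice B) {Φ : ℕ → Cfg → (ℕ → ℂ) → ℂ}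
    (hΦ : Sol W Φ) (m n2 : ℕ) {z : ℕ → ℂ} (hz : GN (B * q ^ 2) z) (h1 : z 1 = q ^ 2 * z 0)
    (ih : SS m n2 Φ (sh 2 z) = ZZ B m n2 (sh 2 z)) : SS (m + 1) n2 Φ z = ZZ B (m + 1) n2 z := by
  rw [SS_rec hΦ m n2 hz.g h1, ih, ZZ_rec hB m n2 hz h1]
  have h0 := hz.g.ne_zero
  have hq := q_ne_zero
  set s := cf (z 0) + cf (z 1) with hs
  have r1 : redFac W (m + 1 + n2) z = q ^ (m + n2) * W.kd (z 0) * W.ku (z 1) *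
      (z 1 ^ (2 * (m + n2)) * ((∏ i ∈ range (2 * m), z (i + 2)) *
        ∏ j ∈ range (2 * n2), z (j + 2 * m + 2)) *
        ∏ i ∈ range (2 * (m + n2)), (cf (z (i + 2)) + cf (z 0) + cf (z 1))) := by
    unfold redFac
    rw [show m + 1 + n2 - 1 = m + n2 by omega, prod_Ico_eq_prod_range,
      show 2 * (m + 1 + n2) - 2 = 2 * (m + n2) by omega]
    congr 1
    have : ∀ i ∈ range (2 * (m + n2)), wa (z 1) (z (2 + i)) * wc (z 1) (z (2 + i)) =
        -1 * z 1 * z (i + 2) * (cf (z (i + 2)) + cf (z 0) + cf (z 1)) := fun i _ => by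
      rw [wa_mul_wc_singlet (h0 0) (h0 _) h1, add_comm 2 i]
      unfold cf
      ring
    rw [prod_congr rfl this]
    simp only [prod_mul_distrib, prod_const, card_range]
    rw [pow_mul (-1 : ℂ), neg_one_sq, one_pow, one_mul, show 2 * (m + n2) = 2 * m + 2 * n2 by ring,
      prod_range_add (fun i : ℕ => z (i + 2))]
    congr 3
    refine prod_congr rfl fun j _ => ?_
    congr 1
    omega
  have r2 : redFac W (m + 1) (iv z ∘ sw 0) = q ^ m * W.kd (z 1)⁻¹ * W.ku (z 0)⁻¹ *
      ((z 0)⁻¹ ^ (2 * m) * (∏ i ∈ range (2 * m), z (i + 2))⁻¹ *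
        ∏ i ∈ range (2 * m), (cf (z (i + 2)) + cf (z 0) + cf (z 1))) := by
    unfold redFac
    rw [show m + 1 - 1 = m by omega, prod_Ico_eq_prod_range,
      show 2 * (m + 1) - 2 = 2 * m by omega]
    simp only [Function.comp, sw_left, show sw 0 1 = 0 from sw_right 0, iv]
    congr 1
    have : ∀ i ∈ range (2 * m), wa (z 0)⁻¹ (z (sw 0 (2 + i)))⁻¹ * wc (z 0)⁻¹ (z (sw 0 (2 + i)))⁻¹ =
        -1 * (z 0)⁻¹ * (z (i + 2))⁻¹ * (cf (z (i + 2)) + cf (z 0) + cf (z 1)) := fun i _ => by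
      rw [sw_of_ne (by omega) (by omega), wa_mul_wc_singlet (inv_ne_zero (h0 1))
        (inv_ne_zero (h0 _)) (by rw [h1]; field_simp), add_comm 2 i]
      unfold cf
      simp only [inv_inv]
      ring
    rw [prod_congr rfl this]
    simp only [prod_mul_distrib, prod_const, card_range, prod_inv_distrib]
    rw [pow_mul (-1 : ℂ), neg_one_sq, one_pow, one_mul]
  have hp : ∏ i ∈ range (2 * m), z (i + 2) ≠ 0 := prod_ne_zero_iff.2 fun _ _ => h0 _
  have hk := hW.quad (z 0) (h0 0)
  rw [← h1] at hk
  rw [r1, r2]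
  generalize ∏ i ∈ range (2 * m), (cf (z (i + 2)) + cf (z 0) + cf (z 1)) = P1
  generalize ∏ i ∈ range (2 * (m + n2)), (cf (z (i + 2)) + cf (z 0) + cf (z 1)) = P2
  generalize ∏ j ∈ range (2 * n2), z (j + 2 * m + 2) = P3
  generalize ∏ i ∈ range (2 * m), z (i + 2) = P4 at *
  have hpow : -q * q ^ (m + n2) * q ^ m * z 1 ^ (2 * (m + n2)) * (z 0)⁻¹ ^ (2 * m) * (B * q ^ 2) =
      -B * (z 0 * z 1) ^ n2 := by
    have hz0 := h0 0
    rw [h1]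
    have e6 : ∀ k, q ^ (6 * k) = 1 := fun k => by
      rw [show 6 * k = 3 * (2 * k) by ring, pow_mul, q_pow_three, one_pow]
    have e3 : ∀ k, q ^ (3 * k) = 1 := fun k => by rw [pow_mul, q_pow_three, one_pow]
    have : (q ^ 2 * z 0) ^ (2 * (m + n2)) * (z 0)⁻¹ ^ (2 * m) = q ^ (4 * (m + n2)) * z 0 ^ (2 * n2) := by
      rw [mul_pow, ← pow_mul, show 2 * (m + n2) = 2 * m + 2 * n2 by ring, pow_add (z 0), inv_pow]
      field_simp
      congr 1
      ring
    calc _ = -B * ((q ^ 2 * z 0) ^ (2 * (m + n2)) * (z 0)⁻¹ ^ (2 * m)) * q ^ (2 * m + n2 + 3) := by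
          ring
      _ = -B * z 0 ^ (2 * n2) * (q ^ (6 * m) * q ^ (3 * (n2 + 1)) * q ^ (2 * n2)) := by rw [this]; ring
      _ = _ := by rw [e6, e3]; ring
  rw [← hpow]
  generalize W.kd (z 0) = k1 at *
  generalize W.ku (z 1) = k2 at *
  generalize W.kd (z 1)⁻¹ = k3 at *
  generalize W.ku (z 0)⁻¹ = k4 at *
  generalize ZZ B m n2 (sh 2 z) = Z
  generalize z 1 ^ (2 * (m + n2)) = A1
  generalize (z 0)⁻¹ ^ (2 * m) = A2
  linear_combination -q * q ^ (m + n2) * q ^ m * A1 * A2 * P1 * P2 * P3 * Z *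
    (hk + k1 * k2 * k3 * k4 * mul_inv_cancel₀ hp)

end OpenXXZ

namespace OpenXXZ
open Finset Polynomial

/-- Inhomogeneities whose cubes are generic. -/
structure GG (ζ : ℂ) (y : ℕ → ℂ) : Prop where
  ne_zero : ∀ _i, y _i ≠ 0
  zmul : ∀ _i, (y _i * ζ) ^ 3 ≠ 1
  zne : ∀ _i, y _i ^ 3 ≠ ζ ^ 3
  mul : ∀ _i _k, (y _i * y _k) ^ 3 ≠ 1
  cne : ∀ _i _k, _i ≠ _k → y _i ^ 3 ≠ y _k ^ 3

lemma GG.comp {ζ : ℂ} {y : ℕ → ℂ} (h : GG ζ y) (σ : Equiv.Perm ℕ) : GG ζ (y ∘ σ) :=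
  ⟨fun _ => h.ne_zero _, fun _ => h.zmul _, fun _ => h.zne _, fun _ _ => h.mul _ _,
    fun _ _ hij => h.cne _ _ (σ.injective.ne hij)⟩

lemma GG.sh {ζ : ℂ} {y : ℕ → ℂ} (h : GG ζ y) (k : ℕ) : GG ζ (sh k y) :=
  ⟨fun _ => h.ne_zero _, fun _ => h.zmul _, fun _ => h.zne _, fun _ _ => h.mul _ _,
    fun _ _ hij => h.cne _ _ (by omega)⟩

lemma GG.gn {ζ : ℂ} {y : ℕ → ℂ} (h : GG ζ y) : GN ζ y where
  g := ⟨h.ne_zero, fun i j hij => by_contra fun hne => h.cne i j hne (by rw [hij]),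
    fun _ _ _ => h.mul _ _⟩
  ne i e := h.zne i (by rw [e])
  mul_ne i e := h.zmul i (by rw [e, one_pow])

lemma GG.gn_cons {ζ : ℂ} {y : ℕ → ℂ} (h : GG ζ (OpenXXZ.sh 1 y)) {j : ℕ} (hj : y 0 ^ 3 = y (j + 1) ^ 3)
    (hne : y 0 ≠ y (j + 1)) : GN ζ y := by
  have h' : ∀ i, ∃ k, y i ^ 3 = OpenXXZ.sh 1 y k ^ 3 := fun i => by
    rcases i with _ | i
    · exact ⟨j, hj⟩
    · exact ⟨i, rfl⟩
  have h0 : ∀ i, i ≠ 0 → y 0 ≠ y i := by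
    intro i hi e
    obtain ⟨i, rfl⟩ := Nat.exists_eq_succ_of_ne_zero hi
    by_cases hij : i = j
    · exact hne (by rw [e, hij])
    · exact h.cne i j hij (by simp only [OpenXXZ.sh]; rw [← hj, e])
  refine ⟨⟨fun i e => ?_, fun i k e => ?_, fun i k _ e => ?_⟩, fun i e => ?_, fun i e => ?_⟩
  · obtain ⟨k, hk⟩ := h' i
    exact h.ne_zero k (pow_eq_zero_iff (n := 3) (by norm_num) |>.1 (by rw [← hk, e]; norm_num))
  · by_contra hik
    rcases i with _ | i
    · exact h0 k (Ne.symm hik) e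
    · rcases k with _ | k
      · exact h0 _ hik e.symm
      · exact h.cne i k (by omega) (by simp only [OpenXXZ.sh]; rw [e])
  · obtain ⟨i', hi⟩ := h' i
    obtain ⟨k', hk⟩ := h' k
    exact h.mul i' k' (by rw [mul_pow, ← hi, ← hk, ← mul_pow, e])
  · obtain ⟨k, hk⟩ := h' i
    exact h.zne k (by rw [← hk, e])
  · obtain ⟨k, hk⟩ := h' i
    exact h.zmul k (by rw [mul_pow, ← hk, ← mul_pow, e, one_pow])

variable {W : Wts} {Φ : ℕ → Cfg → (ℕ → ℂ) → ℂ} {B : ℂ}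

lemma SS_of_node (hB : B ≠ 0) (hW : W.Nice B) (hΦ : Sol W Φ) (n1 n2 : ℕ)
    (ih : ∀ z, GG (B * q ^ 2) z → SS n1 n2 Φ z = ZZ B n1 n2 z) (j : ℕ) :
    ∀ y : ℕ → ℂ, j + 1 < 2 * (n1 + 1) → GG (B * q ^ 2) (sh 1 y) → y 0 ^ 3 = y (j + 1) ^ 3 →
      y 0 ≠ y (j + 1) → SS (n1 + 1) n2 Φ y = ZZ B (n1 + 1) n2 y := by
  induction j with
  | zero =>
    intro y hj hy he hne
    have hgn := hy.gn_cons he hne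
    have h2 : GG (B * q ^ 2) (sh 2 y) := hy.sh 1
    rcases singlet_or he with e | e | e
    · exact absurd e hne
    · exact SS_of_singlet hB hW hΦ n1 n2 hgn e (ih _ h2)
    · have hs : sh 2 (y ∘ sw 0) = sh 2 y := by
        funext j
        simp only [sh, Function.comp]
        rw [sw_of_ne (by omega) (by omega)]
      rw [← SS_sw hΦ (i := 0) (by omega) hgn.g.ne_zero hne, ← ZZ_sw B (i := 0) (by omega)]
      refine SS_of_singlet hB hW hΦ n1 n2 (hgn.comp _) ?_ ?_
      · simpa using e
      · rw [hs]; exact ih _ h2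
  | succ j IH =>
    intro y hj hy he hne
    have hgn := hy.gn_cons he hne
    rw [← SS_sw hΦ (i := j + 1) (by omega) hgn.g.ne_zero (hgn.g.inj.ne (by omega)),
      ← ZZ_sw B (i := j + 1) (by omega)]
    have h0 : (y ∘ sw (j + 1)) 0 = y 0 := by
      simp only [Function.comp]; rw [sw_of_ne (by omega) (by omega)]
    refine IH _ (by omega) ?_ ?_ ?_
    · rw [sh_comp_sw (by omega)]
      exact hy.comp _
    · rw [h0]; simpa using he
    · rw [h0]; simpa using hne

lemma iv_update (z : ℕ → ℂ) (u : ℂ) : iv (Function.update z 0 u) = Function.update (iv z) 0 u⁻¹ := by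
  funext j
  simp only [iv, Function.update_apply]
  split_ifs <;> rfl

lemma sh_update {β : Type*} {k i : ℕ} (h : i < k) (z : ℕ → β) (u : β) :
    sh k (Function.update z i u) = sh k z := by
  funext j
  simp only [sh]
  rw [Function.update_of_ne (by omega)]

lemma SS_poly (hW : W.Nice B) (hΦ : Sol W Φ) (n1 n2 : ℕ) (z : ℕ → ℂ) :
    ∃ P : ℂ[X], P.natDegree ≤ 2 * n1 + 1 + n2 ∧ ∀ u, Gen2 (Function.update z 0 u) →
      SS (n1 + 1) n2 Φ (Function.update z 0 u) = u ^ n2 * P.eval (cf u) := by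
  have h1 := fun α => left_structure hΦ hW.good (n := n1 + 1 + n2) (by omega) α z
  have h2 := fun α => left_structure hΦ hW.good (n := n1 + 1) (by omega) α (iv z)
  choose P1 hd1 hP1 using h1
  choose P2 hd2 hP2 using h2
  have hl : ∀ a : Fin 2, ∃ L : ℂ[X], L.natDegree ≤ 1 ∧ ∀ u, u ≠ 0 →
      (if a = 1 then W.kd u else W.mu u) * (if a = 1 then W.kd u⁻¹ else W.mu u⁻¹) = L.eval (cf u) := by
    intro a
    obtain ⟨a1, b1, h1⟩ := hW.lin
    obtain ⟨a2, b2, h2⟩ := hW.lin'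
    split_ifs
    · exact ⟨C a1 + C b1 * X, by compute_degree, fun u hu => by rw [h1 u hu]; simp⟩
    · exact ⟨C a2 + C b2 * X, by compute_degree, fun u hu => by rw [h2 u hu]; simp⟩
  choose L hdL hL using hl
  let c : Cfg → ℂ := fun γ => Φ n2 (sh (2 * (n1 + 1)) γ) (sh (2 * (n1 + 1)) (iv z))
  refine ⟨∑ γ : Fin (2 * (n1 + 1 + n2)) → Fin 2, C (c (ext _ γ)) *
    (L (ext _ γ 0) * (P1 (ext _ γ) * P2 (ext _ γ))), ?_, ?_⟩
  · refine natDegree_sum_le_of_forall_le _ _ fun γ _ => ?_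
    refine (natDegree_C_mul_le _ _).trans ?_
    refine natDegree_mul_le.trans ?_
    have := natDegree_mul_le (p := P1 (ext _ γ)) (q := P2 (ext _ γ))
    have := hdL (ext _ γ 0)
    have := hd1 (ext _ γ)
    have := hd2 (ext _ γ)
    omega
  · intro u hu
    have hu0 : u ≠ 0 := by simpa using hu.ne_zero 0
    unfold SS csum
    rw [eval_finsetSum, mul_sum]
    refine sum_congr rfl fun γ _ => ?_
    beta_reduce
    rw [iv_update, hP1 _ u hu.gen, hP2 _ u⁻¹ (by rw [← iv_update]; exact hu.iv.gen),
      sh_update (by omega)]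
    rw [eval_mul, eval_mul, eval_mul, eval_C, ← hL _ u hu0, inv_inv, add_comm u⁻¹ u]
    rw [show n1 + 1 + n2 - 1 = n1 + n2 by omega, show n1 + 1 - 1 = n1 by omega]
    simp only [cf, c]
    have : u ^ (n1 + n2) * u⁻¹ ^ n1 = u ^ n2 := by
      rw [pow_add, inv_pow]; field_simp
    linear_combination (if ext _ γ 0 = 1 then W.kd u else W.mu u) *
      (if ext _ γ 0 = 1 then W.kd u⁻¹ else W.mu u⁻¹) * eval (u + u⁻¹) (P1 (ext _ γ)) *
      eval (u + u⁻¹) (P2 (ext _ γ)) * Φ n2 (sh (2 * (n1 + 1)) (ext _ γ)) (sh (2 * (n1 + 1)) (iv z)) * this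

lemma ZZ_poly (hB : B ≠ 0) (n1 n2 : ℕ) {z : ℕ → ℂ} (hz : GN (B * q ^ 2) z) :
    ∃ P : ℂ[X], P.natDegree ≤ 2 * n1 + 1 + n2 ∧ ∀ u, GN (B * q ^ 2) (Function.update z 0 u) →
      ZZ B (n1 + 1) n2 (Function.update z 0 u) = u ^ n2 * P.eval (cf u) := by
  have hζ : B * q ^ 2 ≠ 0 := mul_ne_zero hB (pow_ne_zero _ q_ne_zero)
  obtain ⟨P1, hd1, hP1⟩ := EE_poly (2 * n1 + 1) (c := cf ∘ z) (fun i _ j _ h => by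
    have := hz.g.cf_inj h; omega)
  set d := Function.update (cf ∘ z) (2 * (n1 + 1 + n2)) (cf (B * q ^ 2)) with hd
  obtain ⟨P2, hd2, hP2⟩ := EE_poly (2 * (n1 + 1 + n2)) (c := d) (fun i hi j hj h => by
    have := hz.injOn hζ (2 * (n1 + 1 + n2)) (show i + 1 ∈ Set.Iio _ by simpa using hi)
      (show j + 1 ∈ Set.Iio _ by simpa using hj) h
    omega)
  refine ⟨C ((-B) ^ (n1 + 1 + n2) * (∏ j ∈ range (2 * n1 + 1), z (j + 1) ^ n2) *
    (∏ j ∈ range (2 * n2), z (j + 2 * (n1 + 1)) ^ (n1 + 1)) *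
    EE (2 * n2) (sh (2 * (n1 + 1)) (cf ∘ z))) * (P1 * P2), ?_, ?_⟩
  · refine (natDegree_C_mul_le _ _).trans (natDegree_mul_le.trans ?_)
    omega
  · intro u hu
    have hc : cf ∘ Function.update z 0 u = Function.update (cf ∘ z) 0 (cf u) := by
      funext j
      simp only [Function.comp, Function.update_apply]
      split_ifs <;> rfl
    have hc' : ∀ j, cf u ≠ cf (z (j + 1)) := fun j h => by
      have h' : (cf ∘ Function.update z 0 u) 0 = (cf ∘ Function.update z 0 u) (j + 1) := by
        rw [hc]
        simpa using h
      exact absurd (hu.g.cf_inj h') (by omega)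
    have hcz : cf u ≠ cf (B * q ^ 2) := by
      have := hu.cf_ne hζ 0
      simpa using this
    unfold ZZ
    rw [hc, Function.update_comm (by omega), ← hd, sh_update (by omega),
      show 2 * (n1 + 1) = 2 * n1 + 1 + 1 by omega, hP1 _ fun j _ => hc' j, hP2 _ fun j hj => by
        rw [hd, Function.update_apply]
        split_ifs
        · exact hcz
        · exact hc' j]
    rw [prod_range_succ', eval_mul, eval_C, eval_mul]
    simp only [Function.update_self, Function.update_of_ne (Nat.succ_ne_zero _),
      show ∀ j, Function.update z 0 u (j + (2 * n1 + 1 + 1)) = z (j + (2 * n1 + 1 + 1)) from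
        fun j => Function.update_of_ne (by omega) _ _]
    ring

/-- Interpolation in the first rapidity. -/
lemma SS_interp (hB : B ≠ 0) (hW : W.Nice B) (hΦ : Sol W Φ) (n1 n2 : ℕ) {z : ℕ → ℂ}
    (hz : GN (B * q ^ 2) z) {ι : Type} [Fintype ι] (u : ι → ℂ) (hu : Function.Injective (cf ∘ u))
    (hg : ∀ i, GN (B * q ^ 2) (Function.update z 0 (u i)))
    (he : ∀ i, SS (n1 + 1) n2 Φ (Function.update z 0 (u i)) =
      ZZ B (n1 + 1) n2 (Function.update z 0 (u i)))
    (hc : 2 * n1 + 1 + n2 < Fintype.card ι) : SS (n1 + 1) n2 Φ z = ZZ B (n1 + 1) n2 z := by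
  obtain ⟨P1, hd1, hP1⟩ := SS_poly hW hΦ n1 n2 z
  obtain ⟨P2, hd2, hP2⟩ := ZZ_poly hB n1 n2 hz
  have h0 : P1 - P2 = 0 := by
    refine eq_zero_of_natDegree_lt_card_of_eval_eq_zero _ hu (fun i => ?_)
      ((natDegree_sub_le _ _).trans_lt (by omega))
    have := he i
    rw [hP1 _ (hg i).g, hP2 _ (hg i)] at this
    have hui : u i ≠ 0 := by simpa using (hg i).g.ne_zero 0
    rw [eval_sub, sub_eq_zero]
    exact mul_left_cancel₀ (pow_ne_zero _ hui) this
  have e : Function.update z 0 (z 0) = z := Function.update_eq_self 0 z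
  rw [← e, hP1 _ (by rw [e]; exact hz.g), hP2 _ (by rw [e]; exact hz), sub_eq_zero.1 h0]

lemma q_pow_cube (k : ℕ) (u : ℂ) : (q ^ k * u) ^ 3 = u ^ 3 := by
  rw [mul_pow, ← pow_mul, mul_comm k, pow_mul, q_pow_three, one_pow, one_mul]

lemma q_pow_fin_inj {e e' : Fin 2} {u : ℂ} (hu : u ≠ 0)
    (h : q ^ (e.val + 1) * u = q ^ (e'.val + 1) * u) : e = e' := by
  have h := mul_right_cancel₀ hu h
  have hq := q_ne_zero
  have h1 : q ^ 2 ≠ q := fun h => q_ne_one (mul_left_cancel₀ hq (by linear_combination h))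
  fin_cases e <;> fin_cases e' <;> simp at h ⊢
  · exact h1 h.symm
  · exact h1 h

lemma q_pow_fin_ne_one (e : Fin 2) : q ^ (e.val + 1) ≠ 1 := by
  fin_cases e
  · simpa using q_ne_one
  · simpa using q_sq_ne_one

/-- The nodes `q z_j`, `q² z_j`. -/
lemma node_gn {z : ℕ → ℂ} {ζ : ℂ} (hz : GG ζ z) (j : ℕ) (e : Fin 2) :
    GN ζ (Function.update z 0 (q ^ (e.val + 1) * z (j + 1))) := by
  refine GG.gn_cons (j := j) ?_ ?_ ?_
  · rw [sh_update (by omega)]; exact hz.sh 1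
  · rw [Function.update_self, Function.update_of_ne (by omega), q_pow_cube]
  · rw [Function.update_self, Function.update_of_ne (by omega)]
    intro h
    exact q_pow_fin_ne_one e (mul_right_cancel₀ (hz.ne_zero (j + 1)) (by rw [h, one_mul]))

lemma node_inj {z : ℕ → ℂ} {ζ : ℂ} (hz : GG ζ z) {j k : ℕ} {e e' : Fin 2}
    (h : cf (q ^ (e.val + 1) * z (j + 1)) = cf (q ^ (e'.val + 1) * z (k + 1))) : j = k ∧ e = e' := by
  have hn : ∀ (e : Fin 2) j, q ^ (e.val + 1) * z (j + 1) ≠ 0 := fun e j =>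
    mul_ne_zero (pow_ne_zero _ q_ne_zero) (hz.ne_zero _)
  rcases cf_inj (hn e j) (hn e' k) h with h | h
  · have hjk : j = k := by
      by_contra hjk
      refine hz.cne (j + 1) (k + 1) (by omega) ?_
      rw [← q_pow_cube (e.val + 1), h, q_pow_cube]
    subst hjk
    exact ⟨rfl, q_pow_fin_inj (hz.ne_zero _) h⟩
  · refine absurd ?_ (hz.mul (j + 1) (k + 1))
    rw [mul_pow, ← q_pow_cube (e.val + 1), ← q_pow_cube (e'.val + 1) (z (k + 1)), ← mul_pow, h, one_pow]

lemma node_eq (hB : B ≠ 0) (hW : W.Nice B) (hΦ : Sol W Φ) (n1 n2 : ℕ)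
    (ih : ∀ z, GG (B * q ^ 2) z → SS n1 n2 Φ z = ZZ B n1 n2 z) {z : ℕ → ℂ} (hz : GG (B * q ^ 2) z)
    {j : ℕ} (hj : j + 1 < 2 * (n1 + 1)) (e : Fin 2) :
    SS (n1 + 1) n2 Φ (Function.update z 0 (q ^ (e.val + 1) * z (j + 1))) =
      ZZ B (n1 + 1) n2 (Function.update z 0 (q ^ (e.val + 1) * z (j + 1))) := by
  refine SS_of_node hB hW hΦ n1 n2 ih j _ hj ?_ ?_ ?_
  · rw [sh_update (by omega)]; exact hz.sh 1
  · rw [Function.update_self, Function.update_of_ne (by omega), q_pow_cube]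
  · rw [Function.update_self, Function.update_of_ne (by omega)]
    intro h
    exact q_pow_fin_ne_one e (mul_right_cancel₀ (hz.ne_zero (j + 1)) (by rw [h, one_mul]))

/-- Induction step in the size of the left block. -/
lemma left_step (hB : B ≠ 0) (hW : W.Nice B) (hΦ : Sol W Φ) {n1 n2 : ℕ} (hn : n2 ≤ 2 * n1)
    (ih : ∀ z, GG (B * q ^ 2) z → SS n1 n2 Φ z = ZZ B n1 n2 z) (z : ℕ → ℂ)
    (hz : GG (B * q ^ 2) z) : SS (n1 + 1) n2 Φ z = ZZ B (n1 + 1) n2 z := by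
  refine SS_interp hB hW hΦ n1 n2 hz.gn (ι := Fin (2 * n1 + 1) × Fin 2)
    (fun p => q ^ (p.2.val + 1) * z (p.1.val + 1)) ?_ ?_ ?_ ?_
  · rintro ⟨j, e⟩ ⟨k, e'⟩ h
    obtain ⟨h1, h2⟩ := node_inj hz h
    exact Prod.ext (Fin.ext h1) h2
  · rintro ⟨j, e⟩
    exact node_gn hz j e
  · rintro ⟨j, e⟩
    exact node_eq hB hW hΦ n1 n2 ih hz (by omega) e
  · simp only [Fintype.card_prod, Fintype.card_fin]
    omega

end OpenXXZ

namespace OpenXXZ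
open Finset Polynomial

variable {W : Wts} {Φ : ℕ → Cfg → (ℕ → ℂ) → ℂ} {B : ℂ}

lemma GG.iv {ζ : ℂ} {y : ℕ → ℂ} (h : GG ζ y) : GG ζ (iv y) := by
  have hp : ∀ i, y i ^ 3 ≠ 0 := fun i => pow_ne_zero _ (h.ne_zero i)
  refine ⟨fun i => inv_ne_zero (h.ne_zero i), fun i e => h.zne i ?_, fun i e => h.zmul i ?_,
    fun i k e => h.mul i k ?_, fun i k hik e => h.cne i k hik ?_⟩
  · have := hp i
    simp only [OpenXXZ.iv] at e
    rw [mul_pow, inv_pow, inv_mul_eq_one₀ this] at e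
    exact e
  · have := hp i
    simp only [OpenXXZ.iv, inv_pow] at e
    rw [mul_pow, ← e, mul_inv_cancel₀ this]
  · simp only [OpenXXZ.iv] at e
    rw [← mul_inv, inv_pow, inv_eq_one] at e
    exact e
  · simp only [OpenXXZ.iv, inv_pow, inv_inj] at e
    exact e

lemma rv_lt {N j : ℕ} (h : j < N) : rv N j = N - 1 - j := if_pos h

lemma SS_mir (hΦ : Sol W Φ) (n1 n2 : ℕ) {z : ℕ → ℂ} (hz : Gen2 z) :
    SS n2 n1 (mir Φ) z = (∏ i ∈ range (2 * n2), z i ^ (2 * n1)) *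
      (∏ i ∈ range (2 * n1), z (i + 2 * n2) ^ (2 * n2)) *
        SS n1 n2 Φ (iv z ∘ rv (2 * (n1 + n2))) := by
  unfold SS
  rw [add_comm n2 n1, ← csum_mul_left, ← csum_fl]
  refine csum_congr fun α => ?_
  have hr := (hz.comp (rvE (2 * (n1 + n2))))
  have hii : iv (iv z) = z := by funext j; simp [iv]
  have e2 : Φ n2 (fl (2 * n2) (fl (2 * (n1 + n2)) α)) (iv (iv z) ∘ rv (2 * n2)) =
      Φ n2 (sh (2 * n1) α) (sh (2 * n1) (iv (iv z ∘ rv (2 * (n1 + n2))))) := by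
    refine sol_congr hΦ _ _ (fun j hj => ?_) _ _ (hii.symm ▸ (hz.comp (rvE (2 * n2))).gen)
      ?_ (fun j hj => ?_)
    · rw [fl_apply hj, fl_apply (by omega), sh]
      rw [sub_sub_cancel]
      congr 1
      omega
    · have : sh (2 * n1) (iv (iv z ∘ rv (2 * (n1 + n2)))) = sh (2 * n1) (z ∘ rvE (2 * (n1 + n2))) := by
        funext j
        simp [iv, sh, rvE]
      rw [this]
      exact (hr.sh _).gen
    · rw [hii]
      simp only [Function.comp, sh, iv, inv_inv]
      rw [rv_lt hj, rv_lt (by omega)]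
      congr 1
      omega
  have e1 : Φ n1 (fl (2 * n1) (sh (2 * n2) (fl (2 * (n1 + n2)) α)))
      (iv (sh (2 * n2) (iv z)) ∘ rv (2 * n1)) = Φ n1 α (iv (iv z ∘ rv (2 * (n1 + n2)))) := by
    refine sol_congr hΦ _ _ (fun j hj => ?_) _ _ ?_ ?_ (fun j hj => ?_)
    · rw [fl_apply hj, sh, fl_apply (by omega), sub_sub_cancel]
      congr 1
      omega
    · exact ((hz.iv.sh (2 * n2)).iv.comp (rvE (2 * n1))).gen
    · exact (hz.iv.comp (rvE (2 * (n1 + n2)))).iv.gen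
    · simp only [Function.comp, sh, iv, inv_inv]
      rw [rv_lt hj, rv_lt (by omega)]
      congr 1
      omega
  unfold mir
  rw [fl_fl, e1, e2]
  have h0 := hz.ne_zero
  have hp : (∏ i ∈ range (2 * (n1 + n2)), z i ^ (2 * (n1 + n2) - 2)) *
      (∏ i ∈ range (2 * n2), iv z i ^ (2 * n2 - 2)) *
      (∏ i ∈ range (2 * n1), sh (2 * n2) (iv z) i ^ (2 * n1 - 2)) =
      (∏ i ∈ range (2 * n2), z i ^ (2 * n1)) *
      (∏ i ∈ range (2 * n1), z (i + 2 * n2) ^ (2 * n2)) := by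
    rw [show ∏ i ∈ range (2 * (n1 + n2)), z i ^ (2 * (n1 + n2) - 2) =
      ∏ i ∈ range (2 * n2 + 2 * n1), z i ^ (2 * (n1 + n2) - 2) from by congr 2; ring,
      prod_range_add, show ∀ a b c d : ℂ, a * b * c * d = (a * c) * (b * d) from
        fun a b c d => by ring, ← prod_mul_distrib, ← prod_mul_distrib]
    congr 1
    · refine prod_congr rfl fun i hi => ?_
      rw [mem_range] at hi
      rw [show 2 * (n1 + n2) - 2 = 2 * n1 + (2 * n2 - 2) by omega, pow_add, iv, inv_pow, mul_assoc,
        mul_inv_cancel₀ (pow_ne_zero _ (h0 i)), mul_one]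
    · refine prod_congr rfl fun i hi => ?_
      rw [mem_range] at hi
      rw [show 2 * (n1 + n2) - 2 = 2 * n2 + (2 * n1 - 2) by omega, pow_add, sh, iv, inv_pow,
        add_comm (2 * n2) i, mul_assoc, mul_inv_cancel₀ (pow_ne_zero _ (h0 _)), mul_one]
  rw [← hp]
  ring

lemma rv_lt_iff {N m j : ℕ} (h : m = N ∨ m = N + 1) : rv N j < m ↔ j < m := by
  unfold rv
  split_ifs <;> omega

lemma ZZ_mir (n1 n2 : ℕ) {z : ℕ → ℂ} (hz : ∀ i, z i ≠ 0) :
    ZZ B n2 n1 z = (∏ i ∈ range (2 * n2), z i ^ (2 * n1)) *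
      (∏ i ∈ range (2 * n1), z (i + 2 * n2) ^ (2 * n2)) *
        ZZ B n1 n2 (iv z ∘ rv (2 * (n1 + n2))) := by
  unfold ZZ
  have hc : cf ∘ iv z ∘ rv (2 * (n1 + n2)) = (cf ∘ z) ∘ rv (2 * (n1 + n2)) := by
    funext j
    simp only [Function.comp, iv, cf_inv]
  have e1 : EE (2 * n1) ((cf ∘ z) ∘ rv (2 * (n1 + n2))) = EE (2 * n1) (sh (2 * n2) (cf ∘ z)) := by
    rw [← EE_perm (rvE (2 * n1)) (fun j => rv_lt_iff (.inl rfl)) (sh (2 * n2) (cf ∘ z))]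
    refine EE_congr fun j hj => ?_
    change (cf ∘ z) (rv _ j) = sh (2 * n2) (cf ∘ z) (rv (2 * n1) j)
    rw [rv_lt (by omega), rv_lt (by omega), sh]
    congr 1
    omega
  have e2 : EE (2 * n2) (sh (2 * n1) ((cf ∘ z) ∘ rv (2 * (n1 + n2)))) = EE (2 * n2) (cf ∘ z) := by
    rw [← EE_perm (rvE (2 * n2)) (fun j => rv_lt_iff (.inl rfl)) (cf ∘ z)]
    refine EE_congr fun j hj => ?_
    change (cf ∘ z) (rv _ (j + 2 * n1)) = (cf ∘ z) (rv (2 * n2) j)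
    rw [rv_lt (by omega), rv_lt (by omega)]
    congr 1
    omega
  have e3 : EE (2 * (n1 + n2) + 1) (Function.update ((cf ∘ z) ∘ rv (2 * (n1 + n2)))
      (2 * (n1 + n2)) (cf (B * q ^ 2))) = EE (2 * (n1 + n2) + 1)
        (Function.update (cf ∘ z) (2 * (n1 + n2)) (cf (B * q ^ 2))) := by
    rw [← EE_perm (rvE (2 * (n1 + n2))) (fun j => rv_lt_iff (.inr rfl))
      (Function.update (cf ∘ z) (2 * (n1 + n2)) (cf (B * q ^ 2)))]
    refine EE_congr fun j hj => ?_
    change _ = Function.update (cf ∘ z) _ _ (rv (2 * (n1 + n2)) j)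
    by_cases h : j = 2 * (n1 + n2)
    · subst h
      rw [Function.update_self, show rv (2 * (n1 + n2)) (2 * (n1 + n2)) = 2 * (n1 + n2) from
        if_neg (lt_irrefl _), Function.update_self]
    · have hj' : j < 2 * (n1 + n2) := by omega
      rw [Function.update_of_ne h, Function.update_of_ne (by rw [rv_lt hj']; omega)]
      rfl
  have p1 : (∏ i ∈ range (2 * n2), z i ^ (2 * n1)) *
      ∏ j ∈ range (2 * n2), (iv z ∘ rv (2 * (n1 + n2))) (j + 2 * n1) ^ n1 =
      ∏ j ∈ range (2 * n2), z j ^ n1 := by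
    rw [← prod_range_reflect (fun j => (iv z ∘ rv (2 * (n1 + n2))) (j + 2 * n1) ^ n1), ← prod_mul_distrib]
    refine prod_congr rfl fun j hj => ?_
    rw [mem_range] at hj
    simp only [Function.comp, iv]
    rw [rv_lt (by omega), show 2 * (n1 + n2) - 1 - (2 * n2 - 1 - j + 2 * n1) = j by omega, inv_pow,
      show 2 * n1 = n1 + n1 by ring, pow_add, mul_assoc, mul_inv_cancel₀ (pow_ne_zero _ (hz j)), mul_one]
  have p2 : (∏ i ∈ range (2 * n1), z (i + 2 * n2) ^ (2 * n2)) *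
      ∏ j ∈ range (2 * n1), (iv z ∘ rv (2 * (n1 + n2))) j ^ n2 =
      ∏ j ∈ range (2 * n1), z (j + 2 * n2) ^ n2 := by
    rw [← prod_range_reflect (fun j => (iv z ∘ rv (2 * (n1 + n2))) j ^ n2), ← prod_mul_distrib]
    refine prod_congr rfl fun j hj => ?_
    rw [mem_range] at hj
    simp only [Function.comp, iv]
    rw [rv_lt (by omega), show 2 * (n1 + n2) - 1 - (2 * n1 - 1 - j) = j + 2 * n2 by omega, inv_pow,
      show 2 * n2 = n2 + n2 by ring, pow_add, mul_assoc,
      mul_inv_cancel₀ (pow_ne_zero _ (hz _)), mul_one]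
  rw [hc, e1, e2, e3, ← p1, ← p2, add_comm n2 n1]
  ring

lemma right_step (hB : B ≠ 0) (hΦ : Sol (W1 B) Φ) {n1 n2 : ℕ} (hn : n1 ≤ 2 * n2)
    (ih : ∀ z, GG (B * q ^ 2) z → SS n1 n2 Φ z = ZZ B n1 n2 z) (z : ℕ → ℂ)
    (hz : GG (B * q ^ 2) z) : SS n1 (n2 + 1) Φ z = ZZ B n1 (n2 + 1) z := by
  have hm := sol_mir hΦ
  have key := left_step hB (W2_nice hB) hm hn (fun y hy => by
    rw [SS_mir hΦ n1 n2 hy.gn.g, ZZ_mir n1 n2 hy.ne_zero, ih]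
    exact hy.iv.comp (rvE _)) (iv z ∘ rv (2 * (n1 + (n2 + 1)))) (hz.iv.comp (rvE _))
  have hy : GG (B * q ^ 2) (iv z ∘ rv (2 * (n1 + (n2 + 1)))) := hz.iv.comp (rvE _)
  rw [SS_mir hΦ n1 (n2 + 1) hy.gn.g, ZZ_mir n1 (n2 + 1) hy.ne_zero] at key
  have e : iv (iv z ∘ rv (2 * (n1 + (n2 + 1)))) ∘ rv (2 * (n1 + (n2 + 1))) = z := by
    funext j
    simp only [iv, Function.comp, rv_rv, inv_inv]
  rw [e] at key
  refine mul_left_cancel₀ (mul_ne_zero ?_ ?_) key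
  · exact prod_ne_zero_iff.2 fun _ _ => pow_ne_zero _ (hy.ne_zero _)
  · exact prod_ne_zero_iff.2 fun _ _ => pow_ne_zero _ (hy.ne_zero _)

end OpenXXZ

namespace OpenXXZ
open Finset Polynomial

variable {W : Wts} {Φ : ℕ → Cfg → (ℕ → ℂ) → ℂ} {B : ℂ}

/-- The configuration `abcd`. -/
def cfg4 (a b c d : Fin 2) : Cfg := pre a (pre b (pre c (pre d fun _ => 0)))

lemma csum_four (F : Cfg → ℂ) : csum 4 F = ∑ a, ∑ b, ∑ c, ∑ d, F (cfg4 a b c d) := by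
  have h0 : ∀ G : Cfg → ℂ, csum 0 G = G fun _ => 0 := fun G => by
    unfold csum
    rw [Fintype.sum_unique]
    rfl
  simp only [csum_succ, h0, Fin.sum_univ_two, cfg4]

lemma two_sites (hΦ : Sol W Φ) (hW : W.Good) {z : ℕ → ℂ} (hz : Gen z) (α : Cfg) :
    (α 0 = 1 → α 1 = 0 → Φ 1 α z = W.kd (z 0) * W.ku (z 1)) ∧
    (α 0 = 0 → α 1 = 1 → Φ 1 α z = W.mu (z 0) * W.nu (z 1)) ∧
    (α 0 = α 1 → Φ 1 α z = 0) := by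
  have hb : ∀ (α : Cfg) z, (∀ j, z j ≠ 0) → α 0 = 1 → α 1 = 0 →
      Φ 1 α z = W.kd (z 0) * W.ku (z 1) := by
    intro α z hz h0 h1
    rw [hΦ.base 1 α z hz, if_pos]
    · simp [Wts.f, blk, pf]
    · refine ⟨fun i hi => ?_, fun i hi hi' => ?_⟩
      · rwa [show i = 0 by omega]
      · rwa [show i = 1 by omega]
    · rintro ⟨i, hi, h2, -⟩
      rw [show i = 0 by omega, h0] at h2
      exact absurd h2 (by decide)
  refine ⟨hb α z hz.ne_zero, fun h0 h1 => ?_, fun h => zero_of_cnt hΦ 1 α (fun hc => ?_) z hz⟩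
  · have h2 : (α ∘ sw 0) 0 = 1 := by simp only [Function.comp, sw_left]; exact h1
    have h3 : (α ∘ sw 0) 1 = 0 := by simp only [Function.comp, sw_right]; exact h0
    have := hΦ.exch 1 (α ∘ sw 0) z 0 hz.ne_zero (by omega) h2 h3
    rw [comp_sw_sw, hb _ z hz.ne_zero h2 h3, hb _ (z ∘ sw 0) (fun j => hz.ne_zero _) h2 h3] at this
    simp only [Function.comp, sw_left, sw_right, zero_add] at this
    refine mul_left_cancel₀ (sub_ne_zero.2 (hz.inj.ne (show (1 : ℕ) ≠ 0 by omega))) ?_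
    rw [this]
    have hg := hW (z 0) (z 1) (hz.ne_zero 0) (hz.ne_zero 1)
    linear_combination hg
  · have := cnt_two (N := 0) α
    simp only [Nat.mul_one, zero_add] at this hc
    rw [this, h] at hc
    simp only [cnt, range_zero, sum_empty] at hc
    omega

lemma four_0101 (hΦ : Sol W Φ) (hW : W.Good) {z : ℕ → ℂ} (hz : Gen z) (h2 : z 2 = q ^ 2 * z 1) :
    Φ 2 (cfg4 0 1 0 1) z = q * W.kd (z 1) * W.ku (z 2) * (wa (z 2) (z 0) * wc (z 2) (z 0) *
      (wa (z 2) (z 3) * wc (z 2) (z 3))) * (W.mu (z 0) * W.nu (z 3)) := by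
  have h01 : cfg4 0 1 0 1 = cfg4 1 0 0 1 ∘ sw 0 := by
    funext j
    match j with
    | 0 => rfl
    | 1 => rfl
    | j + 2 => simp only [Function.comp]; rw [sw_of_ne (by omega) (by omega)]; rfl
  have h0 : Φ 2 (cfg4 1 0 0 1) z = 0 := singlet_aligned hΦ (i := 1) (by omega) hz.ne_zero h2 rfl
  have e1 := hΦ.exch 2 (cfg4 1 0 0 1) z 0 hz.ne_zero (by omega) rfl rfl
  rw [h0, ← h01, mul_zero, sub_zero, zero_add] at e1
  have e2 := hΦ.aligned 2 (cfg4 1 0 0 1) (z ∘ sw 0) 1 (fun j => hz.ne_zero _) (by omega) rfl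
  have s0 : sw 0 0 = 1 := sw_left 0
  have s1 : sw 0 1 = 0 := sw_right 0
  have s2 : sw 0 2 = 2 := sw_of_ne (by omega) (by omega)
  have s3 : sw 0 3 = 3 := sw_of_ne (by omega) (by omega)
  have t0 : sw 1 0 = 0 := sw_of_ne (by omega) (by omega)
  have t1 : sw 1 1 = 2 := sw_left 1
  have t2 : sw 1 2 = 1 := sw_right 1
  have t3 : sw 1 3 = 3 := sw_of_ne (by omega) (by omega)
  set v := (z ∘ sw 0) ∘ sw 1 with hv
  have v0 : v 0 = z 1 := by simp only [hv, Function.comp, t0, s0]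
  have v1 : v 1 = z 2 := by simp only [hv, Function.comp, t1, s2]
  have v2 : v 2 = z 0 := by simp only [hv, Function.comp, t2, s1]
  have v3 : v 3 = z 3 := by simp only [hv, Function.comp, t3, s3]
  have hgv : Gen v := (hz.comp (sw 0)).comp (sw 1)
  have e3 := reduction hΦ (n := 2) (by omega) (cfg4 1 0 0 1) rfl rfl v hgv (by rw [v1, v0, h2])
  rw [((two_sites hΦ hW (hgv.sh 2) (sh 2 (cfg4 1 0 0 1))).2.1 rfl rfl : Φ (2 - 1) _ _ = _)] at e3
  simp only [redFac, sh, zero_add, v0, v1, v2, v3, Nat.reduceMul, Nat.reduceAdd] at e3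
  rw [prod_Ico_succ_top (by omega), prod_Ico_succ_top (by omega), Ico_self, prod_empty, one_mul, v2, v3,
    show 2 - 1 = 1 from rfl, pow_one] at e3
  rw [← e3]
  simp only [Function.comp, s1, s2, Nat.reduceAdd] at e2
  have w1 : wa (z 0) (z 2) = q * (z 0 - z 1) := by
    rw [h2]; unfold wa; linear_combination -q * z 1 * q_pow_three
  have w2 : wa (z 2) (z 0) = -q * wa (z 0) (z 1) := by
    rw [h2]; unfold wa; ring
  rw [w1, w2] at e2
  refine mul_left_cancel₀ (sub_ne_zero.2 (hz.inj.ne (show (1 : ℕ) ≠ 0 by omega))) ?_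
  rw [e1]
  refine mul_left_cancel₀ q_ne_zero ?_
  linear_combination e2

lemma four_1010 (hΦ : Sol W Φ) {z : ℕ → ℂ} (hz : Gen z) (h2 : z 2 = q ^ 2 * z 1) :
    Φ 2 (cfg4 1 0 1 0) z = -q * (W.kd (z 0) * W.kd (z 1) * (wa (z 0) (z 1) * wb (z 0) (z 1)) *
      (W.ku (z 2) * W.ku (z 3) * (wa (z 2) (z 3) * wc (z 2) (z 3)))) := by
  have h01 : cfg4 1 0 1 0 = cfg4 1 1 0 0 ∘ sw 1 := by
    funext j
    match j with
    | 0 => simp only [Function.comp]; rw [sw_of_ne (by omega) (by omega)]; rfl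
    | 1 => rfl
    | 2 => rfl
    | j + 3 => simp only [Function.comp]; rw [sw_of_ne (by omega) (by omega)]; rfl
  rw [h01, singlet_flip hΦ (i := 1) (by omega) hz.ne_zero h2 rfl rfl,
    hΦ.base 2 _ z hz.ne_zero, if_pos]
  · congr 1
    simp [Wts.f, blk, pf, prod_range_succ, prod_Ico_succ_top]
  · refine ⟨fun i hi => ?_, fun i hi hi' => ?_⟩
    · interval_cases i <;> rfl
    · interval_cases i <;> rfl
  · rintro ⟨i, hi, h2, h3⟩
    have : i < 3 := by omega
    interval_cases i
    · exact absurd h2 (by decide)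
    · exact absurd h2 (by decide)
    · exact absurd h3 (by decide)

lemma SS11_mid (hB : B ≠ 0) (hΦ : Sol (W1 B) Φ) {z : ℕ → ℂ} (hz : Gen2 z) (h2 : z 2 = q ^ 2 * z 1) :
    SS 1 1 Φ z = B ^ 2 * (z 0 * z 1 * z 2 * z 3) * (cf (B * q ^ 2) + cf (z 1) + cf (z 2)) *
      (cf (z 0) + cf (z 1) + cf (z 2)) * (cf (z 3) + cf (z 1) + cf (z 2)) *
        (cf (z 0) + cf (z 3) + cf (B * q ^ 2)) := by
  have hg := W1_good B
  have key : ∀ a b c d : Fin 2, a = b ∨ b = c ∨ c = d → Φ 2 (cfg4 a b c d) z *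
      Φ 1 (cfg4 a b c d) (iv z) * Φ 1 (sh 2 (cfg4 a b c d)) (sh 2 (iv z)) = 0 := by
    rintro a b c d (h | h | h)
    · rw [(two_sites hΦ hg hz.iv.gen _).2.2 h, mul_zero, zero_mul]
    · rw [singlet_aligned hΦ (i := 1) (by omega) hz.ne_zero h2 h, zero_mul, zero_mul]
    · rw [(two_sites hΦ hg (hz.iv.sh 2).gen (sh 2 (cfg4 a b c d))).2.2 h, mul_zero]
  have hS : SS 1 1 Φ z = ∑ a, ∑ b, ∑ c, ∑ d, Φ 2 (cfg4 a b c d) z *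
      Φ 1 (cfg4 a b c d) (iv z) * Φ 1 (sh 2 (cfg4 a b c d)) (sh 2 (iv z)) := csum_four _
  rw [hS]
  simp only [Fin.sum_univ_two]
  rw [key 0 0 0 0 (by simp), key 0 0 0 1 (by simp), key 0 0 1 0 (by simp), key 0 0 1 1 (by simp),
    key 0 1 0 0 (by simp), key 0 1 1 0 (by simp), key 0 1 1 1 (by simp),
    key 1 0 0 0 (by simp), key 1 0 0 1 (by simp), key 1 0 1 1 (by simp),
    key 1 1 0 0 (by simp), key 1 1 0 1 (by simp), key 1 1 1 0 (by simp), key 1 1 1 1 (by simp),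
    four_0101 hΦ hg hz.gen h2, four_1010 hΦ hz.gen h2,
    (two_sites hΦ hg hz.iv.gen (cfg4 0 1 0 1)).2.1 rfl rfl,
    (two_sites hΦ hg (hz.iv.sh 2).gen (sh 2 (cfg4 0 1 0 1))).2.1 rfl rfl,
    (two_sites hΦ hg hz.iv.gen (cfg4 1 0 1 0)).1 rfl rfl,
    (two_sites hΦ hg (hz.iv.sh 2).gen (sh 2 (cfg4 1 0 1 0))).1 rfl rfl]
  have n0 := hz.ne_zero
  have A0 : wa (z 0) (z 1) * wb (z 0) (z 1) = -(z 0 * z 1) * (cf (z 0) + cf (z 1) + cf (z 2)) := by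
    rw [h2]; unfold wa wb cf; rw [q_sq_mul_inv]
    linear_combination z 0 * q_sq + z 0 * (1 + q) * mul_inv_cancel₀ (n0 1) -
      (z 0 ^ 2 * z 1) * q_pow_three + z 1 * mul_inv_cancel₀ (n0 0) - z 1 * q_pow_three +
      z 0 * z 1 ^ 2 * (q_sq + q * q_pow_three)
  have A3 := wa_mul_wc_singlet (n0 1) (n0 3) h2
  have A0' := wa_mul_wc_singlet (n0 1) (n0 0) h2
  have hk := quad_aux hB (n0 1)
  have hz2 : (z 2)⁻¹ = q * (z 1)⁻¹ := by rw [h2, q_sq_mul_inv]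
  have hl : (B * z 0 - 1) * (B * (z 0)⁻¹ - 1) + (q - q ^ 2 * B * z 3) * (q - q ^ 2 * B * (z 3)⁻¹) =
      -B * (cf (z 0) + cf (z 3) + cf (B * q ^ 2)) := by
    unfold cf
    rw [mul_comm B (q ^ 2), q_sq_mul_inv]
    linear_combination B ^ 2 * mul_inv_cancel₀ (n0 0) + B ^ 2 * (q_sq + q * q_pow_three) + q_sq +
      q * mul_inv_cancel₀ hB - B * (z 3 + (z 3)⁻¹) * q_pow_three +
      q ^ 4 * B ^ 2 * mul_inv_cancel₀ (n0 3)
  rw [← h2] at hk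
  rw [← cf, ← cf, ← cf] at A3 A0'
  simp only [W1, iv, sh, zero_add, Nat.reduceAdd, A0, A3, A0']
  rw [hz2, show q - q ^ 2 * B * (z 1)⁻¹ = -q * (B * (q * (z 1)⁻¹) - 1) by ring]
  set K := B * z 1 - 1
  set K' := B * (q * (z 1)⁻¹) - 1
  set k0 := (B * z 0 - 1) * (B * (z 0)⁻¹ - 1) with hk0
  set k3 := (q - q ^ 2 * B * z 3) * (q - q ^ 2 * B * (z 3)⁻¹) with hk3
  set s := cf (z 1) + cf (z 2) with hs
  set T := cf (B * q ^ 2) + cf (z 1) + cf (z 2) with hT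
  set U := cf (z 0) + cf (z 3) + cf (B * q ^ 2)
  set C := (cf (z 0) + s) * (cf (z 3) + s) with hC
  rw [add_assoc (cf (z 0)), add_assoc (cf (z 3)), ← hs]
  linear_combination (-q ^ 2 * K * K' * z 0 * z 2 * z 3 * C * k3) * h2 -
    (q * K * K' * (z 0 * z 1 * z 2 * z 3) * C * k3) * q_pow_three -
    (q * (z 0 * z 1 * z 2 * z 3) * C * (k0 + k3)) * hk -
    (q * (z 0 * z 1 * z 2 * z 3) * C * (B * q ^ 2 * T)) * hl +
    (B ^ 2 * (z 0 * z 1 * z 2 * z 3) * C * T * U) * q_pow_three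

end OpenXXZ

namespace OpenXXZ
open Finset Polynomial

variable {Φ : ℕ → Cfg → (ℕ → ℂ) → ℂ} {B : ℂ}

lemma EE_zero (c : ℕ → ℂ) : EE 0 c = 1 := by
  simp [EE, vdm]

lemma EE_one (c : ℕ → ℂ) : EE 1 c = 1 := by
  rw [EE_last 0 (fun i hi j hj _ => by simp only [Set.mem_Iio] at hi hj; omega) (fun _ => 0)
    (fun _ => 1) (fun x => by simp [ww]), EE_zero, mul_one]

lemma EE_two {c : ℕ → ℂ} (h : Set.InjOn c (Set.Iio 2)) : EE 2 c = 1 := by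
  rw [EE_last 1 h (fun _ => -c 0) (fun _ => 1) (fun x => by simp [ww]; ring), EE_one, mul_one]

lemma EE_three {c : ℕ → ℂ} (h : Set.InjOn c (Set.Iio 3)) : EE 3 c = c 0 + c 1 + c 2 := by
  rw [EE_last 2 h (fun k => if k = 0 then c 0 * c 1 * (c 0 + c 1) else
    3 - (c 0 ^ 2 + c 0 * c 1 + c 1 ^ 2)) (fun x => c 0 + c 1 + x)
    (fun x => by simp [ww, cY, prod_range_succ, sum_range_succ]; ring),
    EE_two (h.mono (Set.Iio_subset_Iio (by norm_num))), mul_one]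

lemma ZZ11_mid (hB : B ≠ 0) {z : ℕ → ℂ} (hz : GN (B * q ^ 2) z) (h2 : z 2 = q ^ 2 * z 1) :
    ZZ B 1 1 z = B ^ 2 * (z 0 * z 1 * z 2 * z 3) * (cf (B * q ^ 2) + cf (z 1) + cf (z 2)) *
      (cf (z 0) + cf (z 1) + cf (z 2)) * (cf (z 3) + cf (z 1) + cf (z 2)) *
        (cf (z 0) + cf (z 3) + cf (B * q ^ 2)) := by
  have hζ : B * q ^ 2 ≠ 0 := mul_ne_zero hB (pow_ne_zero _ q_ne_zero)
  set d := Function.update (cf ∘ z) 4 (cf (B * q ^ 2)) with hd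
  have hinj : Set.InjOn d (Set.Iio 5) := hz.injOn hζ 4
  set e := (d ∘ sw 0) ∘ sw 1 with he
  have e0 : e 0 = cf (z 1) := rfl
  have e1 : e 1 = cf (z 2) := rfl
  have e2 : e 2 = cf (z 0) := rfl
  have e3 : e 3 = cf (z 3) := rfl
  have e4 : e 4 = cf (B * q ^ 2) := rfl
  have hE : EE 5 d = EE 5 e := by
    rw [he, EE_sw (by omega), EE_sw (by omega)]
  have hinj' : Set.InjOn e (Set.Iio (3 + 2)) := by
    intro i hi j hj h
    have h5 : ∀ k, k < 5 → sw 0 (sw 1 k) < 5 := fun k hk =>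
      (sw_lt (by omega)).2 ((sw_lt (by omega)).2 hk)
    have := hinj (h5 i hi) (h5 j hj) h
    exact (sw 1).injective ((sw 0).injective this)
  have hsh : Set.InjOn (sh 2 e) (Set.Iio 3) := by
    intro i hi j hj h
    simp only [Set.mem_Iio] at hi hj
    have := hinj' (show i + 2 < 3 + 2 by omega) (show j + 2 < 3 + 2 by omega) h
    omega
  unfold ZZ
  simp only [Nat.mul_one, Nat.reduceAdd, Nat.reduceMul]
  rw [← hd, hE, EE_rec 3 hinj' (by rw [e0, e1]; exact cY_singlet (z := sh 1 z) (hz.g.ne_zero _) h2),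
    EE_three hsh, EE_two, EE_two]
  · simp only [prod_range_succ, prod_range_zero, sh, Nat.reduceAdd, zero_add, e0, e1, e2, e3, e4]
    ring
  · intro i _ j _ h
    have := hz.g.cf_inj h
    omega
  · intro i _ j _ h
    exact hz.g.cf_inj h

lemma SS_zero (hΦ : Sol (W1 B) Φ) {z : ℕ → ℂ} (hz : ∀ j, z j ≠ 0) : SS 0 0 Φ z = ZZ B 0 0 z := by
  have h1 : ∀ α : Cfg, ∀ z, (∀ j, z j ≠ 0) → Φ 0 α z = 1 := by
    intro α z hz
    rw [hΦ.base 0 α z hz (fun ⟨i, hi, _⟩ => by omega), if_pos ⟨fun i hi => by omega, fun i _ hi => by omega⟩]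
    simp [Wts.f, blk]
  have hi : ∀ j, iv z j ≠ 0 := fun j => inv_ne_zero (hz j)
  unfold SS
  simp only [add_zero]
  rw [csum_congr (G := fun _ => 1) fun α => by
    rw [h1 _ _ hz, h1 _ _ hi, h1 _ (sh (2 * 0) (iv z)) (fun j => hi _), mul_one, mul_one]]
  simp [csum, ZZ, EE_zero, EE_one]

lemma SS_one_one (hB : B ≠ 0) (hΦ : Sol (W1 B) Φ)
    (ih : ∀ z, GG (B * q ^ 2) z → SS 0 1 Φ z = ZZ B 0 1 z) (z : ℕ → ℂ)
    (hz : GG (B * q ^ 2) z) : SS 1 1 Φ z = ZZ B 1 1 z := by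
  have hmid : ∀ e : Fin 2, e = 0 → SS 1 1 Φ (Function.update z 0 (q ^ (e.val + 1) * z (1 + 1))) =
      ZZ B 1 1 (Function.update z 0 (q ^ (e.val + 1) * z (1 + 1))) := by
    rintro e rfl
    have hy := node_gn hz 1 0
    set y := Function.update z 0 (q ^ ((0 : Fin 2).val + 1) * z (1 + 1)) with hyd
    have hw := hy.comp (sw 0)
    have hw2 : (y ∘ sw 0) 2 = q ^ 2 * (y ∘ sw 0) 1 := by
      change y 2 = q ^ 2 * y 0
      rw [hyd, Function.update_self, Function.update_of_ne (by omega)]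
      simp only [Fin.val_zero, zero_add, pow_one, Nat.reduceAdd]
      linear_combination -z 2 * q_pow_three
    rw [← SS_sw hΦ (i := 0) (by omega) hy.g.ne_zero (hy.g.inj.ne (by omega)),
      ← ZZ_sw B (i := 0) (by omega) y, SS11_mid hB hΦ hw.g hw2, ZZ11_mid hB hw hw2]
  refine SS_interp hB (W1_nice hB) hΦ 0 1 hz.gn (ι := Fin 3)
    (fun i => if i = 2 then q ^ ((0 : Fin 2).val + 1) * z (1 + 1) else
      q ^ ((if i = 0 then (0 : Fin 2) else 1).val + 1) * z (0 + 1)) ?_ ?_ ?_ ?_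
  · intro i j h
    simp only [Function.comp] at h
    split_ifs at h with h1 h2 h3 h4 h5 h6 h7 h8 <;> first
      | (have := node_inj hz h; exfalso; revert this; decide)
      | (clear h; revert i j; decide)
  · intro i
    split_ifs <;> exact node_gn hz _ _
  · intro i
    split_ifs
    · exact hmid 0 rfl
    · exact node_eq hB (W1_nice hB) hΦ 0 1 ih hz (by omega) _
    · exact node_eq hB (W1_nice hB) hΦ 0 1 ih hz (by omega) _
  · simp

/-- The overlaps of the inhomogeneous solutions factorise into determinants. -/
theorem SS_eq_ZZ (hB : B ≠ 0) (hΦ : Sol (W1 B) Φ) (n1 n2 : ℕ) (z : ℕ → ℂ)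
    (hz : GG (B * q ^ 2) z) : SS n1 n2 Φ z = ZZ B n1 n2 z := by
  induction hN : n1 + n2 using Nat.strong_induction_on generalizing n1 n2 z with
  | _ N ih =>
  subst hN
  rcases n1 with _ | m
  · rcases n2 with _ | k
    · exact SS_zero hΦ hz.ne_zero
    · exact right_step hB hΦ (by omega) (fun z hz => ih _ (by omega) 0 k z hz rfl) z hz
  · by_cases h : n2 ≤ 2 * m
    · exact left_step hB (W1_nice hB) hΦ h (fun z hz => ih _ (by omega) m n2 z hz rfl) z hz
    · obtain ⟨k, rfl⟩ : ∃ k, n2 = k + 1 := ⟨n2 - 1, by omega⟩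
      by_cases h' : m + 1 ≤ 2 * k
      · exact right_step hB hΦ h' (fun z hz => ih _ (by omega) (m + 1) k z hz rfl) z hz
      · obtain ⟨rfl, rfl⟩ : m = 0 ∧ k = 0 := by omega
        exact SS_one_one hB hΦ (fun z hz => ih _ (by omega) 0 1 z hz rfl) z hz

end OpenXXZ

namespace OpenXXZ
open Finset Polynomial

/-- A polynomial with at most `m` terms that vanishes to order `m` at `1` is zero. -/
lemma eq_zero_of_sparse (m : ℕ) : ∀ p : ℂ[X], (X - 1) ^ m ∣ p → p.support.card ≤ m → p = 0 := by
  induction m with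
  | zero =>
    intro p _ h
    exact support_eq_empty.1 (card_eq_zero.1 (Nat.le_zero.1 h))
  | succ m ih =>
    intro p hd hc
    by_contra hp
    obtain ⟨k, hk⟩ := nonempty_support_iff.2 hp
    have hco : ∀ e : ℕ, (X * derivative p - C (k : ℂ) * p).coeff e = ((e : ℂ) - k) * p.coeff e := by
      intro e
      rw [coeff_sub, coeff_C_mul]
      rcases e with _ | e
      · simp
      · rw [coeff_X_mul, coeff_derivative]
        push_cast
        ring
    have hD : X * derivative p - C (k : ℂ) * p = 0 := by
      refine ih _ (dvd_sub (Dvd.dvd.mul_left ?_ _) (Dvd.dvd.mul_left (dvd_trans (pow_dvd_pow _ (by omega)) hd) _)) ?_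
      · obtain ⟨r, rfl⟩ := hd
        rw [derivative_mul, derivative_pow]
        simp only [derivative_sub, derivative_X, derivative_one, Nat.add_sub_cancel]
        exact dvd_add (Dvd.dvd.mul_right (Dvd.dvd.mul_right (Dvd.dvd.mul_left (dvd_refl _) _) _) _)
          (Dvd.dvd.mul_right (pow_dvd_pow _ (by omega)) _)
      · have : (X * derivative p - C (k : ℂ) * p).support ⊆ p.support.erase k := by
          intro e he
          rw [mem_support_iff, hco] at he
          rw [mem_erase, mem_support_iff]
          exact ⟨fun h => he (by rw [h, sub_self, zero_mul]), right_ne_zero_of_mul he⟩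
        have := card_le_card this
        rw [card_erase_of_mem hk] at this
        omega
    have hmon : p = C (p.coeff k) * X ^ k := by
      ext e
      rw [coeff_C_mul_X_pow]
      split_ifs with h
      · rw [h]
      · have := hco e
        rw [hD, coeff_zero] at this
        exact (mul_eq_zero.1 this.symm).resolve_left (sub_ne_zero.2 (by exact_mod_cast h))
    have h1 : p.eval 1 = 0 := by
      obtain ⟨r, rfl⟩ := hd
      simp
    rw [hmon] at h1
    simp only [eval_mul, eval_C, eval_pow, eval_X, one_pow, mul_one] at h1
    exact (mem_support_iff.1 hk) h1

lemma card_not_dvd_three (n : ℕ) : ((range (6 * n)).filter fun e => e % 3 ≠ 0).card = 4 * n := by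
  induction n with
  | zero => rfl
  | succ n ih =>
    rw [show 6 * (n + 1) = 6 * n + 1 + 1 + 1 + 1 + 1 + 1 by ring]
    simp only [range_add_one, filter_insert]
    rw [if_pos (by omega), if_pos (by omega), if_neg (by omega), if_pos (by omega), if_pos (by omega),
      if_neg (by omega)]
    repeat rw [card_insert_of_notMem (by simp only [mem_insert, mem_filter, mem_range]; omega)]
    rw [ih]
    ring

lemma eval_eq_of_ne_zero {p r : ℂ[X]} (h : ∀ z : ℂ, z ≠ 0 → p.eval z = r.eval z) : p = r := by
  refine Polynomial.eq_of_infinite_eval_eq _ _ (Set.Infinite.mono (s := {z : ℂ | z ≠ 0}) h ?_)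
  exact Set.Infinite.mono (fun z hz => hz) (Set.finite_singleton (0 : ℂ)).infinite_compl

/-- Reversal of `p (z + 1/z)`. -/
lemma exists_cf_poly (p : ℂ[X]) : ∃ r : ℂ[X], ∀ z : ℂ, z ≠ 0 → r.eval z = z ^ p.natDegree * p.eval (cf z) := by
  refine ⟨∑ k ∈ range (p.natDegree + 1), C (p.coeff k) * ((X ^ 2 + 1) ^ k * X ^ (p.natDegree - k)), ?_⟩
  intro z hz
  rw [eval_finsetSum, eval_eq_sum_range, mul_sum]
  refine sum_congr rfl fun k hk => ?_
  rw [mem_range] at hk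
  simp only [eval_mul, eval_C, eval_pow, eval_add, eval_X, eval_one]
  have e : z ^ p.natDegree = z ^ k * z ^ (p.natDegree - k) := by rw [← pow_add]; congr 1; omega
  have e2 : z ^ 2 + 1 = z * cf z := by unfold cf; field_simp
  rw [e, e2, mul_pow]
  ring

lemma cf_surj (x : ℂ) : ∃ z : ℂ, z ≠ 0 ∧ cf z = x := by
  obtain ⟨s, hs⟩ := IsAlgClosed.exists_eq_mul_self (x ^ 2 / 4 - 1)
  have h : (x / 2 + s) * (x / 2 - s) = 1 := by linear_combination hs
  refine ⟨x / 2 + s, left_ne_zero_of_mul_eq_one h, ?_⟩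
  rw [cf, eq_comm, inv_eq_of_mul_eq_one_right h]
  ring

lemma sum_range_pairs {M : Type*} [AddCommMonoid M] (f : ℕ → M) (n : ℕ) :
    ∑ k ∈ range (2 * n), f k = ∑ i ∈ range n, (f (2 * i) + f (2 * i + 1)) := by
  induction n with
  | zero => rfl
  | succ n ih =>
    rw [show 2 * (n + 1) = 2 * n + 1 + 1 by ring, sum_range_succ, sum_range_succ, ih, sum_range_succ,
      add_assoc]

lemma ww_independent (n : ℕ) (a : ℕ → ℂ) (h : ∑ k ∈ range (2 * n), C (a k) * wwP k = 0) :
    ∀ k < 2 * n, a k = 0 := by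
  set Y : ℂ[X] := X ^ 3 - C 3 * X with hY
  set α : ℂ[X] := ∑ i ∈ range n, C (a (2 * i)) * X ^ i with hα
  set β : ℂ[X] := ∑ i ∈ range n, C (a (2 * i + 1)) * X ^ i with hβ
  have hYd : Y.natDegree = 3 := by rw [hY]; compute_degree!
  have hv : α.comp Y = -(X * β.comp Y) := by
    rw [eq_neg_iff_add_eq_zero, ← h, sum_range_pairs, hα, hβ, Polynomial.sum_comp, Polynomial.sum_comp, mul_sum,
      ← sum_add_distrib]
    refine sum_congr rfl fun i _ => ?_
    simp only [wwP, mul_comp, C_comp, pow_comp, X_comp, ← hY]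
    rw [show 2 * i / 2 = i by omega, show 2 * i % 2 = 0 by omega, show (2 * i + 1) / 2 = i by omega,
      show (2 * i + 1) % 2 = 1 by omega]
    ring
  have hcz : ∀ p : ℂ[X], p.comp Y = 0 → p = 0 := fun p hp => by
    rcases comp_eq_zero_iff.1 hp with h | ⟨-, h⟩
    · exact h
    · rw [h, natDegree_C] at hYd; omega
  have hab : α = 0 ∧ β = 0 := by
    by_cases hb : β = 0
    · rw [hb, zero_comp, mul_zero, neg_zero] at hv
      exact ⟨hcz _ hv, hb⟩
    · have hb' : β.comp Y ≠ 0 := fun h => hb (hcz _ h)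
      have := congrArg natDegree hv
      rw [natDegree_neg, natDegree_X_mul hb', natDegree_comp, natDegree_comp, hYd] at this
      omega
  have hc : ∀ (b : ℕ → ℂ), ∑ i ∈ range n, C (b i) * (X : ℂ[X]) ^ i = 0 → ∀ i < n, b i = 0 := by
    intro b hb i hi
    have := congrArg (fun p => coeff p i) hb
    simpa [finsetSum_coeff, coeff_C_mul, coeff_X_pow, hi] using this
  intro k hk
  rcases Nat.even_or_odd' k with ⟨i, rfl | rfl⟩
  · exact hc (fun i => a (2 * i)) hab.1 i (by omega)
  · exact hc (fun i => a (2 * i + 1)) hab.2 i (by omega)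

/-- Linear independence of the `w_k` modulo multiples of `(c - 2)^{2n}`. -/
lemma ww_kernel (n : ℕ) (p : ℂ[X]) (a : ℕ → ℂ)
    (h : (X - C 2) ^ (2 * n) * p = ∑ k ∈ range (2 * n), C (a k) * wwP k) :
    (∀ k < 2 * n, a k = 0) ∧ p = 0 := by
  obtain ⟨r, hr⟩ := exists_cf_poly p
  set v := ∑ k ∈ range (2 * n), C (a k) * wwP k with hv
  set A : ℂ[X] := ∑ i ∈ range n, C (a (2 * i)) * ((X ^ 2 + 1) ^ i * X ^ (n - 1 - i)) with hA
  set D : ℂ[X] := ∑ i ∈ range n, C (a (2 * i + 1)) * ((X ^ 2 + 1) ^ i * X ^ (n - 1 - i)) with hD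
  set F : ℂ[X] := expand ℂ 3 A * (X ^ 4 - X ^ 2) + expand ℂ 3 D * (X ^ 5 - X ^ 1) with hF
  have hFv : ∀ z : ℂ, z ≠ 0 → F.eval z = z ^ (3 * n) * (z - z⁻¹) * v.eval (cf z) := by
    intro z hz
    rw [hF, hv, sum_range_pairs, hA, hD]
    simp only [eval_add, eval_mul, expand_eval, eval_finsetSum, eval_sub, eval_pow, eval_X, eval_C,
      eval_one, eval_wwP, sum_mul, mul_sum, ← sum_add_distrib]
    refine sum_congr rfl fun i hi => ?_
    rw [mem_range] at hi
    simp only [ww]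
    rw [show 2 * i / 2 = i by omega, show 2 * i % 2 = 0 by omega, show (2 * i + 1) / 2 = i by omega,
      show (2 * i + 1) % 2 = 1 by omega, cf_pow_three hz]
    have e : (z ^ 3) ^ 2 + 1 = z ^ 3 * (z ^ 3 + (z ^ 3)⁻¹) := by field_simp
    have e2 : z ^ (3 * n) = (z ^ 3) ^ i * (z ^ 3) ^ (n - 1 - i) * z ^ 3 := by
      rw [← pow_add, ← pow_succ, ← pow_mul]
      congr 1
      omega
    rw [e, e2, mul_pow]
    unfold cf
    field_simp
    ring
  have hF0 : F = 0 := by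
    refine eq_zero_of_sparse (4 * n) F ?_ ?_
    · have e : X ^ (p.natDegree + 1) * F = (X - 1) ^ (4 * n) * (X ^ n * (X ^ 2 - 1) * r) := by
        refine eval_eq_of_ne_zero fun z hz => ?_
        simp only [eval_mul, eval_pow, eval_X, eval_sub, eval_one, hFv z hz, hr z hz, ← h, eval_C]
        have e1 : cf z - 2 = (z - 1) ^ 2 * z⁻¹ := by unfold cf; field_simp; ring
        have e2 : z ^ (3 * n) = z ^ n * z ^ (2 * n) := by rw [← pow_add]; congr 1; omega
        have e3 : z ^ (2 * n) * (z⁻¹) ^ (2 * n) = 1 := by rw [← mul_pow, mul_inv_cancel₀ hz, one_pow]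
        rw [e1, e2, mul_pow, ← pow_mul, show 2 * (2 * n) = 4 * n by ring]
        linear_combination (z ^ (p.natDegree + 1) * z ^ n * (z - z⁻¹) * (z - 1) ^ (4 * n) *
          eval (cf z) p) * e3 - (z ^ n * (z - 1) ^ (4 * n) * z ^ p.natDegree * eval (cf z) p) *
          mul_inv_cancel₀ hz
      have hco : IsCoprime ((X - 1 : ℂ[X]) ^ (4 * n)) (X ^ (p.natDegree + 1)) :=
        IsCoprime.pow ⟨-1, 1, by ring⟩
      exact hco.dvd_of_dvd_mul_left ⟨_, e⟩
    · rw [← card_not_dvd_three n]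
      refine card_le_card fun e he => ?_
      rw [mem_support_iff] at he
      rw [mem_filter, mem_range]
      constructor
      · by_contra hlt
        refine he (coeff_eq_zero_of_natDegree_lt ?_)
        have hdeg : ∀ b : ℕ → ℂ, (∑ i ∈ range n, C (b i) * (((X : ℂ[X]) ^ 2 + 1) ^ i *
            X ^ (n - 1 - i))).natDegree ≤ 2 * (n - 1) := by
          intro b
          refine natDegree_sum_le_of_forall_le _ _ fun i hi => ?_
          rw [mem_range] at hi
          refine (natDegree_C_mul_le _ _).trans (natDegree_mul_le.trans ?_)
          have h1 : (((X : ℂ[X]) ^ 2 + 1) ^ i).natDegree ≤ i * 2 :=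
            natDegree_pow_le_of_le i (by compute_degree!)
          have h2 := natDegree_X_pow_le (R := ℂ) (n - 1 - i)
          omega
        rcases Nat.eq_zero_or_pos n with rfl | hn
        · exact absurd (by simp [hF, hA, hD]) he
        have h1 : (expand ℂ 3 A * (X ^ 4 - X ^ 2)).natDegree ≤ 2 * (n - 1) * 3 + 5 := by
          refine natDegree_mul_le.trans (Nat.add_le_add ?_ (by compute_degree!))
          rw [natDegree_expand]
          exact Nat.mul_le_mul_right _ (hdeg _)
        have h2 : (expand ℂ 3 D * (X ^ 5 - X ^ 1)).natDegree ≤ 2 * (n - 1) * 3 + 5 := by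
          refine natDegree_mul_le.trans (Nat.add_le_add ?_ (by compute_degree!))
          rw [natDegree_expand]
          exact Nat.mul_le_mul_right _ (hdeg _)
        have : F.natDegree ≤ _ := natDegree_add_le_of_degree_le h1 h2
        omega
      · intro h3
        apply he
        have hz : ∀ (G : ℂ[X]) k, k % 3 ≠ 0 → (expand ℂ 3 G * X ^ k).coeff e = 0 := by
          intro G k hk
          rw [coeff_mul_X_pow']
          split_ifs with hke
          · rw [coeff_expand (by norm_num), if_neg (by omega)]
          · rfl
        rw [hF, mul_sub, mul_sub, coeff_add, coeff_sub, coeff_sub, hz _ _ (by norm_num),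
          hz _ _ (by norm_num), hz _ _ (by norm_num), hz _ _ (by norm_num)]
        ring
  have hvx : v * (X ^ 2 - C 4) = 0 := by
    refine Polynomial.funext fun x => ?_
    obtain ⟨z, hz, rfl⟩ := cf_surj x
    have := hFv z hz
    rw [hF0, eval_zero] at this
    have h2 : (z - z⁻¹) * v.eval (cf z) = 0 := by
      have h3 := pow_ne_zero (3 * n) hz
      rw [mul_assoc] at this
      exact (mul_eq_zero.1 this.symm).resolve_left h3
    simp only [eval_mul, eval_sub, eval_pow, eval_X, eval_C, eval_zero]
    have e : cf z ^ 2 - 4 = (z - z⁻¹) * (z - z⁻¹) := by unfold cf; field_simp; ring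
    rw [e]
    linear_combination (z - z⁻¹) * h2
  have hx4 : (X ^ 2 - C 4 : ℂ[X]) ≠ 0 := X_pow_sub_C_ne_zero (by norm_num) 4
  have hv0 : v = 0 := (mul_eq_zero.1 hvx).resolve_right hx4
  refine ⟨ww_independent n a hv0, ?_⟩
  rw [hv0] at h
  exact (mul_eq_zero.1 h).resolve_left (pow_ne_zero _ (X_sub_C_ne_zero 2))

end OpenXXZ

namespace OpenXXZ
open Finset Polynomial Filter Topology

/-- Index set for the coefficients in the confluent interpolation problem. -/
abbrev CI (n : ℕ) := Fin n ⊕ Fin (2 * n)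

def cpt (n : ℕ) : CI n → ℂ := Sum.elim (fun k => (k.val : ℂ)) fun j => ((n + j.val : ℕ) : ℂ)

lemma cpt_inj (n : ℕ) : Function.Injective (cpt n) := by
  rintro (i | i) (j | j) h <;> simp only [cpt, Sum.elim_inl, Sum.elim_inr, Nat.cast_inj] at h
  · rw [Fin.ext h]
  · omega
  · omega
  · rw [Fin.ext (Nat.add_left_cancel h)]

/-- The monic polynomial of degree `n` with the given lower coefficients. -/
def PPol (n : ℕ) (v : CI n → ℂ) : ℂ[X] := X ^ n + ∑ k : Fin n, C (v (.inl k)) * X ^ (k : ℕ)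

def cmat (n : ℕ) (c : ℕ → ℂ) : Matrix (CI n) (CI n) ℂ := Matrix.of fun i =>
  Sum.elim (fun k => (∏ j ∈ range (2 * n), (cpt n i - c j)) * cpt n i ^ (k : ℕ))
    fun j => -ww j (cpt n i)

def crhs (n : ℕ) (c : ℕ → ℂ) : CI n → ℂ := fun i =>
  ww (2 * n) (cpt n i) - (∏ j ∈ range (2 * n), (cpt n i - c j)) * cpt n i ^ n

def csol (n : ℕ) (c : ℕ → ℂ) : CI n → ℂ := (cmat n c).det⁻¹ • (cmat n c).cramer (crhs n c)

lemma cmat_mulVec (n : ℕ) (c : ℕ → ℂ) (v : CI n → ℂ) (i : CI n) : (cmat n c).mulVec v i =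
    (∏ j ∈ range (2 * n), (cpt n i - c j)) * (∑ k : Fin n, v (.inl k) * cpt n i ^ (k : ℕ)) -
      ∑ k : Fin (2 * n), v (.inr k) * ww k (cpt n i) := by
  rw [Matrix.mulVec, dotProduct, Fintype.sum_sum_type, mul_sum, sub_eq_add_neg, ← sum_neg_distrib]
  simp only [cmat, Matrix.of_apply, Sum.elim_inl, Sum.elim_inr]
  congr 1
  · exact sum_congr rfl fun _ _ => by ring
  · exact sum_congr rfl fun _ _ => by ring

lemma prod_degree (n : ℕ) (c : ℕ → ℂ) :
    (∏ j ∈ range (2 * n), (X - C (c j))).Monic ∧ (∏ j ∈ range (2 * n), (X - C (c j))).natDegree = 2 * n := by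
  refine ⟨monic_prod_of_monic _ _ fun j _ => monic_X_sub_C _, ?_⟩
  rw [natDegree_prod_of_monic _ _ fun j _ => monic_X_sub_C _]
  simp

lemma degree_low (n : ℕ) (v : CI n → ℂ) : (∑ k : Fin n, C (v (.inl k)) * (X : ℂ[X]) ^ (k : ℕ)).degree < n := by
  refine mem_degreeLT.1 (sum_mem fun k _ => mem_degreeLT.2 ?_)
  exact (degree_C_mul_X_pow_le _ _).trans_lt (by exact_mod_cast k.isLt)

lemma degree_lin (n : ℕ) (c : ℕ → ℂ) (v : CI n → ℂ) :
    ((∏ j ∈ range (2 * n), (X - C (c j))) * (∑ k : Fin n, C (v (.inl k)) * X ^ (k : ℕ)) -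
      ∑ k : Fin (2 * n), C (v (.inr k)) * wwP k).degree < ((3 * n : ℕ) : WithBot ℕ) := by
  refine (degree_sub_le _ _).trans_lt (max_lt ?_ ?_)
  · rw [degree_mul, degree_eq_natDegree (prod_degree n c).1.ne_zero, (prod_degree n c).2,
      show 3 * n = 2 * n + n by ring, Nat.cast_add (2 * n) n]
    exact WithBot.add_lt_add_left (WithBot.coe_ne_bot (a := 2 * n)) (degree_low n v)
  · refine mem_degreeLT.1 (sum_mem fun k _ => mem_degreeLT.2 ?_)
    refine degree_le_natDegree.trans_lt ?_
    have h1 := (natDegree_C_mul_le (v (.inr k)) (wwP k)).trans (natDegree_wwP_le k)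
    have h2 := k.isLt
    exact_mod_cast (by omega : (C (v (.inr k)) * wwP k).natDegree < 3 * n)

lemma cmat_det_ne_zero (n : ℕ) : (cmat n fun _ => 2).det ≠ 0 := by
  intro h
  obtain ⟨v, hv, hv0⟩ := Matrix.exists_mulVec_eq_zero_iff.2 h
  apply hv
  have key : (X - C 2) ^ (2 * n) * (∑ k : Fin n, C (v (.inl k)) * X ^ (k : ℕ)) -
      ∑ k : Fin (2 * n), C (v (.inr k)) * wwP k = 0 := by
    have hd := degree_lin n (fun _ => 2) v
    rw [prod_const, card_range] at hd
    refine eq_zero_of_degree_lt_of_eval_index_eq_zero (v := cpt n) univ (cpt_inj n).injOn ?_ ?_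
    · refine hd.trans_le (le_of_eq ?_)
      rw [card_univ, Fintype.card_sum, Fintype.card_fin, Fintype.card_fin, show n + 2 * n = 3 * n by ring]
    · intro i _
      have := congrFun hv0 i
      rw [cmat_mulVec, prod_const, card_range] at this
      simpa [eval_finsetSum, eval_wwP] using this
  obtain ⟨h1, h2⟩ := ww_kernel n _ (fun k => if h : k < 2 * n then v (.inr ⟨k, h⟩) else 0)
    (by rw [sub_eq_zero.1 key, ← Fin.sum_univ_eq_sum_range
          (fun k => C (if h : k < 2 * n then v (.inr ⟨k, h⟩) else 0) * wwP k)]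
        exact sum_congr rfl fun k _ => by rw [dif_pos k.isLt])
  funext i
  rcases i with i | i
  · have := congrArg (fun p => coeff p i.val) h2
    simpa [finsetSum_coeff, coeff_C_mul, coeff_X_pow, Fin.val_inj] using this
  · have := h1 i i.isLt
    rwa [dif_pos i.isLt] at this

lemma csol_spec {n : ℕ} {c : ℕ → ℂ} (h : (cmat n c).det ≠ 0) :
    (∏ j ∈ range (2 * n), (X - C (c j))) * PPol n (csol n c) =
      wwP (2 * n) + ∑ k : Fin (2 * n), C (csol n c (.inr k)) * wwP k := by
  set v := csol n c with hv
  have hm : (cmat n c).mulVec v = crhs n c := by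
    rw [hv, csol, Matrix.mulVec_smul, Matrix.mulVec_cramer, smul_smul, inv_mul_cancel₀ h, one_smul]
  refine eq_of_degree_sub_lt_of_eval_index_eq (v := cpt n) univ (cpt_inj n).injOn ?_ ?_
  · have e : (∏ j ∈ range (2 * n), (X - C (c j))) * PPol n v -
        (wwP (2 * n) + ∑ k : Fin (2 * n), C (v (.inr k)) * wwP k) =
        ((∏ j ∈ range (2 * n), (X - C (c j))) * X ^ n - wwP (2 * n)) +
        ((∏ j ∈ range (2 * n), (X - C (c j))) * (∑ k : Fin n, C (v (.inl k)) * X ^ (k : ℕ)) -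
          ∑ k : Fin (2 * n), C (v (.inr k)) * wwP k) := by
      unfold PPol; ring
    rw [e, card_univ, Fintype.card_sum, Fintype.card_fin, Fintype.card_fin, show n + 2 * n = 3 * n by ring]
    refine (degree_add_le _ _).trans_lt (max_lt ?_ (degree_lin n c v))
    have hY : (X ^ 3 - C 3 * X : ℂ[X]).Monic := by monicity!
    have hYd : (X ^ 3 - C 3 * X : ℂ[X]).natDegree = 3 := by compute_degree!
    have hw : wwP (2 * n) = (X ^ 3 - C 3 * X) ^ n := by
      unfold wwP
      rw [show 2 * n / 2 = n by omega, show 2 * n % 2 = 0 by omega, pow_zero, mul_one]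
    have hp := prod_degree n c
    have hd1 : ((∏ j ∈ range (2 * n), (X - C (c j))) * X ^ n).degree = ((3 * n : ℕ) : WithBot ℕ) := by
      rw [degree_eq_natDegree (hp.1.mul (monic_X_pow n)).ne_zero, hp.1.natDegree_mul (monic_X_pow n), hp.2,
        natDegree_X_pow, show 2 * n + n = 3 * n by ring]
    have hd2 : (wwP (2 * n)).degree = ((3 * n : ℕ) : WithBot ℕ) := by
      rw [hw, degree_eq_natDegree (hY.pow n).ne_zero, hY.natDegree_pow, hYd, mul_comm]
    rw [← hd1]
    refine degree_sub_lt_left (hd1.trans hd2.symm) (hp.1.mul (monic_X_pow n)).ne_zero ?_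
    rw [(hp.1.mul (monic_X_pow n)).leadingCoeff, hw, (hY.pow n).leadingCoeff]
  · intro i _
    have := congrFun hm i
    rw [cmat_mulVec, crhs] at this
    simp only [PPol, eval_mul, eval_add, eval_prod, eval_finsetSum, eval_sub, eval_X, eval_C, eval_pow,
      eval_wwP]
    linear_combination this

lemma csol_continuousAt (n : ℕ) : ContinuousAt (csol n) fun _ => 2 := by
  have h1 : Continuous (cmat n) := by
    refine continuous_matrix fun i j => ?_
    rcases j with j | j
    · simp only [cmat, Matrix.of_apply, Sum.elim_inl]
      fun_prop
    · simp only [cmat, Matrix.of_apply, Sum.elim_inr]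
      fun_prop
  have h2 : Continuous (crhs n) := by
    refine continuous_pi fun i => ?_
    simp only [crhs]
    fun_prop
  exact (h1.matrix_det.continuousAt.inv₀ (cmat_det_ne_zero n)).smul
    (h1.matrix_cramer h2).continuousAt

/-- The homogeneous limit of the ratio of determinants. -/
def pin (n : ℕ) : ℂ[X] := PPol n (csol n fun _ => 2)

lemma tendsto_PPol {ι : Type*} {l : Filter ι} {c : ι → ℕ → ℂ} (hc : ∀ j, Tendsto (fun t => c t j) l (𝓝 2))
    (n : ℕ) (x : ℂ) : Tendsto (fun t => (PPol n (csol n (c t))).eval x) l (𝓝 ((pin n).eval x)) := by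
  have h : Tendsto (fun t => csol n (c t)) l (𝓝 (csol n fun _ => 2)) :=
    (csol_continuousAt n).tendsto.comp (tendsto_pi_nhds.2 hc)
  have h2 : Continuous fun v : CI n → ℂ => (PPol n v).eval x := by
    simp only [PPol, eval_add, eval_pow, eval_X, eval_finsetSum, eval_mul, eval_C]
    fun_prop
  exact h2.continuousAt.tendsto.comp h

lemma EE_limit {ι : Type*} {l : Filter ι} {c : ι → ℕ → ℂ} (hc : ∀ j, Tendsto (fun t => c t j) l (𝓝 2))
    (n : ℕ) (x : ℂ) : ∀ᶠ t in l, Set.InjOn (Function.update (c t) (2 * n) x) (Set.Iio (2 * n + 1)) →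
      EE (2 * n + 1) (Function.update (c t) (2 * n) x) =
        (PPol n (csol n (c t))).eval x * EE (2 * n) (c t) := by
  have h : Tendsto c l (𝓝 fun _ => 2) := tendsto_pi_nhds.2 hc
  have hdet : ∀ᶠ d in 𝓝 (fun _ : ℕ => (2 : ℂ)), (cmat n d).det ≠ 0 := by
    have h1 : Continuous (cmat n) := by
      refine continuous_matrix fun i j => ?_
      rcases j with j | j
      · simp only [cmat, Matrix.of_apply, Sum.elim_inl]
        fun_prop
      · simp only [cmat, Matrix.of_apply, Sum.elim_inr]
        fun_prop
    exact h1.matrix_det.continuousAt.eventually_ne (cmat_det_ne_zero n)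
  filter_upwards [h.eventually hdet] with t ht hinj
  have key := EE_last (2 * n) hinj
    (fun k => if h : k < 2 * n then csol n (c t) (.inr ⟨k, h⟩) else 0)
    (fun x => (PPol n (csol n (c t))).eval x) (fun y => by
      have := congrArg (eval y) (csol_spec ht)
      simp only [eval_mul, eval_add, eval_prod, eval_finsetSum, eval_sub, eval_X, eval_C,
        eval_wwP] at this
      rw [← Fin.sum_univ_eq_sum_range
        (fun k => (if h : k < 2 * n then csol n (c t) (.inr ⟨k, h⟩) else 0) * ww k y)]
      rw [prod_congr rfl fun j hj => by
        rw [Function.update_of_ne (by have := mem_range.1 hj; omega)]]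
      rw [this]
      congr 1
      exact sum_congr rfl fun k _ => by rw [dif_pos k.isLt])
  rw [key, Function.update_self]
  congr 1
  exact EE_congr fun j hj => Function.update_of_ne (by omega) _ _

/-- Characterisation of the homogeneous limit. -/
lemma pin_unique (n : ℕ) (R : ℂ[X]) (a : ℕ → ℂ)
    (h : (X - C 2) ^ (2 * n) * R = wwP (2 * n) + ∑ k ∈ range (2 * n), C (a k) * wwP k) : R = pin n := by
  have hs := csol_spec (cmat_det_ne_zero n)
  rw [prod_const, card_range] at hs
  set v := csol n fun _ => 2
  have := (ww_kernel n (R - pin n)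
    (fun k => a k - if h : k < 2 * n then v (.inr ⟨k, h⟩) else 0) ?_).2
  · exact sub_eq_zero.1 this
  · rw [mul_sub, pin, hs, h]
    simp only [C_sub, sub_mul, sum_sub_distrib]
    rw [← Fin.sum_univ_eq_sum_range
      (fun k => C (if h : k < 2 * n then v (.inr ⟨k, h⟩) else 0) * wwP k)]
    have e : ∑ k : Fin (2 * n), C (if h : (k : ℕ) < 2 * n then v (.inr ⟨k, h⟩) else 0) * wwP k =
        ∑ k : Fin (2 * n), C (v (.inr k)) * wwP k := sum_congr rfl fun k _ => by rw [dif_pos k.isLt]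
    rw [e]
    ring

end OpenXXZ

namespace OpenXXZ
open Finset Filter Topology

variable {B : ℂ}

/-- A curve of real inhomogeneities tending to the homogeneous point. -/
def zcurve (t : ℝ) : ℕ → ℂ := fun j => ((1 + t * (j + 1) : ℝ) : ℂ)

def ones : ℕ → ℂ := fun _ => 1

lemma norm_q : ‖q‖ = 1 := by
  have h : ‖q‖ ^ 3 = 1 := by rw [← norm_pow, q_pow_three, norm_one]
  exact (pow_eq_one_iff_of_nonneg (norm_nonneg _) (by norm_num)).1 h

lemma GG_zcurve (hB : ‖B‖ = 1) {t : ℝ} (ht : 0 < t) : GG (B * q ^ 2) (zcurve t) := by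
  have hζ : ‖B * q ^ 2‖ = 1 := by rw [norm_mul, norm_pow, hB, norm_q]; norm_num
  have h1 : ∀ j : ℕ, 1 < 1 + t * ((j : ℝ) + 1) := fun j => by
    have : 0 < t * ((j : ℝ) + 1) := by positivity
    linarith
  have hn : ∀ j, ‖zcurve t j‖ = 1 + t * (j + 1) := fun j => by
    rw [zcurve, Complex.norm_real, Real.norm_of_nonneg (by linarith [h1 j])]
  have h3 : ∀ {w : ℂ}, 1 < ‖w‖ → 1 < ‖w ^ 3‖ := fun {w} hw => by
    rw [norm_pow]; exact one_lt_pow₀ hw (by norm_num)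
  refine ⟨fun i h => ?_, fun i h => ?_, fun i h => ?_, fun i k h => ?_, fun i k hik h => ?_⟩
  · have := hn i
    rw [h, norm_zero] at this
    linarith [h1 i]
  · have := h3 (w := zcurve t i * (B * q ^ 2)) (by rw [norm_mul, hζ, hn, mul_one]; exact h1 i)
    rw [h, norm_one] at this
    exact lt_irrefl _ this
  · have := h3 (w := zcurve t i) (by rw [hn]; exact h1 i)
    rw [h, norm_pow, hζ, one_pow] at this
    exact lt_irrefl _ this
  · have := h3 (w := zcurve t i * zcurve t k) (by
      rw [norm_mul, hn, hn]; exact one_lt_mul_of_lt_of_le (h1 i) (h1 k).le)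
    rw [h, norm_one] at this
    exact lt_irrefl _ this
  · have h4 := congrArg norm h
    rw [norm_pow, norm_pow, hn, hn] at h4
    have h5 := (pow_left_inj₀ (by linarith [h1 i]) (by linarith [h1 k]) (by norm_num)).1 h4
    have h6 : (i : ℝ) + 1 = k + 1 := mul_left_cancel₀ ht.ne' (by linarith)
    exact hik (by exact_mod_cast add_right_cancel h6)

lemma tendsto_zcurve (j : ℕ) : Tendsto (fun t => zcurve t j) (𝓝[>] 0) (𝓝 1) := by
  have h : Continuous fun t : ℝ => zcurve t j := by unfold zcurve; fun_prop
  have := (h.tendsto 0).mono_left (nhdsWithin_le_nhds (s := Set.Ioi 0))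
  simpa [zcurve] using this

lemma tendsto_phi {ι : Type*} {l : Filter ι} {z : ι → ℕ → ℂ} (hz : ∀ j, Tendsto (fun t => z t j) l (𝓝 1))
    (n : ℕ) (α : Cfg) : Tendsto (fun t => phi B n α (z t)) l (𝓝 (phi B n α ones)) :=
  ((MvPolynomial.continuous_eval _).tendsto ones).comp (tendsto_pi_nhds.2 hz)

lemma tendsto_SS {ι : Type*} {l : Filter ι} {z : ι → ℕ → ℂ} (hz : ∀ j, Tendsto (fun t => z t j) l (𝓝 1))
    (n1 n2 : ℕ) : Tendsto (fun t => SS n1 n2 (phi B) (z t)) l (𝓝 (SS n1 n2 (phi B) ones)) := by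
  have hi : ∀ j, Tendsto (fun t => iv (z t) j) l (𝓝 1) := fun j => by
    simpa [iv] using (hz j).inv₀ one_ne_zero
  have e : iv ones = ones := by funext j; simp [iv, ones]
  have e2 : sh (2 * n1) ones = ones := rfl
  unfold SS csum
  rw [e, e2]
  exact tendsto_finsetSum _ fun γ _ => ((tendsto_phi hz _ _).mul (tendsto_phi hi _ _)).mul
    (tendsto_phi (z := fun t => sh (2 * n1) (iv (z t))) (fun j => hi _) _ _)

/-- The homogeneous limit of the overlap formula. -/
lemma SS_ones_relation (hB : ‖B‖ = 1) (n1 n2 : ℕ) :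
    SS n1 n2 (phi B) ones ^ 2 * ((pin n1).eval (cf (B * q ^ 2)) * (pin n2).eval (cf (B * q ^ 2))) =
      SS n1 0 (phi B) ones * SS n2 0 (phi B) ones * SS (n1 + n2) 0 (phi B) ones *
        (pin (n1 + n2)).eval (cf (B * q ^ 2)) := by
  have hB0 : B ≠ 0 := fun h => by simp [h] at hB
  set x := cf (B * q ^ 2) with hx
  have hc : ∀ j, Tendsto (fun t => (cf ∘ zcurve t) j) (𝓝[>] 0) (𝓝 2) := fun j => by
    have := (tendsto_zcurve j).add ((tendsto_zcurve j).inv₀ one_ne_zero)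
    simpa [cf, one_add_one_eq_two] using this
  have hsz : ∀ j, Tendsto (fun t => sh (2 * n1) (zcurve t) j) (𝓝[>] 0) (𝓝 1) := fun j => tendsto_zcurve _
  have hsc : ∀ j, Tendsto (fun t => (cf ∘ sh (2 * n1) (zcurve t)) j) (𝓝[>] 0) (𝓝 2) := fun j => hc (j + 2 * n1)
  have hpos : ∀ᶠ t : ℝ in 𝓝[>] 0, 0 < t := eventually_mem_nhdsWithin
  have key : ∀ᶠ t : ℝ in 𝓝[>] 0,
      SS n1 n2 (phi B) (zcurve t) ^ 2 * ((PPol n1 (csol n1 (cf ∘ zcurve t))).eval x *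
        (PPol n2 (csol n2 (cf ∘ sh (2 * n1) (zcurve t)))).eval x) =
      (∏ j ∈ range (2 * n1), zcurve t j ^ n2) ^ 2 * (∏ j ∈ range (2 * n2), zcurve t (j + 2 * n1) ^ n1) ^ 2 *
      (SS n1 0 (phi B) (zcurve t) * SS n2 0 (phi B) (sh (2 * n1) (zcurve t)) *
        SS (n1 + n2) 0 (phi B) (zcurve t) *
        (PPol (n1 + n2) (csol (n1 + n2) (cf ∘ zcurve t))).eval x) := by
    filter_upwards [hpos, EE_limit hc n1 x, EE_limit hsc n2 x, EE_limit hc (n1 + n2) x] with t ht h1 h2 h3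
    have hg := GG_zcurve hB ht
    have hζ : B * q ^ 2 ≠ 0 := mul_ne_zero hB0 (pow_ne_zero _ q_ne_zero)
    rw [SS_eq_ZZ hB0 (sol_phi B) n1 n2 _ hg, SS_eq_ZZ hB0 (sol_phi B) n1 0 _ hg,
      SS_eq_ZZ hB0 (sol_phi B) n2 0 _ (hg.sh _), SS_eq_ZZ hB0 (sol_phi B) (n1 + n2) 0 _ hg]
    have h1 := h1 (GN.injOn hζ hg.gn _)
    have h2 := h2 (GN.injOn hζ (hg.sh _).gn _)
    have h3 := h3 (GN.injOn hζ hg.gn _)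
    simp only [ZZ, ← hx, add_zero, mul_zero, range_zero, prod_empty, EE_zero, pow_zero, prod_const_one, mul_one]
    rw [h1, h2, h3]
    have e : sh (2 * n1) (cf ∘ zcurve t) = cf ∘ sh (2 * n1) (zcurve t) := rfl
    rw [e]
    ring
  have hP1 : Tendsto (fun t => ∏ j ∈ range (2 * n1), zcurve t j ^ n2) (𝓝[>] 0) (𝓝 1) := by
    simpa using tendsto_finsetProd (range (2 * n1)) fun j _ => (tendsto_zcurve j).pow n2
  have hP2 : Tendsto (fun t => ∏ j ∈ range (2 * n2), zcurve t (j + 2 * n1) ^ n1) (𝓝[>] 0) (𝓝 1) := by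
    simpa using tendsto_finsetProd (range (2 * n2)) fun j _ => (tendsto_zcurve (j + 2 * n1)).pow n1
  have L := ((tendsto_SS (B := B) tendsto_zcurve n1 n2).pow 2).mul
    ((tendsto_PPol hc n1 x).mul (tendsto_PPol hsc n2 x))
  have R := ((hP1.pow 2).mul (hP2.pow 2)).mul ((((tendsto_SS (B := B) tendsto_zcurve n1 0).mul
    (tendsto_SS (B := B) hsz n2 0)).mul (tendsto_SS (B := B) tendsto_zcurve (n1 + n2) 0)).mul
    (tendsto_PPol hc (n1 + n2) x))
  have := tendsto_nhds_unique_of_eventuallyEq L R key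
  simpa using this

end OpenXXZ

namespace OpenXXZ
open Finset Filter Topology

variable {B : ℂ} {W : Wts} {Φ : ℕ → Cfg → (ℕ → ℂ) → ℂ}

/-- A bounded curve of real inhomogeneities tending to the homogeneous point. -/
def zbd (t : ℝ) : ℕ → ℂ := fun j => ((1 + t / (j + 1) : ℝ) : ℂ)

lemma tendsto_zbd (j : ℕ) : Tendsto (fun t => zbd t j) (𝓝[>] 0) (𝓝 1) := by
  have h : Continuous fun t : ℝ => zbd t j := by unfold zbd; fun_prop
  have := (h.tendsto 0).mono_left (nhdsWithin_le_nhds (s := Set.Ioi 0))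
  simpa [zbd] using this

lemma gen_of_pos {s : ℕ → ℝ} (hs : ∀ j, 0 < s j) (hinj : Function.Injective s) :
    Gen fun j => (s j : ℂ) where
  ne_zero i := by exact_mod_cast (hs i).ne'
  inj i j h := hinj (Complex.ofReal_injective h)
  wb_ne i j _ h := by
    have h1 : (1 : ℂ) = q * ((s i * s j : ℝ) : ℂ) := by
      refine mul_left_cancel₀ q_ne_zero ?_
      unfold wb at h
      push_cast
      linear_combination h
    have h2 := congrArg norm h1
    rw [norm_mul, norm_q, norm_one, one_mul, Complex.norm_real,
      Real.norm_of_nonneg (mul_pos (hs i) (hs j)).le] at h2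
    rw [← h2] at h1
    exact q_ne_one (by simpa using h1.symm)

lemma gen_zbd {u t : ℝ} (hu : 0 < u) (ht : 0 < t) (htu : t < |u - 1|) :
    Gen (Function.update (zbd t) 0 u) := by
  have e : Function.update (zbd t) 0 (u : ℂ) =
      fun j => ((Function.update (fun j : ℕ => 1 + t / ((j : ℝ) + 1)) 0 u j : ℝ) : ℂ) := by
    funext j
    by_cases hj : j = 0
    · subst hj; simp
    · simp [Function.update_of_ne hj, zbd]
  have hne : ∀ j : ℕ, u ≠ 1 + t / ((j : ℝ) + 1) := fun j h => by
    have h1 : 0 < t / ((j : ℝ) + 1) := by positivity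
    have h2 : t / ((j : ℝ) + 1) ≤ t := div_le_self ht.le (by linarith [(Nat.cast_nonneg j : (0 : ℝ) ≤ j)])
    rw [h, add_sub_cancel_left, abs_of_pos h1] at htu
    linarith
  rw [e]
  refine gen_of_pos (fun j => ?_) fun i j h => ?_
  · by_cases hj : j = 0
    · subst hj; simpa using hu
    · rw [Function.update_of_ne hj]; positivity
  · by_cases hi : i = 0 <;> by_cases hj : j = 0
    · omega
    · subst hi
      rw [Function.update_self, Function.update_of_ne hj] at h
      exact absurd h (hne j)
    · subst hj
      rw [Function.update_self, Function.update_of_ne hi] at h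
      exact absurd h.symm (hne i)
    · rw [Function.update_of_ne hi, Function.update_of_ne hj] at h
      have h1 : ((i : ℝ) + 1)⁻¹ = ((j : ℝ) + 1)⁻¹ := mul_left_cancel₀ ht.ne' (by simpa [div_eq_mul_inv] using h)
      have h2 := inv_injective h1
      exact_mod_cast add_right_cancel h2

/-- Continuity along curves, at the points needed below. -/
def CurveCont (Ψ : (ℕ → ℂ) → ℂ) : Prop := ∀ (w : ℕ → ℂ) (z : ℝ → ℕ → ℂ), (∀ j, w j ≠ 0) →
  (∀ j, Tendsto (fun t => z t j) (𝓝[>] 0) (𝓝 (w j))) → Tendsto (fun t => Ψ (z t)) (𝓝[>] 0) (𝓝 (Ψ w))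

/-- The left boundary condition at the homogeneous point. -/
lemma left_deriv (hΦ : Sol W Φ) (hW : W.Good) {n : ℕ} (hn : 1 ≤ n) (α : Cfg) (hc : CurveCont (Φ n α))
    {F' k' : ℂ} (hF : HasDerivAt (fun u => Φ n α (Function.update ones 0 u)) F' 1)
    (hk : HasDerivAt (fun u => if α 0 = 1 then W.kd u else W.mu u) k' 1) :
    F' * (if α 0 = 1 then W.kd 1 else W.mu 1) =
      ((n - 1) * (if α 0 = 1 then W.kd 1 else W.mu 1) + k') * Φ n α ones := by
  set k : ℂ → ℂ := fun u => if α 0 = 1 then W.kd u else W.mu u with hkdef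
  set F : ℂ → ℂ := fun u => Φ n α (Function.update ones 0 u) with hFdef
  have hF1 : F 1 = Φ n α ones := by
    rw [hFdef]
    exact congrArg _ (Function.update_eq_self 0 ones)
  have lim : ∀ u : ℝ, 0 < u → Tendsto (fun t => Φ n α (Function.update (zbd t) 0 (u : ℂ))) (𝓝[>] 0) (𝓝 (F u)) := by
    intro u hu
    refine hc _ _ (fun j => ?_) fun j => ?_
    · by_cases hj : j = 0
      · subst hj; simpa using hu.ne'
      · rw [Function.update_of_ne hj]; exact one_ne_zero
    · by_cases hj : j = 0
      · subst hj; simp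
      · simp only [Function.update_of_ne hj]; exact tendsto_zbd j
  have key : ∀ u : ℝ, 0 < u → F u * k (u : ℂ)⁻¹ = (u : ℂ) ^ (2 * (n - 1)) * k u * F (u : ℂ)⁻¹ := by
    intro u hu
    rcases eq_or_ne u 1 with rfl | hu1
    · simp; ring
    have hui : 0 < u⁻¹ := inv_pos.2 hu
    have hui1 : u⁻¹ ≠ 1 := fun h => hu1 (inv_eq_one.1 h)
    have L := (lim u hu).mul_const (k (u : ℂ)⁻¹)
    have R := (lim u⁻¹ hui).const_mul ((u : ℂ) ^ (2 * (n - 1)) * k u)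
    rw [Complex.ofReal_inv] at R
    refine tendsto_nhds_unique_of_eventuallyEq L R ?_
    have h1 : ∀ᶠ t : ℝ in 𝓝[>] 0, 0 < t := eventually_mem_nhdsWithin
    have h2 : ∀ᶠ t : ℝ in 𝓝[>] 0, t < |u - 1| :=
      nhdsWithin_le_nhds (Iio_mem_nhds (abs_pos.2 (sub_ne_zero.2 hu1)))
    have h3 : ∀ᶠ t : ℝ in 𝓝[>] 0, t < |u⁻¹ - 1| :=
      nhdsWithin_le_nhds (Iio_mem_nhds (abs_pos.2 (sub_ne_zero.2 hui1)))
    filter_upwards [h1, h2, h3] with t ht ht1 ht2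
    obtain ⟨P, -, hP⟩ := left_structure hΦ hW hn α (zbd t)
    have e1 := hP u (gen_zbd hu ht ht1)
    have e2 := hP (u : ℂ)⁻¹ (by rw [← Complex.ofReal_inv]; exact gen_zbd hui ht ht2)
    have hu0 : (u : ℂ) ≠ 0 := by exact_mod_cast hu.ne'
    rw [e1, e2, inv_inv, add_comm ((u : ℂ)⁻¹) u, hkdef]
    simp only
    have e3 : (u : ℂ) ^ (n - 1) * ((u : ℂ)⁻¹) ^ (n - 1) = 1 := by
      rw [← mul_pow, mul_inv_cancel₀ hu0, one_pow]
    rw [two_mul, pow_add]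
    generalize (if α 0 = 1 then W.kd (u : ℂ) else W.mu u) = A
    generalize (if α 0 = 1 then W.kd (u : ℂ)⁻¹ else W.mu (u : ℂ)⁻¹) = A'
    linear_combination (-A * A' * (u : ℂ) ^ (n - 1) * Polynomial.eval ((u : ℂ) + (u : ℂ)⁻¹) P) * e3
  have hinv : HasDerivAt (fun u : ℂ => u⁻¹) (-1) 1 := by
    simpa using hasDerivAt_inv (one_ne_zero (α := ℂ))
  have hk2 : HasDerivAt (fun u : ℂ => k u⁻¹) (k' * -1) 1 :=
    HasDerivAt.comp (h₂ := k) (1 : ℂ) (by rw [inv_one]; exact hk) hinv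
  have hF2 : HasDerivAt (fun u : ℂ => F u⁻¹) (F' * -1) 1 :=
    HasDerivAt.comp (h₂ := F) (1 : ℂ) (by rw [inv_one]; exact hF) hinv
  have hL := hF.mul hk2
  have hR := ((hasDerivAt_pow (2 * (n - 1)) (1 : ℂ)).mul hk).mul hF2
  have hL' := HasDerivAt.comp_ofReal (z := (1 : ℝ)) (by exact_mod_cast hL)
  have hR' := HasDerivAt.comp_ofReal (z := (1 : ℝ)) (by exact_mod_cast hR)
  have hev : (fun u : ℝ => (F * fun u : ℂ => k u⁻¹) (u : ℂ)) =ᶠ[𝓝 1]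
      fun u : ℝ => (((fun u : ℂ => u ^ (2 * (n - 1))) * k) * fun u : ℂ => F u⁻¹) (u : ℂ) := by
    filter_upwards [Ioi_mem_nhds (zero_lt_one (α := ℝ))] with u hu using key u hu
  have := hL'.unique (hR'.congr_of_eventuallyEq hev)
  simp only [inv_one, one_pow, Pi.mul_apply, hF1] at this
  push_cast [Nat.cast_sub hn] at this
  change F' * k 1 = ((n - 1) * k 1 + k') * Φ n α ones
  linear_combination this / 2

end OpenXXZ

namespace OpenXXZ
open Finset Filter Topology

variable {B : ℂ}

lemma ones_update_sw (i : ℕ) (u : ℂ) : Function.update ones i u ∘ sw i = Function.update ones (i + 1) u := by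
  funext j
  simp only [Function.comp, Function.update_apply, Equiv.swap_apply_def, ones]
  split_ifs <;> first | rfl | omega

lemma differentiable_eval (p : MvPolynomial ℕ ℂ) (w : ℕ → ℂ) (i : ℕ) :
    Differentiable ℂ fun u => MvPolynomial.eval (Function.update w i u) p := by
  induction p using MvPolynomial.induction_on with
  | C a => simp
  | add p q hp hq =>
    simp only [map_add]
    exact hp.add hq
  | mul_X p j hp =>
    simp only [map_mul, MvPolynomial.eval_X]
    refine hp.mul ?_
    by_cases h : j = i
    · subst h; simp
    · simp [Function.update_of_ne h]

/-- Value of the components at the homogeneous point. -/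
def val (B : ℂ) (n : ℕ) (α : Cfg) : ℂ := phi B n α ones

/-- Logarithmic-type derivatives of the components at the homogeneous point. -/
def dv (B : ℂ) (n : ℕ) (i : ℕ) (α : Cfg) : ℂ := deriv (fun u => phi B n α (Function.update ones i u)) 1

lemma hasDerivAt_phi (n i : ℕ) (α : Cfg) :
    HasDerivAt (fun u => phi B n α (Function.update ones i u)) (dv B n i α) 1 :=
  (differentiable_eval _ ones i).differentiableAt.hasDerivAt

lemma phi_update_one (n i : ℕ) (α : Cfg) : phi B n α (Function.update ones i 1) = val B n α :=
  congrArg _ (Function.update_eq_self i ones)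

lemma update_ones_ne {i : ℕ} {u : ℂ} (hu : u ≠ 0) (j : ℕ) : Function.update ones i u j ≠ 0 := by
  by_cases h : j = i
  · subst h; simpa using hu
  · rw [Function.update_of_ne h]; exact one_ne_zero

lemma hasDerivAt_wa : HasDerivAt (fun u => wa u 1) q 1 := by
  unfold wa
  simpa using ((hasDerivAt_id (1 : ℂ)).const_mul q).sub_const (q ^ 2 * 1)

lemma hasDerivAt_wa' : HasDerivAt (fun u => wa 1 u) (-q ^ 2) 1 := by
  unfold wa
  simpa using ((hasDerivAt_id (1 : ℂ)).const_mul (q ^ 2)).const_sub (q * 1)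

lemma wa_one : wa 1 1 = kap := by unfold wa kap; ring

lemma dv_aligned {n i : ℕ} {α : Cfg} (hi : i + 1 < 2 * n) (h : α i = α (i + 1)) :
    kap * (dv B n i α - dv B n (i + 1) α) = -val B n α := by
  have h1 := hasDerivAt_wa.mul (hasDerivAt_phi (B := B) n (i + 1) α)
  have h2 := hasDerivAt_wa'.mul (hasDerivAt_phi (B := B) n i α)
  have := h1.unique (h2.congr_of_eventuallyEq (by
    filter_upwards [isOpen_ne.mem_nhds (one_ne_zero (α := ℂ))] with u hu
    have := (sol_phi B).aligned n α (Function.update ones i u) i (update_ones_ne hu) hi h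
    rw [ones_update_sw, Function.update_self, Function.update_of_ne (by omega)] at this
    exact this))
  rw [phi_update_one, phi_update_one, wa_one] at this
  linear_combination -this + val B n α * q_sq

lemma dv_down_up {n i : ℕ} {α : Cfg} (hi : i + 1 < 2 * n) (h1 : α i = 1) (h0 : α (i + 1) = 0) :
    kap * (dv B n i α - dv B n (i + 1) α) = q * val B n α + val B n (α ∘ sw i) := by
  have e1 := ((hasDerivAt_id (1 : ℂ)).const_sub 1).mul (hasDerivAt_phi (B := B) n i (α ∘ sw i))
  have e2 := (hasDerivAt_wa.mul (hasDerivAt_phi (B := B) n (i + 1) α)).sub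
    ((hasDerivAt_phi (B := B) n i α).const_mul (kap * 1))
  have := e1.unique (e2.congr_of_eventuallyEq (by
    filter_upwards [isOpen_ne.mem_nhds (one_ne_zero (α := ℂ))] with u hu
    have := (sol_phi B).exch n α (Function.update ones i u) i (update_ones_ne hu) hi h1 h0
    rw [ones_update_sw, Function.update_self, Function.update_of_ne (by omega)] at this
    exact this))
  simp only [phi_update_one, wa_one, id] at this
  linear_combination this

lemma dv_up_down {n i : ℕ} {α : Cfg} (hi : i + 1 < 2 * n) (h0 : α i = 0) (h1 : α (i + 1) = 1) :
    kap * (dv B n i α - dv B n (i + 1) α) = q ^ 2 * val B n α + val B n (α ∘ sw i) := by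
  have e1 := hasDerivAt_wa.mul (hasDerivAt_phi (B := B) n (i + 1) α)
  have e2 := (((hasDerivAt_id (1 : ℂ)).const_sub 1).mul (hasDerivAt_phi (B := B) n i (α ∘ sw i))).add
    (((hasDerivAt_id (1 : ℂ)).const_mul kap).mul (hasDerivAt_phi (B := B) n i α))
  have hs0 : (α ∘ sw i) i = 1 := by simp only [Function.comp, sw_left, h1]
  have hs1 : (α ∘ sw i) (i + 1) = 0 := by simp only [Function.comp, sw_right, h0]
  have := e1.unique (e2.congr_of_eventuallyEq (by
    filter_upwards [isOpen_ne.mem_nhds (one_ne_zero (α := ℂ))] with u hu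
    simp only [Pi.mul_apply, Pi.add_apply, id]
    rcases eq_or_ne u 1 with rfl | hu1
    · rw [phi_update_one, phi_update_one, phi_update_one, wa_one]; ring
    have a1 := (sol_phi B).exch n (α ∘ sw i) (Function.update ones i u) i (update_ones_ne hu) hi hs0 hs1
    have a2 := (sol_phi B).exch n (α ∘ sw i) (Function.update ones (i + 1) u) i (update_ones_ne hu) hi hs0 hs1
    rw [comp_sw_sw] at a1 a2
    rw [ones_update_sw, Function.update_self, Function.update_of_ne (by omega)] at a1
    rw [← ones_update_sw, comp_sw_sw, ones_update_sw, Function.update_self, Function.update_of_ne (by omega)] at a2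
    simp only [ones] at a1 a2
    refine mul_left_cancel₀ (sub_ne_zero.2 hu1) ?_
    have hq := q_sq
    unfold wa kap at *
    grind))
  simp only [phi_update_one, wa_one, id] at this
  unfold kap at *
  linear_combination -this

lemma curveCont_phi (n : ℕ) (α : Cfg) : CurveCont (phi B n α) := fun w _ _ hz =>
  ((MvPolynomial.continuous_eval _).tendsto w).comp (tendsto_pi_nhds.2 hz)

lemma curveCont_mir (n : ℕ) (α : Cfg) : CurveCont (mir (phi B) n α) := fun w z hw hz => by
  unfold mir
  refine (tendsto_finsetProd _ fun j _ => (hz j).pow _).mul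
    (curveCont_phi n _ _ (fun t => iv (z t) ∘ rv (2 * n)) (fun j => inv_ne_zero (hw _)) fun j => ?_)
  exact (hz _).inv₀ (hw _)

lemma dv_left {n : ℕ} (hn : 1 ≤ n) (hB : B ≠ 1) (α : Cfg) :
    dv B n 0 α = ((n - 1) + if α 0 = 1 then B / (B - 1) else 0) * val B n α := by
  have hB' : B - 1 ≠ 0 := sub_ne_zero.2 hB
  have := left_deriv (sol_phi B) (W1_good B) hn α (curveCont_phi n α) (hasDerivAt_phi n 0 α)
    (k' := if α 0 = 1 then B else 0) (by
      split_ifs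
      · simpa [W1] using ((hasDerivAt_id (1 : ℂ)).const_mul B).sub_const 1
      · exact hasDerivAt_const _ _)
  change _ = _ * val B n α at this
  split_ifs at this ⊢
  · simp only [W1, mul_one] at this
    field_simp
    linear_combination this
  · simp only [W1] at this
    linear_combination this

lemma dv_right {n : ℕ} (hn : 1 ≤ n) (hB : q - q ^ 2 * B ≠ 0) (α : Cfg) :
    dv B n (2 * n - 1) α =
      ((n - 1) - if α (2 * n - 1) = 1 then q ^ 2 * B / (q - q ^ 2 * B) else 0) * val B n α := by
  have e : ∀ u : ℂ, iv (Function.update ones 0 u) ∘ rv (2 * n) = Function.update ones (2 * n - 1) u⁻¹ := by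
    intro u
    funext j
    simp only [iv, rv, Function.comp, Function.update_apply, ones]
    split_ifs <;> first | rfl | omega | simp
  have e2 : ∀ u : ℂ, mir (phi B) n (fl (2 * n) α) (Function.update ones 0 u) =
      u ^ (2 * n - 2) * phi B n α (Function.update ones (2 * n - 1) u⁻¹) := by
    intro u
    rw [mir, e, fl_fl, prod_eq_single_of_mem 0 (mem_range.2 (by omega)) (fun j _ hj => by
      rw [Function.update_of_ne hj]; exact one_pow _), Function.update_self]
  have hinv : HasDerivAt (fun u : ℂ => u⁻¹) (-1) 1 := by
    simpa using hasDerivAt_inv (one_ne_zero (α := ℂ))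
  have hF : HasDerivAt (fun u => mir (phi B) n (fl (2 * n) α) (Function.update ones 0 u))
      ((2 * n - 2) * val B n α - dv B n (2 * n - 1) α) 1 := by
    simp only [e2]
    have h2 := HasDerivAt.comp (h₂ := fun u => phi B n α (Function.update ones (2 * n - 1) u)) (1 : ℂ)
      (by rw [inv_one]; exact hasDerivAt_phi n (2 * n - 1) α) hinv
    have h3 := (hasDerivAt_pow (2 * n - 2) (1 : ℂ)).mul h2
    refine h3.congr_deriv ?_
    simp only [Function.comp, inv_one, one_pow, phi_update_one]
    rw [Nat.cast_sub (by omega)]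
    push_cast
    ring
  have := left_deriv (sol_mir (sol_phi B)) (W2_good B) hn (fl (2 * n) α) (curveCont_mir n _) hF
    (k' := if fl (2 * n) α 0 = 1 then 0 else q ^ 2 * B) (by
      split_ifs
      · exact hasDerivAt_const _ _
      · simpa [W2] using (hinv.const_mul (q ^ 2 * B)).const_sub q)
  have hv : mir (phi B) n (fl (2 * n) α) ones = val B n α := by
    have := e2 1
    rwa [one_pow, one_mul, inv_one, phi_update_one, show Function.update ones 0 1 = ones from
      Function.update_eq_self 0 ones] at this
  rw [hv] at this
  have hfl : fl (2 * n) α 0 = 1 - α (2 * n - 1) := by rw [fl_apply (by omega)]; congr 2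
  rw [hfl] at this
  rcases (by omega : α (2 * n - 1) = 0 ∨ α (2 * n - 1) = 1) with h | h
  · simp only [h, sub_zero, if_true, W2] at this
    simp only [h]
    norm_num
    linear_combination -this
  · simp only [h, sub_self, W2] at this
    simp only [h]
    norm_num at this ⊢
    refine mul_right_cancel₀ hB ?_
    have hX := div_mul_cancel₀ (q ^ 2 * B) hB
    linear_combination -this + val B n α * hX

end OpenXXZ

namespace OpenXXZ
open Finset Filter Topology

variable {B : ℂ}

lemma siteOp_mulVec {N : ℕ} (i : Fin N) (A : Matrix (Fin 2) (Fin 2) ℂ) (v : Conf N → ℂ) (γ : Conf N) :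
    (siteOp N i A).mulVec v γ = ∑ b, A (γ i) b * v (Function.update γ i b) := by
  symm
  refine Fintype.sum_of_injective (fun b => Function.update γ i b) (Function.update_injective γ i) _ _
    (fun β hβ => ?_) fun b => ?_
  · have h : ∃ j ∈ univ.erase i, ¬ γ j = β j := by
      by_contra! h
      refine hβ ⟨β i, funext fun j => ?_⟩
      by_cases hj : j = i
      · subst hj; simp
      · simp only [Function.update_of_ne hj]
        exact h j (mem_erase.2 ⟨hj, mem_univ _⟩)
    obtain ⟨j, hj, hne⟩ := h
    simp only [siteOp, Matrix.of_apply]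
    rw [prod_eq_zero hj (if_neg hne)]
    ring
  · simp only [siteOp, Matrix.of_apply, Function.update_self]
    rw [prod_eq_one fun j hj => if_pos (Function.update_of_ne (mem_erase.1 hj).1 _ _).symm]
    ring

lemma siteOp_mul_mulVec {N : ℕ} {i j : Fin N} (hij : i ≠ j) (A A' : Matrix (Fin 2) (Fin 2) ℂ)
    (v : Conf N → ℂ) (γ : Conf N) : (siteOp N i A * siteOp N j A').mulVec v γ =
      ∑ b, ∑ c, A (γ i) b * A' (γ j) c * v (Function.update (Function.update γ i b) j c) := by
  rw [← Matrix.mulVec_mulVec, siteOp_mulVec]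
  refine sum_congr rfl fun b _ => ?_
  rw [siteOp_mulVec, mul_sum, Function.update_of_ne hij.symm]
  exact sum_congr rfl fun c _ => by ring

lemma bond_mulVec {N : ℕ} {i j : Fin N} (hij : i ≠ j) (v : Conf N → ℂ) (γ : Conf N) :
    (siteOp N i pauliX * siteOp N j pauliX + siteOp N i pauliY * siteOp N j pauliY -
      (1 / 2 : ℂ) • (siteOp N i pauliZ * siteOp N j pauliZ)).mulVec v γ =
    if γ i = γ j then -(1 / 2) * v γ else 2 * v (γ ∘ Equiv.swap i j) + 1 / 2 * v γ := by
  have hu : ∀ b c, b = γ i → c = γ j → Function.update (Function.update γ i b) j c = γ := by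
    rintro b c rfl rfl
    rw [Function.update_eq_self, Function.update_eq_self]
  have hs : ∀ b c, b = γ j → c = γ i →
      Function.update (Function.update γ i b) j c = γ ∘ Equiv.swap i j := by
    rintro b c rfl rfl
    funext k
    simp only [Function.comp, Function.update_apply, Equiv.swap_apply_def]
    split_ifs with h1 h2 <;> simp_all
  rw [Matrix.sub_mulVec, Matrix.add_mulVec, Matrix.smul_mulVec, Pi.sub_apply, Pi.add_apply,
    Pi.smul_apply, siteOp_mul_mulVec hij, siteOp_mul_mulVec hij, siteOp_mul_mulVec hij]
  simp only [Fin.sum_univ_two]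
  rcases (by omega : γ i = 0 ∨ γ i = 1) with h1 | h1 <;> rcases (by omega : γ j = 0 ∨ γ j = 1) with h2 | h2
  · rw [hu 0 0 h1.symm h2.symm]
    simp [h1, h2, pauliX, pauliY, pauliZ]
  · rw [hu 0 1 h1.symm h2.symm, hs 1 0 h2.symm h1.symm]
    simp [h1, h2, pauliX, pauliY, pauliZ]
    ring
  · rw [hu 1 0 h1.symm h2.symm, hs 0 1 h2.symm h1.symm]
    simp [h1, h2, pauliX, pauliY, pauliZ]
    ring
  · rw [hu 1 1 h1.symm h2.symm]
    simp [h1, h2, pauliX, pauliY, pauliZ]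

lemma pauliZ_mulVec {N : ℕ} (i : Fin N) (v : Conf N → ℂ) (γ : Conf N) :
    (siteOp N i pauliZ).mulVec v γ = (1 - 2 * if γ i = 1 then 1 else 0) * v γ := by
  rw [siteOp_mulVec, Fin.sum_univ_two]
  rcases (by omega : γ i = 0 ∨ γ i = 1) with h | h
  · rw [show Function.update γ i 0 = γ by rw [← h, Function.update_eq_self]]
    simp [h, pauliZ]
  · rw [show Function.update γ i 1 = γ by rw [← h, Function.update_eq_self]]
    simp [h, pauliZ]
    ring

/-- The homogeneous vector. -/
def hvec (B : ℂ) (n : ℕ) : Conf (2 * n) → ℂ := fun γ => val B n (ext (2 * n) γ)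

lemma ext_apply {N j : ℕ} (γ : Fin N → Fin 2) (hj : j < N) : ext N γ j = γ ⟨j, hj⟩ := dif_pos hj

lemma ext_swap {N i : ℕ} (hi : i + 1 < N) (γ : Fin N → Fin 2) :
    ext N (γ ∘ Equiv.swap ⟨i, by omega⟩ ⟨i + 1, hi⟩) = ext N γ ∘ sw i := by
  funext j
  simp only [ext, Function.comp, Equiv.swap_apply_def]
  by_cases hj : j < N
  · rw [dif_pos hj]
    simp only [Fin.mk.injEq]
    split_ifs <;> first | rfl | omega
  · rw [dif_neg hj]
    split_ifs <;> first | rfl | omega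

/-- Telescoping density of the bulk Hamiltonian. -/
def dens (B : ℂ) (n : ℕ) (γ : Conf (2 * n)) (i : ℕ) : ℂ :=
  kap / 2 * (if ext (2 * n) γ i = 1 then 1 else 0) * hvec B n γ - kap * dv B n i (ext (2 * n) γ)

lemma bond_hvec {n i : ℕ} (hi : i + 1 < 2 * n) (γ : Conf (2 * n)) :
    -(1 / 2) * (if γ ⟨i, by omega⟩ = γ ⟨i + 1, hi⟩ then -(1 / 2) * hvec B n γ else
      2 * hvec B n (γ ∘ Equiv.swap ⟨i, by omega⟩ ⟨i + 1, hi⟩) + 1 / 2 * hvec B n γ) =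
    -(3 / 4) * hvec B n γ + (dens B n γ i - dens B n γ (i + 1)) := by
  have e0 := ext_apply γ (show i < 2 * n by omega)
  have e1 := ext_apply γ hi
  have hs : hvec B n (γ ∘ Equiv.swap ⟨i, by omega⟩ ⟨i + 1, hi⟩) = val B n (ext (2 * n) γ ∘ sw i) := by
    rw [hvec, ext_swap]
  rw [hs]
  unfold dens
  rw [e0, e1]
  have hq := q_sq
  rcases (by omega : γ ⟨i, Nat.lt_of_succ_lt hi⟩ = 0 ∨ γ ⟨i, Nat.lt_of_succ_lt hi⟩ = 1) with h | h <;>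
    rcases (by omega : γ ⟨i + 1, hi⟩ = 0 ∨ γ ⟨i + 1, hi⟩ = 1) with h' | h'
  · have := dv_aligned (B := B) hi (e0.trans (h.trans (e1.trans h').symm))
    change _ = -hvec B n γ at this
    rw [h, h']
    norm_num
    linear_combination this
  · have := dv_up_down (B := B) hi (e0.trans h) (e1.trans h')
    change _ = q ^ 2 * hvec B n γ + _ at this
    rw [h, h']
    norm_num
    unfold kap at *
    linear_combination this + hvec B n γ / 2 * hq
  · have := dv_down_up (B := B) hi (e0.trans h) (e1.trans h')
    change _ = q * hvec B n γ + _ at this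
    rw [h, h']
    norm_num
    unfold kap at *
    linear_combination this + hvec B n γ / 2 * hq
  · have := dv_aligned (B := B) hi (e0.trans (h.trans (e1.trans h').symm))
    change _ = -hvec B n γ at this
    rw [h, h']
    norm_num
    linear_combination this

/-- The homogeneous vector is an eigenvector of the Hamiltonian. -/
lemma hvec_eigen {n : ℕ} (hn : 0 < 2 * n) {x : ℝ} (hx : 0 < x) (hB1 : B ≠ 1)
    (hxB : (x : ℂ) * (B - 1) = q - q ^ 2 * B) :
    (XXZ (2 * n) hn x).mulVec (hvec B n) = ((E0 (2 * n) x : ℝ) : ℂ) • hvec B n := by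
  funext γ
  have hB' : B - 1 ≠ 0 := sub_ne_zero.2 hB1
  have hx0 : (x : ℂ) ≠ 0 := by exact_mod_cast hx.ne'
  have hB2 : q - q ^ 2 * B ≠ 0 := hxB ▸ mul_ne_zero hx0 hB'
  rw [XXZ, Matrix.add_mulVec, Matrix.add_mulVec, Matrix.smul_mulVec, Matrix.smul_mulVec, Matrix.smul_mulVec,
    Matrix.sum_mulVec]
  simp only [Pi.add_apply, Pi.smul_apply, smul_eq_mul, Finset.sum_apply, pauliZ_mulVec]
  rw [mul_sum, sum_congr rfl fun i _ => by
    rw [bond_mulVec (by simp [Fin.ext_iff]), bond_hvec (by have := i.2; omega) γ]]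
  rw [Fin.sum_univ_eq_sum_range (fun i => -(3 / 4) * hvec B n γ + (dens B n γ i - dens B n γ (i + 1))) (2 * n - 1),
    sum_add_distrib, sum_range_sub', sum_const, card_range]
  have d0 := dv_left (by omega : 1 ≤ n) hB1 (ext (2 * n) γ)
  have d1 := dv_right (by omega : 1 ≤ n) hB2 (ext (2 * n) γ)
  unfold dens
  rw [d0, d1, ext_apply γ hn, ext_apply γ (show 2 * n - 1 < 2 * n by omega)]
  change _ = _ * hvec B n γ
  change _ + _ * (_ * hvec B n γ) = _
  have hv : val B n (ext (2 * n) γ) = hvec B n γ := rfl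
  rw [hv, pL, pR, E0, nsmul_eq_mul, Nat.cast_sub (by omega)]
  push_cast
  have hb1 : B / (B - 1) = 1 / 2 + (x - 1 / 2) / kap := by
    have hk := kap_ne_zero
    field_simp
    unfold kap
    have := q_sq
    grind
  have hb2 : q ^ 2 * B / (q - q ^ 2 * B) = -(1 / 2) + (1 / x - 1 / 2) / kap := by
    have hk := kap_ne_zero
    rw [← hxB]
    field_simp
    unfold kap
    have := q_sq
    grind
  rw [hb1, hb2]
  have hk := kap_ne_zero
  have hsq := kap_sq
  split_ifs
  all_goals
    field_simp
    ring

end OpenXXZ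

namespace OpenXXZ
open Finset Filter Topology

variable {B : ℂ}

/-- The boundary parameter. -/
def bB (r : ℝ) : ℂ := Complex.exp ((2 * Real.pi * r / 3 : ℝ) * Complex.I)

lemma norm_bB (r : ℝ) : ‖bB r‖ = 1 := Complex.norm_exp_ofReal_mul_I _

lemma exp_sub_exp_neg (a : ℂ) :
    Complex.exp (a * Complex.I) - Complex.exp (-(a * Complex.I)) = 2 * Complex.I * Complex.sin a := by
  rw [Complex.sin, neg_mul]
  linear_combination (Complex.exp (a * Complex.I) - Complex.exp (-(a * Complex.I))) * Complex.I_sq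

lemma q_sq_eq : q ^ 2 = Complex.exp (4 * Real.pi / 3 * Complex.I) := by
  rw [q, ← Complex.exp_nat_mul]; congr 1; push_cast; ring

lemma bB_sub_one (r : ℝ) : bB r - 1 =
    Complex.exp (Real.pi * r / 3 * Complex.I) * (2 * Complex.I * Real.sin (Real.pi * r / 3)) := by
  have := exp_sub_exp_neg (Real.pi * r / 3)
  push_cast
  rw [← this, mul_sub, ← Complex.exp_add, ← Complex.exp_add, add_neg_cancel, Complex.exp_zero, bB]
  congr 2; push_cast; ring

lemma q_sub_bB (r : ℝ) : q - q ^ 2 * bB r =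
    Complex.exp (Real.pi * r / 3 * Complex.I) * (2 * Complex.I * Real.sin (Real.pi * (r + 1) / 3)) := by
  have := exp_sub_exp_neg (Real.pi * (r + 1) / 3)
  push_cast
  rw [← this, mul_sub, ← Complex.exp_add, ← Complex.exp_add, q_sq_eq, q, bB, ← Complex.exp_add]
  have e1 : Complex.exp (2 * Real.pi / 3 * Complex.I) =
      -Complex.exp (Real.pi * r / 3 * Complex.I + -(Real.pi * (r + 1) / 3 * Complex.I)) := by
    rw [← neg_one_mul, ← Complex.exp_pi_mul_I, ← Complex.exp_add]; congr 1; ring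
  have e2 : Complex.exp (4 * Real.pi / 3 * Complex.I + (2 * Real.pi * r / 3 : ℝ) * Complex.I) =
      -Complex.exp (Real.pi * r / 3 * Complex.I + Real.pi * (r + 1) / 3 * Complex.I) := by
    rw [← neg_one_mul, ← Complex.exp_pi_mul_I, ← Complex.exp_add]; congr 1; push_cast; ring
  rw [e1, e2]
  ring

lemma sin_pos_of_mem {r : ℝ} (hr : r ∈ Set.Ioo (0 : ℝ) 2) : 0 < Real.sin (Real.pi * r / 3) := by
  have := Real.pi_pos
  exact Real.sin_pos_of_pos_of_lt_pi (by have := hr.1; positivity) (by nlinarith [hr.2])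

lemma bB_ne_one {r : ℝ} (hr : r ∈ Set.Ioo (0 : ℝ) 2) : bB r ≠ 1 := by
  rw [← sub_ne_zero, bB_sub_one]
  refine mul_ne_zero (Complex.exp_ne_zero _) (mul_ne_zero (by simp) ?_)
  exact_mod_cast (sin_pos_of_mem hr).ne'

lemma mul_bB {r x : ℝ} (hr : r ∈ Set.Ioo (0 : ℝ) 2)
    (hx : x = Real.sin (Real.pi * (r + 1) / 3) / Real.sin (Real.pi * r / 3)) :
    (x : ℂ) * (bB r - 1) = q - q ^ 2 * bB r := by
  have h : x * Real.sin (Real.pi * r / 3) = Real.sin (Real.pi * (r + 1) / 3) := by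
    rw [hx, div_mul_cancel₀ _ (sin_pos_of_mem hr).ne']
  rw [bB_sub_one, q_sub_bB, ← h]
  push_cast
  ring

lemma cf_bB (r : ℝ) : cf (bB r * q ^ 2) = ((2 * Real.cos (2 * Real.pi * (r - 1) / 3) : ℝ) : ℂ) := by
  have e : bB r * q ^ 2 = Complex.exp ((2 * Real.pi * (r - 1) / 3 : ℝ) * Complex.I) := by
    rw [q_sq_eq, bB, ← Complex.exp_add, ← mul_one (Complex.exp (((2 * Real.pi * (r - 1) / 3 : ℝ) : ℂ) * Complex.I)),
      ← Complex.exp_two_pi_mul_I, ← Complex.exp_add]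
    congr 1; push_cast; ring
  rw [cf, e, ← Complex.exp_neg]
  push_cast
  rw [Complex.cos]
  ring_nf

lemma val_congr {n : ℕ} {α β : Cfg} (h : ∀ j < 2 * n, α j = β j) : val B n α = val B n β := by
  refine tendsto_nhds_unique_of_eventuallyEq (tendsto_phi (B := B) tendsto_zbd n α)
    (tendsto_phi (B := B) tendsto_zbd n β) ?_
  have h1 : ∀ᶠ t : ℝ in 𝓝[>] 0, 0 < t := eventually_mem_nhdsWithin
  filter_upwards [h1] with t ht
  have hg : Gen (zbd t) := by
    refine gen_of_pos (s := fun j : ℕ => 1 + t / ((j : ℝ) + 1)) (fun j => by positivity) fun i j hij => ?_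
    have h1 : ((i : ℝ) + 1)⁻¹ = ((j : ℝ) + 1)⁻¹ := mul_left_cancel₀ ht.ne' (by simpa [div_eq_mul_inv] using hij)
    exact_mod_cast add_right_cancel (inv_injective h1)
  exact sol_congr (sol_phi B) α β h _ _ hg hg fun _ _ => rfl

lemma csum_append (N1 N2 : ℕ) (F : Cfg → ℂ) :
    csum (N1 + N2) F = ∑ α : Conf N1, ∑ β : Conf N2, F (ext (N1 + N2) (Fin.append α β)) := by
  unfold csum
  rw [← Fintype.sum_prod_type' fun (α : Conf N1) (β : Conf N2) => F (ext (N1 + N2) (Fin.append α β))]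
  exact (Fintype.sum_equiv (Fin.appendEquiv N1 N2) _ _ fun _ => rfl).symm

lemma ext_append_left {N1 N2 j : ℕ} (α : Conf N1) (β : Conf N2) (hj : j < N1) :
    ext (N1 + N2) (Fin.append α β) j = ext N1 α j := by
  rw [ext_apply _ (by omega), ext_apply _ hj]
  exact Fin.append_left α β ⟨j, hj⟩

lemma sh_ext_append {N1 N2 : ℕ} (α : Conf N1) (β : Conf N2) :
    sh N1 (ext (N1 + N2) (Fin.append α β)) = ext N2 β := by
  funext j
  unfold sh
  by_cases hj : j < N2
  · rw [ext_apply _ (by omega), ext_apply _ hj]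
    have := Fin.append_right α β ⟨j, hj⟩
    rw [← this]
    congr 1
    ext
    simp [add_comm]
  · rw [ext, ext, dif_neg (by omega), dif_neg hj]

lemma SS_ones (n1 n2 : ℕ) : SS n1 n2 (phi B) ones = ∑ α : Conf (2 * n1), ∑ β : Conf (2 * n2),
    val B (n1 + n2) (ext _ (Fin.append α β)) * val B n1 (ext _ α) * val B n2 (ext _ β) := by
  have e : iv ones = ones := by funext j; simp [iv, ones]
  have e2 : sh (2 * n1) ones = ones := rfl
  rw [SS, e, e2, show 2 * (n1 + n2) = 2 * n1 + 2 * n2 by ring, csum_append]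
  refine sum_congr rfl fun α _ => sum_congr rfl fun β _ => ?_
  rw [sh_ext_append]
  change val B _ _ * val B _ _ * val B _ _ = _
  rw [val_congr (n := n1) fun j hj => ext_append_left α β hj]

lemma val_zero (α : Cfg) : val B 0 α = 1 := by
  have := (sol_phi B).base 0 α ones (fun _ => one_ne_zero) (fun ⟨i, hi, _⟩ => by omega)
  rw [if_pos ⟨fun i hi => by omega, fun i _ hi => by omega⟩] at this
  change phi B 0 α ones = 1
  simpa [Wts.f, blk] using this

lemma SS_self (n : ℕ) : SS n 0 (phi B) ones = ∑ α : Conf (2 * n), val B n (ext _ α) * val B n (ext _ α) := by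
  rw [SS_ones]
  refine sum_congr rfl fun α _ => ?_
  rw [Fintype.sum_eq_single (fun _ => 0) fun β hβ =>
    absurd (funext fun i => absurd i.isLt (by simp)) hβ]
  rw [val_zero, mul_one]
  congr 1
  exact val_congr fun j hj => ext_append_left α _ hj

lemma val_base_ne_zero (hB : B ≠ 1) {n : ℕ} {α : Cfg} (hα : Base n α) : val B n α ≠ 0 := by
  have h := (sol_phi B).base n α ones (fun _ => one_ne_zero) (by
    rintro ⟨i, hi, h0, h1⟩
    rcases Nat.lt_or_ge i n with h | h
    · rw [hα.1 i h] at h0; exact absurd h0 (by decide)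
    · rw [hα.2 (i + 1) (by omega) hi] at h1; exact absurd h1 (by decide))
  rw [if_pos hα] at h
  change val B n α = _ at h
  rw [h]
  have hpf : ∀ (s : Finset ℕ) (f : ℂ → ℂ → ℂ), f 1 1 ≠ 0 → ∏ i ∈ s, ∏ l ∈ s, pf f ones i l ≠ 0 := by
    intro s f hf
    refine prod_ne_zero_iff.2 fun i _ => prod_ne_zero_iff.2 fun l _ => ?_
    unfold pf
    split_ifs
    · exact mul_ne_zero (by simpa [ones, wa_one] using kap_ne_zero) hf
    · exact one_ne_zero
  have h1 : wb 1 1 ≠ 0 := by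
    have := kap_ne_zero
    unfold wb; unfold kap at this; simpa using this
  have h2 : wc 1 1 ≠ 0 := by
    have := kap_ne_zero
    unfold wc; unfold kap at this
    intro h; apply this; linear_combination h
  unfold Wts.f blk
  refine mul_ne_zero (mul_ne_zero ?_ (hpf _ _ h1)) (mul_ne_zero ?_ (hpf _ _ h2))
  · refine prod_ne_zero_iff.2 fun i _ => ?_
    simpa [W1, ones] using sub_ne_zero.2 hB
  · simp [W1]

end OpenXXZ

namespace OpenXXZ
open Finset Filter Topology

variable {B : ℂ}

lemma XXZ_mulVec {N : ℕ} (hN : 0 < N) (x : ℝ) (v : Conf N → ℂ) (γ : Conf N) :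
    (XXZ N hN x).mulVec v γ =
      ∑ i : Fin (N - 1), -(1 / 2) * (if γ ⟨i.1, by omega⟩ = γ ⟨i.1 + 1, by omega⟩ then -(1 / 2) * v γ
        else 2 * v (γ ∘ Equiv.swap ⟨i.1, by omega⟩ ⟨i.1 + 1, by omega⟩) + 1 / 2 * v γ) +
      ((pL x : ℝ) : ℂ) * ((1 - 2 * if γ ⟨0, hN⟩ = 1 then 1 else 0) * v γ) +
      ((pR x : ℝ) : ℂ) * ((1 - 2 * if γ ⟨N - 1, by omega⟩ = 1 then 1 else 0) * v γ) := by
  rw [XXZ, Matrix.add_mulVec, Matrix.add_mulVec, Matrix.smul_mulVec, Matrix.smul_mulVec, Matrix.smul_mulVec,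
    Matrix.sum_mulVec]
  simp only [Pi.add_apply, Pi.smul_apply, smul_eq_mul, Finset.sum_apply, pauliZ_mulVec]
  rw [mul_sum, sum_congr rfl fun i _ => by rw [bond_mulVec (by simp [Fin.ext_iff])]]

lemma XXZ_mulVec_conj {N : ℕ} (hN : 0 < N) (x : ℝ) (v : Conf N → ℂ) (γ : Conf N) :
    (XXZ N hN x).mulVec (fun α => (starRingEnd ℂ) (v α)) γ = (starRingEnd ℂ) ((XXZ N hN x).mulVec v γ) := by
  rw [XXZ_mulVec, XXZ_mulVec]
  simp only [map_add, map_sum, map_mul, map_neg, map_sub, map_one, Complex.conj_ofReal, apply_ite (starRingEnd ℂ),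
    map_zero, map_div₀, map_ofNat]

/-- A normalized ground state has real components. -/
lemma groundState_conj_eq {N : ℕ} (hN : 0 < N) {x : ℝ} {ψ : Conf N → ℂ} (h : IsGroundState N x ψ)
    (γ : Conf N) : (starRingEnd ℂ) (ψ γ) = ψ γ := by
  rw [IsGroundState, dif_pos hN] at h
  obtain ⟨he, hu, hb⟩ := h
  obtain ⟨c, hc⟩ := hu (fun α => (starRingEnd ℂ) (ψ α)) (by
    funext α
    rw [XXZ_mulVec_conj, he]
    simp)
  have h1 := congrFun hc (baseState N)
  simp only [hb, map_one, Pi.smul_apply, smul_eq_mul, mul_one] at h1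
  have := congrFun hc γ
  simpa [← h1] using this

lemma groundState_selfOverlap_ne_zero {N : ℕ} (hN : 0 < N) {x : ℝ} {ψ : Conf N → ℂ}
    (h : IsGroundState N x ψ) : selfOverlap N ψ ≠ 0 := by
  have hb : ψ (baseState N) = 1 := by
    rw [IsGroundState, dif_pos hN] at h
    exact h.2.2
  have e : selfOverlap N ψ = ((∑ α : Conf N, Complex.normSq (ψ α) : ℝ) : ℂ) := by
    rw [selfOverlap]
    push_cast
    exact sum_congr rfl fun α _ => by rw [Complex.normSq_eq_conj_mul_self, groundState_conj_eq hN h]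
  rw [e]
  have : 0 < ∑ α : Conf N, Complex.normSq (ψ α) :=
    sum_pos' (fun α _ => Complex.normSq_nonneg _) ⟨baseState N, mem_univ _, by simp [hb]⟩
  exact_mod_cast this.ne'

lemma groundState_val_eq {N n : ℕ} (hNn : N = 2 * n) (hn : 1 ≤ n) {x : ℝ} (hx : 0 < x) (hB1 : B ≠ 1)
    (hxB : (x : ℂ) * (B - 1) = q - q ^ 2 * B) {ψ : Conf N → ℂ} (h : IsGroundState N x ψ) :
    ∃ c ≠ 0, ∀ γ : Conf N, val B n (ext N γ) = c * ψ γ := by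
  subst hNn
  rw [IsGroundState, dif_pos (by omega)] at h
  obtain ⟨he, hu, hb⟩ := h
  obtain ⟨c, hc⟩ := hu (hvec B n) (hvec_eigen (by omega) hx hB1 hxB)
  refine ⟨c, ?_, fun γ => congrFun hc γ⟩
  rintro rfl
  refine val_base_ne_zero hB1 (n := n) (α := ext (2 * n) (baseState (2 * n)))
    ⟨fun i hi => ?_, fun i hi hi' => ?_⟩ ?_
  · rw [ext_apply _ (by omega)]
    exact if_pos (by simpa using hi)
  · rw [ext_apply _ hi']
    exact if_neg (by simpa using hi)
  · have := congrFun hc (baseState (2 * n))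
    simpa [hvec] using this

lemma SS_self' {N n : ℕ} (hN : N = 2 * n) :
    SS n 0 (phi B) ones = ∑ α : Conf N, val B n (ext N α) * val B n (ext N α) := by
  subst hN
  exact SS_self n

lemma sum_sq_eq {N n : ℕ} {ψ : Conf N → ℂ} {c : ℂ} (h : ∀ γ : Conf N, val B n (ext N γ) = c * ψ γ) :
    ∑ α : Conf N, val B n (ext N α) * val B n (ext N α) = c ^ 2 * selfOverlap N ψ := by
  rw [selfOverlap, mul_sum]
  exact sum_congr rfl fun α _ => by rw [h]; ring

/-- The fidelity in terms of the polynomials `pin`. -/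
lemma LBF_eq {x : ℝ} (hx : 0 < x) (hBn : ‖B‖ = 1) (hB1 : B ≠ 1) (hxB : (x : ℂ) * (B - 1) = q - q ^ 2 * B)
    {n1 n2 : ℕ} (h1 : 1 ≤ n1) (h2 : 1 ≤ n2) {ψ1 : Conf (2 * n1) → ℂ} {ψ2 : Conf (2 * n2) → ℂ}
    {ψ : Conf (2 * n1 + 2 * n2) → ℂ} (g1 : IsGroundState (2 * n1) x ψ1) (g2 : IsGroundState (2 * n2) x ψ2)
    (g : IsGroundState (2 * n1 + 2 * n2) x ψ) {P : ℕ → ℝ} (hP : ∀ n, (pin n).eval (cf (B * q ^ 2)) = P n)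
    (p1 : 0 < P n1) (p2 : 0 < P n2) (p : 0 < P (n1 + n2)) :
    LBF (2 * n1) (2 * n2) ψ ψ1 ψ2 =
      ((Real.log (P n1) + Real.log (P n2) - Real.log (P (n1 + n2)) : ℝ) : ℂ) := by
  obtain ⟨c1, hc1, e1⟩ := groundState_val_eq rfl h1 hx hB1 hxB g1
  obtain ⟨c2, hc2, e2⟩ := groundState_val_eq rfl h2 hx hB1 hxB g2
  obtain ⟨c, hc, e⟩ := groundState_val_eq (n := n1 + n2) (by ring) (by omega) hx hB1 hxB g
  have o1 := groundState_selfOverlap_ne_zero (by omega) g1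
  have o2 := groundState_selfOverlap_ne_zero (by omega) g2
  have o := groundState_selfOverlap_ne_zero (by omega) g
  have hov : SS n1 n2 (phi B) ones = c * c1 * c2 * overlap (2 * n1) (2 * n2) ψ ψ1 ψ2 := by
    rw [SS_ones, overlap, mul_sum]
    refine sum_congr rfl fun α _ => ?_
    rw [mul_sum]
    refine sum_congr rfl fun β _ => ?_
    rw [e, e1, e2]
    ring
  have key := SS_ones_relation hBn n1 n2
  rw [hov, SS_self' rfl, SS_self' rfl, SS_self' (show 2 * n1 + 2 * n2 = 2 * (n1 + n2) by ring), sum_sq_eq e1,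
    sum_sq_eq e2, sum_sq_eq e, hP, hP, hP] at key
  have p1' : (P n1 : ℂ) ≠ 0 := by exact_mod_cast p1.ne'
  have p2' : (P n2 : ℂ) ≠ 0 := by exact_mod_cast p2.ne'
  have hr : overlap (2 * n1) (2 * n2) ψ ψ1 ψ2 ^ 2 /
      (selfOverlap (2 * n1) ψ1 * selfOverlap (2 * n2) ψ2 * selfOverlap (2 * n1 + 2 * n2) ψ) =
      ((P (n1 + n2) / (P n1 * P n2) : ℝ) : ℂ) := by
    push_cast
    rw [div_eq_div_iff (by positivity) (by positivity)]
    have hcc : c ^ 2 * c1 ^ 2 * c2 ^ 2 ≠ 0 := by positivity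
    refine mul_left_cancel₀ hcc ?_
    linear_combination key
  rw [LBF, hr, ← Complex.ofReal_log (by positivity), Real.log_div p.ne' (by positivity),
    Real.log_mul p1.ne' p2.ne']
  push_cast
  ring

end OpenXXZ

namespace OpenXXZ
open Finset Filter Topology

/-- Fourier coefficients of the functions `FF N`. -/
def bco : ℕ → ℕ → ℝ
  | 0, 0 => 3 / 2
  | 0, _ + 1 => 0
  | N + 1, 0 => -((N + 1) / 2 * bco N 0) / ((N + 1 : ℝ) + 2 / 3)
  | N + 1, l + 1 => (N + 1) / 2 * (bco N l - bco N (l + 1)) / ((N + 1 : ℝ) - 2 * (l + 1) + 2 / 3)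

lemma bco_eq_zero : ∀ N l : ℕ, N < l → bco N l = 0
  | 0, 0, h => absurd h (lt_irrefl _)
  | 0, _ + 1, _ => rfl
  | N + 1, 0, h => absurd h (by omega)
  | N + 1, l + 1, h => by
    rw [bco, bco_eq_zero N l (by omega), bco_eq_zero N (l + 1) (by omega)]
    simp

/-- The functions with `FF' (N + 1) = (N + 1) sin · FF N`, `FF' 0 = cos (2 * a / 3)`. -/
def FF (N : ℕ) (a : ℝ) : ℝ := ∑ l ∈ range (N + 1), bco N l * Real.sin (((N : ℝ) - 2 * l + 2 / 3) * a)

lemma freq_ne_zero (N l : ℕ) : (N : ℝ) - 2 * l + 2 / 3 ≠ 0 := by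
  intro h
  have : 3 * (N : ℝ) + 2 = 6 * l := by linarith
  have : 3 * N + 2 = 6 * l := by exact_mod_cast this
  omega

lemma FF_zero (N : ℕ) : FF N 0 = 0 := by simp [FF]

lemma hasDerivAt_FF_aux (N : ℕ) (a : ℝ) : HasDerivAt (FF N) (∑ l ∈ range (N + 1),
    bco N l * (((N : ℝ) - 2 * l + 2 / 3) * Real.cos (((N : ℝ) - 2 * l + 2 / 3) * a))) a := by
  unfold FF
  refine HasDerivAt.fun_sum fun l _ => HasDerivAt.const_mul _ ?_
  have := (Real.hasDerivAt_sin (((N : ℝ) - 2 * l + 2 / 3) * a)).comp a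
    ((hasDerivAt_id a).const_mul ((N : ℝ) - 2 * l + 2 / 3))
  simpa [Function.comp_def, mul_comm] using this

lemma hasDerivAt_FF_zero (a : ℝ) : HasDerivAt (FF 0) (Real.cos (2 / 3 * a)) a := by
  have := hasDerivAt_FF_aux 0 a
  simpa [bco, ← mul_assoc] using this

lemma hasDerivAt_FF_succ (N : ℕ) (a : ℝ) :
    HasDerivAt (FF (N + 1)) ((N + 1) * Real.sin a * FF N a) a := by
  convert hasDerivAt_FF_aux (N + 1) a using 1
  have h1 : ∀ l ∈ range (N + 1), bco (N + 1) (l + 1) * ((((N + 1 : ℕ) : ℝ) - 2 * ((l + 1 : ℕ) : ℝ) + 2 / 3) *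
      Real.cos ((((N + 1 : ℕ) : ℝ) - 2 * ((l + 1 : ℕ) : ℝ) + 2 / 3) * a)) =
      (N + 1) / 2 * (bco N l * Real.cos ((N - 2 * l - 1 + 2 / 3) * a)) -
      (N + 1) / 2 * (bco N (l + 1) * Real.cos ((N - 2 * ((l + 1 : ℕ) : ℝ) + 1 + 2 / 3) * a)) := by
    intro l _
    have := freq_ne_zero (N + 1) (l + 1)
    rw [bco]
    push_cast at *
    rw [show (N : ℝ) + 1 - 2 * (l + 1) + 2 / 3 = N - 2 * l - 1 + 2 / 3 by ring] at *
    rw [show (N : ℝ) - 2 * (l + 1) + 1 + 2 / 3 = N - 2 * l - 1 + 2 / 3 by ring]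
    generalize (N : ℝ) - 2 * l - 1 + 2 / 3 = w at *
    field_simp
  rw [sum_range_succ', sum_congr rfl h1, sum_sub_distrib]
  have h2 := sum_range_succ' (fun l : ℕ => (N + 1) / 2 * (bco N l * Real.cos (((N : ℝ) - 2 * (l : ℝ) + 1 + 2 / 3) * a))) (N + 1)
  rw [sum_range_succ, bco_eq_zero N (N + 1) (by omega)] at h2
  have h3 : bco (N + 1) 0 * ((((N + 1 : ℕ) : ℝ) - 2 * ((0 : ℕ) : ℝ) + 2 / 3) *
      Real.cos ((((N + 1 : ℕ) : ℝ) - 2 * ((0 : ℕ) : ℝ) + 2 / 3) * a)) =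
      - ((N + 1) / 2 * (bco N 0 * Real.cos ((N - 2 * ((0 : ℕ) : ℝ) + 1 + 2 / 3) * a))) := by
    have := freq_ne_zero (N + 1) 0
    rw [bco]
    push_cast at *
    rw [show (N : ℝ) - 2 * 0 + 1 + 2 / 3 = N + 1 - 2 * 0 + 2 / 3 by ring]
    have h : (N : ℝ) + 1 + 2 / 3 ≠ 0 := by positivity
    simp only [mul_zero, sub_zero] at *
    field_simp
  rw [h3]
  have h4 : (N + 1) * Real.sin a * FF N a =
      ∑ l ∈ range (N + 1), (N + 1) / 2 * (bco N l * Real.cos ((N - 2 * l - 1 + 2 / 3) * a)) -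
      ∑ l ∈ range (N + 1), (N + 1) / 2 * (bco N l * Real.cos ((N - 2 * l + 1 + 2 / 3) * a)) := by
    rw [FF, mul_sum, ← sum_sub_distrib]
    refine sum_congr rfl fun l _ => ?_
    rw [show ((N : ℝ) - 2 * l - 1 + 2 / 3) * a = (N - 2 * l + 2 / 3) * a - a by ring,
      show ((N : ℝ) - 2 * l + 1 + 2 / 3) * a = (N - 2 * l + 2 / 3) * a + a by ring, Real.cos_sub, Real.cos_add]
    ring
  rw [h4]
  simp only [zero_mul, mul_zero, add_zero] at h2
  linear_combination -h2

lemma bco_top_succ (N : ℕ) : bco (N + 1) 0 = -((N + 1) / 2 * bco N 0) / ((N + 1 : ℝ) + 2 / 3) := rfl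

lemma bco_top (N : ℕ) : bco N 0 * ∏ j ∈ range (N + 1), ((j : ℝ) + 2 / 3) = (-1) ^ N * (N.factorial : ℝ) / 2 ^ N := by
  induction N with
  | zero => norm_num [bco]
  | succ N ih =>
    have h : (N : ℝ) + 1 + 2 / 3 ≠ 0 := by positivity
    rw [prod_range_succ, bco_top_succ, Nat.factorial_succ]
    push_cast
    rw [div_mul_eq_mul_div, show -((N + 1) / 2 * bco N 0) * ((∏ j ∈ range (N + 1), ((j : ℝ) + 2 / 3)) * ((N : ℝ) + 1 + 2 / 3)) =
      -((N + 1) / 2 * (bco N 0 * ∏ j ∈ range (N + 1), ((j : ℝ) + 2 / 3)) * ((N : ℝ) + 1 + 2 / 3)) by ring, ih]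
    field_simp
    ring

/-- The comparison functions. -/
def XX (k N : ℕ) (a : ℝ) : ℝ :=
  2 ^ (N + 1) * (∏ j ∈ range N, ((j : ℝ) + 1) / (j + k + 3 / 2)) / (2 * k + 1) * Real.sin (a / 2) ^ (2 * N + 2 * k + 1)

lemma XX_zero (k N : ℕ) : XX k N 0 = 0 := by simp [XX]

lemma hasDerivAt_sin_half_pow (m : ℕ) (a : ℝ) : HasDerivAt (fun a => Real.sin (a / 2) ^ (m + 1))
    ((m + 1) / 2 * Real.sin (a / 2) ^ m * Real.cos (a / 2)) a := by
  have := ((Real.hasDerivAt_sin (a / 2)).comp a ((hasDerivAt_id a).div_const 2)).pow (m + 1)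
  refine this.congr_deriv ?_
  simp
  ring

lemma hasDerivAt_XX_zero (k : ℕ) (a : ℝ) :
    HasDerivAt (XX k 0) (Real.sin (a / 2) ^ (2 * k) * Real.cos (a / 2)) a := by
  have := (hasDerivAt_sin_half_pow (2 * k) a).const_mul (2 / (2 * (k : ℝ) + 1))
  have hk : 2 * (k : ℝ) + 1 ≠ 0 := by positivity
  have e : XX k 0 = fun y => 2 / (2 * (k : ℝ) + 1) * Real.sin (y / 2) ^ (2 * k + 1) := by
    funext b
    simp [XX]
  rw [e]
  refine this.congr_deriv ?_
  push_cast
  field_simp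

lemma hasDerivAt_XX_succ (k N : ℕ) (a : ℝ) :
    HasDerivAt (XX k (N + 1)) ((N + 1) * Real.sin a * XX k N a) a := by
  have := (hasDerivAt_sin_half_pow (2 * (N + 1) + 2 * k) a).const_mul
    (2 ^ (N + 1 + 1) * (∏ j ∈ range (N + 1), ((j : ℝ) + 1) / (j + k + 3 / 2)) / (2 * k + 1))
  have hk : 2 * (k : ℝ) + 1 ≠ 0 := by positivity
  have hk' : (N : ℝ) + k + 3 / 2 ≠ 0 := by positivity
  refine HasDerivAt.congr_deriv (f := XX k (N + 1)) this ?_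
  rw [XX, prod_range_succ, show Real.sin a = 2 * Real.sin (a / 2) * Real.cos (a / 2) by
    rw [← Real.sin_two_mul]; ring_nf]
  push_cast
  rw [show 2 * (N + 1) + 2 * k = 2 * N + 2 * k + 1 + 1 by ring, pow_succ (Real.sin (a / 2)) (2 * N + 2 * k + 1)]
  generalize Real.sin (a / 2) ^ (2 * N + 2 * k + 1) = S
  generalize ∏ j ∈ range N, ((j : ℝ) + 1) / (j + k + 3 / 2) = p
  field_simp
  ring

lemma XX_one (N : ℕ) (a : ℝ) : XX 1 N a = XX 0 N a * (Real.sin (a / 2) ^ 2 / (2 * N + 3)) := by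
  have h : ∀ N : ℕ, (∏ j ∈ range N, ((j : ℝ) + 1) / (j + (1 : ℕ) + 3 / 2)) =
      3 / (2 * N + 3) * ∏ j ∈ range N, ((j : ℝ) + 1) / (j + (0 : ℕ) + 3 / 2) := by
    intro N
    induction N with
    | zero => simp
    | succ N ih =>
      rw [prod_range_succ, prod_range_succ, ih]
      push_cast
      have h1 : (N : ℝ) + 1 + 3 / 2 ≠ 0 := by positivity
      have h2 : 2 * ((N : ℝ) + 1) + 3 ≠ 0 := by positivity
      have h3 : 2 * (N : ℝ) + 3 ≠ 0 := by positivity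
      have h4 : (N : ℝ) + 0 + 3 / 2 ≠ 0 := by positivity
      field_simp
      ring
  rw [XX, XX, h]
  push_cast
  field_simp
  ring

lemma XX_two (N : ℕ) (a : ℝ) :
    XX 2 N a = XX 0 N a * (3 * Real.sin (a / 2) ^ 4 / ((2 * N + 3) * (2 * N + 5))) := by
  have h : ∀ N : ℕ, (∏ j ∈ range N, ((j : ℝ) + 1) / (j + (2 : ℕ) + 3 / 2)) =
      15 / ((2 * N + 3) * (2 * N + 5)) * ∏ j ∈ range N, ((j : ℝ) + 1) / (j + (0 : ℕ) + 3 / 2) := by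
    intro N
    induction N with
    | zero => norm_num
    | succ N ih =>
      rw [prod_range_succ, prod_range_succ, ih]
      push_cast
      have h1 : (N : ℝ) + 2 + 3 / 2 ≠ 0 := by positivity
      have h2 : 2 * ((N : ℝ) + 1) + 3 ≠ 0 := by positivity
      have h2' : 2 * ((N : ℝ) + 1) + 5 ≠ 0 := by positivity
      have h3 : 2 * (N : ℝ) + 3 ≠ 0 := by positivity
      have h3' : 2 * (N : ℝ) + 5 ≠ 0 := by positivity
      have h4 : (N : ℝ) + 0 + 3 / 2 ≠ 0 := by positivity
      field_simp
      ring
  rw [XX, XX, h]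
  push_cast
  field_simp
  ring

lemma abs_cos_sub_le (y : ℝ) : |Real.cos y - (1 - y ^ 2 / 2)| ≤ y ^ 4 := by
  rcases le_or_gt |y| 1 with h | h
  · refine (Real.cos_bound h).trans ?_
    rw [show |y| ^ 4 = y ^ 4 by rw [← abs_pow, abs_of_nonneg (by positivity)]]
    have : 0 ≤ y ^ 4 := by positivity
    linarith
  · have h1 := Real.one_sub_sq_div_two_le_cos (x := y)
    have h2 := Real.cos_le_one y
    have h3 : 1 < y ^ 2 := by rw [← sq_abs]; nlinarith
    rw [abs_of_nonneg (by linarith)]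
    nlinarith

lemma abs_cos_expansion_le (t : ℝ) :
    |Real.cos (2 / 3 * t) - (Real.cos (t / 2) - 7 / 18 * (Real.sin (t / 2) ^ 2 * Real.cos (t / 2)))| ≤ t ^ 4 := by
  have h1 := abs_cos_sub_le (2 / 3 * t)
  have h2 := abs_cos_sub_le (t / 2)
  have h3 := abs_cos_sub_le (3 * (t / 2))
  have h4 := Real.cos_three_mul (t / 2)
  have h5 := Real.sin_sq (t / 2)
  have e : Real.sin (t / 2) ^ 2 * Real.cos (t / 2) = (Real.cos (t / 2) - Real.cos (3 * (t / 2))) / 4 := by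
    rw [h4, h5]; ring
  rw [e, abs_le]
  rw [abs_le] at h1 h2 h3
  have : 0 ≤ t ^ 4 := by positivity
  constructor <;> nlinarith

lemma abs_cos_expansion_le' {a₁ t : ℝ} (ha₁ : a₁ < Real.pi) (h0 : 0 ≤ t) (ht : t ≤ a₁) :
    |Real.cos (2 / 3 * t) - (Real.cos (t / 2) - 7 / 18 * (Real.sin (t / 2) ^ 2 * Real.cos (t / 2)))| ≤
      Real.pi ^ 4 / Real.cos (a₁ / 2) * (Real.sin (t / 2) ^ 4 * Real.cos (t / 2)) := by
  have hpi := Real.pi_pos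
  have hc : 0 < Real.cos (a₁ / 2) := Real.cos_pos_of_mem_Ioo ⟨by linarith, by linarith⟩
  have hct : Real.cos (a₁ / 2) ≤ Real.cos (t / 2) :=
    Real.cos_le_cos_of_nonneg_of_le_pi (by linarith) (by linarith) (by linarith)
  have hs : t ≤ Real.pi * Real.sin (t / 2) := by
    have := Real.mul_le_sin (x := t / 2) (by linarith) (by linarith)
    have h2 : 2 / Real.pi * (t / 2) = t / Real.pi := by field_simp
    rw [h2, div_le_iff₀ hpi] at this
    linarith
  refine (abs_cos_expansion_le t).trans ?_
  have h4 : t ^ 4 ≤ Real.pi ^ 4 * Real.sin (t / 2) ^ 4 := by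
    rw [← mul_pow]; exact pow_le_pow_left₀ h0 hs 4
  refine h4.trans ?_
  rw [div_mul_eq_mul_div, le_div_iff₀ hc, ← mul_assoc]
  exact mul_le_mul_of_nonneg_left hct (by positivity)

lemma nonneg_of_deriv {f f' : ℝ → ℝ} {a₁ : ℝ} (hf : ∀ t, HasDerivAt f (f' t) t) (h0 : f 0 = 0)
    (h : ∀ t, 0 ≤ t → t ≤ a₁ → 0 ≤ f' t) : ∀ t, 0 ≤ t → t ≤ a₁ → 0 ≤ f t := by
  intro t ht hta
  have hm : MonotoneOn f (Set.Icc 0 a₁) := by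
    refine monotoneOn_of_deriv_nonneg (convex_Icc _ _) (fun s _ => (hf s).continuousAt.continuousWithinAt)
      (fun s _ => (hf s).differentiableAt.differentiableWithinAt) fun s hs => ?_
    rw [(hf s).deriv]
    rw [interior_Icc] at hs
    exact h s hs.1.le hs.2.le
  rw [← h0]
  exact hm ⟨le_rfl, ht.trans hta⟩ ⟨ht, hta⟩ ht

lemma abs_FF_sub_le {a₁ : ℝ} (ha₁ : a₁ < Real.pi) (N : ℕ) : ∀ t, 0 ≤ t → t ≤ a₁ →
    |FF N t - (XX 0 N t - 7 / 18 * XX 1 N t)| ≤ Real.pi ^ 4 / Real.cos (a₁ / 2) * XX 2 N t := by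
  set C := Real.pi ^ 4 / Real.cos (a₁ / 2)
  suffices h : ∀ t, 0 ≤ t → t ≤ a₁ → 0 ≤ C * XX 2 N t - (FF N t - (XX 0 N t - 7 / 18 * XX 1 N t)) ∧
      0 ≤ C * XX 2 N t + (FF N t - (XX 0 N t - 7 / 18 * XX 1 N t)) by
    intro t h1 h2
    have := h t h1 h2
    rw [abs_le]
    constructor <;> linarith [this.1, this.2]
  induction N with
  | zero =>
    intro t h1 h2
    constructor
    · refine nonneg_of_deriv (fun t => ((hasDerivAt_XX_zero 2 t).const_mul C).sub ((hasDerivAt_FF_zero t).sub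
        ((hasDerivAt_XX_zero 0 t).sub ((hasDerivAt_XX_zero 1 t).const_mul (7 / 18))))) (by simp [XX_zero, FF_zero])
        (fun s hs hs' => ?_) t h1 h2
      have := (abs_le.1 (abs_cos_expansion_le' ha₁ hs hs')).2
      norm_num
      linarith
    · refine nonneg_of_deriv (fun t => ((hasDerivAt_XX_zero 2 t).const_mul C).add ((hasDerivAt_FF_zero t).sub
        ((hasDerivAt_XX_zero 0 t).sub ((hasDerivAt_XX_zero 1 t).const_mul (7 / 18))))) (by simp [XX_zero, FF_zero])
        (fun s hs hs' => ?_) t h1 h2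
      have := (abs_le.1 (abs_cos_expansion_le' ha₁ hs hs')).1
      norm_num
      linarith
  | succ N ih =>
    intro t h1 h2
    have hsin : ∀ s, 0 ≤ s → s ≤ a₁ → 0 ≤ (N + 1) * Real.sin s := fun s hs hs' =>
      mul_nonneg (by positivity) (Real.sin_nonneg_of_nonneg_of_le_pi hs (by linarith))
    constructor
    · refine nonneg_of_deriv (fun t => ((hasDerivAt_XX_succ 2 N t).const_mul C).sub ((hasDerivAt_FF_succ N t).sub
        ((hasDerivAt_XX_succ 0 N t).sub ((hasDerivAt_XX_succ 1 N t).const_mul (7 / 18))))) (by simp [XX_zero, FF_zero])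
        (fun s hs hs' => ?_) t h1 h2
      have := mul_nonneg (hsin s hs hs') (ih s hs hs').1
      linarith
    · refine nonneg_of_deriv (fun t => ((hasDerivAt_XX_succ 2 N t).const_mul C).add ((hasDerivAt_FF_succ N t).sub
        ((hasDerivAt_XX_succ 0 N t).sub ((hasDerivAt_XX_succ 1 N t).const_mul (7 / 18))))) (by simp [XX_zero, FF_zero])
        (fun s hs hs' => ?_) t h1 h2
      have := mul_nonneg (hsin s hs hs') (ih s hs hs').2
      linarith

/-- The expansion of `FF N` with relative error `O(N⁻²)`. -/
lemma abs_FF_sub_le' {a₁ : ℝ} (ha₁ : a₁ < Real.pi) (N : ℕ) {t : ℝ} (h0 : 0 ≤ t) (ht : t ≤ a₁) :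
    |FF N t - XX 0 N t * (1 - 7 / 18 * (Real.sin (t / 2) ^ 2 / (2 * N + 3)))| ≤
      XX 0 N t * (Real.pi ^ 4 / Real.cos (a₁ / 2) * (3 * Real.sin (t / 2) ^ 4 / ((2 * N + 3) * (2 * N + 5)))) := by
  have := abs_FF_sub_le ha₁ N t h0 ht
  rw [XX_one, XX_two] at this
  convert this using 1
  · congr 1; ring
  · ring

end OpenXXZ

namespace OpenXXZ
open Finset Filter Topology Polynomial

/-- The span of the first `m` basis polynomials. -/
def Wsp (m : ℕ) : Submodule ℂ ℂ[X] := Submodule.span ℂ (wwP '' ((range m : Finset ℕ) : Set ℕ))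

lemma mem_Wsp {m : ℕ} {p : ℂ[X]} (h : p ∈ Wsp m) : ∃ a : ℕ → ℂ, p = ∑ k ∈ range m, C (a k) * wwP k := by
  obtain ⟨c, rfl⟩ := Submodule.mem_span_image_finset_iff_exists_fun' ℂ |>.1 h
  exact ⟨c, sum_congr rfl fun k _ => smul_eq_C_mul _⟩

lemma wwP_mem {m k : ℕ} (h : k < m) : wwP k ∈ Wsp m :=
  Submodule.subset_span ⟨k, by simpa using h, rfl⟩

lemma Wsp_mono {m m' : ℕ} (h : m ≤ m') : Wsp m ≤ Wsp m' :=
  Submodule.span_mono (Set.image_mono (by simpa using h))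

lemma cube_mul_wwP (k : ℕ) : (X ^ 3 - C 3 * X) * wwP k = wwP (k + 2) := by
  unfold wwP
  rw [show (k + 2) / 2 = k / 2 + 1 by omega, show (k + 2) % 2 = k % 2 by omega]
  ring

lemma cube_mul_mem {m : ℕ} {p : ℂ[X]} (h : p ∈ Wsp m) : (X ^ 3 - C 3 * X) * p ∈ Wsp (m + 2) := by
  obtain ⟨a, rfl⟩ := mem_Wsp h
  rw [mul_sum]
  refine Submodule.sum_mem _ fun k hk => ?_
  rw [mul_left_comm, cube_mul_wwP, ← smul_eq_C_mul]
  exact Submodule.smul_mem _ _ (wwP_mem (by have := mem_range.1 hk; omega))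

/-- The polynomial `p` represents the function `f` divided by `sin`. -/
def Rep (p : ℂ[X]) (f : ℝ → ℝ) : Prop :=
  ∀ θ : ℝ, p.eval ((2 * Real.cos θ : ℝ) : ℂ) * (Real.sin θ : ℂ) = (f θ : ℂ)

lemma Rep.step {p p' : ℂ[X]} {w : ℝ} (h : Rep p fun θ => Real.sin ((w - 3) * θ))
    (h' : Rep p' fun θ => Real.sin (w * θ)) :
    Rep ((X ^ 3 - C 3 * X) * p' - p) fun θ => Real.sin ((w + 3) * θ) := by
  intro θ
  have h1 := h θ
  have h2 := h' θ
  have e : Real.sin ((w + 3) * θ) = 2 * Real.cos (3 * θ) * Real.sin (w * θ) - Real.sin ((w - 3) * θ) := by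
    rw [add_mul, sub_mul, Real.sin_add, Real.sin_sub]; ring
  rw [Real.cos_three_mul] at e
  have e' := congrArg (fun t : ℝ => (t : ℂ)) e
  simp only [Complex.ofReal_sub, Complex.ofReal_mul, Complex.ofReal_pow, Complex.ofReal_ofNat] at e' h1 h2 ⊢
  rw [e', ← h1, ← h2]
  simp only [eval_sub, eval_mul, eval_pow, eval_X, eval_C]
  ring

lemma exists_up (k : ℕ) :
    (∃ p, p - wwP (2 * k) ∈ Wsp (2 * k) ∧ Rep p fun θ => Real.sin ((3 * k + 1) * θ)) ∧
    ∃ p, p - wwP (2 * (k + 1)) ∈ Wsp (2 * (k + 1)) ∧ Rep p fun θ => Real.sin ((3 * (k + 1 : ℕ) + 1) * θ) := by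
  induction k with
  | zero =>
    have r0 : Rep 1 fun θ => Real.sin (1 * θ) := fun θ => by simp
    have rm : Rep (-X) fun θ => Real.sin ((1 - 3) * θ) := fun θ => by
      have : Real.sin ((1 - 3) * θ) = -(2 * Real.cos θ) * Real.sin θ := by
        rw [show (1 - 3) * θ = -(2 * θ) by ring, Real.sin_neg, Real.sin_two_mul]; ring
      beta_reduce
      rw [this]; push_cast; simp
    refine ⟨⟨1, by simp [wwP], fun θ => by simp⟩, _, ?_, by convert rm.step r0 using 4; norm_num⟩
    have : (X ^ 3 - C 3 * X) * 1 - -X - wwP (2 * (0 + 1)) = wwP 1 := by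
      simp [wwP]
    rw [this]
    exact wwP_mem (by omega)
  | succ k ih =>
    obtain ⟨⟨p, hp, rp⟩, p', hp', rp'⟩ := ih
    refine ⟨⟨p', hp', rp'⟩, (X ^ 3 - C 3 * X) * p' - p, ?_, ?_⟩
    · have e : (X ^ 3 - C 3 * X) * p' - p - wwP (2 * (k + 1 + 1)) =
          (X ^ 3 - C 3 * X) * (p' - wwP (2 * (k + 1))) - (p - wwP (2 * k)) - wwP (2 * k) := by
        rw [mul_sub, cube_mul_wwP, show 2 * (k + 1) + 2 = 2 * (k + 1 + 1) by ring]
        ring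
      rw [e]
      exact Submodule.sub_mem _ (Submodule.sub_mem _ (cube_mul_mem hp') (Wsp_mono (by omega) hp))
        (wwP_mem (by omega))
    · have e : (3 * ((k + 1 : ℕ) : ℝ) + 1) - 3 = 3 * k + 1 := by push_cast; ring
      have := Rep.step (w := 3 * ((k + 1 : ℕ) : ℝ) + 1) (by rw [e]; exact rp) rp'
      convert this using 4
      push_cast; ring

lemma exists_down (k : ℕ) :
    (∃ p, p ∈ Wsp (2 * k + 1) ∧ Rep p fun θ => Real.sin ((3 * k - 1) * θ)) ∧
    ∃ p, p ∈ Wsp (2 * (k + 1)) ∧ Rep p fun θ => Real.sin ((3 * (k + 1 : ℕ) - 1) * θ) := by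
  induction k with
  | zero =>
    refine ⟨⟨-wwP 0, Submodule.neg_mem _ (wwP_mem (by omega)), fun θ => by simp [wwP]⟩,
      wwP 1, wwP_mem (by omega), fun θ => ?_⟩
    have : Real.sin ((3 * (0 + 1 : ℕ) - 1) * θ) = (2 * Real.cos θ) * Real.sin θ := by
      rw [show (3 * ((0 + 1 : ℕ) : ℝ) - 1) * θ = 2 * θ by push_cast; ring, Real.sin_two_mul]; ring
    beta_reduce
    rw [this]; push_cast; simp [wwP]
  | succ k ih =>
    obtain ⟨⟨p, hp, rp⟩, p', hp', rp'⟩ := ih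
    refine ⟨⟨p', Wsp_mono (by omega) hp', rp'⟩, (X ^ 3 - C 3 * X) * p' - p, ?_, ?_⟩
    · exact Submodule.sub_mem _ (cube_mul_mem hp') (Wsp_mono (by omega) hp)
    · have e : (3 * ((k + 1 : ℕ) : ℝ) - 1) - 3 = 3 * k - 1 := by push_cast; ring
      have := Rep.step (w := 3 * ((k + 1 : ℕ) : ℝ) - 1) (by rw [e]; exact rp) rp'
      convert this using 4
      push_cast; ring

lemma exists_lower {n l : ℕ} (h1 : 1 ≤ l) (h2 : l ≤ 2 * n) :
    ∃ p ∈ Wsp (2 * n), Rep p fun θ => Real.sin ((3 * ((n : ℝ) - l) + 1) * θ) := by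
  rcases le_or_gt l n with h | h
  · obtain ⟨p, hp, rp⟩ := (exists_up (n - l)).1
    refine ⟨p, ?_, ?_⟩
    · rw [← sub_add_cancel p (wwP (2 * (n - l)))]
      exact Submodule.add_mem _ (Wsp_mono (by omega) hp) (wwP_mem (by omega))
    · rw [Nat.cast_sub h] at rp
      exact rp
  · obtain ⟨p, hp, rp⟩ := (exists_down (l - n - 1)).2
    refine ⟨-p, Submodule.neg_mem _ (Wsp_mono (by omega) hp), fun θ => ?_⟩
    have := rp θ
    rw [show l - n - 1 + 1 = l - n by omega, Nat.cast_sub h.le] at this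
    rw [eval_neg, neg_mul, this, ← Complex.ofReal_neg, ← Real.sin_neg]
    ring_nf

lemma FF_rep (n : ℕ) : ∃ a : ℕ → ℂ, Rep (wwP (2 * n) + ∑ k ∈ range (2 * n), C (a k) * wwP k)
    fun θ => (bco (2 * n) 0)⁻¹ * FF (2 * n) (3 * θ / 2) := by
  have ht : bco (2 * n) 0 ≠ 0 := by
    intro h
    have := bco_top (2 * n)
    rw [h, zero_mul] at this
    have h2 : ((2 * n).factorial : ℝ) ≠ 0 := by exact_mod_cast (2 * n).factorial_ne_zero
    rw [pow_mul, neg_one_sq, one_pow, one_mul] at this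
    exact absurd this.symm (by positivity)
  obtain ⟨p0, hp0, rp0⟩ := (exists_up n).1
  have hl : ∀ l, ∃ p ∈ Wsp (2 * n), l + 1 ≤ 2 * n →
      Rep p fun θ => Real.sin ((3 * ((n : ℝ) - (l + 1 : ℕ)) + 1) * θ) := by
    intro l
    by_cases h : l + 1 ≤ 2 * n
    · obtain ⟨p, hp, rp⟩ := exists_lower (n := n) (l := l + 1) (by omega) h
      exact ⟨p, hp, fun _ => rp⟩
    · exact ⟨0, Submodule.zero_mem _, fun h' => absurd h' h⟩
  choose p hp rp using hl
  set Q := p0 + ∑ l ∈ range (2 * n), ((bco (2 * n) (l + 1) / bco (2 * n) 0 : ℝ) : ℂ) • p l with hQ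
  have hm : Q - wwP (2 * n) ∈ Wsp (2 * n) := by
    rw [hQ, add_sub_right_comm]
    exact Submodule.add_mem _ hp0 (Submodule.sum_mem _ fun l _ => Submodule.smul_mem _ _ (hp l))
  obtain ⟨a, ha⟩ := mem_Wsp hm
  refine ⟨a, fun θ => ?_⟩
  beta_reduce
  rw [← ha, add_sub_cancel, hQ, eval_add, eval_finsetSum, add_mul, rp0 θ, sum_mul, FF, mul_sum, sum_range_succ',
    Complex.ofReal_add, add_comm, Complex.ofReal_sum]
  congr 1
  · refine sum_congr rfl fun l hl => ?_
    rw [eval_smul, smul_eq_mul, mul_assoc, rp l (by have := mem_range.1 hl; omega) θ, ← Complex.ofReal_mul]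
    congr 1
    rw [show (((2 * n : ℕ) : ℝ) - 2 * ((l + 1 : ℕ) : ℝ) + 2 / 3) * (3 * θ / 2) =
      (3 * ((n : ℝ) - (l + 1 : ℕ)) + 1) * θ by push_cast; ring]
    ring
  · rw [← mul_assoc, inv_mul_cancel₀ ht, one_mul,
      show (((2 * n : ℕ) : ℝ) - 2 * ((0 : ℕ) : ℝ) + 2 / 3) * (3 * θ / 2) = (3 * (n : ℝ) + 1) * θ by push_cast; ring]

lemma pow_dvd_of_bound {Q : ℂ[X]} (N : ℕ) {K : ℝ} {c : ℕ → ℂ} (hc : Tendsto c atTop (𝓝 2)) (hc' : ∀ j, c j ≠ 2)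
    (hb : ∀ j, ‖Q.eval (c j)‖ ≤ K * ‖c j - 2‖ ^ N) : (X - C 2) ^ N ∣ Q := by
  induction N generalizing Q with
  | zero => simp
  | succ N ih =>
    have h0 : Q.eval 2 = 0 := by
      have h1 : Tendsto (fun j => ‖Q.eval (c j)‖) atTop (𝓝 ‖Q.eval 2‖) :=
        ((Q.continuous.tendsto 2).comp hc).norm
      have h2 : Tendsto (fun j => K * ‖c j - 2‖ ^ (N + 1)) atTop (𝓝 (K * ‖(2 : ℂ) - 2‖ ^ (N + 1))) :=
        (((hc.sub_const 2).norm).pow (N + 1)).const_mul K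
      have := le_of_tendsto_of_tendsto' h1 h2 hb
      simpa using this
    obtain ⟨R, rfl⟩ := dvd_iff_isRoot.2 h0
    rw [pow_succ']
    refine mul_dvd_mul_left _ (ih fun j => ?_)
    have := hb j
    have hpos : 0 < ‖c j - 2‖ := norm_pos_iff.2 (sub_ne_zero.2 (hc' j))
    rw [eval_mul, eval_sub, eval_X, eval_C, norm_mul, pow_succ', mul_left_comm] at this
    exact le_of_mul_le_mul_left this hpos

lemma two_cos_sub_two (θ : ℝ) : 2 * Real.cos θ - 2 = -(4 * Real.sin (θ / 2) ^ 2) := by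
  have := Real.cos_sq' (θ / 2)
  have h2 := Real.cos_two_mul (θ / 2)
  rw [show 2 * (θ / 2) = θ by ring] at h2
  linarith

lemma abs_FF_le (N : ℕ) : ∃ K : ℝ, 0 ≤ K ∧ ∀ θ : ℝ, 0 < θ → θ ≤ 1 →
    |FF N (3 * θ / 2)| ≤ K * ((4 * Real.sin (θ / 2) ^ 2) ^ N * Real.sin θ) := by
  have hpi := Real.pi_gt_three
  set c₀ := Real.pi ^ 4 / Real.cos (2 / 2)
  have hc₀ : 0 ≤ c₀ := div_nonneg (by positivity) (Real.cos_pos_of_mem_Ioo ⟨by linarith, by linarith⟩).le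
  set k := 2 ^ (N + 1) * (∏ j ∈ range N, ((j : ℝ) + 1) / (j + (0 : ℕ) + 3 / 2)) / (2 * (0 : ℕ) + 1)
  have hk : 0 ≤ k := div_nonneg (mul_nonneg (by positivity) (prod_nonneg fun j _ => by positivity)) (by positivity)
  refine ⟨k * (2 + 3 * c₀) * (Real.pi / 2) ^ (2 * N + 1), by positivity, fun θ h0 h1 => ?_⟩
  have hb := abs_FF_sub_le' (show (2 : ℝ) < Real.pi by linarith) N (t := 3 * θ / 2) (by positivity) (by linarith)
  have hX : XX 0 N (3 * θ / 2) = k * Real.sin (3 * θ / 2 / 2) ^ (2 * N + 1) := rfl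
  have hs0 : 0 ≤ Real.sin (3 * θ / 2 / 2) := Real.sin_nonneg_of_nonneg_of_le_pi (by positivity) (by linarith)
  have hs1 : Real.sin (3 * θ / 2 / 2) ≤ θ := (Real.sin_le (by positivity)).trans (by linarith)
  have hX0 : 0 ≤ XX 0 N (3 * θ / 2) := by rw [hX]; positivity
  have hX1 : XX 0 N (3 * θ / 2) ≤ k * θ ^ (2 * N + 1) := by
    rw [hX]
    exact mul_le_mul_of_nonneg_left (pow_le_pow_left₀ hs0 hs1 _) hk
  change _ ≤ XX 0 N (3 * θ / 2) * (c₀ * _) at hb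
  set σ := Real.sin (3 * θ / 2 / 2)
  have hσ : σ ≤ 1 := Real.sin_le_one _
  have d1 : σ ^ 2 / (2 * N + 3) ≤ 1 := by
    rw [div_le_one (by positivity)]
    nlinarith [pow_le_one₀ (n := 2) hs0 hσ, (Nat.cast_nonneg N : (0 : ℝ) ≤ N)]
  have d1' : 0 ≤ σ ^ 2 / (2 * N + 3) := by positivity
  have d2 : 3 * σ ^ 4 / ((2 * N + 3) * (2 * N + 5)) ≤ 3 := by
    rw [div_le_iff₀ (by positivity)]
    nlinarith [pow_le_one₀ (n := 4) hs0 hσ, (Nat.cast_nonneg N : (0 : ℝ) ≤ N)]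
  have hF : |FF N (3 * θ / 2)| ≤ XX 0 N (3 * θ / 2) * (2 + 3 * c₀) := by
    have t1 := abs_sub_abs_le_abs_sub (FF N (3 * θ / 2)) (XX 0 N (3 * θ / 2) * (1 - 7 / 18 * (σ ^ 2 / (2 * N + 3))))
    have t2 : |XX 0 N (3 * θ / 2) * (1 - 7 / 18 * (σ ^ 2 / (2 * N + 3)))| ≤ XX 0 N (3 * θ / 2) * 2 := by
      rw [abs_mul, abs_of_nonneg hX0]
      refine mul_le_mul_of_nonneg_left ?_ hX0
      rw [abs_le]
      constructor <;> linarith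
    have t3 : XX 0 N (3 * θ / 2) * (c₀ * (3 * σ ^ 4 / ((2 * N + 3) * (2 * N + 5)))) ≤ XX 0 N (3 * θ / 2) * (c₀ * 3) :=
      mul_le_mul_of_nonneg_left (mul_le_mul_of_nonneg_left d2 hc₀) hX0
    linarith
  have m1 : θ ≤ Real.pi / 2 * (2 * Real.sin (θ / 2)) := by
    have := Real.mul_le_sin (x := θ / 2) (by linarith) (by linarith)
    calc θ = Real.pi / 2 * (2 * (2 / Real.pi * (θ / 2))) := by field_simp
      _ ≤ _ := by gcongr
  have m2 : θ ≤ Real.pi / 2 * Real.sin θ := by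
    have := Real.mul_le_sin (x := θ) (by linarith) (by linarith)
    calc θ = Real.pi / 2 * (2 / Real.pi * θ) := by field_simp
      _ ≤ _ := by gcongr
  have m3 : θ ^ (2 * N + 1) ≤ (Real.pi / 2) ^ (2 * N + 1) * ((4 * Real.sin (θ / 2) ^ 2) ^ N * Real.sin θ) := by
    calc θ ^ (2 * N + 1) = θ ^ (2 * N) * θ := pow_succ _ _
      _ ≤ (Real.pi / 2 * (2 * Real.sin (θ / 2))) ^ (2 * N) * (Real.pi / 2 * Real.sin θ) :=
        mul_le_mul (pow_le_pow_left₀ h0.le m1 _) m2 h0.le (pow_nonneg (h0.le.trans m1) _)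
      _ = _ := by
        rw [mul_pow, pow_mul (2 * Real.sin (θ / 2)), mul_pow 2]
        ring
  calc _ ≤ _ := hF
    _ ≤ k * θ ^ (2 * N + 1) * (2 + 3 * c₀) := mul_le_mul_of_nonneg_right hX1 (by positivity)
    _ ≤ k * ((Real.pi / 2) ^ (2 * N + 1) * ((4 * Real.sin (θ / 2) ^ 2) ^ N * Real.sin θ)) * (2 + 3 * c₀) := by
      gcongr
    _ = _ := by ring

/-- Closed form of `pin n` in terms of `FF`. -/
lemma pin_eval (n : ℕ) (θ : ℝ) : (pin n).eval ((2 * Real.cos θ : ℝ) : ℂ) *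
    (((4 * Real.sin (θ / 2) ^ 2) ^ (2 * n) * Real.sin θ : ℝ) : ℂ) =
      (((bco (2 * n) 0)⁻¹ * FF (2 * n) (3 * θ / 2) : ℝ) : ℂ) := by
  obtain ⟨a, ha⟩ := FF_rep n
  obtain ⟨K, hK, hb⟩ := abs_FF_le (2 * n)
  set Q := wwP (2 * n) + ∑ k ∈ range (2 * n), C (a k) * wwP k with hQ
  have hn : ∀ θ : ℝ, ‖((2 * Real.cos θ : ℝ) : ℂ) - 2‖ = 4 * Real.sin (θ / 2) ^ 2 := by
    intro θ
    rw [← Complex.ofReal_ofNat, ← Complex.ofReal_sub, Complex.norm_real, two_cos_sub_two, norm_neg,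
      Real.norm_of_nonneg (by positivity)]
  have hpi := Real.pi_gt_three
  have hdvd : (X - C 2) ^ (2 * n) ∣ Q := by
    have hθ : ∀ j : ℕ, 0 < 1 / ((j : ℝ) + 1) ∧ 1 / ((j : ℝ) + 1) ≤ 1 := fun j =>
      ⟨by positivity, by rw [div_le_one (by positivity)]; linarith [(Nat.cast_nonneg j : (0 : ℝ) ≤ j)]⟩
    refine pow_dvd_of_bound (2 * n) (K := |bco (2 * n) 0|⁻¹ * K)
      (c := fun j => ((2 * Real.cos (1 / ((j : ℝ) + 1)) : ℝ) : ℂ)) ?_ (fun j => ?_) fun j => ?_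
    · have h0 := tendsto_one_div_add_atTop_nhds_zero_nat (𝕜 := ℝ)
      have h1 : Continuous fun θ : ℝ => ((2 * Real.cos θ : ℝ) : ℂ) := by fun_prop
      have := (h1.tendsto 0).comp h0
      simpa [Function.comp_def] using this
    · obtain ⟨h0, h1⟩ := hθ j
      have := Real.sin_pos_of_pos_of_lt_pi (half_pos h0) (by linarith)
      rw [← sub_ne_zero, ← norm_pos_iff, hn]
      positivity
    · obtain ⟨h0, h1⟩ := hθ j
      generalize 1 / ((j : ℝ) + 1) = θ at *
      have hs := Real.sin_pos_of_pos_of_lt_pi h0 (by linarith)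
      have h2 := congrArg norm (ha θ)
      rw [norm_mul, Complex.norm_real, Complex.norm_real, Real.norm_of_nonneg hs.le, Real.norm_eq_abs, abs_mul,
        abs_inv] at h2
      rw [hn]
      refine le_of_mul_le_mul_right ?_ hs
      rw [h2]
      calc _ ≤ |bco (2 * n) 0|⁻¹ * (K * ((4 * Real.sin (θ / 2) ^ 2) ^ (2 * n) * Real.sin θ)) :=
            mul_le_mul_of_nonneg_left (hb θ h0 h1) (by positivity)
        _ = _ := by ring
  obtain ⟨R, hR⟩ := hdvd
  have hRp := pin_unique n R a (by rw [← hR])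
  have h2 := ha θ
  beta_reduce at h2
  rw [← h2, hR, hRp, eval_mul, eval_pow, eval_sub, eval_X, eval_C, ← Complex.ofReal_ofNat, ← Complex.ofReal_sub,
    two_cos_sub_two, Complex.ofReal_neg, (even_two_mul n).neg_pow]
  push_cast
  ring

end OpenXXZ

namespace OpenXXZ
open Finset Filter Topology

/-- The constant prefactor in the asymptotics of `pin`. -/
def AA (θ : ℝ) : ℝ := (1 + 2 * Real.cos (θ / 2)) / (2 * Real.cos (θ / 4) * Real.cos (θ / 2))

/-- The growth rate in the asymptotics of `pin`. -/
def LL (θ : ℝ) : ℝ := ((1 + 2 * Real.cos (θ / 2)) / (2 * Real.cos (θ / 4))) ^ 2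

/-- The purely numerical factor in the asymptotics of `pin`. -/
def cN (N : ℕ) : ℝ := (∏ j ∈ range (N + 1), ((j : ℝ) + 2 / 3)) / ∏ j ∈ range N, ((j : ℝ) + 3 / 2)

lemma cN_pos (N : ℕ) : 0 < cN N :=
  div_pos (prod_pos fun j _ => by positivity) (prod_pos fun j _ => by positivity)

lemma cos_pos_half {θ : ℝ} (h0 : 0 ≤ θ) (h1 : θ < 2 * Real.pi / 3) : 0 < Real.cos (θ / 2) :=
  Real.cos_pos_of_mem_Ioo ⟨by linarith [Real.pi_pos], by linarith [Real.pi_pos]⟩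

lemma cos_pos_quarter {θ : ℝ} (h0 : 0 ≤ θ) (h1 : θ < 2 * Real.pi / 3) : 0 < Real.cos (θ / 4) :=
  Real.cos_pos_of_mem_Ioo ⟨by linarith [Real.pi_pos], by linarith [Real.pi_pos]⟩

lemma AA_pos {θ : ℝ} (h0 : 0 ≤ θ) (h1 : θ < 2 * Real.pi / 3) : 0 < AA θ := by
  have := cos_pos_half h0 h1
  have := cos_pos_quarter h0 h1
  unfold AA
  positivity

lemma LL_pos {θ : ℝ} (h0 : 0 ≤ θ) (h1 : θ < 2 * Real.pi / 3) : 0 < LL θ := by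
  have := cos_pos_half h0 h1
  have := cos_pos_quarter h0 h1
  unfold LL
  positivity

lemma sin_three_quarter (θ : ℝ) :
    Real.sin (3 * θ / 4) = Real.sin (θ / 4) * (1 + 2 * Real.cos (θ / 2)) := by
  rw [show 3 * θ / 4 = 3 * (θ / 4) by ring, Real.sin_three_mul, show θ / 2 = 2 * (θ / 4) by ring,
    Real.cos_two_mul']
  linear_combination (2 * Real.sin (θ / 4)) * Real.sin_sq_add_cos_sq (θ / 4) +
    (-4) * Real.sin (θ / 4) * Real.sin_sq_add_cos_sq (θ / 4)

lemma AA_mul_sin {θ : ℝ} (h0 : 0 ≤ θ) (h1 : θ < 2 * Real.pi / 3) :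
    AA θ * Real.sin θ = 2 * Real.sin (3 * θ / 4) := by
  have a := cos_pos_half h0 h1
  have b := cos_pos_quarter h0 h1
  have e : Real.sin θ = 4 * Real.sin (θ / 4) * Real.cos (θ / 4) * Real.cos (θ / 2) := by
    have e1 := Real.sin_two_mul (θ / 2)
    have e2 := Real.sin_two_mul (θ / 4)
    rw [show 2 * (θ / 2) = θ by ring] at e1
    rw [show 2 * (θ / 4) = θ / 2 by ring] at e2
    rw [e1, e2]; ring
  rw [sin_three_quarter, e, AA]
  field_simp
  ring

lemma LL_mul_sin {θ : ℝ} (h0 : 0 ≤ θ) (h1 : θ < 2 * Real.pi / 3) :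
    LL θ * Real.sin (θ / 2) ^ 2 = Real.sin (3 * θ / 4) ^ 2 := by
  have b := cos_pos_quarter h0 h1
  have e2 := Real.sin_two_mul (θ / 4)
  rw [show 2 * (θ / 4) = θ / 2 by ring] at e2
  rw [sin_three_quarter, e2, LL]
  field_simp

lemma XX_eq {θ : ℝ} (h0 : 0 ≤ θ) (h1 : θ < 2 * Real.pi / 3) (n : ℕ) :
    (bco (2 * n) 0)⁻¹ * XX 0 (2 * n) (3 * θ / 2) =
      AA θ * LL θ ^ (2 * n) * cN (2 * n) * ((4 * Real.sin (θ / 2) ^ 2) ^ (2 * n) * Real.sin θ) := by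
  have ht := bco_top (2 * n)
  rw [pow_mul (-1 : ℝ), neg_one_sq, one_pow, one_mul] at ht
  have hp : (∏ j ∈ range (2 * n), ((j : ℝ) + 1)) = ((2 * n).factorial : ℝ) := by
    rw [← prod_range_add_one_eq_factorial]; push_cast; rfl
  have hA := AA_mul_sin h0 h1
  have hL := LL_mul_sin h0 h1
  have hX : XX 0 (2 * n) (3 * θ / 2) = 2 ^ (2 * n + 1) * (((2 * n).factorial : ℝ) /
      ∏ j ∈ range (2 * n), ((j : ℝ) + 3 / 2)) * Real.sin (3 * θ / 4) ^ (2 * (2 * n) + 1) := by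
    rw [← hp, ← prod_div_distrib]
    unfold XX
    simp only [Nat.cast_zero, add_zero, mul_zero, zero_add, div_one]
    congr 3
    ring
  have h2 : (0 : ℝ) < ∏ j ∈ range (2 * n + 1), ((j : ℝ) + 2 / 3) := prod_pos fun j _ => by positivity
  have h3 : (0 : ℝ) < ∏ j ∈ range (2 * n), ((j : ℝ) + 3 / 2) := prod_pos fun j _ => by positivity
  have hf : (0 : ℝ) < ((2 * n).factorial : ℝ) := by exact_mod_cast (2 * n).factorial_pos
  have hb : bco (2 * n) 0 = ((2 * n).factorial : ℝ) / 2 ^ (2 * n) / ∏ j ∈ range (2 * n + 1), ((j : ℝ) + 2 / 3) := by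
    rw [eq_div_iff h2.ne', ht]
  have e1 : AA θ * LL θ ^ (2 * n) * cN (2 * n) * ((4 * Real.sin (θ / 2) ^ 2) ^ (2 * n) * Real.sin θ) =
      (AA θ * Real.sin θ) * (LL θ * Real.sin (θ / 2) ^ 2) ^ (2 * n) * 4 ^ (2 * n) * cN (2 * n) := by
    rw [mul_pow, mul_pow]; ring
  rw [e1, hA, hL, hX, hb, cN, show (4 : ℝ) = 2 * 2 by norm_num, mul_pow 2 2]
  generalize (∏ j ∈ range (2 * n + 1), ((j : ℝ) + 2 / 3)) = a at *
  generalize (∏ j ∈ range (2 * n), ((j : ℝ) + 3 / 2)) = b at *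
  rw [← pow_mul, pow_succ (Real.sin _), pow_succ (2 : ℝ)]
  field_simp

/-- Leading-order approximation of `pin`. -/
def RR (θ : ℝ) (n : ℕ) : ℝ :=
  AA θ * LL θ ^ (2 * n) * cN (2 * n) * (1 - 7 / 18 * (Real.sin (3 * θ / 4) ^ 2 / (2 * (2 * n : ℕ) + 3)))

/-- Error bound for `RR`. -/
def SSb (c θ : ℝ) (n : ℕ) : ℝ :=
  AA θ * LL θ ^ (2 * n) * cN (2 * n) * (c * (3 * Real.sin (3 * θ / 4) ^ 4 / ((2 * (2 * n : ℕ) + 3) * (2 * (2 * n : ℕ) + 5))))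

lemma pin_bound_pos {θ₁ : ℝ} (h1 : θ₁ < 2 * Real.pi / 3) {θ : ℝ} (h0 : 0 < θ) (hle : θ ≤ θ₁) (n : ℕ) :
    ∃ p : ℝ, (pin n).eval ((2 * Real.cos θ : ℝ) : ℂ) = p ∧
      |p - RR θ n| ≤ SSb (Real.pi ^ 4 / Real.cos (3 * θ₁ / 4)) θ n := by
  have hpi := Real.pi_pos
  set W := (4 * Real.sin (θ / 2) ^ 2) ^ (2 * n) * Real.sin θ with hW
  have hW0 : 0 < W := by
    have := Real.sin_pos_of_pos_of_lt_pi h0 (by linarith)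
    have := Real.sin_pos_of_pos_of_lt_pi (half_pos h0) (by linarith)
    positivity
  refine ⟨(bco (2 * n) 0)⁻¹ * FF (2 * n) (3 * θ / 2) / W, ?_, ?_⟩
  · rw [Complex.ofReal_div, eq_div_iff (by exact_mod_cast hW0.ne'), pin_eval]
  · have hb := abs_FF_sub_le' (a₁ := 3 * θ₁ / 2) (by linarith) (2 * n) (t := 3 * θ / 2) (by positivity) (by linarith)
    rw [show 3 * θ₁ / 2 / 2 = 3 * θ₁ / 4 by ring, show 3 * θ / 2 / 2 = 3 * θ / 4 by ring] at hb
    have hX := XX_eq h0.le (hle.trans_lt h1) n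
    rw [← hW] at hX
    have hbc : 0 < (bco (2 * n) 0)⁻¹ := by
      have ht := bco_top (2 * n)
      rw [pow_mul (-1 : ℝ), neg_one_sq, one_pow, one_mul] at ht
      have h2 : (0 : ℝ) < ∏ j ∈ range (2 * n + 1), ((j : ℝ) + 2 / 3) := prod_pos fun j _ => by positivity
      have hf : (0 : ℝ) < ((2 * n).factorial : ℝ) := by exact_mod_cast (2 * n).factorial_pos
      refine inv_pos.2 (pos_of_mul_pos_left ?_ h2.le)
      rw [ht]; positivity
    have key : ∀ y : ℝ, AA θ * LL θ ^ (2 * n) * cN (2 * n) * y =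
        (bco (2 * n) 0)⁻¹ * (XX 0 (2 * n) (3 * θ / 2) * y) / W := by
      intro y
      rw [← mul_assoc, hX]
      field_simp
    unfold RR SSb
    rw [key, key, ← sub_div, ← mul_sub, abs_div, abs_mul, abs_of_pos hbc, abs_of_pos hW0]
    gcongr

lemma pin_bound {θ₁ : ℝ} (h1 : θ₁ < 2 * Real.pi / 3) (hpos : 0 < θ₁) {θ : ℝ} (h0 : 0 ≤ θ) (hle : θ ≤ θ₁) (n : ℕ) :
    ∃ p : ℝ, (pin n).eval ((2 * Real.cos θ : ℝ) : ℂ) = p ∧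
      |p - RR θ n| ≤ SSb (Real.pi ^ 4 / Real.cos (3 * θ₁ / 4)) θ n := by
  rcases h0.eq_or_lt with rfl | h0
  · have hc : Continuous fun θ : ℝ => (pin n).eval ((2 * Real.cos θ : ℝ) : ℂ) := by fun_prop
    have hmem : Set.Ioc 0 θ₁ ∈ 𝓝[>] (0 : ℝ) := Ioc_mem_nhdsGT hpos
    have hex : ∀ᶠ θ : ℝ in 𝓝[>] 0, ((pin n).eval ((2 * Real.cos θ : ℝ) : ℂ)).im = 0 ∧
        |((pin n).eval ((2 * Real.cos θ : ℝ) : ℂ)).re - RR θ n| ≤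
          SSb (Real.pi ^ 4 / Real.cos (3 * θ₁ / 4)) θ n := by
      filter_upwards [hmem] with θ hθ
      obtain ⟨p, hp, hb⟩ := pin_bound_pos h1 hθ.1 hθ.2 n
      rw [hp]
      exact ⟨Complex.ofReal_im _, hb⟩
    have hA : ContinuousAt AA 0 := by
      unfold AA
      refine ContinuousAt.div (by fun_prop) (by fun_prop) (by simp)
    have hL : ContinuousAt LL 0 := by
      unfold LL
      refine ContinuousAt.pow (ContinuousAt.div (by fun_prop) (by fun_prop) (by simp)) 2
    have hR : ContinuousAt (fun θ => RR θ n) 0 := by unfold RR; fun_prop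
    have hS : ContinuousAt (fun θ => SSb (Real.pi ^ 4 / Real.cos (3 * θ₁ / 4)) θ n) 0 := by unfold SSb; fun_prop
    have him : ((pin n).eval ((2 * Real.cos 0 : ℝ) : ℂ)).im = 0 := by
      have t : Tendsto (fun θ : ℝ => ((pin n).eval ((2 * Real.cos θ : ℝ) : ℂ)).im) (𝓝[>] 0)
          (𝓝 ((pin n).eval ((2 * Real.cos 0 : ℝ) : ℂ)).im) :=
        ((Complex.continuous_im.comp hc).tendsto 0).mono_left nhdsWithin_le_nhds
      exact tendsto_nhds_unique t ((tendsto_congr' (hex.mono fun _ h => h.1)).2 tendsto_const_nhds)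
    refine ⟨_, Complex.ext rfl (by rw [him, Complex.ofReal_im]), ?_⟩
    have t : ContinuousAt (fun θ : ℝ => |((pin n).eval ((2 * Real.cos θ : ℝ) : ℂ)).re - RR θ n|) 0 :=
      ((Complex.continuous_re.comp hc).continuousAt.sub hR).abs
    exact le_of_tendsto_of_tendsto (t.tendsto.mono_left nhdsWithin_le_nhds)
      (hS.tendsto.mono_left nhdsWithin_le_nhds) (hex.mono fun _ h => h.2)
  · exact pin_bound_pos h1 h0 hle n

end OpenXXZ

namespace OpenXXZ
open Finset Filter Topology

/-- The rescaled logarithm of `cN`. -/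
def uN (N : ℕ) : ℝ := Real.log (cN N) - 1 / 6 * Real.log N - 13 / (72 * N)

lemma cN_succ (N : ℕ) : cN (N + 1) = cN N * (((N : ℝ) + 5 / 3) / (N + 3 / 2)) := by
  unfold cN
  rw [prod_range_succ _ (N + 1), prod_range_succ (fun j : ℕ => (j : ℝ) + 3 / 2) N, div_mul_div_comm]
  congr 2
  push_cast; ring

lemma abs_log_one_add_sub_le {h : ℝ} (h0 : 0 ≤ h) (h1 : h ≤ 1 / 2) :
    |Real.log (1 + h) - (h - h ^ 2 / 2)| ≤ 2 * h ^ 3 := by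
  have := Real.abs_log_sub_add_sum_range_le (x := -h) (by rw [abs_neg, abs_of_nonneg h0]; linarith) 2
  simp only [sum_range_succ, sum_range_zero, abs_neg, abs_of_nonneg h0, sub_neg_eq_add] at this
  norm_num at this
  have h2 : h ^ 3 / (1 - h) ≤ 2 * h ^ 3 := by
    rw [div_le_iff₀ (by linarith)]
    nlinarith [pow_nonneg h0 3]
  refine le_trans (le_of_eq ?_) (this.trans h2)
  congr 1
  ring

lemma abs_log_one_add_sub_le' {y : ℝ} (h1 : |y| ≤ 1 / 2) : |Real.log (1 + y) - y| ≤ 2 * y ^ 2 := by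
  have := Real.abs_log_sub_add_sum_range_le (x := -y) (by rw [abs_neg]; linarith) 1
  simp only [sum_range_succ, sum_range_zero, abs_neg, sub_neg_eq_add] at this
  norm_num at this
  have h2 : y ^ 2 / (1 - |y|) ≤ 2 * y ^ 2 := by
    rw [div_le_iff₀ (by linarith)]
    nlinarith [sq_nonneg y]
  refine le_trans (le_of_eq ?_) (this.trans h2)
  congr 1
  ring

lemma abs_uN_succ_sub_le {N : ℕ} (hN : 4 ≤ N) : |uN (N + 1) - uN N| ≤ 20 / (N : ℝ) ^ 3 := by
  have hN' : (4 : ℝ) ≤ N := by exact_mod_cast hN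
  have hpos : (0 : ℝ) < N := by linarith
  set h : ℝ := 1 / N with hh
  have hNh : (N : ℝ) = 1 / h := by rw [hh, one_div_one_div]
  have h0 : 0 < h := by positivity
  have h4 : h ≤ 1 / 4 := by rw [hh]; exact one_div_le_one_div_of_le (by norm_num) hN'
  have e1 := abs_log_one_add_sub_le (h := 5 / 3 * h) (by positivity) (by linarith)
  have e2 := abs_log_one_add_sub_le (h := 3 / 2 * h) (by positivity) (by linarith)
  have e3 := abs_log_one_add_sub_le (h := h) (by positivity) (by linarith)
  have hd : uN (N + 1) - uN N = Real.log (1 + 5 / 3 * h) - Real.log (1 + 3 / 2 * h)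
      - 1 / 6 * Real.log (1 + h) + 13 / 72 * (h ^ 2 / (1 + h)) := by
    have c1 : Real.log (cN (N + 1)) = Real.log (cN N) + (Real.log (1 + 5 / 3 * h) - Real.log (1 + 3 / 2 * h)) := by
      rw [cN_succ, Real.log_mul (cN_pos N).ne' (by positivity), ← Real.log_div (by positivity) (by positivity)]
      congr 2
      rw [hNh]; field_simp
    have c2 : Real.log ((N + 1 : ℕ) : ℝ) = Real.log N + Real.log (1 + h) := by
      rw [← Real.log_mul hpos.ne' (by positivity)]
      congr 1
      rw [hNh]; push_cast; rw [hNh]; field_simp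
    unfold uN
    rw [c1, c2]
    push_cast
    rw [hNh]
    field_simp
    ring
  have e4 : |h ^ 2 / (1 + h) - h ^ 2| ≤ h ^ 3 := by
    have : h ^ 2 / (1 + h) - h ^ 2 = -(h ^ 3 / (1 + h)) := by field_simp; ring
    rw [this, abs_neg, abs_of_nonneg (by positivity), div_le_iff₀ (by positivity)]
    nlinarith [pow_pos h0 3]
  have e5 : 20 / (N : ℝ) ^ 3 = 20 * h ^ 3 := by rw [hNh]; field_simp
  rw [hd, e5]
  have h3 := pow_pos h0 3
  rw [abs_le] at *
  constructor <;> nlinarith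

/-- Quantitative convergence from summable cubic increments. -/
lemma abs_sub_le_of_increments {u : ℕ → ℝ} {L K : ℝ} (hK : 0 ≤ K) {M : ℕ} (hM : 2 ≤ M)
    (hu : ∀ N, M ≤ N → |u (N + 1) - u N| ≤ K / (N : ℝ) ^ 3) (hL : Tendsto u atTop (𝓝 L)) {N : ℕ} (hN : M ≤ N) :
    |u N - L| ≤ 4 * K / (N : ℝ) ^ 2 := by
  have step : ∀ n : ℕ, 2 ≤ n → K / (n : ℝ) ^ 3 ≤ 4 * K * (1 / (n : ℝ) ^ 2 - 1 / ((n + 1 : ℕ) : ℝ) ^ 2) := by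
    intro n hn
    have hn' : (2 : ℝ) ≤ n := by exact_mod_cast hn
    have : 1 / (n : ℝ) ^ 3 ≤ 4 * (1 / (n : ℝ) ^ 2 - 1 / ((n + 1 : ℕ) : ℝ) ^ 2) := by
      have e : 4 * (1 / (n : ℝ) ^ 2 - 1 / ((n + 1 : ℕ) : ℝ) ^ 2) = 4 * (2 * n + 1) * n / (n ^ 3 * (n + 1) ^ 2) := by
        push_cast; field_simp; ring
      rw [e, div_le_div_iff₀ (by positivity) (by positivity)]
      have : ((n : ℝ) + 1) ^ 2 ≤ 4 * (2 * n + 1) * n := by nlinarith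
      nlinarith [pow_pos (show (0 : ℝ) < n by linarith) 3]
    calc _ = K * (1 / (n : ℝ) ^ 3) := by ring
      _ ≤ K * _ := mul_le_mul_of_nonneg_left this hK
      _ = _ := by ring
  have tel : ∀ k, |u (N + k) - u N| ≤ 4 * K * (1 / (N : ℝ) ^ 2 - 1 / ((N + k : ℕ) : ℝ) ^ 2) := by
    intro k
    induction k with
    | zero => simp
    | succ k ih =>
      have a := hu (N + k) (by omega)
      have b := step (N + k) (by omega)
      have c := abs_add_le (u (N + k + 1) - u (N + k)) (u (N + k) - u N)
      rw [sub_add_sub_cancel] at c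
      rw [← add_assoc]
      linarith
  have t : Tendsto (fun k => |u (N + k) - u N|) atTop (𝓝 |L - u N|) := by
    have := (hL.comp (tendsto_add_atTop_nat N)).sub_const (u N)
    refine this.abs.congr fun k => by simp [add_comm]
  rw [abs_sub_comm]
  refine le_of_tendsto' t fun k => (tel k).trans ?_
  have : 0 ≤ 4 * K * (1 / ((N + k : ℕ) : ℝ) ^ 2) := by positivity
  have e : 4 * K / (N : ℝ) ^ 2 = 4 * K * (1 / (N : ℝ) ^ 2) := by ring
  rw [e]
  linarith

lemma cN_eq_GammaSeq {N : ℕ} (hN : 1 ≤ N) : cN N * (N : ℝ) ^ (-(1 / 6) : ℝ) =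
    Real.GammaSeq (1 / 2) N / (2 * Real.GammaSeq (2 / 3) N) := by
  have hN' : (0 : ℝ) < N := by exact_mod_cast hN
  unfold cN Real.GammaSeq
  have e1 : ∏ j ∈ range (N + 1), ((1 : ℝ) / 2 + j) = (∏ j ∈ range N, ((j : ℝ) + 3 / 2)) * (1 / 2) := by
    rw [prod_range_succ']
    congr 1
    · refine prod_congr rfl fun j _ => ?_
      push_cast; ring
    · simp
  have e2 : ∏ j ∈ range (N + 1), ((2 : ℝ) / 3 + j) = ∏ j ∈ range (N + 1), ((j : ℝ) + 2 / 3) :=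
    prod_congr rfl fun j _ => add_comm _ _
  have e3 : (N : ℝ) ^ (1 / 2 : ℝ) = (N : ℝ) ^ (2 / 3 : ℝ) * (N : ℝ) ^ (-(1 / 6) : ℝ) := by
    rw [← Real.rpow_add hN']; norm_num
  have h2 : (0 : ℝ) < ∏ j ∈ range (N + 1), ((j : ℝ) + 2 / 3) := prod_pos fun j _ => by positivity
  have h3 : (0 : ℝ) < ∏ j ∈ range N, ((j : ℝ) + 3 / 2) := prod_pos fun j _ => by positivity
  have h4 : (0 : ℝ) < (N : ℝ) ^ (2 / 3 : ℝ) := Real.rpow_pos_of_pos hN' _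
  have h5 : (0 : ℝ) < (N.factorial : ℝ) := by exact_mod_cast N.factorial_pos
  rw [e1, e2, e3]
  generalize (∏ j ∈ range (N + 1), ((j : ℝ) + 2 / 3)) = a at *
  generalize (∏ j ∈ range N, ((j : ℝ) + 3 / 2)) = b at *
  field_simp

/-- The limit of `uN`. -/
def LC : ℝ := Real.log (Real.sqrt Real.pi / (2 * Real.Gamma (2 / 3)))

lemma tendsto_uN : Tendsto uN atTop (𝓝 LC) := by
  have hG : 0 < Real.Gamma (2 / 3) := Real.Gamma_pos_of_pos (by norm_num)
  have h1 : Tendsto (fun N => Real.GammaSeq (1 / 2) N / (2 * Real.GammaSeq (2 / 3) N)) atTop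
      (𝓝 (Real.sqrt Real.pi / (2 * Real.Gamma (2 / 3)))) := by
    rw [← Real.Gamma_one_half_eq]
    exact (Real.GammaSeq_tendsto_Gamma _).div ((Real.GammaSeq_tendsto_Gamma _).const_mul 2) (by positivity)
  have h2 := h1.log (by have := Real.pi_pos; positivity)
  have h3 : Tendsto (fun N : ℕ => 13 / (72 * (N : ℝ))) atTop (𝓝 0) := by
    have := (tendsto_const_div_atTop_nhds_zero_nat (13 / 72 : ℝ))
    refine this.congr fun N => by rw [div_div]
  have h4 := h2.sub h3
  rw [sub_zero] at h4
  refine h4.congr' ?_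
  filter_upwards [eventually_ge_atTop 1] with N hN
  have hN' : (0 : ℝ) < N := by exact_mod_cast hN
  rw [← cN_eq_GammaSeq hN, Real.log_mul (cN_pos N).ne' (Real.rpow_pos_of_pos hN' _).ne', Real.log_rpow hN', uN]
  ring

lemma abs_uN_sub_le {N : ℕ} (hN : 4 ≤ N) : |uN N - LC| ≤ 80 / (N : ℝ) ^ 2 := by
  have := abs_sub_le_of_increments (by norm_num) (by norm_num : 2 ≤ 4) (fun N hN => abs_uN_succ_sub_le hN)
    tendsto_uN hN
  norm_num at this ⊢
  exact this

lemma log_pin_asymp {θ : ℝ} (h0 : 0 ≤ θ) (h1 : θ < 2 * Real.pi / 3) {P : ℕ → ℝ}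
    (hP : ∀ n, (pin n).eval ((2 * Real.cos θ : ℝ) : ℂ) = P n) : ∃ C : ℝ, 0 ≤ C ∧ ∃ n₀ : ℕ, ∀ n, n₀ ≤ n →
      0 < P n ∧ |Real.log (P n) - ((2 * n : ℕ) * Real.log (LL θ) + 1 / 6 * Real.log (2 * n : ℕ) +
        (Real.log (AA θ) + LC) + (13 - 14 * Real.sin (3 * θ / 4) ^ 2) / 72 / (2 * n : ℕ))| ≤
          C / ((2 * n : ℕ) : ℝ) ^ 2 := by
  set θ₁ := (θ + 2 * Real.pi / 3) / 2 with hθ₁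
  obtain ⟨c, hc⟩ : ∃ c, c = Real.pi ^ 4 / Real.cos (3 * θ₁ / 4) := ⟨_, rfl⟩
  have hpi := Real.pi_pos
  have hc0 : 0 ≤ c := hc ▸ div_nonneg (by positivity)
    (Real.cos_pos_of_mem_Ioo ⟨by rw [hθ₁]; linarith, by rw [hθ₁]; linarith⟩).le
  refine ⟨2 * (1 + c) ^ 2 + c + 1 + 80, by positivity, max 2 ⌈2 * (1 + c)⌉₊, fun n hn => ?_⟩
  have hn2 : 2 ≤ n := (le_max_left _ _).trans hn
  have hn3 : 2 * (1 + c) ≤ n := (Nat.le_ceil _).trans (by exact_mod_cast (le_max_right _ _).trans hn)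
  obtain ⟨p, hp, hb⟩ := pin_bound (θ₁ := θ₁) (by rw [hθ₁]; linarith) (by rw [hθ₁]; linarith) h0
    (by rw [hθ₁]; linarith) n
  rw [hP] at hp
  have hp : P n = p := by exact_mod_cast hp
  rw [hp]
  have hu := abs_uN_sub_le (N := 2 * n) (by omega)
  unfold uN at hu
  unfold RR SSb at hb
  rw [← hc] at hb
  have hA := AA_pos h0 h1
  have hL := LL_pos h0 h1
  have hcN := cN_pos (2 * n)
  have hn3' : 2 * (1 + c) ≤ ((2 * n : ℕ) : ℝ) := by push_cast; linarith [(Nat.cast_nonneg n : (0 : ℝ) ≤ n)]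
  have hlogK : Real.log (AA θ * LL θ ^ (2 * n) * cN (2 * n)) =
      Real.log (AA θ) + (2 * n : ℕ) * Real.log (LL θ) + Real.log (cN (2 * n)) := by
    rw [Real.log_mul (by positivity) hcN.ne', Real.log_mul hA.ne' (by positivity), Real.log_pow]
  have hK : 0 < AA θ * LL θ ^ (2 * n) * cN (2 * n) := by positivity
  have hs0 : 0 ≤ Real.sin (3 * θ / 4) ^ 2 := sq_nonneg _
  have hs1 : Real.sin (3 * θ / 4) ^ 2 ≤ 1 := Real.sin_sq_le_one _
  rw [show Real.sin (3 * θ / 4) ^ 4 = (Real.sin (3 * θ / 4) ^ 2) ^ 2 by ring] at hb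
  generalize AA θ * LL θ ^ (2 * n) * cN (2 * n) = K at *
  generalize Real.sin (3 * θ / 4) ^ 2 = s at *
  have hN4 : (4 : ℝ) ≤ ((2 * n : ℕ) : ℝ) := by exact_mod_cast (by omega : 4 ≤ 2 * n)
  generalize Real.log (cN (2 * n)) = lc at *
  generalize ((2 * n : ℕ) : ℝ) = N at *
  have hNpos : 0 < N := by linarith
  set y := p / K - 1 with hy
  have hpy : p = K * (1 + y) := by rw [hy]; field_simp; ring
  have hb1 : |y + 7 / 18 * (s / (2 * N + 3))| ≤ c / N ^ 2 := by
    have e : p - K * (1 - 7 / 18 * (s / (2 * N + 3))) = K * (y + 7 / 18 * (s / (2 * N + 3))) := by rw [hpy]; ring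
    rw [e, abs_mul, abs_of_pos hK] at hb
    refine (le_of_mul_le_mul_left hb hK).trans ?_
    rw [← mul_one_div c]
    refine mul_le_mul_of_nonneg_left ?_ hc0
    rw [div_le_div_iff₀ (by positivity) (by positivity)]
    nlinarith [mul_le_mul hs1 hs1 hs0 zero_le_one, sq_nonneg N]
  have hd : |7 / 18 * (s / (2 * N + 3)) - 14 * s / 72 / N| ≤ 1 / N ^ 2 := by
    have e : 7 / 18 * (s / (2 * N + 3)) - 14 * s / 72 / N = -(7 / 12 * s / (N * (2 * N + 3))) := by
      field_simp; ring
    rw [e, abs_neg, abs_of_nonneg (by positivity), div_le_div_iff₀ (by positivity) (by positivity)]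
    nlinarith [sq_nonneg N]
  have hyN : |y| ≤ (1 + c) / N := by
    have t1 : c / N ^ 2 ≤ c / N / 4 := by
      rw [div_div]; exact div_le_div_of_nonneg_left hc0 (by positivity) (by nlinarith)
    have t2 : 0 ≤ 7 / 18 * (s / (2 * N + 3)) := by positivity
    have t3 : 7 / 18 * (s / (2 * N + 3)) ≤ 1 / N := by
      rw [← mul_div_assoc, div_le_div_iff₀ (by positivity) (by positivity)]; nlinarith
    have t4 : 0 ≤ c / N := by positivity
    have t5 : 0 < 1 / N := by positivity
    rw [add_div]
    rw [abs_le] at *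
    constructor <;> linarith
  have hy2 : |y| ≤ 1 / 2 := hyN.trans (by rw [div_le_div_iff₀ hNpos (by norm_num)]; linarith)
  have hlog := abs_log_one_add_sub_le' hy2
  have hysq : y ^ 2 ≤ (1 + c) ^ 2 / N ^ 2 := by
    rw [← sq_abs, ← div_pow]
    exact pow_le_pow_left₀ (abs_nonneg _) hyN 2
  have h1y : 0 < 1 + y := by rw [abs_le] at hy2; linarith
  refine ⟨by rw [hpy]; positivity, ?_⟩
  rw [hpy, Real.log_mul hK.ne' h1y.ne', hlogK]
  have eC : (2 * (1 + c) ^ 2 + c + 1 + 80) / N ^ 2 = 2 * ((1 + c) ^ 2 / N ^ 2) + c / N ^ 2 + 1 / N ^ 2 + 80 / N ^ 2 := by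
    ring
  have eE : (13 - 14 * s) / 72 / N = 13 / (72 * N) - 14 * s / 72 / N := by field_simp
  rw [eC, eE]
  rw [abs_le] at *
  constructor <;> linarith

end OpenXXZ

namespace OpenXXZ
open Finset Filter Topology

lemma LC_add_log_AA {θ D : ℝ} (h0 : 0 ≤ θ) (h1 : θ < 2 * Real.pi / 3)
    (hD : D = 4 * Real.sqrt (Real.pi / 3) / (Real.Gamma (1 / 3) * AA θ)) :
    Real.log (AA θ) + LC = -Real.log D := by
  have hA := AA_pos h0 h1
  have hG1 : 0 < Real.Gamma (1 / 3) := Real.Gamma_pos_of_pos (by norm_num)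
  have hG2 : 0 < Real.Gamma (2 / 3) := Real.Gamma_pos_of_pos (by norm_num)
  have hpi := Real.pi_pos
  have hr := Real.Gamma_mul_Gamma_one_sub (1 / 3)
  rw [show (1 : ℝ) - 1 / 3 = 2 / 3 by norm_num, mul_one_div, Real.sin_pi_div_three] at hr
  have hp := Real.sq_sqrt hpi.le
  rw [LC, hD, ← Real.log_inv, ← Real.log_mul (by positivity) (by positivity), Real.sqrt_div' _ (by norm_num)]
  congr 1
  have h3 : 0 < Real.sqrt 3 := by positivity
  have hp0 : 0 < Real.sqrt Real.pi := by positivity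
  rw [eq_div_iff (by positivity)] at hr
  field_simp
  linear_combination 4 * hp - 4 * hr

lemma D_eq {r : ℝ} (hr : r ∈ Set.Ioo (0 : ℝ) 2) :
    (if r = 1 then 8 / (3 * Real.Gamma (1 / 3)) * Real.sqrt (Real.pi / 3)
      else 2 / Real.Gamma (1 / 3) * Real.sqrt (Real.pi / 3) *
        (Real.sin (2 * Real.pi * (r - 1) / 3) / Real.sin (Real.pi * (r - 1) / 2))) =
      4 * Real.sqrt (Real.pi / 3) / (Real.Gamma (1 / 3) * AA |2 * Real.pi * (r - 1) / 3|) := by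
  have hG1 : 0 < Real.Gamma (1 / 3) := Real.Gamma_pos_of_pos (by norm_num)
  have hpi := Real.pi_pos
  split_ifs with h
  · have : AA |2 * Real.pi * (r - 1) / 3| = 3 / 2 := by
      rw [h]; norm_num [AA]
    rw [this]
    field_simp
    norm_num
  · rw [show Real.pi * (r - 1) / 2 = 3 * (2 * Real.pi * (r - 1) / 3) / 4 by ring]
    have ht0 : 2 * Real.pi * (r - 1) / 3 ≠ 0 := by
      have := sub_ne_zero.2 h
      positivity
    have ht1 : |2 * Real.pi * (r - 1) / 3| < 2 * Real.pi / 3 := by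
      rw [abs_lt]
      constructor <;> nlinarith [hr.1, hr.2]
    generalize 2 * Real.pi * (r - 1) / 3 = t at *
    have e : Real.sin t / Real.sin (3 * t / 4) = Real.sin |t| / Real.sin (3 * |t| / 4) := by
      rcases abs_choice t with h | h <;> rw [h]
      rw [mul_neg, neg_div, Real.sin_neg, Real.sin_neg, neg_div_neg_eq]
    have hA := AA_pos (abs_nonneg t) ht1
    have hs := Real.sin_pos_of_pos_of_lt_pi (abs_pos.2 ht0) (by linarith)
    have hm := AA_mul_sin (abs_nonneg t) ht1
    have hs3 : Real.sin (3 * |t| / 4) = AA |t| * Real.sin |t| / 2 := by rw [hm]; ring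
    rw [e, hs3]
    field_simp
    norm_num

/-- Combining the three one-chain expansions. -/
lemma combine {f : ℝ → ℝ} {l d e C δ ε n1 n2 : ℝ} (hC : 0 ≤ C) (hδ : 0 < δ)
    (h1 : 0 < n1) (h2 : 0 < n2)
    (hN : 3 * C ≤ ε * δ ^ 2 * (n1 + n2)) (hb1 : δ ≤ n1 / (n1 + n2)) (hb2 : n1 / (n1 + n2) ≤ 1 - δ)
    (f1 : |f n1 - (n1 * l + 1 / 6 * Real.log n1 + -d + e / 72 / n1)| ≤ C / n1 ^ 2)
    (f2 : |f n2 - (n2 * l + 1 / 6 * Real.log n2 + -d + e / 72 / n2)| ≤ C / n2 ^ 2)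
    (f3 : |f (n1 + n2) - ((n1 + n2) * l + 1 / 6 * Real.log (n1 + n2) + -d + e / 72 / (n1 + n2))| ≤ C / (n1 + n2) ^ 2) :
    |f n1 + f n2 - f (n1 + n2) - (1 / 6 * Real.log (n1 + n2)
      + 1 / 6 * Real.log ((n1 / (n1 + n2)) * (1 - n1 / (n1 + n2))) - d
      + e / 72 * (1 / (n1 / (n1 + n2)) + 1 / (1 - n1 / (n1 + n2)) - 1) / (n1 + n2))| ≤ ε / (n1 + n2) := by
  have hs : 0 < n1 + n2 := by positivity
  have e1 : 1 - n1 / (n1 + n2) = n2 / (n1 + n2) := by field_simp; ring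
  have hb3 : δ ≤ n2 / (n1 + n2) := by rw [← e1]; linarith
  rw [e1]
  have hb1' : δ * (n1 + n2) ≤ n1 := (le_div_iff₀ hs).1 hb1
  have hb2' : δ * (n1 + n2) ≤ n2 := (le_div_iff₀ hs).1 hb3
  have hδ1 : δ ≤ 1 := hb1.trans (by rw [div_le_one hs]; linarith)
  have b : ∀ m, δ * (n1 + n2) ≤ m → C / m ^ 2 ≤ C / (δ * (n1 + n2)) ^ 2 := fun m hm =>
    div_le_div_of_nonneg_left hC (by positivity) (pow_le_pow_left₀ (by positivity) hm 2)
  have b1 := b n1 hb1'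
  have b2 := b n2 hb2'
  have b3 := b (n1 + n2) (by nlinarith)
  have b4 : 3 * (C / (δ * (n1 + n2)) ^ 2) ≤ ε / (n1 + n2) := by
    rw [← mul_div_assoc, div_le_div_iff₀ (by positivity) hs]
    nlinarith
  have e2 : e / 72 * (1 / (n1 / (n1 + n2)) + 1 / (n2 / (n1 + n2)) - 1) / (n1 + n2) =
      e / 72 / n1 + e / 72 / n2 - e / 72 / (n1 + n2) := by
    field_simp
  rw [e2, Real.log_mul (by positivity) (by positivity), Real.log_div h1.ne' hs.ne', Real.log_div h2.ne' hs.ne']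
  rw [abs_le] at *
  constructor <;> linarith

end OpenXXZ

open OpenXXZ

/-- **Theorem 1.2 (even-even case).** Asymptotics of the logarithmic bipartite
fidelity: for even `N1, N2 → ∞` with `ξ = N1/N` bounded away from `0` and `1`,
`F_{N1,N2} = (1/6)ln N + (1/6)ln(ξ(1−ξ)) − ln D + (E/72)(1/ξ + 1/(1−ξ) − 1)/N + o(1/N)`. -/
theorem lbf_asymptotics_even_even
    (x : ℝ) (hx : 0 < x)
    (ψ : (M : ℕ) → Conf M → ℂ)
    (hψ : ∀ M : ℕ, 1 ≤ M → IsGroundState M x (ψ M))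
    (r : ℝ) (hr : r ∈ Set.Ioo (0:ℝ) 2)
    (hxr : x = Real.sin (Real.pi * (r+1)/3) / Real.sin (Real.pi * r/3))
    (D E : ℝ)
    (hD : D = if r = 1 then 8/(3 * Real.Gamma (1/3)) * Real.sqrt (Real.pi/3)
      else 2/Real.Gamma (1/3) * Real.sqrt (Real.pi/3) *
        (Real.sin (2*Real.pi*(r-1)/3) / Real.sin (Real.pi*(r-1)/2)))
    (hE : E = 13 - 14 * Real.sin (Real.pi*(r-1)/2)^2) :
    ∀ δ ∈ Set.Ioo (0:ℝ) (1/2), ∀ ε > (0:ℝ), ∃ N₀ : ℕ,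
      ∀ N1 N2 : ℕ, Even N1 → Even N2 → 2 ≤ N1 → 2 ≤ N2 →
        N₀ ≤ N1 + N2 →
        δ ≤ (N1 : ℝ)/((N1:ℝ)+N2) → (N1 : ℝ)/((N1:ℝ)+N2) ≤ 1 - δ →
        ‖LBF N1 N2 (ψ (N1+N2)) (ψ N1) (ψ N2)
          - (((1/6) * Real.log ((N1:ℝ)+N2)
            + (1/6) * Real.log (((N1:ℝ)/((N1:ℝ)+N2)) * (1 - (N1:ℝ)/((N1:ℝ)+N2)))
            - Real.log D
            + E/72 * (1/((N1:ℝ)/((N1:ℝ)+N2)) + 1/(1 - (N1:ℝ)/((N1:ℝ)+N2)) - 1)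
                / ((N1:ℝ)+N2) : ℝ) : ℂ)‖
          ≤ ε / ((N1:ℝ)+N2) := by
  intro δ hδ ε hε
  have hδ0 : 0 < δ := hδ.1
  have hpi := Real.pi_pos
  set θ := |2 * Real.pi * (r - 1) / 3| with hθ
  have hθ0 : 0 ≤ θ := abs_nonneg _
  have hθ1 : θ < 2 * Real.pi / 3 := by
    rw [hθ, abs_lt]
    constructor <;> nlinarith [hr.1, hr.2]
  have hcf : cf (bB r * q ^ 2) = ((2 * Real.cos θ : ℝ) : ℂ) := by rw [cf_bB, hθ, Real.cos_abs]
  have hsin : Real.sin (3 * θ / 4) ^ 2 = Real.sin (Real.pi * (r - 1) / 2) ^ 2 := by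
    rw [show Real.pi * (r - 1) / 2 = 3 * (2 * Real.pi * (r - 1) / 3) / 4 by ring, hθ]
    rcases abs_choice (2 * Real.pi * (r - 1) / 3) with h | h <;> rw [h]
    rw [mul_neg, neg_div, Real.sin_neg, neg_sq]
  rw [← hsin] at hE
  rw [D_eq hr] at hD
  have hdl := LC_add_log_AA hθ0 hθ1 hD
  have hP : ∃ P : ℕ → ℝ, ∀ n, (pin n).eval ((2 * Real.cos θ : ℝ) : ℂ) = P n := by
    have := fun n => pin_bound (θ₁ := (θ + 2 * Real.pi / 3) / 2) (by linarith) (by linarith) hθ0 (by linarith) n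
    choose P hP _ using this
    exact ⟨P, hP⟩
  obtain ⟨P, hP⟩ := hP
  obtain ⟨C, hC, n₀, hn₀⟩ := log_pin_asymp hθ0 hθ1 hP
  refine ⟨max ⌈2 * n₀ / δ⌉₊ ⌈3 * C / (ε * δ ^ 2)⌉₊, fun N1 N2 he1 he2 h1 h2 hN hb1 hb2 => ?_⟩
  obtain ⟨n1, rfl⟩ := even_iff_two_dvd.1 he1
  obtain ⟨n2, rfl⟩ := even_iff_two_dvd.1 he2
  have p1 : (0 : ℝ) < (2 * n1 : ℕ) := by exact_mod_cast (by omega : 0 < 2 * n1)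
  have p2 : (0 : ℝ) < (2 * n2 : ℕ) := by exact_mod_cast (by omega : 0 < 2 * n2)
  have hs : (0 : ℝ) < (2 * n1 : ℕ) + (2 * n2 : ℕ) := by positivity
  have hN1 : 2 * n₀ / δ ≤ (2 * n1 : ℕ) + (2 * n2 : ℕ) :=
    (Nat.le_ceil _).trans (by exact_mod_cast (le_max_left _ _).trans hN)
  have hN2 : 3 * C / (ε * δ ^ 2) ≤ (2 * n1 : ℕ) + (2 * n2 : ℕ) :=
    (Nat.le_ceil _).trans (by exact_mod_cast (le_max_right _ _).trans hN)
  rw [div_le_iff₀' hδ0] at hN1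
  rw [div_le_iff₀' (by positivity)] at hN2
  have g1 : n₀ ≤ n1 := by
    have := hN1.trans ((le_div_iff₀ hs).1 hb1)
    have : 2 * n₀ ≤ 2 * n1 := by exact_mod_cast this
    omega
  have g2 : n₀ ≤ n2 := by
    have a : δ * ((2 * n1 : ℕ) + (2 * n2 : ℕ)) ≤ (2 * n2 : ℕ) := by
      have := (div_le_iff₀ hs).1 hb2
      linarith
    have := hN1.trans a
    have : 2 * n₀ ≤ 2 * n2 := by exact_mod_cast this
    omega
  obtain ⟨q1, f1⟩ := hn₀ n1 g1
  obtain ⟨q2, f2⟩ := hn₀ n2 g2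
  obtain ⟨q3, f3⟩ := hn₀ (n1 + n2) (by omega)
  rw [LBF_eq hx (norm_bB r) (bB_ne_one hr) (mul_bB hr hxr) (by omega) (by omega) (hψ _ (by omega)) (hψ _ (by omega))
    (hψ _ (by omega)) (P := P) (by rw [hcf]; exact hP) q1 q2 q3, ← Complex.ofReal_sub, Complex.norm_real,
    Real.norm_eq_abs]
  rw [hdl, ← hE] at f1 f2 f3
  set f : ℝ → ℝ := fun y => Real.log (P ⌊y / 2⌋₊) with hf
  have hfv : ∀ n : ℕ, f (2 * n : ℕ) = Real.log (P n) := by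
    intro n
    rw [hf]
    beta_reduce
    rw [show ((2 * n : ℕ) : ℝ) / 2 = n by push_cast; ring, Nat.floor_natCast]
  rw [← hfv] at f1 f2 f3
  rw [← hfv, ← hfv, ← hfv]
  rw [mul_add 2 n1 n2, Nat.cast_add] at f3 ⊢
  exact combine hC hδ0 p1 p2 hN2 hb1 hb2 f1 f2 f3

end
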